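/- Blow-up of all nontrivial solutions for q = 1 via the boundary term: Suppose q = 1 and l > 1. Define k̲(t) = inf_{∂Ω × Ω} k(x,y,t) and b̄(t) = sup_Ω b(x,t). Assume ∫₀^∞ k̲(t) exp[−(l−1)(λ₁ t + ∫₀^t b̄(τ)dτ)] dt = ∞. Then every nontrivial (not identically zero) solution of problem (P) blows up in finite time. -/

import Mathlib

open Set MeasureTheory Real Filter

noncomputable section

/-- The Laplacian of `f : ℝⁿ → ℝ`, written as the sum of second directional
derivatives along the coordinate directions. -/
def lap {n : ℕ} (f : EuclideanSpace ℝ (Fin n) → ℝ) (x : EuclideanSpace ℝ (Fin n)) : ℝ :=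
  ∑ i : Fin n,
    fderiv ℝ (fun y => fderiv ℝ f y (EuclideanSpace.single i 1)) x (EuclideanSpace.single i 1)

/-- Local Hölder continuity on `closure Ω × [0,∞)` (with exponent `α ∈ (0,1)`). -/
def LocHolder {n : ℕ} (Ω : Set (EuclideanSpace ℝ (Fin n)))
    (f : EuclideanSpace ℝ (Fin n) → ℝ → ℝ) : Prop :=
  ∃ α : ℝ, 0 < α ∧ α < 1 ∧ ∀ M : ℝ, 0 < M → ∃ C : ℝ,
    ∀ x ∈ closure Ω, ∀ y ∈ closure Ω, ∀ s ∈ Icc (0:ℝ) M, ∀ t ∈ Icc (0:ℝ) M,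
      |f x s - f y t| ≤ C * (dist x y + |s - t|) ^ α

/-- Structural hypotheses on the domain `Ω` and the coefficients `a`, `b`, `k`
of problem (P): `Ω` is a nonempty bounded open set, `a, b` are nonnegative and locally
Hölder continuous on `closure Ω × [0,∞)`, and `k` is nonnegative and continuous on
`∂Ω × closure Ω × [0,∞)`. -/
def GoodData {n : ℕ} (Ω : Set (EuclideanSpace ℝ (Fin n)))
    (a b : EuclideanSpace ℝ (Fin n) → ℝ → ℝ)
    (k : EuclideanSpace ℝ (Fin n) → EuclideanSpace ℝ (Fin n) → ℝ → ℝ) : Prop :=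
  IsOpen Ω ∧ Bornology.IsBounded Ω ∧ Ω.Nonempty ∧
  LocHolder Ω a ∧ LocHolder Ω b ∧
  (∀ x ∈ closure Ω, ∀ t : ℝ, 0 ≤ t → 0 ≤ a x t ∧ 0 ≤ b x t) ∧
  ContinuousOn (fun z : (EuclideanSpace ℝ (Fin n) × EuclideanSpace ℝ (Fin n)) × ℝ =>
      k z.1.1 z.1.2 z.2) ((frontier Ω ×ˢ closure Ω) ×ˢ Ici 0) ∧
  (∀ x ∈ frontier Ω, ∀ y ∈ closure Ω, ∀ t : ℝ, 0 ≤ t → 0 ≤ k x y t)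

/-- Admissible initial datum for problem (P): nonnegative, continuous on `closure Ω`,
and compatible with the nonlocal boundary condition at `t = 0`. -/
def GoodInit {n : ℕ} (Ω : Set (EuclideanSpace ℝ (Fin n)))
    (k : EuclideanSpace ℝ (Fin n) → EuclideanSpace ℝ (Fin n) → ℝ → ℝ) (l : ℝ)
    (u0 : EuclideanSpace ℝ (Fin n) → ℝ) : Prop :=
  ContinuousOn u0 (closure Ω) ∧ (∀ x ∈ closure Ω, 0 ≤ u0 x) ∧
  ∀ x ∈ frontier Ω, u0 x = ∫ y in Ω, k x y 0 * u0 y ^ l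

/-- Regularity required of sub/supersolutions in `Q_T`: continuity on
`Q_T ∪ Γ_T = closure Ω × [0,T)`, `C²` in space and differentiability in time inside `Q_T`. -/
def RegQ {n : ℕ} (Ω : Set (EuclideanSpace ℝ (Fin n))) (T : ℝ)
    (u : EuclideanSpace ℝ (Fin n) → ℝ → ℝ) : Prop :=
  ContinuousOn (fun z : EuclideanSpace ℝ (Fin n) × ℝ => u z.1 z.2) (closure Ω ×ˢ Ico 0 T) ∧
  (∀ t ∈ Ioo (0:ℝ) T, ContDiffOn ℝ 2 (fun x => u x t) Ω) ∧
  (∀ x ∈ Ω, ∀ t ∈ Ioo (0:ℝ) T, DifferentiableAt ℝ (u x) t)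

/-- `u` is a supersolution of problem (P) in `Q_T`. -/
def IsSuperSol {n : ℕ} (r p q l : ℝ) (Ω : Set (EuclideanSpace ℝ (Fin n)))
    (a b : EuclideanSpace ℝ (Fin n) → ℝ → ℝ)
    (k : EuclideanSpace ℝ (Fin n) → EuclideanSpace ℝ (Fin n) → ℝ → ℝ)
    (u0 : EuclideanSpace ℝ (Fin n) → ℝ) (T : ℝ)
    (u : EuclideanSpace ℝ (Fin n) → ℝ → ℝ) : Prop :=
  RegQ Ω T u ∧ (∀ x ∈ closure Ω, ∀ t ∈ Ico (0:ℝ) T, 0 ≤ u x t) ∧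
  (∀ x ∈ Ω, ∀ t ∈ Ioo (0:ℝ) T,
    deriv (u x) t ≥ lap (fun y => u y t) x
      + a x t * u x t ^ r * (∫ y in Ω, u y t ^ p) - b x t * u x t ^ q) ∧
  (∀ x ∈ frontier Ω, ∀ t ∈ Ioo (0:ℝ) T, u x t ≥ ∫ y in Ω, k x y t * u y t ^ l) ∧
  (∀ x ∈ Ω, u x 0 ≥ u0 x)

/-- `u` is a subsolution of problem (P) in `Q_T`. -/
def IsSubSol {n : ℕ} (r p q l : ℝ) (Ω : Set (EuclideanSpace ℝ (Fin n)))
    (a b : EuclideanSpace ℝ (Fin n) → ℝ → ℝ)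
    (k : EuclideanSpace ℝ (Fin n) → EuclideanSpace ℝ (Fin n) → ℝ → ℝ)
    (u0 : EuclideanSpace ℝ (Fin n) → ℝ) (T : ℝ)
    (u : EuclideanSpace ℝ (Fin n) → ℝ → ℝ) : Prop :=
  RegQ Ω T u ∧ (∀ x ∈ closure Ω, ∀ t ∈ Ico (0:ℝ) T, 0 ≤ u x t) ∧
  (∀ x ∈ Ω, ∀ t ∈ Ioo (0:ℝ) T,
    deriv (u x) t ≤ lap (fun y => u y t) x
      + a x t * u x t ^ r * (∫ y in Ω, u y t ^ p) - b x t * u x t ^ q) ∧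
  (∀ x ∈ frontier Ω, ∀ t ∈ Ioo (0:ℝ) T, u x t ≤ ∫ y in Ω, k x y t * u y t ^ l) ∧
  (∀ x ∈ Ω, u x 0 ≤ u0 x)

/-- `u` is a solution of problem (P) in `Q_T`: both a subsolution and a supersolution. -/
def IsSol {n : ℕ} (r p q l : ℝ) (Ω : Set (EuclideanSpace ℝ (Fin n)))
    (a b : EuclideanSpace ℝ (Fin n) → ℝ → ℝ)
    (k : EuclideanSpace ℝ (Fin n) → EuclideanSpace ℝ (Fin n) → ℝ → ℝ)
    (u0 : EuclideanSpace ℝ (Fin n) → ℝ) (T : ℝ)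
    (u : EuclideanSpace ℝ (Fin n) → ℝ → ℝ) : Prop :=
  IsSubSol r p q l Ω a b k u0 T u ∧ IsSuperSol r p q l Ω a b k u0 T u

/-- `u` solves problem (P) in `Q_T` for every `T < Tstar`. -/
def IsSolOn {n : ℕ} (r p q l : ℝ) (Ω : Set (EuclideanSpace ℝ (Fin n)))
    (a b : EuclideanSpace ℝ (Fin n) → ℝ → ℝ)
    (k : EuclideanSpace ℝ (Fin n) → EuclideanSpace ℝ (Fin n) → ℝ → ℝ)
    (u0 : EuclideanSpace ℝ (Fin n) → ℝ) (Tstar : ℝ)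
    (u : EuclideanSpace ℝ (Fin n) → ℝ → ℝ) : Prop :=
  ∀ T : ℝ, 0 < T → T < Tstar → IsSol r p q l Ω a b k u0 T u

/-- `sup_Ω u(·,t) → ∞` as `t → Tstar⁻`. -/
def BlowsUpAt {n : ℕ} (Ω : Set (EuclideanSpace ℝ (Fin n)))
    (u : EuclideanSpace ℝ (Fin n) → ℝ → ℝ) (Tstar : ℝ) : Prop :=
  ∀ M : ℝ, ∀ᶠ t in nhdsWithin Tstar (Iio Tstar), ∃ x ∈ Ω, M < u x t

/-- Every nontrivial solution with initial datum `u0` blows up in finite time: there is no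
global solution, and every noncontinuable solution on a maximal time interval `[0, Tstar)`
satisfies `sup_Ω u(·,t) → ∞` as `t → Tstar⁻`. -/
def AllSolutionsBlowUp {n : ℕ} (r p q l : ℝ) (Ω : Set (EuclideanSpace ℝ (Fin n)))
    (a b : EuclideanSpace ℝ (Fin n) → ℝ → ℝ)
    (k : EuclideanSpace ℝ (Fin n) → EuclideanSpace ℝ (Fin n) → ℝ → ℝ)
    (u0 : EuclideanSpace ℝ (Fin n) → ℝ) : Prop :=
  (∀ u : EuclideanSpace ℝ (Fin n) → ℝ → ℝ, ¬ (∀ T : ℝ, 0 < T → IsSol r p q l Ω a b k u0 T u)) ∧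
  (∀ (u : EuclideanSpace ℝ (Fin n) → ℝ → ℝ) (Tstar : ℝ), 0 < Tstar →
    IsSolOn r p q l Ω a b k u0 Tstar u →
    (¬ ∃ (v : EuclideanSpace ℝ (Fin n) → ℝ → ℝ) (T' : ℝ), Tstar < T' ∧
        IsSolOn r p q l Ω a b k u0 T' v ∧
        ∀ x ∈ closure Ω, ∀ t ∈ Ico (0:ℝ) Tstar, v x t = u x t) →
    BlowsUpAt Ω u Tstar)

/-- `φ` is a (positive, hence principal) Dirichlet eigenfunction of `-Δ` on `Ω` with
eigenvalue `lam`:  `Δφ + lam φ = 0` in `Ω`, `φ = 0` on `∂Ω`, `φ > 0` in `Ω`. -/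
def IsDirichletEigen {n : ℕ} (Ω : Set (EuclideanSpace ℝ (Fin n))) (lam : ℝ)
    (φ : EuclideanSpace ℝ (Fin n) → ℝ) : Prop :=
  ContinuousOn φ (closure Ω) ∧ ContDiffOn ℝ 2 φ Ω ∧
  (∀ x ∈ Ω, lap φ x + lam * φ x = 0) ∧ (∀ x ∈ frontier Ω, φ x = 0) ∧ (∀ x ∈ Ω, 0 < φ x)

/-- `lam` is the first Dirichlet eigenvalue of `-Δ` on `Ω`, with (some) positive
eigenfunction `φ`. -/
def IsFirstEigen {n : ℕ} (Ω : Set (EuclideanSpace ℝ (Fin n))) (lam : ℝ)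
    (φ : EuclideanSpace ℝ (Fin n) → ℝ) : Prop :=
  IsDirichletEigen Ω lam φ ∧
  ∀ lam' : ℝ, (∃ ψ : EuclideanSpace ℝ (Fin n) → ℝ, ContinuousOn ψ (closure Ω) ∧
      ContDiffOn ℝ 2 ψ Ω ∧ (∀ x ∈ Ω, lap ψ x + lam' * ψ x = 0) ∧
      (∀ x ∈ frontier Ω, ψ x = 0) ∧ ∃ x ∈ Ω, ψ x ≠ 0) → lam ≤ lam'

/-- `sup_Ω f(·,t)`. -/
def supOmega {n : ℕ} (Ω : Set (EuclideanSpace ℝ (Fin n)))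
    (f : EuclideanSpace ℝ (Fin n) → ℝ → ℝ) (t : ℝ) : ℝ :=
  sSup ((fun x => f x t) '' Ω)

/-- `inf_Ω f(·,t)`. -/
def infOmega {n : ℕ} (Ω : Set (EuclideanSpace ℝ (Fin n)))
    (f : EuclideanSpace ℝ (Fin n) → ℝ → ℝ) (t : ℝ) : ℝ :=
  sInf ((fun x => f x t) '' Ω)

/-- `inf_{∂Ω × Ω} k(·,·,t)`. -/
def infBdry {n : ℕ} (Ω : Set (EuclideanSpace ℝ (Fin n)))
    (k : EuclideanSpace ℝ (Fin n) → EuclideanSpace ℝ (Fin n) → ℝ → ℝ) (t : ℝ) : ℝ :=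
  sInf ((fun z : EuclideanSpace ℝ (Fin n) × EuclideanSpace ℝ (Fin n) => k z.1 z.2 t) ''
    (frontier Ω ×ˢ Ω))

open Metric

section

/-- Euclidean space of dimension `n`. -/
abbrev Eu (n : ℕ) := EuclideanSpace ℝ (Fin n)

variable {n : ℕ} {x x0 z : Eu n}
  {t ε B M T s C t0 t1 δ c τ R lam q r α H N A ρ θ Tm s0 σ l η T' p : ℝ} {f g κ w ψ u0 G : Eu n → ℝ}
  {u W F v W' β a b h : Eu n → ℝ → ℝ} {U Ω S : Set (Eu n)} {i : Fin n} {I : Set ℝ}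
  {k : Eu n → Eu n → ℝ → ℝ}

/-- Partial derivative in the `i`-th coordinate direction. -/
def pd (i : Fin n) (f : Eu n → ℝ) (x : Eu n) : ℝ :=
  fderiv ℝ f x (EuclideanSpace.single i 1)

lemma lap_eq_sum_pd (f : Eu n → ℝ) (x : Eu n) : lap f x = ∑ i, pd i (pd i f) x := rfl

lemma pd_congr (h : f =ᶠ[nhds x] g) :
    pd i f x = pd i g x := by
  unfold pd; rw [h.fderiv_eq]

lemma pd_eventuallyEq (h : f =ᶠ[nhds x] g) :
    pd i f =ᶠ[nhds x] pd i g :=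
  h.eventuallyEq_nhds.mono fun _ hy => pd_congr hy

lemma lap_congr (h : f =ᶠ[nhds x] g) : lap f x = lap g x := by
  simp only [lap_eq_sum_pd]
  exact Finset.sum_congr rfl fun i _ => pd_congr (pd_eventuallyEq h)

lemma pd_add (hf : DifferentiableAt ℝ f x) (hg : DifferentiableAt ℝ g x) :
    pd i (fun y => f y + g y) x = pd i f x + pd i g x := by
  unfold pd
  rw [fderiv_fun_add hf hg]; rfl

lemma pd_mul (hf : DifferentiableAt ℝ f x) (hg : DifferentiableAt ℝ g x) :
    pd i (fun y => f y * g y) x = f x * pd i g x + pd i f x * g x := by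
  unfold pd
  rw [fderiv_fun_mul hf hg]; simp [mul_comm]

lemma pd_const (c : ℝ) (x : Eu n) : pd i (fun _ => c) x = 0 := by
  simp [pd]

lemma ContDiffAt.pd {m k : WithTop ℕ∞} (hf : ContDiffAt ℝ k f x) (hmk : m + 1 ≤ k) :
    ContDiffAt ℝ m (pd i f) x := by
  have := hf.fderiv_right hmk
  exact this.clm_apply contDiffAt_const

lemma ContDiff.pd {m k : WithTop ℕ∞} (hf : ContDiff ℝ k f) (hmk : m + 1 ≤ k) :
    ContDiff ℝ m (pd i f) :=
  contDiff_iff_contDiffAt.2 fun x => (hf.contDiffAt (x := x)).pd hmk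

lemma ContDiffAt.eventually_diff (hf : ContDiffAt ℝ 2 f x) :
    ∀ᶠ y in nhds x, DifferentiableAt ℝ f y :=
  (hf.eventually (by simp)).mono fun _ hy => hy.differentiableAt (by simp)

lemma ContDiffAt.pd_diff (hf : ContDiffAt ℝ 2 f x) :
    DifferentiableAt ℝ (_root_.pd i f) x :=
  (ContDiffAt.pd (m := 1) hf (by norm_num)).differentiableAt (by simp)

lemma lap_add (hf : ContDiffAt ℝ 2 f x) (hg : ContDiffAt ℝ 2 g x) :
    lap (fun y => f y + g y) x = lap f x + lap g x := by
  simp only [lap_eq_sum_pd, ← Finset.sum_add_distrib]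
  refine Finset.sum_congr rfl fun i _ => ?_
  have : pd i (fun y => f y + g y) =ᶠ[nhds x] fun y => pd i f y + pd i g y := by
    filter_upwards [hf.eventually_diff, hg.eventually_diff] with y h1 h2 using pd_add h1 h2
  rw [pd_congr this, pd_add hf.pd_diff hg.pd_diff]

lemma lap_mul (hf : ContDiffAt ℝ 2 f x) (hg : ContDiffAt ℝ 2 g x) :
    lap (fun y => f y * g y) x
      = f x * lap g x + lap f x * g x + 2 * ∑ i, pd i f x * pd i g x := by
  simp only [lap_eq_sum_pd, Finset.mul_sum, Finset.sum_mul, ← Finset.sum_add_distrib]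
  refine Finset.sum_congr rfl fun i _ => ?_
  have : pd i (fun y => f y * g y) =ᶠ[nhds x] fun y => f y * pd i g y + pd i f y * g y := by
    filter_upwards [hf.eventually_diff, hg.eventually_diff] with y h1 h2 using pd_mul h1 h2
  have df := hf.differentiableAt (by simp)
  have dg := hg.differentiableAt (by simp)
  have dfi : DifferentiableAt ℝ (pd i f) x := hf.pd_diff
  have dgi : DifferentiableAt ℝ (pd i g) x := hg.pd_diff
  rw [pd_congr this, pd_add (f := fun y => f y * pd i g y) (g := fun y => pd i f y * g y) (df.mul dgi) (dfi.mul dg),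
    pd_mul df dgi, pd_mul dfi dg]
  ring

lemma lap_const (c : ℝ) (x : Eu n) : lap (fun _ => c) x = 0 := by
  rw [lap_eq_sum_pd]
  refine Finset.sum_eq_zero fun i _ => ?_
  rw [show pd i (fun _ : Eu n => c) = fun _ => 0 from funext fun y => pd_const c y]
  exact pd_const 0 x

lemma lap_const_mul (c : ℝ) (hf : ContDiffAt ℝ 2 f x) :
    lap (fun y => c * f y) x = c * lap f x := by
  rw [lap_mul contDiffAt_const hf, lap_const]
  simp [pd_const]

lemma lap_neg (hf : ContDiffAt ℝ 2 f x) :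
    lap (fun y => - f y) x = - lap f x := by
  have := lap_const_mul (-1) hf
  simpa using this

lemma lap_sub (hf : ContDiffAt ℝ 2 f x) (hg : ContDiffAt ℝ 2 g x) :
    lap (fun y => f y - g y) x = lap f x - lap g x := by
  have := lap_add hf hg.neg
  simp only [sub_eq_add_neg]
  rw [this]; congr 1; exact lap_neg hg

lemma continuous_pd (hf : ContDiff ℝ 1 f) : Continuous (pd i f) :=
  (ContDiff.pd (m := 0) hf (by simp)).continuous

lemma continuous_lap (hf : ContDiff ℝ 2 f) : Continuous (lap f) :=
  continuous_finsetSum _ fun i _ =>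
    continuous_pd (ContDiff.pd (m := 1) hf (by norm_num))

lemma tsupport_pd_subset (i : Fin n) (f : Eu n → ℝ) : tsupport (pd i f) ⊆ tsupport f := by
  refine (closure_minimal ?_ isClosed_closure)
  intro x hx
  by_contra hn
  apply hx
  have : f =ᶠ[nhds x] fun _ => 0 := notMem_tsupport_iff_eventuallyEq.1 hn
  rw [pd_congr this, pd_const]

lemma lap_eq_zero_of_notMem (hx : x ∉ tsupport f) : lap f x = 0 := by
  rw [lap_congr (notMem_tsupport_iff_eventuallyEq.1 hx)]; exact lap_const 0 x

lemma tsupport_lap_subset (f : Eu n → ℝ) : tsupport (lap f) ⊆ tsupport f := by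
  refine (closure_minimal ?_ isClosed_closure)
  intro x hx
  by_contra hn
  exact hx (lap_eq_zero_of_notMem hn)

lemma HasCompactSupport.pd (hf : HasCompactSupport f) :
    HasCompactSupport (pd i f) := hf.of_isClosed_subset isClosed_closure (tsupport_pd_subset i f)

lemma HasCompactSupport.lap (hf : HasCompactSupport f) :
    HasCompactSupport (lap f) := hf.of_isClosed_subset isClosed_closure (tsupport_lap_subset f)

/-- Second derivative necessary condition along a line. -/
lemma deriv2_nonpos_of_isLocalMax {g : ℝ → ℝ} (h : IsLocalMax g 0)
    (hc : ContinuousAt g 0) : deriv (deriv g) 0 ≤ 0 := by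
  by_contra! hpos
  have h0 : deriv g 0 = 0 := h.deriv_eq_zero
  have hmin : IsLocalMin g 0 := isLocalMin_of_deriv_deriv_pos hpos h0 hc
  have : g =ᶠ[nhds 0] fun _ => g 0 := by
    filter_upwards [h, hmin] with y h1 h2 using le_antisymm h1 h2
  have h2 : deriv g =ᶠ[nhds 0] deriv (fun _ => g 0) := this.deriv
  have : deriv (deriv g) 0 = 0 := by
    rw [h2.deriv_eq]; simp
  linarith

lemma pd_pd_nonpos_of_isLocalMax (hf : ContDiffAt ℝ 2 f x) (h : IsLocalMax f x) (i : Fin n) :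
    pd i (pd i f) x ≤ 0 := by
  set e : Eu n := EuclideanSpace.single i 1
  set L : ℝ → Eu n := fun s => x + s • e
  have hL : ∀ s, HasDerivAt L e s := fun s => by
    have := ((hasDerivAt_id s).smul_const e).const_add x
    rw [one_smul] at this; exact this
  have hL0 : L 0 = x := by simp [L]
  have hLc : Tendsto L (nhds 0) (nhds x) := by
    have := (hL 0).continuousAt.tendsto; rwa [hL0] at this
  have h1 : deriv (fun s => f (L s)) =ᶠ[nhds 0] fun s => pd i f (L s) := by
    filter_upwards [hLc.eventually hf.eventually_diff] with s hs
    exact (hs.hasFDerivAt.comp_hasDerivAt s (hL s)).deriv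
  have h2 : deriv (fun s => pd i f (L s)) 0 = pd i (pd i f) x := by
    have hd : DifferentiableAt ℝ (pd i f) (L 0) := by rw [hL0]; exact hf.pd_diff
    have := (hd.hasFDerivAt.comp_hasDerivAt 0 (hL 0)).deriv
    rw [hL0] at this
    exact this
  have h3 : IsLocalMax (fun s => f (L s)) 0 := by
    have := hLc.eventually h
    simpa [IsLocalMax, IsMaxFilter, hL0] using this
  have h4 : ContinuousAt (fun s => f (L s)) 0 := by
    refine ContinuousAt.comp (g := f) ?_ (hL 0).continuousAt
    rw [hL0]; exact hf.continuousAt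
  have := deriv2_nonpos_of_isLocalMax h3 h4
  rwa [h1.deriv_eq, h2] at this

lemma lap_nonpos_of_isLocalMax (hf : ContDiffAt ℝ 2 f x) (h : IsLocalMax f x) : lap f x ≤ 0 :=
  Finset.sum_nonpos fun i _ => pd_pd_nonpos_of_isLocalMax hf h i

lemma contDiff_coord_sub (i : Fin n) (c : ℝ) {k : WithTop ℕ∞} :
    ContDiff ℝ k (fun y : Eu n => y i - c) := by
  have : ContDiff ℝ k (fun y : Eu n => y i) :=
    (EuclideanSpace.proj i : Eu n →L[ℝ] ℝ).contDiff
  exact this.sub contDiff_const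

lemma pd_coord_sub (i j : Fin n) (c : ℝ) (x : Eu n) :
    pd i (fun y : Eu n => y j - c) x = if i = j then 1 else 0 := by
  have h : HasFDerivAt (fun y : Eu n => y j - c)
      (EuclideanSpace.proj j : Eu n →L[ℝ] ℝ) x :=
    ((EuclideanSpace.proj j : Eu n →L[ℝ] ℝ).hasFDerivAt).sub_const c
  unfold pd
  rw [h.fderiv]
  simp [eq_comm]

lemma norm_sub_sq_eq_sum (y x0 : Eu n) : ‖y - x0‖ ^ 2 = ∑ i, (y i - x0 i) ^ 2 := by
  rw [EuclideanSpace.norm_sq_eq]; simp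

lemma contDiff_normSq (x0 : Eu n) {k : WithTop ℕ∞} : ContDiff ℝ k (fun y : Eu n => ‖y - x0‖ ^ 2) :=
  (contDiff_id.sub contDiff_const).norm_sq ℝ

lemma pd_normSq (x0 : Eu n) (i : Fin n) (x : Eu n) :
    pd i (fun y : Eu n => ‖y - x0‖ ^ 2) x = 2 * (x i - x0 i) := by
  have h : HasFDerivAt (fun y : Eu n => ‖y - x0‖ ^ 2) (2 • innerSL ℝ (x - x0)) x := by
    have := ((hasFDerivAt_id (𝕜 := ℝ) x).sub_const x0).norm_sq
    simpa using this
  unfold pd; rw [h.fderiv]; simp [EuclideanSpace.inner_single_right]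

lemma lap_normSq (x0 : Eu n) (x : Eu n) :
    lap (fun y : Eu n => ‖y - x0‖ ^ 2) x = 2 * n := by
  rw [lap_eq_sum_pd]
  have : ∀ i : Fin n, pd i (pd i (fun y : Eu n => ‖y - x0‖ ^ 2)) x = 2 := by
    intro i
    have h : pd i (fun y : Eu n => ‖y - x0‖ ^ 2) = fun y => 2 * (y i - x0 i) := by
      funext y; exact pd_normSq x0 i y
    rw [h, pd_mul (differentiableAt_const _)
      ((contDiff_coord_sub i (x0 i) (k := 1)).differentiable (by simp) x), pd_coord_sub, pd_const]
    simp
  simp [this, mul_comm]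

lemma integral_pd_mul (hf : ContDiff ℝ 1 f) (hg : ContDiff ℝ 1 g) (hs : HasCompactSupport g) :
    ∫ x, pd i f x * g x = - ∫ x, f x * pd i g x := by
  have hfc := hf.continuous
  have hgc := hg.continuous
  have h := integral_mul_fderiv_eq_neg_fderiv_mul_of_integrable (μ := volume) (f := f) (g := g)
    (v := EuclideanSpace.single i (1:ℝ))
    ((continuous_pd hf).mul hgc |>.integrable_of_hasCompactSupport hs.mul_left)
    (hfc.mul (continuous_pd hg) |>.integrable_of_hasCompactSupport
      (HasCompactSupport.mul_left (hs.pd)))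
    (hfc.mul hgc |>.integrable_of_hasCompactSupport hs.mul_left)
    (fun x _ => hf.differentiable (by simp) x) (fun x _ => hg.differentiable (by simp) x)
  simp only [pd] at *
  linarith

lemma integral_lap_mul (hf : ContDiff ℝ 2 f) (hg : ContDiff ℝ 2 g) (hs : HasCompactSupport g) :
    ∫ x, lap f x * g x = ∫ x, f x * lap g x := by
  simp only [lap_eq_sum_pd, Finset.sum_mul, Finset.mul_sum]
  have f1 : ∀ i, ContDiff ℝ 1 (pd i f) := fun i => ContDiff.pd hf (by norm_num)
  have g1 : ∀ i, ContDiff ℝ 1 (pd i g) := fun i => ContDiff.pd hg (by norm_num)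
  rw [integral_finsetSum, integral_finsetSum]
  · refine Finset.sum_congr rfl fun i _ => ?_
    rw [integral_pd_mul (f1 i) (hg.of_le (by norm_num)) hs]
    rw [integral_pd_mul (hf.of_le (by norm_num)) (g1 i) hs.pd, neg_neg]
  · intro i _
    exact (hf.continuous.mul (continuous_pd (g1 i))).integrable_of_hasCompactSupport
      (HasCompactSupport.mul_left hs.pd.pd)
  · intro i _
    exact ((continuous_pd (f1 i)).mul hg.continuous).integrable_of_hasCompactSupport hs.mul_left

lemma integral_lap_eq_zero (hg : ContDiff ℝ 2 g) (hs : HasCompactSupport g) : ∫ x, lap g x = 0 := by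
  have := integral_lap_mul (f := fun _ => (1:ℝ)) contDiff_const hg hs
  simpa [lap_const] using this.symm

/-- Joint continuity of `u` on `A × B`. -/
abbrev JC (u : Eu n → ℝ → ℝ) (A : Set (Eu n)) (B : Set ℝ) : Prop :=
  ContinuousOn (fun z : Eu n × ℝ => u z.1 z.2) (A ×ˢ B)

lemma JC.slice {A : Set (Eu n)} {B : Set ℝ} (h : JC u A B) (ht : t ∈ B) :
    ContinuousOn (fun x => u x t) A :=
  ContinuousOn.comp (g := fun z : Eu n × ℝ => u z.1 z.2) h
    (by fun_prop : ContinuousOn (fun x : Eu n => (x, t)) A) fun _ hx => ⟨hx, ht⟩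

lemma JC.time {A : Set (Eu n)} {B : Set ℝ} (h : JC u A B) (hx : x ∈ A) : ContinuousOn (u x) B :=
  ContinuousOn.comp (g := fun z : Eu n × ℝ => u z.1 z.2) h
    (by fun_prop : ContinuousOn (fun t : ℝ => (x, t)) B) fun _ ht => ⟨hx, ht⟩

lemma JC.mono {A A' : Set (Eu n)} {B B' : Set ℝ} (h : JC u A B) (hA : A' ⊆ A) (hB : B' ⊆ B) :
    JC u A' B' :=
  ContinuousOn.mono h (prod_mono hA hB)

lemma jc_mul_cutoff (hU : IsOpen U) {B : Set ℝ} (hu : JC u U B) (hψ : Continuous ψ)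
    (hsU : tsupport ψ ⊆ U) :
    JC (fun x t => u x t * ψ x) univ B := by
  rintro ⟨x, t⟩ ⟨-, ht⟩
  by_cases hx : x ∈ U
  · have h1 : ContinuousWithinAt (fun z : Eu n × ℝ => u z.1 z.2) (U ×ˢ B) (x, t) := hu _ ⟨hx, ht⟩
    have h2 : ContinuousWithinAt (fun z : Eu n × ℝ => u z.1 z.2) (univ ×ˢ B) (x, t) := by
      refine h1.mono_of_mem_nhdsWithin ?_
      rw [nhdsWithin_prod_eq, nhdsWithin_univ]
      exact prod_mem_prod (hU.mem_nhds hx) self_mem_nhdsWithin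
    exact h2.mul (hψ.comp continuous_fst).continuousWithinAt
  · have h0 : ψ =ᶠ[nhds x] 0 := notMem_tsupport_iff_eventuallyEq.1 fun h => hx (hsU h)
    have : (fun z : Eu n × ℝ => u z.1 z.2 * ψ z.1) =ᶠ[nhds (x, t)] fun _ => 0 := by
      have h1 : ∀ᶠ z : Eu n × ℝ in nhds (x, t), ψ z.1 = 0 :=
        (continuous_fst.tendsto (x, t)).eventually h0
      filter_upwards [h1] with z hz
      simp [hz]
    exact (continuousAt_const.congr this.symm).continuousWithinAt

lemma continuous_mul_cutoff (hU : IsOpen U) {u : Eu n → ℝ} (hu : ContinuousOn u U)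
    (hψ : Continuous ψ) (hsU : tsupport ψ ⊆ U) :
    Continuous (fun x => u x * ψ x) := by
  have h : JC (fun x (_ : ℝ) => u x) U univ :=
    hu.comp continuousOn_fst fun z hz => hz.1
  have := (jc_mul_cutoff hU h hψ hsU).slice (mem_univ (0:ℝ))
  rwa [← continuousOn_univ]

lemma integrable_mul_cutoff (hU : IsOpen U) {u : Eu n → ℝ} (hu : ContinuousOn u U)
    (hψ : Continuous ψ) (hs : HasCompactSupport ψ) (hsU : tsupport ψ ⊆ U) :
    Integrable (fun x => u x * ψ x) :=
  (continuous_mul_cutoff hU hu hψ hsU).integrable_of_hasCompactSupport hs.mul_left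

lemma continuousOn_pairing (hU : IsOpen U) {B : Set ℝ} (hu : JC u U B) (hψ : Continuous ψ)
    (hs : HasCompactSupport ψ) (hsU : tsupport ψ ⊆ U) :
    ContinuousOn (fun t => ∫ x, u x t * ψ x) B := by
  have h := jc_mul_cutoff hU hu hψ hsU
  refine continuousOn_integral_of_compact_support (μ := volume) (k := tsupport ψ)
    (f := fun t x => u x t * ψ x) hs ?_ ?_
  · exact h.comp continuous_swap.continuousOn fun z hz => ⟨mem_univ _, hz.1⟩
  · intro t x _ hx
    simp [image_eq_zero_of_notMem_tsupport hx]

/-- Weak (distributional in space, integrated in time) solutions of `u_t = Δu + f`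
in `U × [t0, t1]`. -/
structure Weak (U : Set (Eu n)) (t0 t1 : ℝ) (u f : Eu n → ℝ → ℝ) : Prop where
  cu : JC u U (Icc t0 t1)
  cf : JC f U (Icc t0 t1)
  eq : ∀ ψ : Eu n → ℝ, ContDiff ℝ 2 ψ → HasCompactSupport ψ → tsupport ψ ⊆ U →
    ∀ s ∈ Icc t0 t1, ∀ t ∈ Icc t0 t1, s ≤ t →
      (∫ x, u x t * ψ x) - ∫ x, u x s * ψ x
        = ∫ τ in s..t, ((∫ x, u x τ * lap ψ x) + ∫ x, f x τ * ψ x)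

namespace Weak

variable {f g : Eu n → ℝ → ℝ}

lemma continuousOn_rhs (hU : IsOpen U) (h : Weak U t0 t1 u f) (hψ : ContDiff ℝ 2 ψ)
    (hs : HasCompactSupport ψ) (hsU : tsupport ψ ⊆ U) :
    ContinuousOn (fun τ => (∫ x, u x τ * lap ψ x) + ∫ x, f x τ * ψ x) (Icc t0 t1) :=
  (continuousOn_pairing hU h.cu (continuous_lap hψ) hs.lap
    ((tsupport_lap_subset ψ).trans hsU)).add (continuousOn_pairing hU h.cf hψ.continuous hs hsU)

lemma intervalIntegrable_rhs (hU : IsOpen U) (h : Weak U t0 t1 u f) (hψ : ContDiff ℝ 2 ψ)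
    (hs : HasCompactSupport ψ) (hsU : tsupport ψ ⊆ U) (hs' : s ∈ Icc t0 t1) (ht : t ∈ Icc t0 t1) :
    IntervalIntegrable (fun τ => (∫ x, u x τ * lap ψ x) + ∫ x, f x τ * ψ x) volume s t :=
  ((h.continuousOn_rhs hU hψ hs hsU).mono (uIcc_subset_Icc hs' ht)).intervalIntegrable

lemma add (hU : IsOpen U) (hu : Weak U t0 t1 u f) (hv : Weak U t0 t1 v g) :
    Weak U t0 t1 (fun x t => u x t + v x t) (fun x t => f x t + g x t) where
  cu := hu.cu.add hv.cu
  cf := hu.cf.add hv.cf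
  eq := by
    intro ψ hψ hs hsU s hs' t ht hst
    have hl := continuous_lap hψ
    have hlU := (tsupport_lap_subset ψ).trans hsU
    have e1 : ∀ τ ∈ Icc t0 t1, ∫ x, (u x τ + v x τ) * ψ x
        = (∫ x, u x τ * ψ x) + ∫ x, v x τ * ψ x := fun τ hτ => by
      simp only [add_mul]
      exact integral_add (integrable_mul_cutoff hU (hu.cu.slice hτ) hψ.continuous hs hsU)
        (integrable_mul_cutoff hU (hv.cu.slice hτ) hψ.continuous hs hsU)
    have e2 : ∀ τ ∈ Icc t0 t1, ((∫ x, (u x τ + v x τ) * lap ψ x) +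
        ∫ x, (f x τ + g x τ) * ψ x)
        = ((∫ x, u x τ * lap ψ x) + ∫ x, f x τ * ψ x) +
          ((∫ x, v x τ * lap ψ x) + ∫ x, g x τ * ψ x) := fun τ hτ => by
      simp only [add_mul]
      rw [integral_add (integrable_mul_cutoff hU (hu.cu.slice hτ) hl hs.lap hlU)
        (integrable_mul_cutoff hU (hv.cu.slice hτ) hl hs.lap hlU),
        integral_add (integrable_mul_cutoff hU (hu.cf.slice hτ) hψ.continuous hs hsU)
        (integrable_mul_cutoff hU (hv.cf.slice hτ) hψ.continuous hs hsU)]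
      ring
    rw [e1 t ht, e1 s hs', intervalIntegral.integral_congr
      (g := fun τ => ((∫ x, u x τ * lap ψ x) + ∫ x, f x τ * ψ x) +
          ((∫ x, v x τ * lap ψ x) + ∫ x, g x τ * ψ x))
      (fun τ hτ => e2 τ (uIcc_subset_Icc hs' ht hτ)),
      intervalIntegral.integral_add (hu.intervalIntegrable_rhs hU hψ hs hsU hs' ht)
        (hv.intervalIntegrable_rhs hU hψ hs hsU hs' ht),
      ← hu.eq ψ hψ hs hsU s hs' t ht hst, ← hv.eq ψ hψ hs hsU s hs' t ht hst]
    ring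

lemma const_mul (c : ℝ) (hu : Weak U t0 t1 u f) :
    Weak U t0 t1 (fun x t => c * u x t) (fun x t => c * f x t) where
  cu := continuousOn_const.mul hu.cu
  cf := continuousOn_const.mul hu.cf
  eq := by
    intro ψ hψ hs hsU s hs' t ht hst
    simp only [mul_assoc, integral_const_mul, ← mul_add, intervalIntegral.integral_const_mul,
      ← mul_sub]
    rw [hu.eq ψ hψ hs hsU s hs' t ht hst]

lemma neg (hu : Weak U t0 t1 u f) : Weak U t0 t1 (fun x t => - u x t) (fun x t => - f x t) := by
  simpa using hu.const_mul (-1)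

lemma sub (hU : IsOpen U) (hu : Weak U t0 t1 u f) (hv : Weak U t0 t1 v g) :
    Weak U t0 t1 (fun x t => u x t - v x t) (fun x t => f x t - g x t) := by
  simpa [sub_eq_add_neg] using hu.add hU hv.neg

lemma mono (hu : Weak U t0 t1 u f) {U' : Set (Eu n)} {s1 : ℝ} (hU : U' ⊆ U) (h0 : t0 ≤ s0)
    (h1 : s1 ≤ t1) : Weak U' s0 s1 u f where
  cu := hu.cu.mono hU (Icc_subset_Icc h0 h1)
  cf := hu.cf.mono hU (Icc_subset_Icc h0 h1)
  eq := fun ψ hψ hs hsU s hs' t ht hst => hu.eq ψ hψ hs (hsU.trans hU) s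
    (Icc_subset_Icc h0 h1 hs') t (Icc_subset_Icc h0 h1 ht) hst

lemma congr (hu : Weak U t0 t1 u f) (h1 : ∀ x ∈ U, ∀ t ∈ Icc t0 t1, v x t = u x t)
    (h2 : ∀ x ∈ U, ∀ t ∈ Icc t0 t1, g x t = f x t) : Weak U t0 t1 v g where
  cu := ContinuousOn.congr hu.cu fun z hz => h1 _ hz.1 _ hz.2
  cf := ContinuousOn.congr hu.cf fun z hz => h2 _ hz.1 _ hz.2
  eq := by
    intro ψ hψ hs hsU s hs' t ht hst
    have key : ∀ (w w' : Eu n → ℝ → ℝ) (θ : Eu n → ℝ), tsupport θ ⊆ U →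
        (∀ x ∈ U, ∀ t ∈ Icc t0 t1, w x t = w' x t) → ∀ τ ∈ Icc t0 t1,
        ∫ x, w x τ * θ x = ∫ x, w' x τ * θ x := by
      intro w w' θ hθ hw τ hτ
      refine integral_congr_ae (Eventually.of_forall fun x => ?_)
      by_cases hx : x ∈ tsupport θ
      · simp [hw x (hθ hx) τ hτ]
      · simp [image_eq_zero_of_notMem_tsupport hx]
    rw [key v u ψ hsU h1 t ht, key v u ψ hsU h1 s hs', hu.eq ψ hψ hs hsU s hs' t ht hst]
    refine intervalIntegral.integral_congr fun τ hτ => ?_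
    have hτ' := uIcc_subset_Icc hs' ht hτ
    beta_reduce
    rw [key v u _ ((tsupport_lap_subset ψ).trans hsU) h1 τ hτ', key g f ψ hsU h2 τ hτ']

lemma shift (hu : Weak U t0 t1 u f) (c : ℝ) :
    Weak U (t0 + c) (t1 + c) (fun x t => u x (t - c)) (fun x t => f x (t - c)) where
  cu := ContinuousOn.comp (g := fun z : Eu n × ℝ => u z.1 z.2) hu.cu
    (by fun_prop : ContinuousOn (fun z : Eu n × ℝ => (z.1, z.2 - c)) _)
    fun z hz => ⟨hz.1, by linarith [hz.2.1], by linarith [hz.2.2]⟩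
  cf := ContinuousOn.comp (g := fun z : Eu n × ℝ => f z.1 z.2) hu.cf
    (by fun_prop : ContinuousOn (fun z : Eu n × ℝ => (z.1, z.2 - c)) _)
    fun z hz => ⟨hz.1, by linarith [hz.2.1], by linarith [hz.2.2]⟩
  eq := by
    intro ψ hψ hs hsU s hs' t ht hst
    rw [intervalIntegral.integral_comp_sub_right
      (fun τ => (∫ x, u x τ * lap ψ x) + ∫ x, f x τ * ψ x) c]
    exact hu.eq ψ hψ hs hsU _ ⟨by linarith [hs'.1], by linarith [hs'.2]⟩ _
      ⟨by linarith [ht.1], by linarith [ht.2]⟩ (by linarith)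

lemma hasDerivAt_pairing (hU : IsOpen U) (h : Weak U t0 t1 u f) (hψ : ContDiff ℝ 2 ψ)
    (hs : HasCompactSupport ψ) (hsU : tsupport ψ ⊆ U) (ht : t ∈ Ioo t0 t1) :
    HasDerivAt (fun t => ∫ x, u x t * ψ x)
      ((∫ x, u x t * lap ψ x) + ∫ x, f x t * ψ x) t := by
  have h0 : t0 ∈ Icc t0 t1 := ⟨le_rfl, (ht.1.trans ht.2).le⟩
  have hc := h.continuousOn_rhs hU hψ hs hsU
  have hd : HasDerivAt (fun t' => ∫ τ in t0..t', ((∫ x, u x τ * lap ψ x) + ∫ x, f x τ * ψ x))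
      ((∫ x, u x t * lap ψ x) + ∫ x, f x t * ψ x) t := by
    refine intervalIntegral.integral_hasDerivAt_right
      (h.intervalIntegrable_rhs hU hψ hs hsU h0 ⟨ht.1.le, ht.2.le⟩) ?_
      (hc.continuousAt (Icc_mem_nhds ht.1 ht.2))
    exact (hc.mono Ioo_subset_Icc_self).stronglyMeasurableAtFilter isOpen_Ioo t ht
  have : (fun t => ∫ x, u x t * ψ x) =ᶠ[nhds t] fun t' => (∫ x, u x t0 * ψ x) +
      ∫ τ in t0..t', ((∫ x, u x τ * lap ψ x) + ∫ x, f x τ * ψ x) := by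
    filter_upwards [Ioo_mem_nhds ht.1 ht.2] with t' ht'
    rw [← h.eq ψ hψ hs hsU t0 h0 t' ⟨ht'.1.le, ht'.2.le⟩ ht'.1.le]; ring
  exact (hd.const_add _).congr_of_eventuallyEq this

end Weak

lemma abs_integral_mul_le {θ : Eu n → ℝ} (hθ : Continuous θ) (hs : HasCompactSupport θ)
    (hw : ∀ x ∈ tsupport θ, |w x| ≤ ε) :
    |∫ x, w x * θ x| ≤ ε * ∫ x, |θ x| := by
  rw [← integral_const_mul]
  have hi : Integrable (fun x => ε * |θ x|) :=
    ((hθ.integrable_of_hasCompactSupport hs).abs).const_mul ε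
  rw [← norm_eq_abs]
  refine norm_integral_le_of_norm_le hi (Eventually.of_forall fun x => ?_)
  by_cases hx : x ∈ tsupport θ
  · rw [norm_eq_abs, abs_mul]; exact mul_le_mul_of_nonneg_right (hw x hx) (abs_nonneg _)
  · simp [image_eq_zero_of_notMem_tsupport hx]

/-- Weak solutions are closed under locally uniform approximation. -/
lemma Weak.of_approx (hU : IsOpen U) {f : Eu n → ℝ → ℝ} (hu : JC u U (Icc t0 t1))
    (hf : JC f U (Icc t0 t1))
    (h : ∀ K ⊆ U, IsCompact K → ∀ ε > 0, ∃ U' u' f', IsOpen U' ∧ K ⊆ U' ∧ Weak U' t0 t1 u' f' ∧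
      ∀ x ∈ K, ∀ t ∈ Icc t0 t1, |u x t - u' x t| ≤ ε ∧ |f x t - f' x t| ≤ ε) :
    Weak U t0 t1 u f := by
  refine ⟨hu, hf, ?_⟩
  intro ψ hψ hs hsU s hs' t ht hst
  have hl := continuous_lap hψ
  have hlU := (tsupport_lap_subset ψ).trans hsU
  set A := ∫ x, |ψ x|
  set B := ∫ x, |lap ψ x|
  have hA : 0 ≤ A := integral_nonneg fun _ => abs_nonneg _
  have hB : 0 ≤ B := integral_nonneg fun _ => abs_nonneg _
  set R := fun τ => (∫ x, u x τ * lap ψ x) + ∫ x, f x τ * ψ x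
  have hR : ContinuousOn R (Icc t0 t1) :=
    (continuousOn_pairing hU hu hl hs.lap hlU).add (continuousOn_pairing hU hf hψ.continuous hs hsU)
  rw [← sub_eq_zero, ← abs_eq_zero]
  refine le_antisymm (le_of_forall_pos_le_add fun δ hδ => ?_) (abs_nonneg _)
  set C := A + A + (B + A) * (t - s) + 1
  have hC : 0 < C := by
    have : 0 ≤ (B + A) * (t - s) := mul_nonneg (by linarith) (by linarith)
    positivity
  obtain ⟨U', u', f', hU', hK, hW, hcl⟩ := h (tsupport ψ) hsU hs (δ / C) (by positivity)
  set ε := δ / C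
  have hε : 0 < ε := by positivity
  have hlU' := (tsupport_lap_subset ψ).trans hK
  have d : ∀ (w w' : Eu n → ℝ → ℝ) (θ : Eu n → ℝ), Continuous θ → HasCompactSupport θ →
      tsupport θ ⊆ tsupport ψ → JC w U (Icc t0 t1) → JC w' U' (Icc t0 t1) → ∀ τ ∈ Icc t0 t1,
      (∀ x ∈ tsupport ψ, |w x τ - w' x τ| ≤ ε) →
      |(∫ x, w x τ * θ x) - ∫ x, w' x τ * θ x| ≤ ε * ∫ x, |θ x| := by
    intro w w' θ hθ hθs hθψ hw hw' τ hτ hww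
    rw [← integral_sub (integrable_mul_cutoff hU (hw.slice hτ) hθ hθs (hθψ.trans hsU))
      (integrable_mul_cutoff hU' (hw'.slice hτ) hθ hθs (hθψ.trans hK))]
    simp only [← sub_mul]
    exact abs_integral_mul_le hθ hθs fun x hx => hww x (hθψ hx)
  have d1 := fun τ hτ => d u u' ψ hψ.continuous hs subset_rfl hu hW.cu τ hτ
    fun x hx => (hcl x hx τ hτ).1
  have d2 := fun τ hτ => d u u' (lap ψ) hl hs.lap (tsupport_lap_subset ψ) hu hW.cu τ hτ
    fun x hx => (hcl x hx τ hτ).1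
  have d3 := fun τ hτ => d f f' ψ hψ.continuous hs subset_rfl hf hW.cf τ hτ
    fun x hx => (hcl x hx τ hτ).2
  have e := hW.eq ψ hψ hs hK s hs' t ht hst
  set R' := fun τ => (∫ x, u' x τ * lap ψ x) + ∫ x, f' x τ * ψ x
  have hRR : |(∫ τ in s..t, R τ) - ∫ τ in s..t, R' τ| ≤ ε * (B + A) * (t - s) := by
    rw [← intervalIntegral.integral_sub
      ((hR.mono (uIcc_subset_Icc hs' ht)).intervalIntegrable)
      (hW.intervalIntegrable_rhs hU' hψ hs hK hs' ht)]
    have := intervalIntegral.norm_integral_le_of_norm_le_const (a := s) (b := t)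
      (f := fun τ => R τ - R' τ) (C := ε * (B + A)) (fun τ hτ => ?_)
    · rwa [abs_of_nonneg (sub_nonneg.2 hst)] at this
    · have hτ' : τ ∈ Icc t0 t1 := uIcc_subset_Icc hs' ht (uIoc_subset_uIcc hτ)
      have a1 := d2 τ hτ'
      have a2 := d3 τ hτ'
      rw [norm_eq_abs]
      calc |R τ - R' τ| = |((∫ x, u x τ * lap ψ x) - ∫ x, u' x τ * lap ψ x) +
            ((∫ x, f x τ * ψ x) - ∫ x, f' x τ * ψ x)| := by simp only [R, R']; ring_nf
        _ ≤ _ := (abs_add_le _ _).trans (by rw [mul_add]; exact add_le_add a1 a2)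
  have b1 := d1 t ht
  have b2 := d1 s hs'
  have eC : ε * C = δ := by simp only [ε]; field_simp
  have : ε * (A + A + (B + A) * (t - s)) ≤ δ := by
    rw [← eC]; exact mul_le_mul_of_nonneg_left (by simp [C]) hε.le
  rw [abs_le] at *
  constructor <;> nlinarith [b1.1, b1.2, b2.1, b2.2, hRR.1, hRR.2]

/-- Spatial mollification of `w` with the kernel `κ`. -/
def mol (κ w : Eu n → ℝ) (x : Eu n) : ℝ := ∫ y, w y * κ (x - y)

/-- Points whose closed `ε`-ball lies in `U`. -/
def inner' (U : Set (Eu n)) (ε : ℝ) : Set (Eu n) := {x | closedBall x ε ⊆ U}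

lemma exists_thicken (hU : IsOpen U) (hx : x ∈ inner' U ε) : ∃ δ > 0, closedBall x (ε + δ) ⊆ U := by
  rcases lt_or_ge ε 0 with hε | hε
  · refine ⟨-ε / 2, by linarith, ?_⟩
    rw [closedBall_eq_empty.2 (by linarith)]; exact empty_subset _
  obtain ⟨δ, hδ, h⟩ := (isCompact_closedBall x ε).exists_cthickening_subset_open hU hx
  exact ⟨δ, hδ, by rw [cthickening_closedBall hδ.le hε] at h; rwa [add_comm]⟩

lemma isOpen_inner' (hU : IsOpen U) (ε : ℝ) : IsOpen (inner' U ε) := by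
  rw [Metric.isOpen_iff]
  intro x hx
  obtain ⟨δ, hδ, h⟩ := exists_thicken hU hx
  refine ⟨δ, hδ, fun y hy => ?_⟩
  refine (closedBall_subset_closedBall' ?_).trans h
  rw [mem_ball] at hy; linarith

lemma mol_eq_conv (κ w : Eu n → ℝ) :
    mol κ w = MeasureTheory.convolution w κ (ContinuousLinearMap.lsmul ℝ ℝ) volume := by
  funext x; simp [mol, convolution]

lemma mol_contDiff_of_locallyIntegrable {k : ℕ∞} (hw : LocallyIntegrable w) (hκ : ContDiff ℝ k κ)
    (hs : HasCompactSupport κ) : ContDiff ℝ k (mol κ w) := by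
  rw [mol_eq_conv]
  exact hs.contDiff_convolution_right _ hw hκ

lemma pd_mol_of_locallyIntegrable (hw : LocallyIntegrable w) (hκ : ContDiff ℝ 1 κ)
    (hs : HasCompactSupport κ) (i : Fin n) (x : Eu n) :
    pd i (mol κ w) x = mol (pd i κ) w x := by
  have h := hs.hasFDerivAt_convolution_right (μ := volume) (ContinuousLinearMap.lsmul ℝ ℝ) hw hκ x
  rw [← mol_eq_conv] at h
  unfold pd
  rw [h.fderiv, convolution]
  rw [ContinuousLinearMap.integral_apply]
  · simp [mol]
  · have := (hs.fderiv (𝕜 := ℝ)).convolutionExists_right (μ := volume)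
      ((ContinuousLinearMap.lsmul ℝ ℝ).precompR (Eu n)) hw
      (hκ.continuous_fderiv (by simp)) x
    exact this

lemma tsupport_reflect_subset (hκ : tsupport κ ⊆ closedBall 0 ε) (x : Eu n) :
    tsupport (fun y => κ (x - y)) ⊆ closedBall x ε := by
  refine closure_minimal (fun y hy => ?_) isClosed_closedBall
  have := hκ (subset_closure hy)
  rw [mem_closedBall, dist_zero_right] at this
  rwa [mem_closedBall, dist_comm, dist_eq_norm]

lemma hasCompactSupport_of_ball (hκ : tsupport κ ⊆ closedBall 0 ε) : HasCompactSupport κ :=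
  (isCompact_closedBall _ _).of_isClosed_subset isClosed_closure hκ

lemma hasCompactSupport_reflect (hκ : tsupport κ ⊆ closedBall 0 ε) (x : Eu n) :
    HasCompactSupport (fun y => κ (x - y)) :=
  (isCompact_closedBall _ _).of_isClosed_subset isClosed_closure (tsupport_reflect_subset hκ x)

lemma pd_reflect (κ : Eu n → ℝ) (i : Fin n) (x y : Eu n) :
    pd i (fun y => κ (x - y)) y = - pd i κ (x - y) := by
  unfold pd
  have h := fderiv_comp_smul (𝕜 := ℝ) (f := fun z => κ (x + z)) (x := y) (-1)
  rw [fderiv_comp_add_left] at h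
  simp only [neg_smul, one_smul, ← sub_eq_add_neg] at h
  rw [h]; simp

lemma lap_reflect (κ : Eu n → ℝ) (x y : Eu n) :
    lap (fun y => κ (x - y)) y = lap κ (x - y) := by
  simp only [lap_eq_sum_pd]
  refine Finset.sum_congr rfl fun i _ => ?_
  have h1 : pd i (fun y => κ (x - y)) = fun y => (fun z => - pd i κ z) (x - y) := by
    funext y; exact pd_reflect κ i x y
  rw [h1, pd_reflect (fun z => - pd i κ z)]
  unfold pd
  rw [fderiv_fun_neg]; simp

lemma mol_congr {w' : Eu n → ℝ} (hκ : tsupport κ ⊆ closedBall 0 ε)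
    (h : ∀ y ∈ closedBall x ε, w y = w' y) : mol κ w x = mol κ w' x := by
  refine integral_congr_ae (Eventually.of_forall fun y => ?_)
  by_cases hy : y ∈ closedBall x ε
  · simp [h y hy]
  · have : κ (x - y) = 0 :=
      image_eq_zero_of_notMem_tsupport fun h' => hy (by
        have := hκ h'
        rw [mem_closedBall, dist_zero_right] at this
        rwa [mem_closedBall, dist_comm, dist_eq_norm])
    simp [this]

lemma mol_localize (hU : IsOpen U) (hw : ContinuousOn w U) (hx : x ∈ inner' U ε) :
    ∃ w' : Eu n → ℝ, LocallyIntegrable w' ∧ ∀ᶠ y in nhds x,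
      ∀ κ' : Eu n → ℝ, tsupport κ' ⊆ closedBall 0 ε → mol κ' w y = mol κ' w' y := by
  obtain ⟨δ, hδ, h⟩ := exists_thicken hU hx
  refine ⟨(closedBall x (ε + δ)).indicator w, ?_, ?_⟩
  · refine Integrable.locallyIntegrable ?_
    rw [integrable_indicator_iff measurableSet_closedBall]
    exact (hw.mono h).integrableOn_compact (isCompact_closedBall _ _)
  · filter_upwards [ball_mem_nhds x hδ] with y hy κ' hκ'
    refine mol_congr hκ' fun z hz => ?_
    rw [indicator_of_mem]
    refine closedBall_subset_closedBall' ?_ hz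
    rw [mem_ball] at hy; linarith

lemma mol_contDiffAt {k : ℕ∞} (hU : IsOpen U) (hw : ContinuousOn w U) (hκc : ContDiff ℝ k κ)
    (hκ : tsupport κ ⊆ closedBall 0 ε) (hx : x ∈ inner' U ε) :
    ContDiffAt ℝ k (mol κ w) x := by
  obtain ⟨w', hw', h⟩ := mol_localize hU hw hx
  have hc := mol_contDiff_of_locallyIntegrable hw' hκc (hasCompactSupport_of_ball hκ)
  exact hc.contDiffAt.congr_of_eventuallyEq (h.mono fun y hy => hy κ hκ)

lemma pd_mol (hU : IsOpen U) (hw : ContinuousOn w U) (hκc : ContDiff ℝ 1 κ)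
    (hκ : tsupport κ ⊆ closedBall 0 ε) (hx : x ∈ inner' U ε) (i : Fin n) :
    pd i (mol κ w) x = mol (pd i κ) w x := by
  obtain ⟨w', hw', h⟩ := mol_localize hU hw hx
  rw [pd_congr (h.mono fun y hy => hy κ hκ),
    pd_mol_of_locallyIntegrable hw' hκc (hasCompactSupport_of_ball hκ),
    h.self_of_nhds _ ((tsupport_pd_subset i κ).trans hκ)]

lemma mol_sum {ι : Type*} (s : Finset ι) (g : ι → Eu n → ℝ)
    (hi : ∀ i ∈ s, Integrable (fun y => w y * g i (x - y))) :
    mol (fun z => ∑ i ∈ s, g i z) w x = ∑ i ∈ s, mol (g i) w x := by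
  simp only [mol, Finset.mul_sum]
  exact integral_finsetSum _ hi

lemma mol_integrable (hU : IsOpen U) (hw : ContinuousOn w U) (hκc : Continuous κ)
    (hκ : tsupport κ ⊆ closedBall 0 ε) (hx : x ∈ inner' U ε) :
    Integrable (fun y => w y * κ (x - y)) :=
  integrable_mul_cutoff hU hw (by fun_prop) (hasCompactSupport_reflect hκ x)
    ((tsupport_reflect_subset hκ x).trans hx)

lemma lap_mol (hU : IsOpen U) (hw : ContinuousOn w U) (hκc : ContDiff ℝ 2 κ)
    (hκ : tsupport κ ⊆ closedBall 0 ε) (hx : x ∈ inner' U ε) :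
    lap (mol κ w) x = mol (lap κ) w x := by
  have h1 : ∀ i, ContDiff ℝ 1 (pd i κ) := fun i => ContDiff.pd hκc (by norm_num)
  have hs : ∀ i, tsupport (pd i κ) ⊆ closedBall 0 ε :=
    fun i => (tsupport_pd_subset i κ).trans hκ
  rw [lap_eq_sum_pd, show lap κ = fun z => ∑ i, pd i (pd i κ) z from rfl, mol_sum]
  · refine Finset.sum_congr rfl fun i _ => ?_
    have : pd i (mol κ w) =ᶠ[nhds x] mol (pd i κ) w := by
      filter_upwards [(isOpen_inner' hU ε).mem_nhds hx] with y hy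
      exact pd_mol hU hw (hκc.of_le (by norm_num)) hκ hy i
    rw [pd_congr this, pd_mol hU hw (h1 i) (hs i) hx]
  · intro i _
    exact mol_integrable hU hw (continuous_pd (h1 i)) ((tsupport_pd_subset i _).trans (hs i)) hx

lemma abs_mol_le (hκ0 : ∀ z, 0 ≤ κ z) (hκc : Continuous κ) (h1 : ∫ z, κ z = 1)
    (hκ : tsupport κ ⊆ closedBall 0 ε) (hw : ∀ y ∈ closedBall x ε, |w y| ≤ B) :
    |mol κ w x| ≤ B := by
  have := abs_integral_mul_le (w := w) (θ := fun y => κ (x - y)) (by fun_prop)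
    (hasCompactSupport_reflect hκ x) fun y hy => hw y (tsupport_reflect_subset hκ x hy)
  simp only [abs_of_nonneg (hκ0 _)] at this
  rwa [integral_sub_left_eq_self κ volume x, h1, mul_one] at this

lemma mol_sub_const (hU : IsOpen U) (hw : ContinuousOn w U) (hκc : Continuous κ)
    (h1 : ∫ z, κ z = 1) (hκ : tsupport κ ⊆ closedBall 0 ε) (hx : x ∈ inner' U ε) (c : ℝ) :
    mol κ w x - c = mol κ (fun y => w y - c) x := by
  simp only [mol, sub_mul]
  rw [integral_sub (mol_integrable hU hw hκc hκ hx)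
    (mol_integrable isOpen_univ (U := univ) (w := fun _ => c) continuousOn_const hκc hκ
      (subset_univ _)), integral_const_mul, integral_sub_left_eq_self κ volume x, h1, mul_one]

lemma abs_mol_sub_le (hU : IsOpen U) (hw : ContinuousOn w U) (hκ0 : ∀ z, 0 ≤ κ z)
    (hκc : Continuous κ) (h1 : ∫ z, κ z = 1) (hκ : tsupport κ ⊆ closedBall 0 ε)
    (hx : x ∈ inner' U ε) (hwc : ∀ y ∈ closedBall x ε, |w y - c| ≤ B) : |mol κ w x - c| ≤ B := by
  rw [mol_sub_const hU hw hκc h1 hκ hx]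
  exact abs_mol_le hκ0 hκc h1 hκ hwc

lemma jc_mol (hU : IsOpen U) {B : Set ℝ} (hu : JC u U B) (hκc : Continuous κ)
    (hκ : tsupport κ ⊆ closedBall 0 ε) :
    JC (fun x t => mol κ (fun y => u y t) x) (inner' U ε) B := by
  have e : ∀ x t, mol κ (fun y => u y t) x = ∫ z, u (x - z) t * κ z := by
    intro x t
    rw [mol, ← integral_sub_left_eq_self (fun z => u (x - z) t * κ z) volume x]
    simp
  simp only [JC, e]
  refine continuousOn_integral_of_compact_support (μ := volume) (k := closedBall 0 ε)
    (f := fun (p : Eu n × ℝ) z => u (p.1 - z) p.2 * κ z) (isCompact_closedBall _ _) ?_ ?_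
  · rintro ⟨⟨x, t⟩, z⟩ ⟨⟨hx, ht⟩, -⟩
    by_cases hz : z ∈ closedBall 0 ε
    · have hxz : x - z ∈ U := hx (by simpa [dist_eq_norm] using hz)
      have h1 : ContinuousWithinAt (fun z : Eu n × ℝ => u z.1 z.2) (univ ×ˢ B) (x - z, t) := by
        refine ContinuousWithinAt.mono_of_mem_nhdsWithin
          (hu (x - z, t) ⟨hxz, ht⟩ : ContinuousWithinAt _ _ _) ?_
        rw [nhdsWithin_prod_eq, nhdsWithin_univ]
        exact prod_mem_prod (hU.mem_nhds hxz) self_mem_nhdsWithin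
      have h2 : ContinuousWithinAt (fun q : (Eu n × ℝ) × Eu n => u (q.1.1 - q.2) q.1.2)
          ((inner' U ε ×ˢ B) ×ˢ univ) ((x, t), z) :=
        ContinuousWithinAt.comp (g := fun z : Eu n × ℝ => u z.1 z.2) (t := univ ×ˢ B)
          (f := fun q : (Eu n × ℝ) × Eu n => (q.1.1 - q.2, q.1.2)) h1
          (by fun_prop) fun q hq => ⟨mem_univ _, hq.1.2⟩
      exact h2.mul (by fun_prop)
    · have h0 : κ =ᶠ[nhds z] 0 := notMem_tsupport_iff_eventuallyEq.1 fun h => hz (hκ h)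
      have h1 : ∀ᶠ q : (Eu n × ℝ) × Eu n in nhds ((x, t), z), κ q.2 = 0 :=
        (continuous_snd.tendsto ((x, t), z)).eventually h0
      have : (fun q : (Eu n × ℝ) × Eu n => u (q.1.1 - q.2) q.1.2 * κ q.2)
          =ᶠ[nhds ((x, t), z)] fun _ => 0 := by
        filter_upwards [h1] with q hq
        simp [hq]
      exact (continuousAt_const.congr this.symm).continuousWithinAt
  · intro p z _ hz
    simp [image_eq_zero_of_notMem_tsupport fun h => hz (hκ h)]

lemma Weak.hasDerivAt_mol {f : Eu n → ℝ → ℝ} (hU : IsOpen U) (h : Weak U t0 t1 u f)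
    (hκc : ContDiff ℝ 2 κ) (hκ : tsupport κ ⊆ closedBall 0 ε) (hx : x ∈ inner' U ε)
    (ht : t ∈ Ioo t0 t1) :
    HasDerivAt (fun t => mol κ (fun y => u y t) x)
      (mol (lap κ) (fun y => u y t) x + mol κ (fun y => f y t) x) t := by
  have := h.hasDerivAt_pairing hU (ψ := fun y => κ (x - y)) (by fun_prop)
    (hasCompactSupport_reflect hκ x) ((tsupport_reflect_subset hκ x).trans hx) ht
  simp only [lap_reflect] at this
  exact this

lemma exists_mollifier (hε : 0 < ε) : ∃ ρ : Eu n → ℝ, ContDiff ℝ (⊤ : ℕ∞) ρ ∧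
    tsupport ρ ⊆ closedBall 0 ε ∧ (∀ z, 0 ≤ ρ z) ∧ ∫ z, ρ z = 1 := by
  let b : ContDiffBump (0 : Eu n) := ⟨ε / 2, ε, by linarith, by linarith⟩
  refine ⟨b.normed volume, b.contDiff_normed, ?_, fun z => b.nonneg_normed z, b.integral_normed⟩
  rw [b.tsupport_normed_eq]

lemma exists_unif_radius {K : Set (Eu n)} (hU : IsOpen U) (hK : IsCompact K) (hKU : K ⊆ U)
    (hv : JC v U (Icc t0 t1)) {γ : ℝ} (hγ : 0 < γ) :
    ∃ ε > 0, ∀ x ∈ K, x ∈ inner' U ε ∧ ∀ y ∈ closedBall x ε, ∀ t ∈ Icc t0 t1,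
      |v y t - v x t| ≤ γ := by
  obtain ⟨δ, hδ, hsub⟩ := hK.exists_cthickening_subset_open hU hKU
  have hc : IsCompact (cthickening δ K ×ˢ Icc t0 t1) := hK.cthickening.prod isCompact_Icc
  have hu := hc.uniformContinuousOn_of_continuous (hv.mono hsub subset_rfl)
  rw [uniformContinuousOn_iff] at hu
  obtain ⟨ε, hε, h⟩ := hu γ hγ
  refine ⟨min δ (ε / 2), by positivity, fun x hx => ?_⟩
  have hb : closedBall x (min δ (ε / 2)) ⊆ cthickening δ K :=
    (closedBall_subset_closedBall (min_le_left _ _)).trans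
      (closedBall_subset_cthickening hx δ)
  refine ⟨hb.trans hsub, fun y hy t ht => ?_⟩
  have hxx : x ∈ cthickening δ K := self_subset_cthickening K hx
  have := h (y, t) ⟨hb hy, ht⟩ (x, t) ⟨hxx, ht⟩ (by
    rw [Prod.dist_eq]
    simp only [dist_self]
    rw [max_eq_left dist_nonneg]
    have := (mem_closedBall.1 hy).trans (min_le_right _ _)
    linarith)
  rw [Real.dist_eq] at this
  exact this.le

lemma deriv_nonneg_of_left_max {F : ℝ → ℝ} {D : ℝ} (hF : HasDerivAt F D t)
    (h : ∀ᶠ s in nhdsWithin t (Iio t), F s ≤ F t) : 0 ≤ D := by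
  have h1 := hasDerivWithinAt_iff_tendsto_slope.1 (hF.hasDerivWithinAt (s := Iio t))
  have : Iio t \ {t} = Iio t := by ext s; simp
  rw [this] at h1
  refine ge_of_tendsto h1 ?_
  filter_upwards [h, self_mem_nhdsWithin] with s hs hst
  rw [slope_def_field]
  have : s - t < 0 := sub_neg.2 hst
  exact div_nonneg_of_nonpos (by linarith) this.le

/-- Comparison principle for the sum of a classical and a weak solution. -/
theorem comparison (hU : IsOpen U) (hb : Bornology.IsBounded U) {v1 v2 h1 h2 : Eu n → ℝ → ℝ}
    (hc : JC (fun x t => v1 x t + v2 x t) (closure U) (Icc t0 t1))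
    (hv1 : ∀ x ∈ U, ∀ t ∈ Ioo t0 t1, ContDiffAt ℝ 2 (fun y => v1 y t) x)
    (hd1 : ∀ x ∈ U, ∀ t ∈ Ioo t0 t1, HasDerivAt (v1 x) (lap (fun y => v1 y t) x + h1 x t) t)
    (hw : Weak U t0 t1 v2 h2)
    (hsrc : ∀ x ∈ U, ∀ t ∈ Ioo t0 t1, 0 < v1 x t + v2 x t → h1 x t + h2 x t ≤ 0)
    (hpb0 : ∀ x ∈ closure U, v1 x t0 + v2 x t0 ≤ 0)
    (hpb1 : ∀ x ∈ frontier U, ∀ t ∈ Icc t0 t1, v1 x t + v2 x t ≤ 0) :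
    ∀ x ∈ closure U, ∀ t ∈ Icc t0 t1, v1 x t + v2 x t ≤ 0 := by
  suffices H : ∀ x ∈ closure U, ∀ t ∈ Ico t0 t1, v1 x t + v2 x t ≤ 0 by
    intro x hx t ht
    rcases eq_or_lt_of_le (ht.1.trans ht.2) with h01 | h01
    · have : t = t0 := le_antisymm (h01 ▸ ht.2) ht.1
      rw [this]; exact hpb0 x hx
    have hcl := closure_Ico h01.ne
    have hcx := hc.time hx
    rw [← hcl] at hcx ht
    exact le_on_closure (fun s hs => H x hx s hs) hcx continuousOn_const ht
  intro xh hxh th hth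
  by_contra! hpos
  have hKc : IsCompact (closure U) := hb.isCompact_closure
  obtain ⟨η, hη, hηth⟩ : ∃ η > 0, η * (th - t0) < v1 xh th + v2 xh th := by
    refine ⟨(v1 xh th + v2 xh th) / (2 * (th - t0 + 1)), ?_, ?_⟩
    · have : 0 < th - t0 + 1 := by linarith [hth.1]
      positivity
    · have h3 : 0 < th - t0 + 1 := by linarith [hth.1]
      rw [div_mul_eq_mul_div, div_lt_iff₀ (by positivity)]
      nlinarith [hth.1]
  set v : Eu n × ℝ → ℝ := fun z => v1 z.1 z.2 + v2 z.1 z.2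
  set V : Eu n × ℝ → ℝ := fun z => v z - η * (z.2 - t0)
  set D := closure U ×ˢ Icc t0 th
  have hDc : IsCompact D := hKc.prod isCompact_Icc
  have hsubI : Icc t0 th ⊆ Icc t0 t1 := Icc_subset_Icc le_rfl hth.2.le
  have hVc : ContinuousOn V D :=
    ContinuousOn.sub (ContinuousOn.mono hc (prod_mono subset_rfl hsubI)) (by fun_prop)
  obtain ⟨zm, hzm, hmax⟩ := hDc.exists_isMaxOn ⟨(xh, th), hxh, hth.1, le_rfl⟩ hVc
  set m := V zm
  have hm : 0 < m := by
    have := hmax (show (xh, th) ∈ D from ⟨hxh, hth.1, le_rfl⟩)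
    have h3 : 0 < V (xh, th) := by simp only [V, v]; linarith
    exact h3.trans_le this
  set P := D ∩ V ⁻¹' (Ici (m / 2))
  have hPc : IsCompact P := hDc.of_isClosed_subset
    (hVc.preimage_isClosed_of_isClosed hDc.isClosed isClosed_Ici) inter_subset_left
  have hzmP : zm ∈ P := ⟨hzm, by simp only [mem_preimage, mem_Ici]; linarith⟩
  have hPpos : ∀ z ∈ P, 0 < v z ∧ z.1 ∈ U ∧ t0 < z.2 := by
    intro z hz
    have h3 : m / 2 ≤ v z - η * (z.2 - t0) := hz.2
    have h4 : 0 ≤ η * (z.2 - t0) := mul_nonneg hη.le (by linarith [hz.1.2.1])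
    have h5 : 0 < v z := by linarith
    refine ⟨h5, ?_, ?_⟩
    · by_contra hzU
      have : z.1 ∈ frontier U := by
        rw [hU.frontier_eq]; exact ⟨hz.1.1, hzU⟩
      exact absurd (hpb1 _ this _ (hsubI hz.1.2)) (not_le.2 h5)
    · refine lt_of_le_of_ne hz.1.2.1 fun he => ?_
      have := hpb0 _ hz.1.1
      rw [he] at this
      exact absurd this (not_le.2 h5)
  set K := Prod.fst '' P
  have hK : IsCompact K := hPc.image continuous_fst
  have hKU : K ⊆ U := by rintro _ ⟨z, hz, rfl⟩; exact (hPpos z hz).2.1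
  obtain ⟨ε1, hε1, h8⟩ := exists_unif_radius hU hK hKU hw.cu (γ := m / 8) (by positivity)
  obtain ⟨ε2, hε2, h9⟩ := exists_unif_radius hU hK hKU hw.cf (γ := η / 2) (by positivity)
  set ε := min ε1 ε2
  have hε : 0 < ε := lt_min hε1 hε2
  obtain ⟨ρ, hρc, hρs, hρ0, hρ1⟩ := exists_mollifier (n := n) hε
  have hρ2 : ContDiff ℝ 2 ρ := hρc.of_le (WithTop.coe_le_coe.2 le_top)
  have hKin : K ⊆ inner' U ε := fun x hx =>
    (closedBall_subset_closedBall (min_le_left _ _)).trans (h8 x hx).1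
  set w : Eu n → ℝ → ℝ := fun x t => mol ρ (fun y => v2 y t) x
  set g : Eu n → ℝ → ℝ := fun x t => mol ρ (fun y => h2 y t) x
  have hwv : ∀ x ∈ K, ∀ t ∈ Icc t0 t1, |w x t - v2 x t| ≤ m / 8 := fun x hx t ht =>
    abs_mol_sub_le hU (hw.cu.slice ht) hρ0 hρc.continuous hρ1 hρs (hKin hx) fun y hy =>
      (h8 x hx).2 y (closedBall_subset_closedBall (min_le_left _ _) hy) t ht
  have hgh : ∀ x ∈ K, ∀ t ∈ Icc t0 t1, |g x t - h2 x t| ≤ η / 2 := fun x hx t ht =>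
    abs_mol_sub_le hU (hw.cf.slice ht) hρ0 hρc.continuous hρ1 hρs (hKin hx) fun y hy =>
      (h9 x hx).2 y (closedBall_subset_closedBall (min_le_right _ _) hy) t ht
  set W : Eu n × ℝ → ℝ := fun z => V z - v2 z.1 z.2 + w z.1 z.2
  have hPsub : P ⊆ K ×ˢ Icc t0 t1 := fun z hz => ⟨⟨z, hz, rfl⟩, hsubI hz.1.2⟩
  have hWc : ContinuousOn W P := by
    refine ((hVc.mono inter_subset_left).sub ?_).add ?_
    · exact ContinuousOn.mono hw.cu (hPsub.trans (prod_mono hKU subset_rfl))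
    · exact ContinuousOn.mono (jc_mol hU hw.cu hρc.continuous hρs)
        (hPsub.trans (prod_mono hKin subset_rfl))
  obtain ⟨zs, hzs, hmaxW⟩ := hPc.exists_isMaxOn ⟨zm, hzmP⟩ hWc
  have hVzs : m / 2 < V zs := by
    have h3 : W zm ≤ W zs := hmaxW hzmP
    have h4 := abs_le.1 (hwv zm.1 (hPsub hzmP).1 zm.2 (hPsub hzmP).2)
    have h5 := abs_le.1 (hwv zs.1 (hPsub hzs).1 zs.2 (hPsub hzs).2)
    simp only [W] at h3
    have : V zm = m := rfl
    linarith [h4.1, h5.2]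
  obtain ⟨xs, ts⟩ := zs
  obtain ⟨hvpos, hxsU, hts0⟩ := hPpos _ hzs
  simp only at hxsU hts0
  have hts : ts ∈ Ioo t0 t1 := ⟨hts0, hzs.1.2.2.trans_lt hth.2⟩
  have hxsK : xs ∈ K := (hPsub hzs).1
  have hWeq : ∀ y t, W (y, t) = v1 y t + w y t - η * (t - t0) := by
    intro y t; simp only [W, V, v]; ring
  -- spatial maximum
  have hlocx : IsLocalMax (fun y => v1 y ts + w y ts) xs := by
    have hcx : ContinuousAt (fun y => V (y, ts)) xs := by
      have h3 : ContinuousOn (fun y => V (y, ts)) U :=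
        hVc.comp (by fun_prop) fun y hy => ⟨subset_closure hy, hzs.1.2⟩
      exact h3.continuousAt (hU.mem_nhds hxsU)
    filter_upwards [hcx.eventually (lt_mem_nhds hVzs), hU.mem_nhds hxsU] with y hy hyU
    have h3 : (y, ts) ∈ P := ⟨⟨subset_closure hyU, hzs.1.2⟩, (le_of_lt hy : m / 2 ≤ V (y, ts))⟩
    have h4 : W (y, ts) ≤ W (xs, ts) := hmaxW h3
    rw [hWeq, hWeq] at h4
    linarith
  have hwcd : ContDiffAt ℝ 2 (fun y => w y ts) xs :=
    mol_contDiffAt (k := 2) hU (hw.cu.slice ⟨hts.1.le, hts.2.le⟩) hρ2 hρs (hKin hxsK)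
  have hlap : lap (fun y => v1 y ts) xs + lap (fun y => w y ts) xs ≤ 0 := by
    rw [← lap_add (hv1 xs hxsU ts hts) hwcd]
    exact lap_nonpos_of_isLocalMax ((hv1 xs hxsU ts hts).add hwcd) hlocx
  have hlapw : lap (fun y => w y ts) xs = mol (lap ρ) (fun y => v2 y ts) xs :=
    lap_mol hU (hw.cu.slice ⟨hts.1.le, hts.2.le⟩) hρ2 hρs (hKin hxsK)
  -- time derivative
  have hdt : HasDerivAt (fun t => W (xs, t)) (lap (fun y => v1 y ts) xs + h1 xs ts +
      (lap (fun y => w y ts) xs + g xs ts) - η) ts := by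
    rw [hlapw]
    have h3 := (hd1 xs hxsU ts hts).add (hw.hasDerivAt_mol hU hρ2 hρs (hKin hxsK) hts)
    have h4 : HasDerivAt (fun t : ℝ => η * (t - t0)) η ts := by
      simpa using ((hasDerivAt_id ts).sub_const t0).const_mul η
    refine (h3.sub h4).congr_of_eventuallyEq (Eventually.of_forall fun t => ?_)
    exact hWeq xs t
  have hD : 0 ≤ lap (fun y => v1 y ts) xs + h1 xs ts +
      (lap (fun y => w y ts) xs + g xs ts) - η := by
    refine deriv_nonneg_of_left_max hdt ?_
    have hct : ContinuousWithinAt (fun t => V (xs, t)) (Icc t0 th) ts := by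
      have h3 : ContinuousOn (fun t => V (xs, t)) (Icc t0 th) :=
        hVc.comp (by fun_prop) fun t ht => ⟨subset_closure hxsU, ht⟩
      exact h3 ts hzs.1.2
    have hmem : Icc t0 th ∈ nhdsWithin ts (Iio ts) := by
      filter_upwards [self_mem_nhdsWithin, mem_nhdsWithin_of_mem_nhds (lt_mem_nhds hts0)]
        with s hs hs'
      exact ⟨le_of_lt hs', (le_of_lt hs).trans hzs.1.2.2⟩
    have hct' : Tendsto (fun t => V (xs, t)) (nhdsWithin ts (Iio ts)) (nhds (V (xs, ts))) :=
      hct.mono_left (nhdsWithin_le_iff.2 hmem)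
    filter_upwards [hct'.eventually (lt_mem_nhds hVzs), hmem] with s hs hsI
    exact hmaxW (show (xs, s) ∈ P from ⟨⟨subset_closure hxsU, hsI⟩, le_of_lt hs⟩)
  have hg := (abs_le.1 (hgh xs hxsK ts ⟨hts.1.le, hts.2.le⟩)).2
  have hs := hsrc xs hxsU ts hts hvpos
  linarith

lemma Weak.of_classical {P D f : Eu n → ℝ → ℝ} (hPc : Continuous fun z : Eu n × ℝ => P z.1 z.2)
    (hDc : Continuous fun z : Eu n × ℝ => D z.1 z.2) (hfc : Continuous fun z : Eu n × ℝ => f z.1 z.2)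
    (hP : ∀ t, ContDiff ℝ 2 fun x => P x t) (hd : ∀ x t, HasDerivAt (P x) (D x t) t)
    (heq : ∀ x t, D x t = lap (fun y => P y t) x + f x t) (t0 t1 : ℝ) :
    Weak univ t0 t1 P f := by
  refine ⟨hPc.continuousOn, hfc.continuousOn, ?_⟩
  intro ψ hψ hs _ s _ t _ hst
  have hsl : ∀ {g : Eu n → ℝ → ℝ}, Continuous (fun z : Eu n × ℝ => g z.1 z.2) → ∀ τ,
      Continuous fun x => g x τ := fun hg τ => hg.comp (by fun_prop : Continuous fun x => (x, τ))
  have hitg : ∀ {w : Eu n → ℝ}, Continuous w → Integrable fun x => w x * ψ x := fun hw =>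
    (hw.mul hψ.continuous).integrable_of_hasCompactSupport hs.mul_left
  have key : ∀ τ ∈ uIcc s t, HasDerivAt (fun τ => ∫ x, P x τ * ψ x) (∫ x, D x τ * ψ x) τ := by
    intro τ _
    have hK : IsCompact (tsupport ψ ×ˢ Icc (τ - 1) (τ + 1)) := hs.isCompact.prod isCompact_Icc
    obtain ⟨C, hC⟩ := hK.exists_bound_of_continuousOn hDc.continuousOn
    refine (hasDerivAt_integral_of_dominated_loc_of_deriv_le (bound := fun x => C * |ψ x|)
      (F' := fun τ x => D x τ * ψ x)
      (ball_mem_nhds τ one_pos) (Eventually.of_forall fun τ' => ?_) (hitg (hsl hPc τ)) ?_ ?_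
      ?_ ?_).2
    · exact (hitg (hsl hPc τ')).aestronglyMeasurable
    · exact (hitg (hsl hDc τ)).aestronglyMeasurable
    · refine Eventually.of_forall fun x τ' hτ' => ?_
      rw [norm_mul, Real.norm_eq_abs (ψ x)]
      by_cases hx : x ∈ tsupport ψ
      · have := hC (x, τ') ⟨hx, by
          rw [mem_ball, Real.dist_eq, abs_lt] at hτ'
          constructor <;> linarith⟩
        gcongr
      · simp [image_eq_zero_of_notMem_tsupport hx]
    · exact ((hψ.continuous.abs.integrable_of_hasCompactSupport (hs.comp_left (g := abs) (by simp)))).const_mul C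
    · exact Eventually.of_forall fun x τ' _ => (hd x τ').mul_const _
  have hcont : Continuous fun τ => ∫ x, D x τ * ψ x := by
    rw [← continuousOn_univ]
    exact continuousOn_pairing isOpen_univ (B := univ) hDc.continuousOn
      hψ.continuous hs (subset_univ _)
  rw [← intervalIntegral.integral_eq_sub_of_hasDerivAt key (hcont.intervalIntegrable _ _)]
  refine intervalIntegral.integral_congr fun τ _ => ?_
  beta_reduce
  have h1 : (∫ x, P x τ * lap ψ x) = ∫ x, lap (fun y => P y τ) x * ψ x :=
    (integral_lap_mul (hP τ) hψ hs).symm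
  rw [h1, ← integral_add (hitg (continuous_lap (hP τ))) (hitg (hsl hfc τ))]
  refine integral_congr_ae (Eventually.of_forall fun x => ?_)
  beta_reduce
  rw [heq]; ring

/-- Density of the standard Gaussian. -/
def gaussDen (z : Eu n) : ℝ := ((2 * π) ^ ((n : ℝ) / 2))⁻¹ * exp (-(1 / 2) * ‖z‖ ^ 2)

lemma gaussDen_nonneg (z : Eu n) : 0 ≤ gaussDen z := by unfold gaussDen; positivity

lemma integrable_exp_normSq {b : ℝ} (hb : 0 < b) :
    Integrable fun z : Eu n => exp (-b * ‖z‖ ^ 2) := by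
  by_contra h
  have h1 := GaussianFourier.integral_rexp_neg_mul_sq_norm (V := Eu n) hb
  rw [integral_undef h] at h1
  have : 0 < (π / b) ^ ((Module.finrank ℝ (Eu n) : ℝ) / 2) := by positivity
  linarith

lemma integral_gaussDen : ∫ z : Eu n, gaussDen z = 1 := by
  unfold gaussDen
  rw [integral_const_mul, GaussianFourier.integral_rexp_neg_mul_sq_norm (by norm_num)]
  have : π / (1 / 2) = 2 * π := by ring
  rw [this, finrank_euclideanSpace_fin]
  exact inv_mul_cancel₀ (by positivity)

lemma contDiff_gaussDen : ContDiff ℝ 2 (gaussDen : Eu n → ℝ) := by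
  unfold gaussDen
  exact contDiff_const.mul (contDiff_const.mul (contDiff_norm_sq ℝ)).exp

lemma gaussDen_integrable : Integrable (gaussDen : Eu n → ℝ) :=
  (integrable_exp_normSq (by norm_num)).const_mul _

lemma pd_gaussDen (i : Fin n) (z : Eu n) : pd i gaussDen z = - (z i * gaussDen z) := by
  unfold gaussDen pd
  have h := (((contDiff_normSq (k := 2) (0 : Eu n)).differentiable (by norm_num) z).hasFDerivAt)
  simp only [sub_zero] at h
  have h2 := ((h.const_mul (-(1/2))).exp).const_mul ((2 * π) ^ ((n : ℝ) / 2))⁻¹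
  rw [h2.fderiv]
  simp [EuclideanSpace.inner_single_right]
  ring

/-- The standard Gaussian measure. -/
def gam (n : ℕ) : Measure (Eu n) := volume.withDensity fun z => ENNReal.ofReal (gaussDen z)

lemma measurable_gaussDen : Measurable fun z : Eu n => ENNReal.ofReal (gaussDen z) :=
  (contDiff_gaussDen.continuous.measurable).ennreal_ofReal

lemma integral_gam (f : Eu n → ℝ) : ∫ z, f z ∂(gam n) = ∫ z, gaussDen z * f z := by
  unfold gam
  rw [integral_withDensity_eq_integral_toReal_smul₀ measurable_gaussDen.aemeasurable
    (Eventually.of_forall fun _ => ENNReal.ofReal_lt_top)]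
  refine integral_congr_ae (Eventually.of_forall fun z => ?_)
  simp [ENNReal.toReal_ofReal (gaussDen_nonneg z)]

lemma integrable_gam :
    Integrable f (gam n) ↔ Integrable fun z => gaussDen z * f z := by
  unfold gam
  rw [integrable_withDensity_iff_integrable_smul' measurable_gaussDen
    (Eventually.of_forall fun _ => ENNReal.ofReal_lt_top)]
  refine integrable_congr (Eventually.of_forall fun z => ?_)
  simp [ENNReal.toReal_ofReal (gaussDen_nonneg z)]

instance : IsProbabilityMeasure (gam n) := by
  constructor
  unfold gam
  rw [withDensity_apply _ MeasurableSet.univ, Measure.restrict_univ,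
    ← ofReal_integral_eq_lintegral_ofReal gaussDen_integrable
      (Eventually.of_forall gaussDen_nonneg), integral_gaussDen]
  simp

lemma gam_moment : Integrable (fun z : Eu n => (1 + ‖z‖ ^ 2) ^ 2) (gam n) := by
  rw [integrable_gam]
  refine ((integrable_exp_normSq (n := n) (b := 1 / 4) (by norm_num)).const_mul
    (64 * ((2 * π) ^ ((n : ℝ) / 2))⁻¹)).mono' ?_ (Eventually.of_forall fun z => ?_)
  · exact (contDiff_gaussDen.continuous.mul (by fun_prop)).aestronglyMeasurable
  · rw [norm_of_nonneg (mul_nonneg (gaussDen_nonneg z) (by positivity))]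
    unfold gaussDen
    have h1 : (1 + ‖z‖ ^ 2) ^ 2 ≤ 64 * exp (1 / 4 * ‖z‖ ^ 2) := by
      have h2 := add_one_le_exp (‖z‖ ^ 2 / 8)
      have h3 : exp (1 / 4 * ‖z‖ ^ 2) = exp (‖z‖ ^ 2 / 8) ^ 2 := by
        rw [← exp_nat_mul]; congr 1; push_cast; ring
      rw [h3]
      have h4 : 1 + ‖z‖ ^ 2 ≤ 8 * exp (‖z‖ ^ 2 / 8) := by linarith
      nlinarith [sq_nonneg ‖z‖]
    have h5 : exp (-(1 / 4) * ‖z‖ ^ 2) = exp (-(1/2) * ‖z‖ ^ 2) * exp (1 / 4 * ‖z‖ ^ 2) := by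
      rw [← exp_add]; congr 1; ring
    rw [h5]
    have h6 : 0 ≤ ((2 * π) ^ ((n : ℝ) / 2))⁻¹ * exp (-(1 / 2) * ‖z‖ ^ 2) := by positivity
    nlinarith

lemma gam_integrable_of_le (hG : Continuous G) (h : ∀ z, |G z| ≤ C * (1 + ‖z‖ ^ 2) ^ 2) :
    Integrable G (gam n) :=
  (gam_moment.const_mul C).mono' hG.aestronglyMeasurable (Eventually.of_forall fun z => by
    simpa using h z)

lemma gam_integrable_of_bdd (hG : Continuous G) (h : ∀ z, |G z| ≤ C) : Integrable G (gam n) :=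
  (integrable_const C).mono' hG.aestronglyMeasurable (Eventually.of_forall fun z => by
    simpa using h z)

lemma abs_integral_gam_le (h : ∀ z, |G z| ≤ C) :
    |∫ z, G z ∂(gam n)| ≤ C := by
  have := norm_integral_le_of_norm_le_const (μ := gam n) (f := G) (C := C)
    (Eventually.of_forall fun z => by simpa using h z)
  simpa using this

lemma gam_ibp (hG : ContDiff ℝ 1 G) (i : Fin n) (h0 : ∀ z, |G z| ≤ C * (1 + ‖z‖))
    (h1 : ∀ z, |pd i G z| ≤ C * (1 + ‖z‖)) :
    ∫ z, z i * G z ∂(gam n) = ∫ z, pd i G z ∂(gam n) := by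
  have hC : 0 ≤ C := by have := (abs_nonneg _).trans (h0 0); simpa using this
  have hzi : ∀ z : Eu n, |z i| ≤ ‖z‖ := fun z => by simpa using PiLp.norm_apply_le z i
  have hci : Continuous fun z : Eu n => z i := by fun_prop
  have hpc : Continuous (pd i G) := continuous_pd hG
  have e0 : Integrable G (gam n) := gam_integrable_of_le (C := 2 * C) hG.continuous fun z =>
    (h0 z).trans (by nlinarith [sq_nonneg (‖z‖ - 1), sq_nonneg (‖z‖ ^ 2), norm_nonneg z])
  have e1 : Integrable (pd i G) (gam n) := gam_integrable_of_le (C := 2 * C) hpc fun z =>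
    (h1 z).trans (by nlinarith [sq_nonneg (‖z‖ - 1), sq_nonneg (‖z‖ ^ 2), norm_nonneg z])
  have e2 : Integrable (fun z => z i * G z) (gam n) :=
    gam_integrable_of_le (C := 2 * C) (hci.mul hG.continuous) fun z => by
      rw [abs_mul]
      calc |z i| * |G z| ≤ ‖z‖ * (C * (1 + ‖z‖)) := by gcongr; exacts [hzi z, h0 z]
        _ ≤ _ := by nlinarith [sq_nonneg (‖z‖ - 1), sq_nonneg (‖z‖ ^ 2), norm_nonneg z]
  rw [integral_gam, integral_gam]
  rw [integrable_gam] at e0 e1 e2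
  have hgd : Differentiable ℝ (gaussDen : Eu n → ℝ) := contDiff_gaussDen.differentiable (by norm_num)
  have := integral_mul_fderiv_eq_neg_fderiv_mul_of_integrable (μ := (volume : Measure (Eu n)))
    (f := gaussDen) (g := G) (v := EuclideanSpace.single i 1) ?_ e1 e0 (fun x _ => hgd x)
    (fun x _ => hG.differentiable (by norm_num) x)
  · refine Eq.trans ?_ this.symm
    rw [← integral_neg]
    refine integral_congr_ae (Eventually.of_forall fun z => ?_)
    have h := pd_gaussDen i z
    unfold pd at h
    simp only [h]
    ring
  · refine (e2.neg).congr (Eventually.of_forall fun z => ?_)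
    have h := pd_gaussDen i z
    unfold pd at h
    simp only [h, Pi.neg_apply]
    ring

/-- The heat semigroup. -/
def heatS (σ : ℝ) (g : Eu n → ℝ) (x : Eu n) : ℝ := ∫ z, g (x + √(2 * σ) • z) ∂(gam n)

lemma hasFDerivAt_affine (hg : DifferentiableAt ℝ g (x + r • z)) :
    HasFDerivAt (fun z => g (x + r • z)) (r • fderiv ℝ g (x + r • z)) z := by
  have h1 : HasFDerivAt (fun z : Eu n => x + r • z) (r • ContinuousLinearMap.id ℝ (Eu n)) z :=
    ((hasFDerivAt_id z).const_smul r).const_add x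
  refine (hg.hasFDerivAt.comp z h1).congr_fderiv ?_
  ext v; simp

lemma pd_affine (hg : DifferentiableAt ℝ g (x + r • z)) (i : Fin n) :
    pd i (fun z => g (x + r • z)) z = r * pd i g (x + r • z) := by
  unfold pd; rw [(hasFDerivAt_affine hg).fderiv]; simp

lemma fderiv_apply_eq_sum (g : Eu n → ℝ) (y z : Eu n) :
    fderiv ℝ g y z = ∑ i, z i * pd i g y := by
  have hz : z = ∑ i, z i • EuclideanSpace.single i (1 : ℝ) := by
    ext j
    simp [Finset.sum_apply, Pi.single_apply]
  conv_lhs => rw [hz]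
  rw [map_sum]
  simp [pd]

lemma abs_coord_le (z : Eu n) (i : Fin n) : |z i| ≤ ‖z‖ := by simpa using PiLp.norm_apply_le z i

lemma gam_ibp_affine (hg : ContDiff ℝ 1 g) (i : Fin n) (h0 : ∀ z, |g z| ≤ C)
    (h1 : ∀ z, |pd i g z| ≤ C) (x : Eu n) (r : ℝ) :
    ∫ z, z i * g (x + r • z) ∂(gam n) = r * ∫ z, pd i g (x + r • z) ∂(gam n) := by
  have hC : 0 ≤ C := (abs_nonneg _).trans (h0 0)
  have hd := hg.differentiable (by norm_num)
  have hp : ∀ z, pd i (fun z => g (x + r • z)) z = r * pd i g (x + r • z) := fun z =>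
    pd_affine (hd _) i
  rw [gam_ibp (C := C * (1 + |r|)) (G := fun z => g (x + r • z)) (by fun_prop) i ?_ ?_]
  · simp_rw [hp]; rw [integral_const_mul]
  · intro z
    refine (h0 _).trans ?_
    have : 0 ≤ C * |r| := by positivity
    have h2 : 0 ≤ C * (1 + |r|) * ‖z‖ := by positivity
    nlinarith
  · intro z
    rw [hp, abs_mul]
    have h3 : |r| * |pd i g (x + r • z)| ≤ |r| * C := by gcongr; exact h1 _
    have h2 : 0 ≤ C * (1 + |r|) * ‖z‖ := by positivity
    nlinarith

lemma hasDerivAt_gam_affine (hg : ContDiff ℝ 2 g) (h0 : ∀ z, |g z| ≤ C)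
    (h1 : ∀ i z, |pd i g z| ≤ C) (h2 : ∀ i z, |pd i (pd i g) z| ≤ C) (x : Eu n) (r : ℝ) :
    HasDerivAt (fun r : ℝ => ∫ z, g (x + r • z) ∂(gam n))
      (r * ∫ z, lap g (x + r • z) ∂(gam n)) r := by
  have hC : 0 ≤ C := (abs_nonneg _).trans (h0 0)
  have hd := hg.differentiable (by norm_num)
  have hpc : ∀ i, ContDiff ℝ 1 (pd i g) := fun i => hg.pd (by norm_num)
  have hF' : ∀ r : ℝ, Continuous fun z : Eu n => ∑ i, z i * pd i g (x + r • z) := fun r =>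
    continuous_finsetSum _ fun i _ => by
      have := (hpc i).continuous
      fun_prop
  have hgc := hg.continuous
  have key := (hasDerivAt_integral_of_dominated_loc_of_deriv_le (μ := gam n) (x₀ := r)
      (F := fun r z => g (x + r • z))
      (bound := fun z => n * (‖z‖ * C))
      (F' := fun r z => ∑ i, z i * pd i g (x + r • z))
      (ball_mem_nhds r one_pos) (Eventually.of_forall fun r' => ?_)
      (gam_integrable_of_bdd (C := C) (by fun_prop) fun z => h0 _) ?_ ?_ ?_ ?_).2
  · refine key.congr_deriv ?_
    have hi : ∀ i, Integrable (fun z : Eu n => z i * pd i g (x + r • z)) (gam n) := fun i => by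
      have := (hpc i).continuous
      refine gam_integrable_of_le (C := C) (by fun_prop) fun z => ?_
      rw [abs_mul]
      calc |z i| * |pd i g (x + r • z)| ≤ ‖z‖ * C := by
            gcongr; exacts [abs_coord_le z i, h1 _ _]
        _ ≤ _ := by
          have : ‖z‖ ≤ (1 + ‖z‖ ^ 2) ^ 2 := by nlinarith [sq_nonneg (‖z‖ - 1), sq_nonneg (‖z‖ ^ 2)]
          nlinarith
    have hi2 : ∀ i, Integrable (fun z : Eu n => pd i (pd i g) (x + r • z)) (gam n) := fun i => by
      have := continuous_pd (hpc i) (i := i)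
      exact gam_integrable_of_bdd (C := C) (by fun_prop) fun z => h2 _ _
    rw [integral_finsetSum _ fun i _ => hi i]
    simp_rw [lap_eq_sum_pd]
    rw [integral_finsetSum _ fun i _ => hi2 i, Finset.mul_sum]
    refine Finset.sum_congr rfl fun i _ => ?_
    exact (gam_ibp_affine (hpc i) i (fun z => h1 i z) (h2 i) x r)
  · exact (by fun_prop : Continuous fun z => g (x + r' • z)).aestronglyMeasurable
  · exact (hF' r).aestronglyMeasurable
  · refine Eventually.of_forall fun z r' _ => ?_
    refine (norm_sum_le _ _).trans ?_
    refine (Finset.sum_le_card_nsmul _ _ (‖z‖ * C) fun i _ => ?_).trans (by simp)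
    rw [norm_mul]
    gcongr
    exacts [abs_coord_le z i, h1 _ _]
  · refine gam_integrable_of_le (C := n * C) (by fun_prop) fun z => ?_
    rw [abs_of_nonneg (by positivity)]
    have : ‖z‖ ≤ (1 + ‖z‖ ^ 2) ^ 2 := by nlinarith [sq_nonneg (‖z‖ - 1), sq_nonneg (‖z‖ ^ 2)]
    have h3 : 0 ≤ n * C := by positivity
    nlinarith
  · refine Eventually.of_forall fun z r' _ => ?_
    have h3 : HasDerivAt (fun r : ℝ => x + r • z) z r' := by
      simpa using ((hasDerivAt_id r').smul_const z).const_add x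
    have := (hd (x + r' • z)).hasFDerivAt.comp_hasDerivAt r' h3
    rwa [fderiv_apply_eq_sum] at this

lemma continuous_gam_param {X : Type*} [TopologicalSpace X] [FirstCountableTopology X]
    {F : X → Eu n → ℝ} (hF : Continuous fun q : X × Eu n => F q.1 q.2) (hM : ∀ q z, |F q z| ≤ M) :
    Continuous fun q => ∫ z, F q z ∂(gam n) := by
  refine continuous_of_dominated (bound := fun _ => M) (fun q => ?_) (fun q => ?_)
    (integrable_const M) (Eventually.of_forall fun z => ?_)
  · exact (hF.comp (by fun_prop : Continuous fun z => (q, z))).aestronglyMeasurable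
  · exact Eventually.of_forall fun z => by simpa using hM q z
  · exact hF.comp (by fun_prop : Continuous fun q => (q, z))

lemma continuous_heatS (hc : Continuous fun z : Eu n × ℝ => h z.1 z.2) (hM : ∀ x t, |h x t| ≤ M) :
    Continuous fun q : ℝ × Eu n × ℝ => heatS q.1 (fun y => h y q.2.2) q.2.1 := by
  unfold heatS
  refine continuous_gam_param (F := fun (q : ℝ × Eu n × ℝ) z => h (q.2.1 + √(2 * q.1) • z) q.2.2) ?_
    (fun _ _ => hM _ _)
  exact hc.comp (by fun_prop : Continuous fun q : (ℝ × Eu n × ℝ) × Eu n =>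
    (q.1.2.1 + √(2 * q.1.1) • q.2, q.1.2.2))

lemma continuous_heatS_time (hc : Continuous g) (hM : ∀ x, |g x| ≤ M) (x : Eu n) :
    Continuous fun σ => heatS σ g x :=
  (continuous_heatS (h := fun y _ => g y) (by fun_prop) (fun x _ => hM x)).comp
    (by fun_prop : Continuous fun σ : ℝ => (σ, x, (0 : ℝ)))

lemma heatS_zero (g : Eu n → ℝ) (x : Eu n) : heatS 0 g x = g x := by simp [heatS]

lemma heatS_sub_eq_integral (hg : ContDiff ℝ 2 g) (h0 : ∀ z, |g z| ≤ C)
    (h1 : ∀ i z, |pd i g z| ≤ C) (h2 : ∀ i z, |pd i (pd i g) z| ≤ C) (x : Eu n) (hσ : 0 ≤ σ) :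
    heatS σ g x - g x = ∫ τ in (0)..σ, heatS τ (lap g) x := by
  have hlb : ∀ z, |lap g z| ≤ n * C := fun z => by
    rw [lap_eq_sum_pd]
    refine (Finset.abs_sum_le_sum_abs _ _).trans ?_
    exact (Finset.sum_le_card_nsmul _ _ C fun i _ => h2 i z).trans (by simp)
  rw [intervalIntegral.integral_eq_sub_of_hasDerivAt_of_le hσ
    (f := fun τ => heatS τ g x), heatS_zero]
  · exact (continuous_heatS_time hg.continuous h0 x).continuousOn
  · intro τ hτ
    have hs : 0 < √(2 * τ) := sqrt_pos.2 (by linarith [hτ.1])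
    have hr : HasDerivAt (fun τ : ℝ => √(2 * τ)) (1 / √(2 * τ)) τ := by
      have h3 : HasDerivAt (fun τ : ℝ => 2 * τ) 2 τ := by
        simpa using (hasDerivAt_id τ).const_mul 2
      convert h3.sqrt (by linarith [hτ.1]) using 1
      field_simp
    have := (hasDerivAt_gam_affine hg h0 h1 h2 x (√(2 * τ))).comp τ hr
    unfold heatS
    refine this.congr_deriv ?_
    field_simp
  · exact (continuous_heatS_time (continuous_lap hg) hlb x).intervalIntegrable _ _

lemma heatS_le_of_integrable {ζ : Eu n → ℝ} (hζ : Integrable ζ) (h0 : ∀ z, 0 ≤ ζ z) (hs0 : 0 < s0)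
    (hσ : s0 ≤ σ) (x : Eu n) :
    heatS σ ζ x ≤ (√(2 * s0) ^ n)⁻¹ * ∫ z, ζ z := by
  have hr0 : 0 < √(2 * s0) := sqrt_pos.2 (by linarith)
  have hr : 0 < √(2 * σ) := sqrt_pos.2 (by linarith)
  have hmono : √(2 * s0) ≤ √(2 * σ) := sqrt_le_sqrt (by linarith)
  have hitg : Integrable fun z => ζ (x + √(2 * σ) • z) :=
    (integrable_comp_smul_iff volume (fun z => ζ (x + z)) hr.ne').2 (hζ.comp_add_left x)
  have heq : ∫ z, ζ (x + √(2 * σ) • z) = (√(2 * σ) ^ n)⁻¹ * ∫ z, ζ z := by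
    rw [Measure.integral_comp_smul volume (fun z => ζ (x + z)), integral_add_left_eq_self]
    rw [finrank_euclideanSpace_fin, abs_of_pos (by positivity), smul_eq_mul]
  unfold heatS
  rw [integral_gam]
  have hge1 : gaussDen ≤ fun _ : Eu n => (1 : ℝ) := by
    intro z
    unfold gaussDen
    have h1 : exp (-(1 / 2) * ‖z‖ ^ 2) ≤ 1 := exp_le_one_iff.2 (by nlinarith [sq_nonneg ‖z‖])
    have h2 : ((2 * π) ^ ((n : ℝ) / 2))⁻¹ ≤ 1 :=
      inv_le_one_of_one_le₀ (one_le_rpow (by linarith [pi_gt_three]) (by positivity))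
    exact mul_le_one₀ h2 (exp_pos _).le h1
  calc ∫ z, gaussDen z * ζ (x + √(2 * σ) • z) ≤ ∫ z, ζ (x + √(2 * σ) • z) := by
        refine integral_mono_of_nonneg
          (Eventually.of_forall fun z => mul_nonneg (gaussDen_nonneg z) (h0 _)) hitg
          (Eventually.of_forall fun z => ?_)
        exact mul_le_of_le_one_left (h0 _) (hge1 z)
    _ = _ := heq
    _ ≤ _ := by
      gcongr
      exact integral_nonneg h0

/-- The heat potential of a source `h` on the whole space, with zero initial data. -/
def Pot (h : Eu n → ℝ → ℝ) (x : Eu n) (t : ℝ) : ℝ :=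
  ∫ s in (0)..t, heatS s (fun y => h y (t - s)) x

lemma continuous_heatS_comp (hc : Continuous fun z : Eu n × ℝ => h z.1 z.2)
    (hM : ∀ x t, |h x t| ≤ M) {X : Type*} [TopologicalSpace X] {a c : X → ℝ} {b : X → Eu n}
    (ha : Continuous a) (hb : Continuous b) (hc' : Continuous c) :
    Continuous fun q => heatS (a q) (fun y => h y (c q)) (b q) :=
  (continuous_heatS hc hM).comp (by fun_prop : Continuous fun q => (a q, b q, c q))

lemma Pot_eq_mul (h : Eu n → ℝ → ℝ) (x : Eu n) (t : ℝ) :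
    Pot h x t = t * ∫ s in (0)..1, heatS (t * s) (fun y => h y (t - t * s)) x := by
  have := intervalIntegral.smul_integral_comp_mul_left
    (f := fun s => heatS s (fun y => h y (t - s)) x) (a := 0) (b := 1) t
  simp only [mul_zero, mul_one, smul_eq_mul] at this
  rw [this, Pot]

lemma Pot_eq_rev (h : Eu n → ℝ → ℝ) (x : Eu n) (t : ℝ) :
    Pot h x t = ∫ s in (0)..t, heatS (t - s) (fun y => h y s) x := by
  have := intervalIntegral.integral_comp_sub_left
    (f := fun s => heatS (t - s) (fun y => h y s) x) (a := 0) (b := t) t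
  simp only [sub_self, sub_zero, sub_sub_cancel] at this
  rw [← this, Pot]

lemma continuous_Pot (hc : Continuous fun z : Eu n × ℝ => h z.1 z.2)
    (hM : ∀ x t, |h x t| ≤ M) : Continuous fun z : Eu n × ℝ => Pot h z.1 z.2 := by
  simp_rw [Pot_eq_mul]
  refine continuous_snd.mul ?_
  refine intervalIntegral.continuous_parametric_intervalIntegral_of_continuous'
    (f := fun (z : Eu n × ℝ) s => heatS (z.2 * s) (fun y => h y (z.2 - z.2 * s)) z.1) ?_ 0 1
  exact continuous_heatS_comp (a := fun q : (Eu n × ℝ) × ℝ => q.1.2 * q.2)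
    (c := fun q : (Eu n × ℝ) × ℝ => q.1.2 - q.1.2 * q.2) (b := fun q => q.1.1) hc hM
    (by fun_prop) (by fun_prop) (by fun_prop)

lemma abs_heatS_le (hg : ∀ x, |g x| ≤ C) (σ : ℝ) (x : Eu n) :
    |heatS σ g x| ≤ C := abs_integral_gam_le fun _ => hg _

lemma heatS_integrable (hgc : Continuous g) (hg : ∀ x, |g x| ≤ C) (σ : ℝ) (x : Eu n) :
    Integrable (fun z => g (x + √(2 * σ) • z)) (gam n) :=
  gam_integrable_of_bdd (by fun_prop) fun _ => hg _

lemma abs_Pot_le {m : ℝ → ℝ} (hm : Continuous m) (ht : 0 ≤ t)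
    (h0 : ∀ s ∈ Icc 0 t, ∀ y, |h y s| ≤ m s) :
    |Pot h x t| ≤ ∫ s in (0)..t, m s := by
  rw [Pot_eq_rev]
  rw [← Real.norm_eq_abs]
  refine intervalIntegral.norm_integral_le_of_norm_le ht (Eventually.of_forall fun s hs => ?_)
    (hm.intervalIntegrable _ _)
  exact abs_heatS_le (h0 s ⟨hs.1.le, hs.2⟩) _ _

lemma abs_Pot_le_const (ht : 0 ≤ t) (h0 : ∀ y s, |h y s| ≤ M) :
    |Pot h x t| ≤ t * M := by
  have := abs_Pot_le (h := h) (x := x) (m := fun _ => M) continuous_const ht fun s _ y => h0 y s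
  simpa using this

lemma Pot_zero (h : Eu n → ℝ → ℝ) (x : Eu n) : Pot h x 0 = 0 := by simp [Pot]

lemma Pot_nonneg (h0 : ∀ x t, 0 ≤ h x t) (ht : 0 ≤ t) : 0 ≤ Pot h x t :=
  intervalIntegral.integral_nonneg ht fun _ _ => integral_nonneg fun _ => h0 _ _

lemma intervalIntegrable_Pot (hc : Continuous fun z : Eu n × ℝ => h z.1 z.2)
    (hM : ∀ x t, |h x t| ≤ M) (x : Eu n) (t a b : ℝ) :
    IntervalIntegrable (fun s => heatS s (fun y => h y (t - s)) x) volume a b :=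
  (continuous_heatS_comp (a := fun s : ℝ => s) (b := fun _ => x) (c := fun s => t - s)
    hc hM (by fun_prop) (by fun_prop) (by fun_prop)).intervalIntegrable _ _

lemma continuous_slice (hc : Continuous fun z : Eu n × ℝ => h z.1 z.2) (t : ℝ) :
    Continuous fun y => h y t := hc.comp (by fun_prop : Continuous fun y => (y, t))

lemma Pot_sub {h' : Eu n → ℝ → ℝ} {M' : ℝ} (hc : Continuous fun z : Eu n × ℝ => h z.1 z.2)
    (hM : ∀ x t, |h x t| ≤ M) (hc' : Continuous fun z : Eu n × ℝ => h' z.1 z.2)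
    (hM' : ∀ x t, |h' x t| ≤ M') (x : Eu n) (t : ℝ) :
    Pot h x t - Pot h' x t = Pot (fun x t => h x t - h' x t) x t := by
  unfold Pot
  rw [← intervalIntegral.integral_sub (intervalIntegrable_Pot hc hM x t _ _)
    (intervalIntegrable_Pot hc' hM' x t _ _)]
  refine intervalIntegral.integral_congr fun s _ => ?_
  exact (integral_sub (heatS_integrable (continuous_slice hc _) (fun x => hM x _) s x)
    (heatS_integrable (continuous_slice hc' _) (fun x => hM' x _) s x)).symm

lemma Pot_small {ζ : Eu n → ℝ} (hζc : Continuous ζ) (hζ : Integrable ζ) (h0 : ∀ z, 0 ≤ ζ z)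
    (h1 : ∀ z, ζ z ≤ 1) (hs0 : 0 < s0) (ht : 0 ≤ t) (x : Eu n) :
    Pot (fun x _ => ζ x) x t ≤ s0 + t * ((√(2 * s0) ^ n)⁻¹ * ∫ z, ζ z) := by
  have hI : 0 ≤ ∫ z, ζ z := integral_nonneg h0
  have hM : ∀ (x : Eu n) (t : ℝ), |ζ x| ≤ 1 := fun x _ => abs_le.2 ⟨by linarith [h0 x], h1 x⟩
  have hc : Continuous fun z : Eu n × ℝ => ζ z.1 := by fun_prop
  have hii := fun a b => intervalIntegrable_Pot (h := fun x _ => ζ x) hc hM x t a b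
  have hle1 : ∀ σ, heatS σ ζ x ≤ 1 := fun σ =>
    (le_abs_self _).trans (abs_heatS_le (fun x => hM x 0) σ x)
  have hpos : 0 ≤ (√(2 * s0) ^ n)⁻¹ * ∫ z, ζ z := by positivity
  rcases le_total t s0 with hts | hts
  · have : Pot (fun x _ => ζ x) x t ≤ ∫ s in (0)..t, (1 : ℝ) :=
      intervalIntegral.integral_mono_on ht (hii _ _) (by simp) fun s _ => hle1 s
    simp only [intervalIntegral.integral_const, sub_zero, smul_eq_mul, mul_one] at this
    have : 0 ≤ t * ((√(2 * s0) ^ n)⁻¹ * ∫ z, ζ z) := by positivity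
    linarith
  · unfold Pot
    rw [← intervalIntegral.integral_add_adjacent_intervals (hii 0 s0) (hii s0 t)]
    have e1 : (∫ s in (0)..s0, heatS s ζ x) ≤ ∫ s in (0)..s0, (1 : ℝ) :=
      intervalIntegral.integral_mono_on hs0.le (hii _ _) (by simp) fun s _ => hle1 s
    have e2 : (∫ s in s0..t, heatS s ζ x) ≤ ∫ s in s0..t, ((√(2 * s0) ^ n)⁻¹ * ∫ z, ζ z) :=
      intervalIntegral.integral_mono_on hts (hii _ _) (by simp) fun s hs =>
        heatS_le_of_integrable hζ h0 hs0 hs.1 x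
    simp only [intervalIntegral.integral_const, sub_zero, smul_eq_mul, mul_one] at e1 e2
    have : (t - s0) * ((√(2 * s0) ^ n)⁻¹ * ∫ z, ζ z) ≤ t * ((√(2 * s0) ^ n)⁻¹ * ∫ z, ζ z) := by
      gcongr; linarith
    linarith

lemma integral_triangle {F : ℝ → ℝ → ℝ} (hF : Continuous fun z : ℝ × ℝ => F z.1 z.2) (ht : 0 ≤ t) :
    (∫ s in (0)..t, ∫ τ in s..t, F s τ) = ∫ τ in (0)..t, ∫ s in (0)..τ, F s τ := by
  have e1 : ∀ s ∈ Ioc 0 t, (∫ τ in s..t, F s τ)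
      = ∫ τ in Ioc 0 t, {z : ℝ × ℝ | z.1 < z.2}.indicator (fun z => F z.1 z.2) (s, τ) := by
    intro s hs
    rw [intervalIntegral.integral_of_le hs.2]
    have : (fun τ => {z : ℝ × ℝ | z.1 < z.2}.indicator (fun z => F z.1 z.2) (s, τ))
        = (Ioi s).indicator (F s) := by
      ext τ; simp [indicator]
    rw [this, setIntegral_indicator measurableSet_Ioi]
    congr 2
    ext τ; simp only [mem_Ioc, mem_inter_iff, mem_Ioi]
    exact ⟨fun h => ⟨⟨hs.1.trans h.1, h.2⟩, h.1⟩, fun h => ⟨h.2, h.1.2⟩⟩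
  have e2 : ∀ τ ∈ Ioc 0 t, (∫ s in (0)..τ, F s τ)
      = ∫ s in Ioc 0 t, {z : ℝ × ℝ | z.1 < z.2}.indicator (fun z => F z.1 z.2) (s, τ) := by
    intro τ hτ
    rw [intervalIntegral.integral_of_le hτ.1.le, integral_Ioc_eq_integral_Ioo]
    have : (fun s => {z : ℝ × ℝ | z.1 < z.2}.indicator (fun z => F z.1 z.2) (s, τ))
        = (Iio τ).indicator (fun s => F s τ) := by
      ext s; simp [indicator]
    rw [this, setIntegral_indicator measurableSet_Iio]
    congr 2
    ext s; simp only [mem_Ioc, mem_inter_iff, mem_Iio, mem_Ioo]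
    exact ⟨fun h => ⟨⟨h.1, h.2.le.trans hτ.2⟩, h.2⟩, fun h => ⟨h.1.1, h.2⟩⟩
  rw [intervalIntegral.integral_of_le ht, intervalIntegral.integral_of_le ht,
    setIntegral_congr_fun measurableSet_Ioc e1, setIntegral_congr_fun measurableSet_Ioc e2]
  refine integral_integral_swap (f := fun s τ =>
    {z : ℝ × ℝ | z.1 < z.2}.indicator (fun z => F z.1 z.2) (s, τ)) ?_
  rw [Measure.prod_restrict]
  have hm : MeasurableSet {z : ℝ × ℝ | z.1 < z.2} := measurableSet_lt measurable_fst measurable_snd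
  refine Integrable.indicator ?_ hm
  refine (hF.continuousOn.integrableOn_compact (isCompact_Icc.prod isCompact_Icc)).mono_set
    (prod_mono Ioc_subset_Icc_self Ioc_subset_Icc_self)

/-- Pairing with the heat semigroup. -/
lemma pairing_heatS (hg : Continuous g) (hM : ∀ x, |g x| ≤ M) (hψ : ContDiff ℝ 2 ψ)
    (hs : HasCompactSupport ψ) (hσ : 0 ≤ σ) :
    (∫ x, heatS σ g x * ψ x) = (∫ x, g x * ψ x) + ∫ τ in (0)..σ, ∫ x, heatS τ g x * lap ψ x := by
  set m : (Eu n → ℝ) → Eu n → ℝ := fun θ w => ∫ x, g (x + w) * θ x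
  have hmol : ∀ θ, m θ = mol (fun y => θ (0 - y)) g := by
    intro θ; ext w
    simp only [m, mol]
    rw [← integral_add_right_eq_self (fun y => g y * θ (0 - (w - y))) w]
    simp
  have hswap : ∀ θ : Eu n → ℝ, Continuous θ → HasCompactSupport θ → ∀ τ,
      (∫ x, heatS τ g x * θ x) = heatS τ (m θ) 0 := by
    intro θ hθ hθs τ
    unfold heatS
    simp_rw [← integral_mul_const]
    rw [integral_integral_swap]
    · simp [m]
    · have : Integrable (fun q : Eu n × Eu n => θ q.1 * (1 : ℝ))
          ((volume : Measure (Eu n)).prod (gam n)) :=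
        (hθ.integrable_of_hasCompactSupport hθs).mul_prod (integrable_const 1)
      refine (this.norm.const_mul M).mono' ?_ (Eventually.of_forall fun q => ?_)
      · refine Continuous.aestronglyMeasurable ?_
        fun_prop
      · simp only [Function.uncurry, norm_mul, mul_one]
        gcongr
        exact hM _
  have hl := continuous_lap hψ
  have hls : HasCompactSupport (lap ψ) := hs.lap
  obtain ⟨R', hR'⟩ := hs.isCompact.isBounded.subset_closedBall 0
  have hrc : HasCompactSupport fun y => ψ (0 - y) := hasCompactSupport_reflect hR' 0
  have hrψ : ContDiff ℝ 2 fun y => ψ (0 - y) := hψ.comp (contDiff_const.sub contDiff_id)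
  obtain ⟨R, hR⟩ := hrc.isCompact.isBounded.subset_closedBall 0
  have hin : ∀ x : Eu n, x ∈ inner' univ R := fun x => subset_univ _
  have hmC : ContDiff ℝ 2 (m ψ) := by
    rw [hmol, contDiff_iff_contDiffAt]
    exact fun x => mol_contDiffAt (k := 2) isOpen_univ hg.continuousOn hrψ hR (hin x)
  have hmpd : ∀ i, pd i (m ψ) = mol (pd i fun y => ψ (0 - y)) g := fun i => by
    ext x; rw [hmol]
    exact pd_mol isOpen_univ hg.continuousOn (hrψ.of_le (by norm_num)) hR (hin x) i
  have hmpd2 : ∀ i, pd i (pd i (m ψ)) = mol (pd i (pd i fun y => ψ (0 - y))) g := fun i => by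
    ext x; rw [hmpd]
    exact pd_mol isOpen_univ hg.continuousOn (hrψ.pd (by norm_num))
      ((tsupport_pd_subset _ _).trans hR) (hin x) i
  have hlapm : lap (m ψ) = m (lap ψ) := by
    ext x
    rw [hmol, hmol, lap_mol isOpen_univ hg.continuousOn hrψ hR (hin x)]
    congr 1
    ext y
    exact lap_reflect ψ 0 y
  have hbd : ∀ κ : Eu n → ℝ, Continuous κ → HasCompactSupport κ → ∃ C, ∀ x, |mol κ g x| ≤ C := by
    intro κ hκ hκs
    refine ⟨M * ∫ y, |κ y|, fun x => ?_⟩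
    have hi : Integrable fun y => |κ (x - y)| :=
      ((hκ.integrable_of_hasCompactSupport hκs).abs).comp_sub_left x
    calc |mol κ g x| ≤ ∫ y, M * |κ (x - y)| := by
          refine norm_integral_le_of_norm_le (f := fun y => g y * κ (x - y)) (hi.const_mul M) (Eventually.of_forall fun y => ?_)
          rw [norm_mul]
          exact mul_le_mul_of_nonneg_right (hM y) (abs_nonneg _)
      _ = _ := by rw [integral_const_mul, integral_sub_left_eq_self (fun y => |κ y|) volume x]
  obtain ⟨C0, hC0⟩ := hbd _ hrψ.continuous hrc
  choose C1 hC1 using fun i => hbd (pd i fun y => ψ (0 - y))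
    (continuous_pd (hrψ.of_le (by norm_num))) (_root_.HasCompactSupport.pd hrc)
  choose C2 hC2 using fun i => hbd (pd i (pd i fun y => ψ (0 - y)))
    (continuous_pd (hrψ.pd (by norm_num))) (_root_.HasCompactSupport.pd (_root_.HasCompactSupport.pd hrc))
  set C := |C0| + (∑ i, |C1 i|) + ∑ i, |C2 i| with hC
  have s1 : 0 ≤ ∑ i, |C1 i| := Finset.sum_nonneg fun i _ => abs_nonneg _
  have s2 : 0 ≤ ∑ i, |C2 i| := Finset.sum_nonneg fun i _ => abs_nonneg _
  have s3 := abs_nonneg C0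
  have b1 : ∀ i, |C1 i| ≤ ∑ i, |C1 i| := fun i =>
    Finset.single_le_sum (f := fun i => |C1 i|) (fun i _ => abs_nonneg _) (Finset.mem_univ i)
  have b2 : ∀ i, |C2 i| ≤ ∑ i, |C2 i| := fun i =>
    Finset.single_le_sum (f := fun i => |C2 i|) (fun i _ => abs_nonneg _) (Finset.mem_univ i)
  have hid := heatS_sub_eq_integral hmC (C := C)
    (fun z => by
      rw [hmol]; exact (hC0 z).trans (by linarith [le_abs_self C0]))
    (fun i z => by
      rw [hmpd]; exact (hC1 i z).trans (by linarith [le_abs_self (C1 i), b1 i]))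
    (fun i z => by
      rw [hmpd2]; exact (hC2 i z).trans (by linarith [le_abs_self (C2 i), b2 i])) 0 hσ
  rw [hswap ψ hψ.continuous hs]
  simp_rw [hswap (lap ψ) hl hls]
  rw [← hlapm, ← hid]
  simp [m]

lemma Pot_swap (hc : Continuous fun z : Eu n × ℝ => h z.1 z.2) (hM : ∀ x t, |h x t| ≤ M)
    {θ : Eu n → ℝ} (hθ : Continuous θ) (hs : HasCompactSupport θ) (ht : 0 ≤ t) :
    (∫ x, Pot h x t * θ x) = ∫ s in (0)..t, ∫ x, heatS (t - s) (fun y => h y s) x * θ x := by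
  simp_rw [Pot_eq_rev, ← intervalIntegral.integral_mul_const, intervalIntegral.integral_of_le ht]
  refine integral_integral_swap (f := fun x s => heatS (t - s) (fun y => h y s) x * θ x) ?_
  have : Integrable (fun q : Eu n × ℝ => θ q.1 * (1 : ℝ))
      ((volume : Measure (Eu n)).prod (volume.restrict (Ioc 0 t))) :=
    (hθ.integrable_of_hasCompactSupport hs).mul_prod (integrable_const 1)
  refine (this.norm.const_mul M).mono' ?_ (Eventually.of_forall fun q => ?_)
  · refine Continuous.aestronglyMeasurable ?_
    exact (continuous_heatS_comp hc hM (a := fun q : Eu n × ℝ => t - q.2) (b := fun q => q.1)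
      (c := fun q => q.2) (by fun_prop) (by fun_prop) (by fun_prop)).mul (by fun_prop)
  · simp only [Function.uncurry, norm_mul, mul_one]
    gcongr
    exact abs_heatS_le (fun x => hM x _) _ _

lemma continuous_integral_mul {X : Type*} [TopologicalSpace X] [FirstCountableTopology X]
    {F : X → Eu n → ℝ} (hF : Continuous fun q : X × Eu n => F q.1 q.2) (hM : ∀ q z, |F q z| ≤ M)
    {θ : Eu n → ℝ} (hθ : Continuous θ) (hs : HasCompactSupport θ) :
    Continuous fun q => ∫ z, F q z * θ z := by
  refine continuous_of_dominated (bound := fun z => M * ‖θ z‖) (fun q => ?_) (fun q => ?_)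
    ((hθ.integrable_of_hasCompactSupport hs).norm.const_mul M) (Eventually.of_forall fun z => ?_)
  · exact ((hF.comp (by fun_prop : Continuous fun z => (q, z))).mul hθ).aestronglyMeasurable
  · refine Eventually.of_forall fun z => ?_
    rw [norm_mul]
    gcongr
    exact hM q z
  · exact (hF.comp (by fun_prop : Continuous fun q => (q, z))).mul continuous_const

lemma Pot_pairing (hc : Continuous fun z : Eu n × ℝ => h z.1 z.2) (hM : ∀ x t, |h x t| ≤ M)
    (hψ : ContDiff ℝ 2 ψ) (hs : HasCompactSupport ψ) (ht : 0 ≤ t) :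
    (∫ x, Pot h x t * ψ x) = ∫ τ in (0)..t, ((∫ x, Pot h x τ * lap ψ x) + ∫ x, h x τ * ψ x) := by
  have hl := continuous_lap hψ
  have hls : HasCompactSupport (lap ψ) := hs.lap
  set Q : ℝ → ℝ → ℝ := fun s τ => ∫ x, heatS τ (fun y => h y s) x * lap ψ x
  have hQ : Continuous fun z : ℝ × ℝ => Q z.1 z.2 := by
    refine continuous_integral_mul
      (F := fun (q : ℝ × ℝ) x => heatS q.2 (fun y => h y q.1) x) ?_
      (fun q z => abs_heatS_le (fun x => hM x _) _ _) hl hls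
    exact continuous_heatS_comp hc hM (a := fun q : (ℝ × ℝ) × Eu n => q.1.2)
      (b := fun q => q.2) (c := fun q => q.1.1) (by fun_prop) (by fun_prop) (by fun_prop)
  have hq : Continuous fun s => ∫ x, h x s * ψ x :=
    continuous_integral_mul (F := fun (s : ℝ) x => h x s)
      (hc.comp (by fun_prop : Continuous fun q : ℝ × Eu n => (q.2, q.1))) (fun s x => hM x s)
      hψ.continuous hs
  have hP : Continuous fun s => ∫ x, Pot h x s * lap ψ x := by
    rw [← continuousOn_univ]
    exact continuousOn_pairing isOpen_univ (B := univ) (continuous_Pot hc hM).continuousOn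
      hl hls (subset_univ _)
  rw [Pot_swap hc hM hψ.continuous hs ht]
  have e1 : ∀ s ∈ uIcc 0 t, (∫ x, heatS (t - s) (fun y => h y s) x * ψ x)
      = (∫ x, h x s * ψ x) + ∫ τ in s..t, Q s (τ - s) := by
    intro s hs'
    rw [uIcc_of_le ht] at hs'
    rw [pairing_heatS (continuous_slice hc s) (fun x => hM x s) hψ hs (by linarith [hs'.2])]
    congr 1
    rw [intervalIntegral.integral_comp_sub_right (fun τ => Q s τ) s]
    simp [Q]
  have hQ' : Continuous fun z : ℝ × ℝ => Q z.1 (z.2 - z.1) :=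
    hQ.comp (by fun_prop : Continuous fun z : ℝ × ℝ => (z.1, z.2 - z.1))
  rw [intervalIntegral.integral_congr e1, intervalIntegral.integral_add, add_comm,
    integral_triangle (F := fun s τ => Q s (τ - s)) hQ' ht,
    intervalIntegral.integral_add (hP.intervalIntegrable _ _) (hq.intervalIntegrable _ _)]
  · congr 1
    refine intervalIntegral.integral_congr fun τ hτ => ?_
    rw [uIcc_of_le ht] at hτ
    exact (Pot_swap hc hM hl hls hτ.1).symm
  · exact hq.intervalIntegrable _ _
  · refine Continuous.intervalIntegrable ?_ _ _
    have := intervalIntegral.continuous_parametric_primitive_of_continuous (μ := volume)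
      (f := fun s τ => Q s (τ - s)) (a₀ := 0) hQ'
    have e2 : (fun s => ∫ τ in s..t, Q s (τ - s)) =
        fun s => (∫ τ in (0)..t, Q s (τ - s)) - ∫ τ in (0)..s, Q s (τ - s) := by
      ext s
      have hi : ∀ a b, IntervalIntegrable (fun τ => Q s (τ - s)) volume a b := fun a b =>
        (hQ'.comp (by fun_prop : Continuous fun τ : ℝ => (s, τ))).intervalIntegrable _ _
      rw [eq_sub_iff_add_eq', intervalIntegral.integral_add_adjacent_intervals (hi _ _) (hi _ _)]
    rw [e2]
    exact (this.comp (by fun_prop : Continuous fun s : ℝ => (s, t))).sub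
      (this.comp (by fun_prop : Continuous fun s : ℝ => (s, s)))

lemma weak_Pot (hc : Continuous fun z : Eu n × ℝ => h z.1 z.2) (hM : ∀ x t, |h x t| ≤ M) (T : ℝ) :
    Weak univ 0 T (Pot h) h := by
  refine ⟨(continuous_Pot hc hM).continuousOn, hc.continuousOn, ?_⟩
  intro ψ hψ hs _ s hs' t ht hst
  have hl := continuous_lap hψ
  have hls : HasCompactSupport (lap ψ) := hs.lap
  have hP : Continuous fun s => (∫ x, Pot h x s * lap ψ x) + ∫ x, h x s * ψ x := by
    rw [← continuousOn_univ]
    exact (continuousOn_pairing isOpen_univ (B := univ) (continuous_Pot hc hM).continuousOn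
      hl hls (subset_univ _)).add (continuousOn_pairing isOpen_univ (B := univ) hc.continuousOn
      hψ.continuous hs (subset_univ _))
  rw [Pot_pairing hc hM hψ hs hs'.1, Pot_pairing hc hM hψ hs ht.1,
    intervalIntegral.integral_interval_sub_left (hP.intervalIntegrable _ _)
      (hP.intervalIntegrable _ _)]

/-- The sum of squares of the partial derivatives. -/
def gradSq (f : Eu n → ℝ) (x : Eu n) : ℝ := ∑ i : Fin n, pd i f x ^ 2

lemma gradSq_nonneg (f : Eu n → ℝ) (x : Eu n) : 0 ≤ gradSq f x :=
  Finset.sum_nonneg fun _ _ => sq_nonneg _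

lemma pd_comp {g : ℝ → ℝ} (i : Fin n) (hg : DifferentiableAt ℝ g (f x))
    (hf : DifferentiableAt ℝ f x) :
    pd i (fun y => g (f y)) x = deriv g (f x) * pd i f x := by
  unfold pd
  have h := (hg.hasDerivAt.hasFDerivAt.comp x hf.hasFDerivAt).fderiv
  have h' : fderiv ℝ (fun y => g (f y)) x = _ := h
  rw [h']
  simp [mul_comm]

lemma lap_comp {g : ℝ → ℝ} (hg : ContDiff ℝ 2 g) (hf : ContDiffAt ℝ 2 f x) :
    lap (fun y => g (f y)) x
      = deriv (deriv g) (f x) * gradSq f x + deriv g (f x) * lap f x := by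
  rw [lap_eq_sum_pd, lap_eq_sum_pd, gradSq, Finset.mul_sum, Finset.mul_sum,
    ← Finset.sum_add_distrib]
  refine Finset.sum_congr rfl fun i _ => ?_
  have hg1 : ContDiff ℝ 1 (deriv g) := ((contDiff_succ_iff_deriv (n := 1)).1 hg).2.2
  have hev : (fun y => pd i (fun y => g (f y)) y) =ᶠ[nhds x]
      fun y => deriv g (f y) * pd i f y := by
    filter_upwards [hf.eventually_diff] with y hy
    exact pd_comp i ((hg.differentiable (by norm_num)) _) hy
  rw [pd_congr hev, pd_mul (f := fun y => deriv g (f y))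
    (((hg1.differentiable (by norm_num)) _).comp x (hf.differentiableAt (by norm_num)))
    hf.pd_diff, pd_comp i ((hg1.differentiable (by norm_num)) _)
      (hf.differentiableAt (by norm_num))]
  ring

/-- A smooth monotone step, zero on `(-∞, 1]` and one on `[2, ∞)`. -/
def eta1 (s : ℝ) : ℝ := Real.smoothTransition (s - 1)

/-- The primitive of the step `eta1`. -/
def eta (s : ℝ) : ℝ := ∫ u in (0:ℝ)..s, eta1 u

lemma contDiff_eta1 {m : WithTop ℕ∞} (hm : m ≤ (⊤ : ℕ∞)) : ContDiff ℝ m eta1 := by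
  have : ContDiff ℝ (⊤ : ℕ∞) eta1 := by
    unfold eta1
    exact Real.smoothTransition.contDiff.comp (contDiff_id.sub contDiff_const)
  exact this.of_le hm

lemma continuous_eta1 : Continuous eta1 := (contDiff_eta1 (m := 0) (by simp)).continuous
lemma eta1_nonneg (s : ℝ) : 0 ≤ eta1 s := Real.smoothTransition.nonneg _
lemma eta1_le_one (s : ℝ) : eta1 s ≤ 1 := Real.smoothTransition.le_one _
lemma eta1_eq_zero (h : s ≤ 1) : eta1 s = 0 :=
  Real.smoothTransition.zero_of_nonpos (by linarith)
lemma eta1_eq_one (h : 2 ≤ s) : eta1 s = 1 :=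
  Real.smoothTransition.one_of_one_le (by linarith)
lemma monotone_eta1 : Monotone eta1 := fun a b h =>
  Real.smoothTransition.monotone (by linarith)

lemma deriv_eta1_nonneg (s : ℝ) : 0 ≤ deriv eta1 s := monotone_eta1.deriv_nonneg

lemma deriv_eta1_eq_zero (h : s < 1) : deriv eta1 s = 0 := by
  have : eta1 =ᶠ[nhds s] fun _ => 0 := by
    filter_upwards [Iio_mem_nhds h] with y hy using eta1_eq_zero (le_of_lt hy)
  rw [this.deriv_eq]; simp

lemma deriv_eta1_eq_zero' (h : 2 < s) : deriv eta1 s = 0 := by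
  have : eta1 =ᶠ[nhds s] fun _ => 1 := by
    filter_upwards [Ioi_mem_nhds h] with y hy using eta1_eq_one (le_of_lt hy)
  rw [this.deriv_eq]; simp

lemma hasDerivAt_eta (s : ℝ) : HasDerivAt eta (eta1 s) s :=
  intervalIntegral.integral_hasDerivAt_right (continuous_eta1.intervalIntegrable _ _)
    continuous_eta1.stronglyMeasurable.stronglyMeasurableAtFilter continuous_eta1.continuousAt

lemma deriv_eta : deriv eta = eta1 := funext fun s => (hasDerivAt_eta s).deriv

lemma contDiff_eta : ContDiff ℝ 2 eta := by
  have : ContDiff ℝ (1 + 1) eta := by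
    rw [contDiff_succ_iff_deriv]
    refine ⟨fun s => (hasDerivAt_eta s).differentiableAt, by simp, ?_⟩
    rw [deriv_eta]
    exact contDiff_eta1 (by exact_mod_cast le_top)
  simpa [one_add_one_eq_two] using this

lemma eta_eq_zero (h0 : 0 ≤ s) (h : s ≤ 1) : eta s = 0 := by
  unfold eta
  rw [intervalIntegral.integral_congr (g := fun _ => 0)]
  · simp
  · intro u hu
    rw [uIcc_of_le h0] at hu
    exact eta1_eq_zero (hu.2.trans h)

lemma eta_nonneg (h0 : 0 ≤ s) : 0 ≤ eta s :=
  intervalIntegral.integral_nonneg h0 fun u _ => eta1_nonneg u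

lemma eta_le (h0 : 0 ≤ s) : eta s ≤ s := by
  have h := intervalIntegral.integral_mono_on (a := 0) (b := s) (μ := volume) (f := eta1)
    (g := fun _ => (1:ℝ)) h0
    (continuous_eta1.intervalIntegrable _ _) (continuous_const.intervalIntegrable _ _)
    fun u _ => eta1_le_one u
  simpa [eta] using h

lemma sub_two_le_eta (h0 : 0 ≤ s) : s - 2 ≤ eta s := by
  rcases le_total s 2 with h | h
  · linarith [eta_nonneg h0]
  · have h1 : eta s = eta 2 + ∫ u in (2:ℝ)..s, eta1 u :=
      (intervalIntegral.integral_add_adjacent_intervals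
        (continuous_eta1.intervalIntegrable _ _) (continuous_eta1.intervalIntegrable _ _)).symm
    have h2 : ∫ u in (2:ℝ)..s, eta1 u = s - 2 := by
      rw [intervalIntegral.integral_congr (g := fun _ => 1)]
      · simp
      · intro u hu
        rw [uIcc_of_le h] at hu
        exact eta1_eq_one hu.1
    linarith [eta_nonneg (s := 2) (by norm_num)]

/-- A positive Dirichlet eigenfunction, extended by zero to the whole space. -/
structure Bar (Ω : Set (Eu n)) (lam : ℝ) (f : Eu n → ℝ) : Prop where
  op : IsOpen Ω
  bdd : Bornology.IsBounded Ω
  cont : Continuous f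
  zero : ∀ x, x ∉ Ω → f x = 0
  pos : ∀ x ∈ Ω, 0 < f x
  c2 : ∀ x ∈ Ω, ContDiffAt ℝ 2 f x
  eig : ∀ x ∈ Ω, lap f x = -lam * f x
  lam_pos : 0 < lam

lemma continuous_indicator_of_zero {φ : Eu n → ℝ} (hc : ContinuousOn φ (closure Ω))
    (h0 : ∀ x ∈ frontier Ω, φ x = 0) :
    Continuous (Ω.indicator φ) := by
  classical
  rw [← piecewise_eq_indicator]
  exact continuous_piecewise h0 hc continuousOn_const

lemma Bar.nonneg (h : Bar Ω lam f) (x : Eu n) :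
    0 ≤ f x := by
  by_cases hx : x ∈ Ω
  · exact (h.pos x hx).le
  · exact (h.zero x hx).ge

lemma Bar.mem (h : Bar Ω lam f) (hx : 0 < f x) : x ∈ Ω := by
  by_contra hn
  exact hx.ne' (h.zero x hn)

lemma Bar.of_eigen (hn : 0 < n) {φ : Eu n → ℝ} (ho : IsOpen Ω) (hb : Bornology.IsBounded Ω)
    (hne : Ω.Nonempty) (h : IsDirichletEigen Ω lam φ) :
    Bar Ω lam (Ω.indicator φ) := by
  obtain ⟨hc, hc2, heig, h0, hpos⟩ := h
  have hcont := continuous_indicator_of_zero hc h0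
  have hev : ∀ x ∈ Ω, Ω.indicator φ =ᶠ[nhds x] φ := fun x hx => by
    filter_upwards [ho.mem_nhds hx] with y hy using indicator_of_mem hy _
  have hc2' : ∀ x ∈ Ω, ContDiffAt ℝ 2 φ x := fun x hx => (hc2 x hx).contDiffAt (ho.mem_nhds hx)
  refine ⟨ho, hb, hcont, fun x hx => indicator_of_notMem hx _,
    fun x hx => by rw [indicator_of_mem hx]; exact hpos x hx,
    fun x hx => (hc2' x hx).congr_of_eventuallyEq (hev x hx),
    fun x hx => by
      rw [lap_congr (hev x hx), indicator_of_mem hx]; linarith [heig x hx], ?_⟩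
  by_contra hlam
  push Not at hlam
  obtain ⟨x0, hx0⟩ := hne
  obtain ⟨R, hR⟩ := hb.exists_norm_le
  -- a small multiple of `‖x‖²` does not move the maximum to the boundary
  set γ : ℝ := φ x0 / (2 * (R ^ 2 + 1)) with hγ
  have hγ0 : 0 < γ := div_pos (hpos x0 hx0) (by positivity)
  have hK : IsCompact (closure Ω) := hb.isCompact_closure
  have hgc : ContinuousOn (fun x => φ x + γ * ‖x - 0‖ ^ 2) (closure Ω) :=
    hc.add (by fun_prop)
  obtain ⟨xm, hxm, hmax⟩ := hK.exists_isMaxOn ⟨x0, subset_closure hx0⟩ hgc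
  have hxmO : xm ∈ Ω := by
    by_contra hn
    have hfr : xm ∈ frontier Ω := ⟨hxm, by rwa [ho.interior_eq]⟩
    have h1 : φ x0 + γ * ‖x0 - 0‖ ^ 2 ≤ φ xm + γ * ‖xm - 0‖ ^ 2 := hmax (subset_closure hx0)
    have h2 : ‖xm‖ ≤ R := by
      have : closure Ω ⊆ closedBall 0 R :=
        closure_minimal (fun y hy => by simpa using hR y hy) isClosed_closedBall
      simpa using this hxm
    have h3 : ‖xm - 0‖ ^ 2 ≤ R ^ 2 := by
      rw [sub_zero]; exact pow_le_pow_left₀ (norm_nonneg _) h2 2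
    rw [h0 xm hfr] at h1
    have h4 : γ * (2 * (R ^ 2 + 1)) = φ x0 := by
      rw [hγ]; field_simp
    nlinarith [mul_le_mul_of_nonneg_left h3 hγ0.le, sq_nonneg ‖x0 - 0‖,
      mul_nonneg hγ0.le (sq_nonneg ‖x0 - 0‖), mul_nonneg hγ0.le (sq_nonneg R)]
  have hsq : ContDiffAt ℝ 2 (fun x : Eu n => ‖x - 0‖ ^ 2) xm :=
    (contDiff_normSq (0 : Eu n)).contDiffAt
  have hloc : IsLocalMax (fun x => φ x + γ * ‖x - 0‖ ^ 2) xm :=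
    hmax.isLocalMax (mem_of_superset (ho.mem_nhds hxmO) subset_closure)
  have hle := lap_nonpos_of_isLocalMax ((hc2' xm hxmO).add (contDiffAt_const.mul hsq)) hloc
  rw [lap_add (hc2' xm hxmO) (contDiffAt_const.mul hsq), lap_const_mul γ hsq, lap_normSq] at hle
  have hn' : (0:ℝ) < n := by exact_mod_cast hn
  have h5 := heig xm hxmO
  nlinarith [mul_pos hγ0 hn', hpos xm hxmO, mul_nonneg (neg_nonneg.2 hlam) (hpos xm hxmO).le]

lemma Bar.isCompact_ge (h : Bar Ω lam f) (hc : 0 < c) : IsCompact {x | c ≤ f x} := by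
  refine isCompact_of_isClosed_isBounded (isClosed_le continuous_const h.cont)
    (h.bdd.subset fun x hx => h.mem (hc.trans_le hx))

lemma Bar.ge_subset (h : Bar Ω lam f) (hc : 0 < c) : {x | c ≤ f x} ⊆ Ω :=
  fun _ hx => h.mem (hc.trans_le hx)

/-- Smooth cutoff equal to one where `f ≥ 2ε` and supported in `f ≥ ε`. -/
def cut (f : Eu n → ℝ) (ε : ℝ) (x : Eu n) : ℝ := eta1 (f x / ε)

/-- Convex regularised truncation of `f` at level `ε`. -/
def psi (f : Eu n → ℝ) (ε : ℝ) (x : Eu n) : ℝ := ε * eta (f x / ε)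

/-- The convexity term in the Laplacian of `psi`. -/
def pen (f : Eu n → ℝ) (ε : ℝ) (x : Eu n) : ℝ := deriv eta1 (f x / ε) / ε * gradSq f x

lemma cut_nonneg (x : Eu n) : 0 ≤ cut f ε x := eta1_nonneg _
lemma cut_le_one (x : Eu n) : cut f ε x ≤ 1 := eta1_le_one _

lemma cut_eq_zero (hε : 0 < ε) (h : f x ≤ ε) : cut f ε x = 0 :=
  eta1_eq_zero (by rwa [div_le_one hε])

lemma cut_eq_one (hε : 0 < ε) (h : 2 * ε ≤ f x) : cut f ε x = 1 :=
  eta1_eq_one (by rwa [le_div_iff₀ hε])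

lemma Bar.continuous_cut (h : Bar Ω lam f) (ε : ℝ) : Continuous (cut f ε) :=
  continuous_eta1.comp (h.cont.div_const ε)

lemma pen_nonneg (hε : 0 < ε) (x : Eu n) : 0 ≤ pen f ε x :=
  mul_nonneg (div_nonneg (deriv_eta1_nonneg _) hε.le) (gradSq_nonneg _ _)

lemma pen_eq_zero (hε : 0 < ε) (h : 2 * ε < f x) : pen f ε x = 0 := by
  unfold pen
  rw [deriv_eta1_eq_zero' (by rwa [lt_div_iff₀ hε])]; simp

lemma Bar.psi_eq_zero (hB : Bar Ω lam f) (hε : 0 < ε) (h : f x ≤ ε) :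
    psi f ε x = 0 := by
  unfold psi
  rw [eta_eq_zero (div_nonneg (hB.nonneg x) hε.le) (by rwa [div_le_one hε])]; simp

lemma Bar.psi_nonneg (hB : Bar Ω lam f) (hε : 0 < ε) (x : Eu n) : 0 ≤ psi f ε x :=
  mul_nonneg hε.le (eta_nonneg (div_nonneg (hB.nonneg x) hε.le))

lemma Bar.psi_le (hB : Bar Ω lam f) (hε : 0 < ε) (x : Eu n) : psi f ε x ≤ f x := by
  have := mul_le_mul_of_nonneg_left (eta_le (div_nonneg (hB.nonneg x) hε.le)) hε.le
  rwa [mul_div_cancel₀ _ hε.ne'] at this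

lemma Bar.le_psi (hB : Bar Ω lam f) (hε : 0 < ε) (x : Eu n) : f x - 2 * ε ≤ psi f ε x := by
  have := mul_le_mul_of_nonneg_left (sub_two_le_eta (div_nonneg (hB.nonneg x) hε.le)) hε.le
  rw [mul_sub, mul_div_cancel₀ _ hε.ne'] at this
  unfold psi; linarith

lemma Bar.psi_eventually_zero (hB : Bar Ω lam f) (hε : 0 < ε) (h : f x < ε) :
    psi f ε =ᶠ[nhds x] fun _ => 0 := by
  filter_upwards [hB.cont.continuousAt.eventually_lt continuousAt_const h] with y hy
  exact hB.psi_eq_zero hε hy.le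

lemma Bar.contDiff_psi (hB : Bar Ω lam f) (hε : 0 < ε) : ContDiff ℝ 2 (psi f ε) := by
  rw [contDiff_iff_contDiffAt]
  intro x
  by_cases hx : x ∈ Ω
  · exact contDiffAt_const.mul (contDiff_eta.contDiffAt.comp x ((hB.c2 x hx).div_const ε))
  · exact contDiffAt_const.congr_of_eventuallyEq
      (hB.psi_eventually_zero hε (by rw [hB.zero x hx]; exact hε))

lemma Bar.tsupport_psi (hB : Bar Ω lam f) (hε : 0 < ε) :
    tsupport (psi f ε) ⊆ {x | ε ≤ f x} := by
  refine closure_minimal (fun x hx => ?_) (isClosed_le continuous_const hB.cont)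
  by_contra hn
  exact hx (hB.psi_eq_zero hε (not_le.1 hn).le)

lemma Bar.hasCompactSupport_psi (hB : Bar Ω lam f) (hε : 0 < ε) :
    HasCompactSupport (psi f ε) :=
  (hB.isCompact_ge hε).of_isClosed_subset (isClosed_tsupport _) (hB.tsupport_psi hε)

lemma gradSq_const_mul (c : ℝ) (hf : DifferentiableAt ℝ f x) :
    gradSq (fun y => c * f y) x = c ^ 2 * gradSq f x := by
  unfold gradSq
  rw [Finset.mul_sum]
  refine Finset.sum_congr rfl fun i _ => ?_
  rw [pd_mul (f := fun _ => c) (differentiableAt_const c) hf, pd_const]; ring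

lemma Bar.lap_psi (hB : Bar Ω lam f) (hε : 0 < ε) (x : Eu n) :
    lap (psi f ε) x = pen f ε x - lam * (cut f ε x * f x) := by
  by_cases hx : x ∈ Ω
  · have hc := hB.c2 x hx
    have hc' : ContDiffAt ℝ 2 (fun y => ε⁻¹ * f y) x := contDiffAt_const.mul hc
    have h1 : psi f ε = fun y => ε * eta (ε⁻¹ * f y) := by
      funext y; simp [psi, div_eq_inv_mul]
    rw [h1, lap_const_mul ε (f := fun y => eta (ε⁻¹ * f y)) (contDiff_eta.contDiffAt.comp x hc'),
      lap_comp (f := fun y => ε⁻¹ * f y) contDiff_eta hc',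
      lap_const_mul ε⁻¹ hc, gradSq_const_mul _ (hc.differentiableAt (by norm_num)),
      hB.eig x hx, deriv_eta]
    unfold pen cut
    rw [div_eq_inv_mul]
    field_simp
    ring
  · rw [lap_congr (hB.psi_eventually_zero hε (by rw [hB.zero x hx]; exact hε)), lap_const]
    unfold pen
    rw [hB.zero x hx, deriv_eta1_eq_zero (by simp)]
    simp

lemma Bar.continuous_pen (hB : Bar Ω lam f) (hε : 0 < ε) : Continuous (pen f ε) := by
  have : pen f ε = fun x => lap (psi f ε) x + lam * (cut f ε x * f x) := by
    funext x; rw [hB.lap_psi hε]; ring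
  rw [this]
  exact (continuous_lap (hB.contDiff_psi hε)).add
    (continuous_const.mul ((hB.continuous_cut ε).mul hB.cont))

lemma Bar.exists_bound (hB : Bar Ω lam f) : ∃ C, 0 < C ∧ ∀ x, f x ≤ C := by
  obtain ⟨C, hC⟩ := (hB.bdd.isCompact_closure).bddAbove_image hB.cont.continuousOn
  refine ⟨max C 1, by positivity, fun x => ?_⟩
  by_cases hx : x ∈ Ω
  · exact (hC ⟨x, subset_closure hx, rfl⟩).trans (le_max_left _ _)
  · rw [hB.zero x hx]; positivity

lemma Bar.exists_pen_bound (hB : Bar Ω lam f) (hε : 0 < ε) : ∃ C, 0 < C ∧ ∀ x, pen f ε x ≤ C := by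
  obtain ⟨C, hC⟩ := (hB.bdd.isCompact_closure).bddAbove_image (hB.continuous_pen hε).continuousOn
  refine ⟨max C 1, by positivity, fun x => ?_⟩
  by_cases hx : x ∈ Ω
  · exact (hC ⟨x, subset_closure hx, rfl⟩).trans (le_max_left _ _)
  · unfold pen
    rw [hB.zero x hx, deriv_eta1_eq_zero (by simp)]; simp

open scoped BoundedContinuousFunction in
/-- Solvability of the linear heat equation with a bounded zeroth order term on the whole space. -/
lemma exists_penalized (hF : Continuous fun z : Eu n × ℝ => F z.1 z.2) (hM : ∀ x t, |F x t| ≤ M)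
    {V : Eu n → ℝ} (hV : Continuous V) (hA : 0 < A) (hVA : ∀ x, |V x| ≤ A) (hT : 0 ≤ T) :
    ∃ w : Eu n → ℝ → ℝ, (Continuous fun z : Eu n × ℝ => w z.1 z.2) ∧ (∃ B, ∀ x t, |w x t| ≤ B) ∧
      (∀ x, w x 0 = 0) ∧ Weak univ 0 T w (fun x t => F x t - V x * w x t) := by
  set N : ℝ := 2 * A with hN
  have hN0 : 0 < N := by positivity
  set c : ℝ → ℝ := fun t => max 0 (min t T) with hcdef
  have hcc : Continuous c := by fun_prop
  have hc0 : ∀ t, 0 ≤ c t := fun t => le_max_left _ _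
  have hcT : ∀ t, c t ≤ T := fun t => max_le hT (min_le_right _ _)
  have hcI : ∀ t ∈ Icc 0 T, c t = t := fun t ht => by
    simp only [hcdef]; rw [min_eq_left ht.2, max_eq_right ht.1]
  have hexpT : ∀ t, exp (N * c t) ≤ exp (N * T) := fun t =>
    exp_le_exp.2 (mul_le_mul_of_nonneg_left (hcT t) hN0.le)
  set h : ((Eu n × ℝ) →ᵇ ℝ) → Eu n → ℝ → ℝ := fun v x s => F x s - V x * (exp (N * c s) * v (x, s))
    with hh
  have hhc : ∀ v, Continuous fun z : Eu n × ℝ => h v z.1 z.2 := fun v =>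
    hF.sub ((hV.comp continuous_fst).mul
      (((by fun_prop : Continuous fun z : Eu n × ℝ => exp (N * c z.2))).mul v.continuous))
  have hM0 : 0 ≤ M := (abs_nonneg _).trans (hM 0 0)
  have hhM : ∀ v x s, |h v x s| ≤ M + A * (exp (N * T) * ‖v‖) := fun v x s => by
    refine (abs_sub _ _).trans (add_le_add (hM x s) ?_)
    rw [abs_mul, abs_mul, abs_of_pos (exp_pos _)]
    have h1 : |v (x, s)| ≤ ‖v‖ := v.norm_coe_le_norm (x, s)
    gcongr
    · exact hVA x
    · exact hcT s
  have hPb : ∀ v (z : Eu n × ℝ), ‖exp (-(N * c z.2)) * Pot (h v) z.1 (c z.2)‖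
      ≤ T * (M + A * (exp (N * T) * ‖v‖)) := fun v z => by
    rw [Real.norm_eq_abs, abs_mul, abs_of_pos (exp_pos _)]
    have h1 : exp (-(N * c z.2)) ≤ 1 :=
      exp_le_one_iff.2 (neg_nonpos.2 (mul_nonneg hN0.le (hc0 _)))
    have h2 := abs_Pot_le_const (x := z.1) (hc0 z.2) (hhM v)
    have h3 : c z.2 * (M + A * (exp (N * T) * ‖v‖)) ≤ T * (M + A * (exp (N * T) * ‖v‖)) :=
      mul_le_mul_of_nonneg_right (hcT _) (by positivity)
    calc _ ≤ 1 * |Pot (h v) z.1 (c z.2)| := mul_le_mul_of_nonneg_right h1 (abs_nonneg _)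
      _ ≤ _ := by rw [one_mul]; exact h2.trans h3
  set Φ : ((Eu n × ℝ) →ᵇ ℝ) → ((Eu n × ℝ) →ᵇ ℝ) := fun v =>
    BoundedContinuousFunction.ofNormedAddCommGroup
      (fun z => exp (-(N * c z.2)) * Pot (h v) z.1 (c z.2))
      ((by fun_prop : Continuous fun z : Eu n × ℝ => exp (-(N * c z.2))).mul
        ((continuous_Pot (hhc v) (hhM v)).comp
          (by fun_prop : Continuous fun z : Eu n × ℝ => (z.1, c z.2)))) _ (hPb v) with hΦ
  have hcontr : ContractingWith (1 / 2) Φ := by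
    refine ⟨by rw [← NNReal.coe_lt_coe]; norm_num, LipschitzWith.of_dist_le_mul fun v v' => ?_⟩
    rw [BoundedContinuousFunction.dist_le (by positivity)]
    intro z
    simp only [hΦ, BoundedContinuousFunction.coe_ofNormedAddCommGroup]
    rw [Real.dist_eq, ← mul_sub, Pot_sub (hhc v) (hhM v) (hhc v') (hhM v'), abs_mul,
      abs_of_pos (exp_pos _)]
    set D := dist v v'
    have hp := abs_Pot_le (h := fun x t => h v x t - h v' x t) (x := z.1)
      (m := fun s => exp (N * s) * (A * D)) (by fun_prop) (hc0 z.2) (fun s hs y => by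
        have : h v y s - h v' y s = -(V y * (exp (N * c s) * (v (y, s) - v' (y, s)))) := by
          simp only [hh]; ring
        rw [this, abs_neg, abs_mul, abs_mul, abs_of_pos (exp_pos _),
          hcI s ⟨hs.1, hs.2.trans (hcT _)⟩]
        have h1 : |v (y, s) - v' (y, s)| ≤ D := by
          rw [← Real.dist_eq]; exact BoundedContinuousFunction.dist_coe_le_dist _
        calc |V y| * (exp (N * s) * |v (y, s) - v' (y, s)|) ≤ A * (exp (N * s) * D) := by
              gcongr; exact hVA y
          _ = _ := by ring)
    have hitg : ∫ s in (0:ℝ)..c z.2, exp (N * s) * (A * D)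
        = (exp (N * c z.2) - 1) / N * (A * D) := by
      rw [intervalIntegral.integral_mul_const, intervalIntegral.integral_comp_mul_left _ hN0.ne',
        integral_exp]
      simp [div_eq_inv_mul]
    rw [hitg] at hp
    have hD : 0 ≤ D := dist_nonneg
    have hNN : A / N = 1 / 2 := by rw [hN]; field_simp
    calc _ ≤ exp (-(N * c z.2)) * ((exp (N * c z.2) - 1) / N * (A * D)) :=
          mul_le_mul_of_nonneg_left hp (exp_pos _).le
      _ = (1 - exp (-(N * c z.2))) * (A / N) * D := by
          have : exp (-(N * c z.2)) * exp (N * c z.2) = 1 := by rw [← exp_add]; simp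
          calc _ = (exp (-(N * c z.2)) * exp (N * c z.2) - exp (-(N * c z.2))) * (A / N) * D := by
                field_simp
            _ = _ := by rw [this]
      _ ≤ 1 * (1 / 2) * D := by
          rw [hNN]
          have := exp_pos (-(N * c z.2))
          gcongr
          linarith
      _ = _ := by norm_num
  obtain ⟨v, hv⟩ : ∃ v, Φ v = v := ⟨_, hcontr.fixedPoint_isFixedPt⟩
  set w : Eu n → ℝ → ℝ := fun x t => exp (N * c t) * v (x, t) with hw
  have hwP : ∀ x, ∀ t ∈ Icc 0 T, w x t = Pot (h v) x t := fun x t ht => by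
    have := congrArg (fun g : (Eu n × ℝ) →ᵇ ℝ => g (x, t)) hv
    simp only [hΦ, BoundedContinuousFunction.coe_ofNormedAddCommGroup] at this
    simp only [hw]
    rw [← this, ← mul_assoc, ← exp_add, hcI t ht]; simp
  refine ⟨w, ?_, ⟨exp (N * T) * ‖v‖, fun x t => ?_⟩, fun x => ?_, ?_⟩
  · exact (by fun_prop : Continuous fun z : Eu n × ℝ => exp (N * c z.2)).mul v.continuous
  · rw [hw, abs_mul, abs_of_pos (exp_pos _)]
    have h1 : |v (x, t)| ≤ ‖v‖ := v.norm_coe_le_norm (x, t)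
    gcongr
    exact hcT t
  · rw [hwP x 0 ⟨le_rfl, hT⟩, Pot_zero]
  · exact (weak_Pot (hhc v) (hhM v) T).congr (fun x _ t ht => hwP x t ht) fun x _ t _ => rfl

lemma exists_unif_limit {α : Type*} {S : Set α} {W : ℝ → α → ℝ}
    (h : ∀ θ > 0, ∃ ε0 > 0, ∀ ε ∈ Ioc 0 ε0, ∀ ε' ∈ Ioc 0 ε0, ∀ z ∈ S, |W ε z - W ε' z| ≤ θ) :
    ∃ w : α → ℝ, ∀ θ > 0, ∃ ε0 > 0, ∀ ε ∈ Ioc 0 ε0, ∀ z ∈ S, |W ε z - w z| ≤ θ := by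
  have hlim : ∀ z ∈ S, ∃ y, Tendsto (fun ε => W ε z) (nhdsWithin 0 (Ioi 0)) (nhds y) := by
    intro z hz
    refine cauchy_map_iff_exists_tendsto.1 ?_
    rw [Metric.cauchy_iff]
    refine ⟨inferInstance, fun θ hθ => ?_⟩
    obtain ⟨ε0, h0, hε⟩ := h (θ / 2) (half_pos hθ)
    refine ⟨(fun ε => W ε z) '' Ioc 0 ε0, image_mem_map (Ioc_mem_nhdsGT h0), ?_⟩
    rintro _ ⟨a, ha, rfl⟩ _ ⟨b, hb, rfl⟩
    rw [Real.dist_eq]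
    exact (hε a ha b hb z hz).trans_lt (half_lt_self hθ)
  choose! w hw using hlim
  refine ⟨w, fun θ hθ => ?_⟩
  obtain ⟨ε0, h0, hε⟩ := h θ hθ
  refine ⟨ε0, h0, fun ε hεm z hz => ?_⟩
  refine le_of_tendsto ((tendsto_const_nhds.sub (hw z hz)).abs) ?_
  filter_upwards [Ioc_mem_nhdsGT h0] with ε' hε'
  exact hε ε hεm ε' hε' z hz

lemma continuousOn_of_unif_approx {α : Type*} [TopologicalSpace α] {S : Set α} {w : α → ℝ}
    (h : ∀ θ > 0, ∃ g : α → ℝ, ContinuousOn g S ∧ ∀ z ∈ S, |g z - w z| ≤ θ) :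
    ContinuousOn w S := by
  refine continuousOn_of_uniform_approx_of_continuousOn fun u hu => ?_
  obtain ⟨θ, hθ, hu⟩ := Metric.mem_uniformity_dist.1 hu
  obtain ⟨g, hg, hgw⟩ := h (θ / 2) (half_pos hθ)
  refine ⟨g, hg, fun z hz => hu ?_⟩
  rw [Real.dist_eq, abs_sub_comm]
  exact (hgw z hz).trans_lt (half_lt_self hθ)

/-- The cutoff layer between the levels `ε` and `2δ` of `f`. -/
def layer (f : Eu n → ℝ) (ε δ : ℝ) (x : Eu n) : ℝ := cut f ε x * (1 - cut f δ x)

lemma layer_nonneg (x : Eu n) : 0 ≤ layer f ε δ x :=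
  mul_nonneg (cut_nonneg x) (sub_nonneg.2 (cut_le_one x))

lemma layer_le_one (x : Eu n) : layer f ε δ x ≤ 1 :=
  mul_le_one₀ (cut_le_one x) (sub_nonneg.2 (cut_le_one x)) (by linarith [cut_nonneg (f := f) (ε := δ) x])

lemma Bar.continuous_layer (hB : Bar Ω lam f) (ε δ : ℝ) : Continuous (layer f ε δ) :=
  (hB.continuous_cut ε).mul (continuous_const.sub (hB.continuous_cut δ))

lemma Bar.layer_eq_zero (hB : Bar Ω lam f) (hε : 0 < ε) (hx : x ∉ Ω) :
    layer f ε δ x = 0 := by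
  unfold layer
  rw [cut_eq_zero hε (by rw [hB.zero x hx]; exact hε.le), zero_mul]

lemma Bar.integrable_layer (hB : Bar Ω lam f) (δ : ℝ) (hε : 0 < ε) :
    Integrable (layer f ε δ) := by
  refine (hB.continuous_layer ε δ).integrable_of_hasCompactSupport ?_
  refine HasCompactSupport.intro hB.bdd.isCompact_closure fun x hx => hB.layer_eq_zero hε ?_
  exact fun h => hx (subset_closure h)

lemma Bar.tendsto_integral_layer (hB : Bar Ω lam f) :
    Tendsto (fun δ => ∫ x in Ω, (1 - cut f δ x)) (nhdsWithin 0 (Ioi 0)) (nhds 0) := by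
  have h := tendsto_integral_filter_of_dominated_convergence (μ := volume.restrict Ω)
    (l := nhdsWithin (0:ℝ) (Ioi 0)) (F := fun δ x => 1 - cut f δ x) (f := fun _ => (0:ℝ))
    (fun _ => 1) ?_ ?_ ?_ ?_
  · simpa using h
  · exact Eventually.of_forall fun δ =>
      (continuous_const.sub (hB.continuous_cut δ)).aestronglyMeasurable
  · refine Eventually.of_forall fun δ => Eventually.of_forall fun x => ?_
    rw [Real.norm_eq_abs, abs_of_nonneg (sub_nonneg.2 (cut_le_one x))]
    linarith [cut_nonneg (f := f) (ε := δ) x]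
  · exact integrableOn_const (hB.bdd.measure_lt_top.ne)
  · refine (ae_restrict_iff' hB.op.measurableSet).2 (Eventually.of_forall fun x hx => ?_)
    refine tendsto_const_nhds.congr' ?_
    have hp := hB.pos x hx
    filter_upwards [Ioc_mem_nhdsGT (half_pos hp)] with δ hδ
    rw [cut_eq_one hδ.1 (by linarith [hδ.2]), sub_self]

lemma Bar.exists_layer_small (hB : Bar Ω lam f) (hT : 0 ≤ T) {κ : ℝ} (hκ : 0 < κ) :
    ∃ δ > 0, ∀ ε > 0, ∀ x, ∀ t ∈ Icc 0 T, Pot (fun x _ => layer f ε δ x) x t ≤ κ := by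
  set s0 := κ / 2
  have hs0 : 0 < s0 := half_pos hκ
  set c := (√(2 * s0) ^ n)⁻¹
  have hc : 0 < c := by positivity
  have hlt : (0:ℝ) < s0 / (T * c + 1) := by positivity
  obtain ⟨δ, hδ, hδ0⟩ := ((hB.tendsto_integral_layer.eventually_lt_const hlt).and
    self_mem_nhdsWithin).exists
  refine ⟨δ, hδ0, fun ε hε x t ht => ?_⟩
  have h1 := Pot_small (hB.continuous_layer ε δ) (hB.integrable_layer δ hε) layer_nonneg
    layer_le_one hs0 ht.1 x
  have h2 : ∫ z, layer f ε δ z ≤ s0 / (T * c + 1) := by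
    refine le_trans ?_ hδ.le
    rw [← setIntegral_eq_integral_of_forall_compl_eq_zero fun x hx => hB.layer_eq_zero hε hx]
    refine setIntegral_mono (hB.integrable_layer δ hε).integrableOn ?_ fun y => ?_
    · refine Integrable.mono' (g := fun _ => (1:ℝ)) (integrableOn_const hB.bdd.measure_lt_top.ne)
        (continuous_const.sub (hB.continuous_cut δ)).aestronglyMeasurable
        (Eventually.of_forall fun x => ?_)
      rw [Real.norm_eq_abs, abs_of_nonneg (sub_nonneg.2 (cut_le_one x))]
      linarith [cut_nonneg (f := f) (ε := δ) x]
    · exact mul_le_of_le_one_left (sub_nonneg.2 (cut_le_one y)) (cut_le_one y)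
  have h3 : t * (c * ∫ z, layer f ε δ z) ≤ T * (c * (s0 / (T * c + 1))) := by
    have h0 : 0 ≤ ∫ z, layer f ε δ z := integral_nonneg layer_nonneg
    have := ht.2
    gcongr
  have h4 : T * (c * (s0 / (T * c + 1))) ≤ s0 := by
    rw [← mul_assoc, mul_div_assoc', div_le_iff₀ (by positivity)]
    nlinarith
  have h5 : s0 + s0 = κ := add_halves κ
  exact h1.trans (by linarith)

lemma hasDerivAt_lin (c d t : ℝ) : HasDerivAt (fun t : ℝ => c + d * t) d t := by
  simpa using ((hasDerivAt_id t).const_mul d).const_add c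

/-- One-sided bound for the penalised problem. -/
lemma Bar.penalized_le (hB : Bar Ω lam f) {w G : Eu n → ℝ → ℝ} (hε : 0 < ε) (hδ : 0 < δ)
    (hM : 0 ≤ M) (hwB : ∀ x t, |w x t| ≤ B) (hw0 : ∀ x, w x 0 = 0)
    (hwk : Weak univ 0 T w (fun x t => G x t - pen f ε x / (ε + psi f ε x) * w x t))
    (hG : ∀ x, ∀ t ∈ Icc 0 T, G x t ≤ M * cut f ε x) :
    ∀ x, ∀ t ∈ Icc 0 T, w x t ≤ M / (lam * δ) * (ε + psi f ε x)
      + M * Pot (fun x _ => layer f ε δ x) x t := by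
  intro x t ht
  have hlam := hB.lam_pos
  set K := M / (lam * δ) with hK
  have hK0 : 0 ≤ K := by positivity
  have hB0 : 0 ≤ B := (abs_nonneg _).trans (hwB 0 0)
  set P := Pot (fun x _ => layer f ε δ x) with hP
  have hlc : Continuous fun z : Eu n × ℝ => layer f ε δ z.1 :=
    (hB.continuous_layer ε δ).comp continuous_fst
  have hlb : ∀ (x : Eu n) (t : ℝ), |layer f ε δ x| ≤ 1 := fun x _ => by
    rw [abs_of_nonneg (layer_nonneg x)]; exact layer_le_one x
  have hPc : Continuous fun z : Eu n × ℝ => P z.1 z.2 :=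
    continuous_Pot (h := fun x _ => layer f ε δ x) hlc hlb
  have hPw : Weak univ 0 T P (fun x _ => layer f ε δ x) := weak_Pot hlc hlb T
  have hP0 : ∀ x, ∀ t, 0 ≤ t → 0 ≤ P x t := fun x t ht => Pot_nonneg (fun x _ => layer_nonneg x) ht
  have hps := hB.contDiff_psi hε
  suffices H : ∀ γ > 0, w x t - (K * (ε + psi f ε x) + M * P x t) ≤ γ * (‖x - 0‖ ^ 2 + 2 * n * t) by
    have hlim : Tendsto (fun γ : ℝ => γ * (‖x - 0‖ ^ 2 + 2 * n * t)) (nhdsWithin 0 (Ioi 0))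
        (nhds (0 * (‖x - 0‖ ^ 2 + 2 * n * t))) :=
      (tendsto_id.mul_const _).mono_left nhdsWithin_le_nhds
    have := ge_of_tendsto hlim (eventually_nhdsWithin_of_forall fun γ hγ => H γ hγ)
    linarith
  intro γ hγ
  set R : ℝ := ‖x‖ + 1 + B / γ with hR
  have hBγ : 0 ≤ B / γ := by positivity
  have hR1 : 1 ≤ R := by linarith [norm_nonneg x]
  have hBR : B / γ ≤ R := by linarith [norm_nonneg x]
  have hxR : x ∈ ball (0 : Eu n) R := by
    rw [mem_ball_zero_iff]; linarith
  have hsm : ∀ x t, ContDiffAt ℝ 2 (fun y : Eu n => K * (ε + psi f ε y)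
      + γ * (‖y - 0‖ ^ 2 + 2 * n * t)) x := fun x t =>
    ((contDiff_const.mul (contDiff_const.add hps)).add
      (contDiff_const.mul ((contDiff_normSq 0).add contDiff_const))).contDiffAt
  have hlap : ∀ x t, lap (fun y : Eu n => -(K * (ε + psi f ε y)
      + γ * (‖y - 0‖ ^ 2 + 2 * n * t))) x
      = -(K * lap (psi f ε) x + γ * (2 * n)) := fun x t => by
    have e1 : ContDiffAt ℝ 2 (fun y : Eu n => ε + psi f ε y) x :=
      (contDiff_const.add hps).contDiffAt
    have e2 : ContDiffAt ℝ 2 (fun y : Eu n => ‖y - 0‖ ^ 2 + 2 * n * t) x :=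
      ((contDiff_normSq 0).add contDiff_const).contDiffAt
    rw [lap_neg (f := fun y : Eu n => K * (ε + psi f ε y) + γ * (‖y - 0‖ ^ 2 + 2 * n * t)),
      lap_add (contDiffAt_const.mul e1) (contDiffAt_const.mul e2), lap_const_mul K e1,
      lap_const_mul γ e2, lap_add contDiffAt_const hps.contDiffAt,
      lap_add (contDiff_normSq 0).contDiffAt contDiffAt_const, lap_const, lap_normSq, lap_const]
    · ring
    · exact hsm x t
  have hmain := comparison (U := ball (0 : Eu n) R) isOpen_ball isBounded_ball
    (t0 := 0) (t1 := T)
    (v1 := fun x t => -(K * (ε + psi f ε x) + γ * (‖x - 0‖ ^ 2 + 2 * n * t)))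
    (v2 := fun x t => w x t - M * P x t)
    (h1 := fun x t => K * lap (psi f ε) x)
    (h2 := fun x t => (G x t - pen f ε x / (ε + psi f ε x) * w x t) - M * layer f ε δ x)
    ?_ ?_ ?_ ?_ ?_ ?_ ?_
  · have := hmain x (subset_closure hxR) t ht
    linarith
  · refine ContinuousOn.add ?_ ?_
    · refine Continuous.continuousOn ?_
      have := hps.continuous
      fun_prop
    · exact (hwk.cu.mono (by simp) le_rfl).sub (continuous_const.mul hPc).continuousOn
  · exact fun x _ t _ => (hsm x t).neg
  · intro x _ t _
    beta_reduce
    rw [hlap]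
    refine ((hasDerivAt_lin (-(K * (ε + psi f ε x)) - γ * ‖x - 0‖ ^ 2) (-γ * (2 * n))
      t).congr_of_eventuallyEq (Eventually.of_forall fun s => ?_)).congr_deriv ?_
    · beta_reduce; ring
    · ring
  · exact (hwk.sub isOpen_univ (hPw.const_mul M)).mono (subset_univ _) le_rfl le_rfl
  · intro x _ t ht hpos
    have ht' : t ∈ Icc 0 T := ⟨ht.1.le, ht.2.le⟩
    have hΦ : 0 < ε + psi f ε x := by linarith [hB.psi_nonneg hε x]
    have hwK : K * (ε + psi f ε x) ≤ w x t := by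
      have h1 : 0 ≤ γ * (‖x - 0‖ ^ 2 + 2 * n * t) := by have := ht.1.le; positivity
      have h2 := mul_nonneg hM (hP0 x t ht.1.le)
      linarith
    have hVw : K * pen f ε x ≤ pen f ε x / (ε + psi f ε x) * w x t := by
      calc K * pen f ε x = pen f ε x / (ε + psi f ε x) * (K * (ε + psi f ε x)) := by field_simp
        _ ≤ _ := mul_le_mul_of_nonneg_left hwK (div_nonneg (pen_nonneg hε x) hΦ.le)
    have hlay : cut f δ x ≤ f x / δ := by
      rcases le_total (f x) δ with h | h
      · rw [cut_eq_zero hδ h]; exact div_nonneg (hB.nonneg x) hδ.le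
      · exact (cut_le_one x).trans ((one_le_div hδ).2 h)
    have hKf : K * (lam * (cut f ε x * f x)) = M * cut f ε x * (f x / δ) := by
      rw [hK]; field_simp
    have h5 := mul_le_mul_of_nonneg_left hlay (mul_nonneg hM (cut_nonneg (f := f) (ε := ε) x))
    have h6 := hG x t ht'
    rw [hB.lap_psi hε]
    unfold layer
    nlinarith
  · intro x _
    have h1 : 0 ≤ K * (ε + psi f ε x) := mul_nonneg hK0 (by linarith [hB.psi_nonneg hε x])
    have h2 : P x 0 = 0 := Pot_zero _ _
    have h3 : 0 ≤ γ * (‖x - 0‖ ^ 2 + 2 * n * 0) := by positivity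
    rw [hw0, h2]; linarith
  · intro x hx t ht
    have hxn : ‖x‖ = R := by
      have := frontier_ball_subset_sphere hx
      simpa using this
    have h1 : 0 ≤ K * (ε + psi f ε x) := mul_nonneg hK0 (by linarith [hB.psi_nonneg hε x])
    have h2 := mul_nonneg hM (hP0 x t ht.1)
    have h3 : B ≤ γ * (‖x - 0‖ ^ 2 + 2 * n * t) := by
      have h4 : B = γ * (B / γ) := by field_simp
      have h5 : B / γ ≤ ‖x - 0‖ ^ 2 := by
        rw [sub_zero, hxn]
        nlinarith
      have h6 : 0 ≤ 2 * (n:ℝ) * t := by have := ht.1; positivity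
      nlinarith [mul_le_mul_of_nonneg_left h5 hγ.le, mul_nonneg hγ.le h6]
    have h4 := (abs_le.1 (hwB x t)).2
    linarith

lemma Weak.le_of_bdry (hU : IsOpen U) (hb : Bornology.IsBounded U) {m : ℝ} {d g : Eu n → ℝ → ℝ}
    (hw : Weak U t0 t1 d g) (hc : JC d (closure U) (Icc t0 t1))
    (hg : ∀ x ∈ U, ∀ t ∈ Ioo t0 t1, g x t ≤ m) (hm : 0 ≤ m) (h0 : ∀ x ∈ closure U, d x t0 ≤ c)
    (h1 : ∀ x ∈ frontier U, ∀ t ∈ Icc t0 t1, d x t ≤ c) :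
    ∀ x ∈ closure U, ∀ t ∈ Icc t0 t1, d x t ≤ c + m * (t - t0) := by
  have h := comparison hU hb (v1 := fun _ t => -(c + m * (t - t0))) (v2 := d) (h1 := fun _ _ => -m)
    (h2 := g) (t0 := t0) (t1 := t1) ?_ (fun _ _ _ _ => contDiffAt_const) ?_ hw ?_ ?_ ?_
  · intro x hx t ht
    linarith [h x hx t ht]
  · exact ContinuousOn.add (Continuous.continuousOn (by fun_prop)) hc
  · intro x _ t _
    rw [lap_const]
    refine ((hasDerivAt_lin (-(c - m * t0)) (-m) t).congr_of_eventuallyEq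
      (Eventually.of_forall fun s => ?_)).congr_deriv (by ring)
    beta_reduce; ring
  · intro x hx t ht _
    linarith [hg x hx t ht]
  · intro x hx
    simpa using h0 x hx
  · intro x hx t ht
    have := h1 x hx t ht
    nlinarith [mul_nonneg hm (sub_nonneg.2 ht.1)]

lemma Weak.abs_le_of_bdry (hU : IsOpen U) (hb : Bornology.IsBounded U) {m : ℝ}
    {d g : Eu n → ℝ → ℝ} (hw : Weak U t0 t1 d g) (hc : JC d (closure U) (Icc t0 t1))
    (hg : ∀ x ∈ U, ∀ t ∈ Ioo t0 t1, |g x t| ≤ m) (hm : 0 ≤ m) (h0 : ∀ x ∈ closure U, |d x t0| ≤ c)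
    (h1 : ∀ x ∈ frontier U, ∀ t ∈ Icc t0 t1, |d x t| ≤ c) :
    ∀ x ∈ closure U, ∀ t ∈ Icc t0 t1, |d x t| ≤ c + m * (t - t0) := by
  intro x hx t ht
  refine abs_le'.2 ⟨?_, ?_⟩
  · exact hw.le_of_bdry hU hb hc (fun x hx t ht => (abs_le.1 (hg x hx t ht)).2) hm
      (fun x hx => (abs_le.1 (h0 x hx)).2) (fun x hx t ht => (abs_le.1 (h1 x hx t ht)).2) x hx t ht
  · exact hw.neg.le_of_bdry hU hb (ContinuousOn.neg hc)
      (fun x hx t ht => neg_le.1 (abs_le.1 (hg x hx t ht)).1) hm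
      (fun x hx => neg_le.1 (abs_le.1 (h0 x hx)).1)
      (fun x hx t ht => neg_le.1 (abs_le.1 (h1 x hx t ht)).1) x hx t ht

/-- Truncation of time to the interval `[0, T]`. -/
def clamp (T t : ℝ) : ℝ := max 0 (min t T)

lemma continuous_clamp (T : ℝ) : Continuous (clamp T) := by unfold clamp; fun_prop

lemma clamp_mem (hT : 0 ≤ T) (t : ℝ) : clamp T t ∈ Icc 0 T :=
  ⟨le_max_left _ _, max_le hT (min_le_right _ _)⟩

lemma clamp_of_mem (ht : t ∈ Icc 0 T) : clamp T t = t := by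
  unfold clamp; rw [min_eq_left ht.2, max_eq_right ht.1]

lemma Bar.tsupport_cut (hB : Bar Ω lam f) (hε : 0 < ε) :
    tsupport (cut f ε) ⊆ {x | ε ≤ f x} := by
  refine closure_minimal (fun x hx => ?_) (isClosed_le continuous_const hB.cont)
  by_contra hn
  exact hx (cut_eq_zero hε (not_le.1 hn).le)

lemma jc_univ_clamp (hT : 0 ≤ T) (hu : JC u univ (Icc 0 T)) :
    Continuous fun z : Eu n × ℝ => u z.1 (clamp T z.2) :=
  ContinuousOn.comp_continuous (g := fun z : Eu n × ℝ => u z.1 z.2) hu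
    (f := fun z : Eu n × ℝ => (z.1, clamp T z.2))
    (by have := continuous_clamp T; fun_prop) fun z => ⟨mem_univ _, clamp_mem hT _⟩

lemma Bar.exists_approx (hB : Bar Ω lam f) (hT : 0 ≤ T) (hM : 0 ≤ M) (hF : JC F Ω (Icc 0 T))
    (hFM : ∀ x ∈ Ω, ∀ t ∈ Icc 0 T, |F x t| ≤ M) (hε : 0 < ε) :
    ∃ w : Eu n → ℝ → ℝ, (Continuous fun z : Eu n × ℝ => w z.1 z.2) ∧
      (∀ x, w x 0 = 0) ∧ Weak {x | 2 * ε < f x} 0 T w F ∧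
      ∀ δ > 0, ∀ x, ∀ t ∈ Icc 0 T, |w x t| ≤ M / (lam * δ) * (ε + f x)
        + M * Pot (fun x _ => layer f ε δ x) x t := by
  set G : Eu n → ℝ → ℝ := fun x t => F x (clamp T t) * cut f ε x with hGdef
  have hGc : Continuous fun z : Eu n × ℝ => G z.1 z.2 :=
    jc_univ_clamp hT (jc_mul_cutoff hB.op hF (hB.continuous_cut ε)
      ((hB.tsupport_cut hε).trans (hB.ge_subset hε)))
  have hGM' : ∀ x t, |G x t| ≤ M * cut f ε x := fun x t => by
    by_cases hx : x ∈ Ω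
    · rw [hGdef, abs_mul, abs_of_nonneg (cut_nonneg x)]
      exact mul_le_mul_of_nonneg_right (hFM x hx _ (clamp_mem hT t)) (cut_nonneg x)
    · simp only [hGdef]
      rw [cut_eq_zero hε (by rw [hB.zero x hx]; exact hε.le)]; simp
  have hGM : ∀ x t, |G x t| ≤ M := fun x t =>
    (hGM' x t).trans (mul_le_of_le_one_right hM (cut_le_one x))
  have hΦ : ∀ x, ε ≤ ε + psi f ε x := fun x => by linarith [hB.psi_nonneg hε x]
  obtain ⟨C, hC, hCp⟩ := hB.exists_pen_bound hε
  have hV : Continuous fun x => pen f ε x / (ε + psi f ε x) :=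
    (hB.continuous_pen hε).div (continuous_const.add (hB.contDiff_psi hε).continuous)
      fun x => (hε.trans_le (hΦ x)).ne'
  obtain ⟨w, hwc, ⟨B, hwB⟩, hw0, hwk⟩ := exists_penalized hGc hGM hV (A := C / ε) (by positivity)
    (fun x => by
      rw [abs_of_nonneg (div_nonneg (pen_nonneg hε x) (hε.le.trans (hΦ x)))]
      exact div_le_div₀ hC.le (hCp x) hε (hΦ x)) hT
  refine ⟨w, hwc, hw0, ?_, fun δ hδ x t ht => ?_⟩
  · refine (hwk.mono (subset_univ _) le_rfl le_rfl).congr (fun _ _ _ _ => rfl) fun x hx t ht => ?_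
    simp only [hGdef]
    rw [pen_eq_zero hε hx, cut_eq_one hε (le_of_lt hx), clamp_of_mem ht]; ring
  · have hlam := hB.lam_pos
    have hle : M / (lam * δ) * (ε + psi f ε x) ≤ M / (lam * δ) * (ε + f x) :=
      mul_le_mul_of_nonneg_left (by linarith [hB.psi_le hε x]) (by positivity)
    have h1 := hB.penalized_le hε hδ hM hwB hw0 hwk
      (fun x t _ => (abs_le.1 (hGM' x t)).2) x t ht
    have h2 := hB.penalized_le (w := fun x t => -w x t) (G := fun x t => -G x t) hε hδ hM
      (fun x t => by rw [abs_neg]; exact hwB x t) (fun x => by simp [hw0 x])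
      (hwk.neg.congr (fun _ _ _ _ => rfl) fun x _ t _ => by ring)
      (fun x t _ => neg_le.1 (abs_le.1 (hGM' x t)).1) x t ht
    exact abs_le'.2 ⟨by linarith, by linarith⟩

/-- Solvability of the heat equation with bounded source and zero data on the parabolic boundary. -/
lemma Bar.exists_zero_data (hB : Bar Ω lam f) (hT : 0 ≤ T) (hF : JC F Ω (Icc 0 T))
    (hFM : ∀ x ∈ Ω, ∀ t ∈ Icc 0 T, |F x t| ≤ M) :
    ∃ w : Eu n → ℝ → ℝ, JC w univ (Icc 0 T) ∧ (∀ x, w x 0 = 0) ∧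
      (∀ x, x ∉ Ω → ∀ t ∈ Icc 0 T, w x t = 0) ∧ Weak Ω 0 T w F := by
  have hFM' : ∀ x ∈ Ω, ∀ t ∈ Icc 0 T, |F x t| ≤ max M 0 := fun x hx t ht =>
    (hFM x hx t ht).trans (le_max_left _ _)
  have hM0 : 0 ≤ max M 0 := le_max_right _ _
  generalize max M 0 = M' at hFM' hM0
  clear hFM
  choose! W hWc hW0 hWw hWb using fun (ε : ℝ) (hε : 0 < ε) => hB.exists_approx hT hM0 hF hFM' hε
  have hlam := hB.lam_pos
  have hbd : ∀ κ > 0, ∃ K ≥ 0, ∀ ε > 0, ∀ x, ∀ t ∈ Icc 0 T, |W ε x t| ≤ κ + K * (ε + f x) := by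
    intro κ hκ
    obtain ⟨δ, hδ, hs⟩ := hB.exists_layer_small hT (κ := κ / (M' + 1)) (by positivity)
    refine ⟨M' / (lam * δ), by positivity, fun ε hε x t ht => ?_⟩
    have h1 := hWb ε hε δ hδ x t ht
    have h2 := mul_le_mul_of_nonneg_left (hs ε hε x t ht) hM0
    have h3 : M' * (κ / (M' + 1)) ≤ κ := by
      rw [mul_div_assoc', div_le_iff₀ (by positivity)]; nlinarith
    linarith
  have hcmp : ∀ κ > 0, ∃ K ≥ 0, ∀ ε > 0, ∀ ε' > 0, ε' ≤ ε → ∀ x, ∀ t ∈ Icc 0 T,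
      |W ε x t - W ε' x t| ≤ 2 * κ + 6 * K * ε := by
    intro κ hκ
    obtain ⟨K, hK, hb⟩ := hbd κ hκ
    refine ⟨K, hK, fun ε hε ε' hε' hle => ?_⟩
    set U := {x | 2 * ε < f x} with hUdef
    have hU : IsOpen U := isOpen_lt continuous_const hB.cont
    have hUO : U ⊆ Ω := fun x hx => hB.mem (lt_trans (by positivity) hx)
    have hout : ∀ x, x ∉ U → ∀ t ∈ Icc 0 T, |W ε x t - W ε' x t| ≤ 2 * κ + 6 * K * ε := by
      intro x hx t ht
      have hfx : f x ≤ 2 * ε := not_lt.1 hx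
      have h1 := hb ε hε x t ht
      have h2 := hb ε' hε' x t ht
      have h3 := abs_sub (W ε x t) (W ε' x t)
      nlinarith [mul_le_mul_of_nonneg_left hfx hK, mul_le_mul_of_nonneg_left hle hK]
    have hcl := Weak.abs_le_of_bdry hU (hB.bdd.subset hUO) (c := 2 * κ + 6 * K * ε) (m := 0)
      (d := fun x t => W ε x t - W ε' x t) (g := fun x t => F x t - F x t) (t0 := 0) (t1 := T)
      ((hWw ε hε).sub hU ((hWw ε' hε').mono (fun x (hx : 2 * ε < f x) =>
        lt_of_le_of_lt (mul_le_mul_of_nonneg_left hle two_pos.le) hx) le_rfl le_rfl))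
      ((hWc ε hε).sub (hWc ε' hε')).continuousOn (fun x _ t _ => by simp) le_rfl
      (fun x _ => by rw [hW0 ε hε, hW0 ε' hε', sub_self, abs_zero]; positivity)
      (fun x hx t ht => hout x (by rw [hU.frontier_eq] at hx; exact hx.2) t ht)
    intro x t ht
    by_cases hx : x ∈ U
    · simpa using hcl x (subset_closure hx) t ht
    · exact hout x hx t ht
  obtain ⟨w, hw⟩ := exists_unif_limit (S := (univ : Set (Eu n)) ×ˢ Icc 0 T)
    (W := fun ε z => W ε z.1 z.2) (fun θ hθ => by
      obtain ⟨K, hK, hc⟩ := hcmp (θ / 4) (by positivity)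
      refine ⟨θ / (12 * K + 1), by positivity, fun ε hε ε' hε' z hz => ?_⟩
      have hKε : ∀ ε ∈ Ioc 0 (θ / (12 * K + 1)), 2 * (θ / 4) + 6 * K * ε ≤ θ := fun ε hε => by
        have h1 := (le_div_iff₀ (by positivity)).1 hε.2
        nlinarith [hε.1]
      rcases le_total ε' ε with h | h
      · exact (hc ε hε.1 ε' hε'.1 h z.1 z.2 hz.2).trans (hKε ε hε)
      · rw [abs_sub_comm]
        exact (hc ε' hε'.1 ε hε.1 h z.1 z.2 hz.2).trans (hKε ε' hε'))
  have hex : ∀ θ > 0, ∀ η > 0, ∃ ε > 0, ε ≤ η ∧ ∀ x, ∀ t ∈ Icc 0 T, |W ε x t - w (x, t)| ≤ θ := by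
    intro θ hθ η hη
    obtain ⟨ε0, h0, h⟩ := hw θ hθ
    exact ⟨min ε0 η, lt_min h0 hη, min_le_right _ _, fun x t ht =>
      h _ ⟨lt_min h0 hη, min_le_left _ _⟩ (x, t) ⟨mem_univ _, ht⟩⟩
  refine ⟨fun x t => if t = 0 then 0 else w (x, t), ?_, fun x => by simp, ?_, ?_⟩
  all_goals
    have hw0 : ∀ x, w (x, 0) = 0 := fun x => by
      refine abs_eq_zero.1 (le_antisymm (le_of_forall_pos_le_add fun θ hθ => ?_) (abs_nonneg _))
      obtain ⟨ε, hε, -, h⟩ := hex θ hθ 1 one_pos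
      have := h x 0 ⟨le_rfl, hT⟩
      rw [hW0 ε hε, zero_sub, abs_neg] at this
      linarith
    have hif : (fun (x : Eu n) (t : ℝ) => if t = 0 then 0 else w (x, t)) = fun x t => w (x, t) := by
      funext x t
      split_ifs with h
      · rw [h, hw0]
      · rfl
    have hjc : JC (fun x t => w (x, t)) univ (Icc 0 T) := by
      refine continuousOn_of_unif_approx fun θ hθ => ?_
      obtain ⟨ε, hε, -, h⟩ := hex θ hθ 1 one_pos
      exact ⟨fun z => W ε z.1 z.2, (hWc ε hε).continuousOn, fun z hz => h z.1 z.2 hz.2⟩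
    rw [hif]
  · exact hjc
  · intro x hx t ht
    refine abs_eq_zero.1 (le_antisymm (le_of_forall_pos_le_add fun θ hθ => ?_) (abs_nonneg _))
    obtain ⟨K, hK, hb⟩ := hbd (θ / 3) (by positivity)
    obtain ⟨ε, hε, hε1, h⟩ := hex (θ / 3) (by positivity) (θ / (3 * (K + 1))) (by positivity)
    have h1 := hb ε hε x t ht
    have h2 := h x t ht
    have h3 : K * ε ≤ θ / 3 := by
      have := (le_div_iff₀ (by positivity)).1 hε1
      nlinarith
    rw [hB.zero x hx, add_zero] at h1
    have h4 : |w (x, t)| ≤ |W ε x t| + |W ε x t - w (x, t)| := by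
      have := abs_sub (W ε x t) (W ε x t - w (x, t))
      simpa using this
    linarith
  · refine Weak.of_approx hB.op (hjc.mono (subset_univ _) le_rfl) hF fun K hKO hK θ hθ => ?_
    obtain ⟨c, hc, hcK⟩ : ∃ c > 0, ∀ x ∈ K, c ≤ f x := by
      rcases K.eq_empty_or_nonempty with h | h
      · exact ⟨1, one_pos, by simp [h]⟩
      · obtain ⟨x, hx, hm⟩ := hK.exists_isMinOn h hB.cont.continuousOn
        exact ⟨f x, hB.pos x (hKO hx), fun y hy => hm hy⟩
    obtain ⟨ε, hε, hε1, h⟩ := hex θ hθ (c / 4) (by positivity)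
    refine ⟨{x | 2 * ε < f x}, W ε, F, isOpen_lt continuous_const hB.cont, fun x hx => ?_,
      hWw ε hε, fun x hx t ht => ⟨by rw [abs_sub_comm]; exact h x t ht, by simpa using hθ.le⟩⟩
    have := hcK x hx
    exact lt_of_lt_of_le (by linarith) this

/-- The parabolic boundary of `Ω × [t0, t1]`. -/
def PB (Ω : Set (Eu n)) (t0 t1 : ℝ) : Set (Eu n × ℝ) :=
  {z | z.1 ∈ closure Ω ∧ z.2 ∈ Icc t0 t1 ∧ (z.2 = t0 ∨ z.1 ∈ frontier Ω)}

lemma isClosed_PB (Ω : Set (Eu n)) (t0 t1 : ℝ) : IsClosed (PB Ω t0 t1) := by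
  have h1 : IsClosed {z : Eu n × ℝ | z.1 ∈ closure Ω} := isClosed_closure.preimage continuous_fst
  have h2 : IsClosed {z : Eu n × ℝ | z.2 ∈ Icc t0 t1} := isClosed_Icc.preimage continuous_snd
  have h3 : IsClosed {z : Eu n × ℝ | z.2 = t0} := isClosed_eq continuous_snd continuous_const
  have h4 : IsClosed {z : Eu n × ℝ | z.1 ∈ frontier Ω} := isClosed_frontier.preimage continuous_fst
  exact h1.inter (h2.inter (h3.union h4))

section slices
variable {P : Eu n × ℝ → ℝ}

lemma hasFDerivAt_slice (hP : DifferentiableAt ℝ P (x, t)) :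
    HasFDerivAt (fun y => P (y, t))
      ((fderiv ℝ P (x, t)).comp (ContinuousLinearMap.inl ℝ (Eu n) ℝ)) x :=
  hP.hasFDerivAt.comp x (hasFDerivAt_prodMk_left x t)

lemma pd_slice (hP : DifferentiableAt ℝ P (x, t)) (i : Fin n) :
    pd i (fun y => P (y, t)) x = fderiv ℝ P (x, t) (EuclideanSpace.single i 1, 0) := by
  unfold pd
  rw [(hasFDerivAt_slice hP).fderiv]
  simp

lemma continuous_lap_slice (hP : ContDiff ℝ 2 P) :
    Continuous fun z : Eu n × ℝ => lap (fun y => P (y, z.2)) z.1 := by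
  have h1 : ∀ i : Fin n, ContDiff ℝ 1 fun z => fderiv ℝ P z (EuclideanSpace.single i 1, 0) :=
    fun i => (hP.fderiv_right (m := 1) (by norm_num)).clm_apply contDiff_const
  have h2 : ∀ z : Eu n × ℝ, lap (fun y => P (y, z.2)) z.1
      = ∑ i : Fin n, fderiv ℝ (fun z => fderiv ℝ P z (EuclideanSpace.single i 1, 0)) z
          (EuclideanSpace.single i 1, 0) := by
    rintro ⟨x, t⟩
    rw [lap_eq_sum_pd]
    refine Finset.sum_congr rfl fun i _ => ?_
    rw [← pd_slice ((h1 i).differentiable (by norm_num) _)]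
    refine pd_congr (Eventually.of_forall fun y => ?_)
    exact pd_slice (hP.differentiable (by norm_num) _) i
  simp_rw [h2]
  refine continuous_finsetSum _ fun i _ => ?_
  exact ((h1 i).continuous_fderiv (by norm_num)).clm_apply continuous_const

lemma weak_of_smooth (hP : ContDiff ℝ 2 P) (t0 t1 : ℝ) :
    Weak univ t0 t1 (fun x t => P (x, t))
      (fun x t => fderiv ℝ P (x, t) (0, 1) - lap (fun y => P (y, t)) x) := by
  have hD : Continuous fun z : Eu n × ℝ => fderiv ℝ P (z.1, z.2) (0, 1) :=
    (hP.continuous_fderiv (by norm_num)).clm_apply continuous_const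
  refine Weak.of_classical (P := fun x t => P (x, t)) (D := fun x t => fderiv ℝ P (x, t) (0, 1)) hP.continuous hD
    (hD.sub (continuous_lap_slice hP)) (fun t => hP.comp (contDiff_id.prodMk contDiff_const))
    (fun x t => ?_) (fun x t => by ring) t0 t1
  have h := ((hP.differentiable (by norm_num) (x, t)).hasFDerivAt.comp t
    (hasFDerivAt_prodMk_right x t)).hasDerivAt
  refine HasDerivAt.congr_deriv (f := fun t => P (x, t)) h ?_
  simp
end slices

lemma Bar.isBounded_source (hB : Bar Ω lam f) {g : Eu n × ℝ → ℝ} (hg : Continuous g) :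
    ∃ C, ∀ x ∈ Ω, ∀ t ∈ Icc 0 T, |g (x, t)| ≤ C := by
  obtain ⟨C, hC⟩ := (hB.bdd.isCompact_closure.prod (isCompact_Icc (a := 0) (b := T))).bddAbove_image
    hg.abs.continuousOn
  exact ⟨C, fun x hx t ht => hC ⟨(x, t), ⟨subset_closure hx, ht⟩, rfl⟩⟩

/-- Solvability of the heat equation with bounded source and smooth boundary data. -/
lemma Bar.exists_smooth_data (hB : Bar Ω lam f) (hT : 0 ≤ T) (hF : JC F Ω (Icc 0 T))
    (hFM : ∀ x ∈ Ω, ∀ t ∈ Icc 0 T, |F x t| ≤ M) {P : Eu n × ℝ → ℝ} (hP : ContDiff ℝ 2 P) :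
    ∃ v : Eu n → ℝ → ℝ, JC v univ (Icc 0 T) ∧ (∀ z ∈ PB Ω 0 T, v z.1 z.2 = P z) ∧
      Weak Ω 0 T v F := by
  have hPw := weak_of_smooth hP 0 T
  obtain ⟨C, hC⟩ := hB.isBounded_source (T := T)
    (g := fun z => fderiv ℝ P z (0, 1) - lap (fun y => P (y, z.2)) z.1)
    (((hP.continuous_fderiv (by norm_num)).clm_apply continuous_const).sub
      (continuous_lap_slice hP))
  obtain ⟨w, hwc, hw0, hwb, hww⟩ := hB.exists_zero_data hT
    (F := fun x t => F x t - (fderiv ℝ P (x, t) (0, 1) - lap (fun y => P (y, t)) x)) (M := M + C)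
    (hF.sub (hPw.cf.mono (by simp) le_rfl))
    (fun x hx t ht => (abs_sub _ _).trans (add_le_add (hFM x hx t ht) (hC x hx t ht)))
  refine ⟨fun x t => P (x, t) + w x t, hP.continuous.continuousOn.add hwc, fun z hz => ?_, ?_⟩
  · have : w z.1 z.2 = 0 := by
      rcases hz.2.2 with h | h
      · rw [h, hw0]
      · exact hwb _ (by rw [hB.op.frontier_eq] at h; exact h.2) _ hz.2.1
    simp [this]
  · exact ((hPw.mono (subset_univ _) le_rfl le_rfl).add hB.op hww).congr (fun _ _ _ _ => rfl)
      fun x _ t _ => by ring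

lemma Bar.exists_data_zero (hB : Bar Ω lam f) (hT : 0 ≤ T) (hF : JC F Ω (Icc 0 T))
    (hFM : ∀ x ∈ Ω, ∀ t ∈ Icc 0 T, |F x t| ≤ M) {G : Eu n → ℝ → ℝ}
    (hG : ContinuousOn (fun z : Eu n × ℝ => G z.1 z.2) (PB Ω 0 T)) :
    ∃ v : Eu n → ℝ → ℝ, JC v (closure Ω) (Icc 0 T) ∧ (∀ z ∈ PB Ω 0 T, v z.1 z.2 = G z.1 z.2) ∧
      Weak Ω 0 T v F := by
  obtain ⟨g, hg⟩ := ContinuousMap.exists_restrict_eq (isClosed_PB Ω 0 T)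
    ⟨_, hG.domRestrict⟩
  have hgG : ∀ z ∈ PB Ω 0 T, g z = G z.1 z.2 := fun z hz =>
    congrArg (fun h : C(PB Ω 0 T, ℝ) => h ⟨z, hz⟩) hg
  have hap : ∀ ε > 0, ∃ P : Eu n × ℝ → ℝ, ContDiff ℝ 2 P ∧ ∀ z, |P z - g z| ≤ ε := by
    intro ε hε
    obtain ⟨P, hP, hd, -⟩ := g.continuous.exists_contDiff_approx 2 (ε := fun _ => ε)
      continuous_const (fun _ => hε)
    exact ⟨P, by exact_mod_cast hP, fun z => by rw [← Real.dist_eq]; exact (hd z).le⟩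
  choose! P hP hPg using hap
  choose! W hWc hWb hWw using fun (ε : ℝ) (hε : 0 < ε) => hB.exists_smooth_data hT hF hFM (hP ε hε)
  have hcmp : ∀ ε > 0, ∀ ε' > 0, ∀ x ∈ closure Ω, ∀ t ∈ Icc 0 T,
      |W ε x t - W ε' x t| ≤ ε + ε' := by
    intro ε hε ε' hε'
    have hpb : ∀ z ∈ PB Ω 0 T, |W ε z.1 z.2 - W ε' z.1 z.2| ≤ ε + ε' := by
      intro z hz
      rw [hWb ε hε z hz, hWb ε' hε' z hz]
      have h1 := hPg ε hε z
      have h2 := hPg ε' hε' z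
      have h3 := abs_sub (P ε z - g z) (P ε' z - g z)
      rw [sub_sub_sub_cancel_right] at h3
      linarith
    have := Weak.abs_le_of_bdry hB.op hB.bdd (c := ε + ε') (m := 0)
      (d := fun x t => W ε x t - W ε' x t) (g := fun x t => F x t - F x t) (t0 := 0) (t1 := T)
      ((hWw ε hε).sub hB.op (hWw ε' hε'))
      (((hWc ε hε).sub (hWc ε' hε')).mono (prod_mono (subset_univ _) le_rfl))
      (fun x _ t _ => by simp) le_rfl
      (fun x hx => hpb (x, 0) ⟨hx, ⟨le_rfl, hT⟩, Or.inl rfl⟩)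
      (fun x hx t ht => hpb (x, t) ⟨frontier_subset_closure hx, ht, Or.inr hx⟩)
    intro x hx t ht
    simpa using this x hx t ht
  obtain ⟨w, hw⟩ := exists_unif_limit (S := closure Ω ×ˢ Icc 0 T)
    (W := fun ε z => W ε z.1 z.2) (fun θ hθ => ⟨θ / 2, half_pos hθ, fun ε hε ε' hε' z hz =>
      (hcmp ε hε.1 ε' hε'.1 z.1 hz.1 z.2 hz.2).trans (by linarith [hε.2, hε'.2])⟩)
  have hex : ∀ θ > 0, ∃ ε > 0, ε ≤ θ ∧ ∀ z ∈ closure Ω ×ˢ Icc 0 T, |W ε z.1 z.2 - w z| ≤ θ := by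
    intro θ hθ
    obtain ⟨ε0, h0, h⟩ := hw θ hθ
    exact ⟨min ε0 θ, lt_min h0 hθ, min_le_right _ _, fun z hz =>
      h _ ⟨lt_min h0 hθ, min_le_left _ _⟩ z hz⟩
  have hjc : JC (fun x t => w (x, t)) (closure Ω) (Icc 0 T) := by
    refine continuousOn_of_unif_approx fun θ hθ => ?_
    obtain ⟨ε, hε, -, h⟩ := hex θ hθ
    exact ⟨fun z => W ε z.1 z.2, JC.mono (hWc ε hε) (subset_univ _) le_rfl, h⟩
  refine ⟨fun x t => w (x, t), hjc, fun z hz => ?_, ?_⟩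
  · refine sub_eq_zero.1 (abs_eq_zero.1
      (le_antisymm (le_of_forall_pos_le_add fun θ hθ => ?_) (abs_nonneg _)))
    obtain ⟨ε, hε, hεθ, h⟩ := hex (θ / 2) (half_pos hθ)
    have h1 := h z ⟨hz.1, hz.2.1⟩
    have h2 := hPg ε hε z
    rw [hWb ε hε z hz] at h1
    rw [hgG z hz] at h2
    have h3 := abs_sub (P ε z - G z.1 z.2) (P ε z - w z)
    rw [sub_sub_sub_cancel_left] at h3
    linarith
  · refine Weak.of_approx hB.op (hjc.mono subset_closure le_rfl) hF fun K hKO _ θ hθ => ?_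
    obtain ⟨ε, hε, -, h⟩ := hex θ hθ
    refine ⟨Ω, W ε, F, hB.op, hKO, hWw ε hε, fun x hx t ht => ⟨?_, by simpa using hθ.le⟩⟩
    rw [abs_sub_comm]; exact h (x, t) ⟨subset_closure (hKO hx), ht⟩

/-- Solvability of the first boundary value problem for the heat equation with bounded source. -/
lemma Bar.exists_data (hB : Bar Ω lam f) (hT : t0 ≤ t1) (hF : JC F Ω (Icc t0 t1))
    (hFM : ∀ x ∈ Ω, ∀ t ∈ Icc t0 t1, |F x t| ≤ M) {G : Eu n → ℝ → ℝ}
    (hG : ContinuousOn (fun z : Eu n × ℝ => G z.1 z.2) (PB Ω t0 t1)) :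
    ∃ v : Eu n → ℝ → ℝ, JC v (closure Ω) (Icc t0 t1) ∧
      (∀ z ∈ PB Ω t0 t1, v z.1 z.2 = G z.1 z.2) ∧ Weak Ω t0 t1 v F := by
  have hmem : ∀ t ∈ Icc 0 (t1 - t0), t + t0 ∈ Icc t0 t1 := fun t ht =>
    ⟨by linarith [ht.1], by linarith [ht.2]⟩
  have hmem' : ∀ t ∈ Icc t0 t1, t - t0 ∈ Icc 0 (t1 - t0) := fun t ht =>
    ⟨by linarith [ht.1], by linarith [ht.2]⟩
  have hsh : Continuous fun z : Eu n × ℝ => (z.1, z.2 + t0) := by fun_prop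
  have hsh' : Continuous fun z : Eu n × ℝ => (z.1, z.2 - t0) := by fun_prop
  obtain ⟨v, hvc, hvb, hvw⟩ := hB.exists_data_zero (sub_nonneg.2 hT) (F := fun x t => F x (t + t0))
    (M := M) (ContinuousOn.comp (g := fun z : Eu n × ℝ => F z.1 z.2) hF hsh.continuousOn
      fun z hz => ⟨hz.1, hmem _ hz.2⟩) (fun x hx t ht => hFM x hx _ (hmem t ht))
    (G := fun x t => G x (t + t0))
    (ContinuousOn.comp (g := fun z : Eu n × ℝ => G z.1 z.2) hG hsh.continuousOn
      fun z hz => ⟨hz.1, hmem _ hz.2.1, hz.2.2.imp (fun h => by simp [h]) id⟩)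
  refine ⟨fun x t => v x (t - t0), ?_, fun z hz => ?_, ?_⟩
  · exact ContinuousOn.comp (g := fun z : Eu n × ℝ => v z.1 z.2) hvc hsh'.continuousOn
      fun z hz => ⟨hz.1, hmem' _ hz.2⟩
  · have := hvb (z.1, z.2 - t0) ⟨hz.1, hmem' _ hz.2.1, hz.2.2.imp (fun h => by simp [h]) id⟩
    simpa using this
  · have := hvw.shift t0
    rw [zero_add, sub_add_cancel] at this
    exact this.congr (fun _ _ _ _ => rfl) fun x _ t _ => by simp

/-- At the point `(x, t)`, the function `f` satisfies `∂ₜ f = Δ f + h` classically. -/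
structure HeatAt (f : Eu n → ℝ → ℝ) (h : ℝ) (x : Eu n) (t : ℝ) : Prop where
  c2 : ContDiffAt ℝ 2 (fun y => f y t) x
  der : HasDerivAt (f x) (lap (fun y => f y t) x + h) t

lemma HeatAt.congr_source {f : Eu n → ℝ → ℝ} {h k : ℝ} (hf : HeatAt f h x t) (hk : h = k) :
    HeatAt f k x t := hk ▸ hf

lemma HeatAt.add {f g : Eu n → ℝ → ℝ} {h k : ℝ} (hf : HeatAt f h x t) (hg : HeatAt g k x t) :
    HeatAt (fun y s => f y s + g y s) (h + k) x t := by
  refine ⟨hf.c2.add hg.c2, (hf.der.add hg.der).congr_deriv ?_⟩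
  rw [lap_add hf.c2 hg.c2]; ring

lemma HeatAt.mul {f g : Eu n → ℝ → ℝ} {h k : ℝ} (hf : HeatAt f h x t) (hg : HeatAt g k x t) :
    HeatAt (fun y s => f y s * g y s)
      (f x t * k + h * g x t - 2 * ∑ j, pd j (fun y => f y t) x * pd j (fun y => g y t) x) x t := by
  refine ⟨hf.c2.mul hg.c2, (hf.der.mul hg.der).congr_deriv ?_⟩
  rw [lap_mul hf.c2 hg.c2]; ring

lemma heatAt_const (c : ℝ) (x : Eu n) (t : ℝ) : HeatAt (fun _ _ => c) 0 x t :=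
  ⟨contDiffAt_const, (hasDerivAt_const t c).congr_deriv (by rw [lap_const, add_zero])⟩

lemma HeatAt.sum {ι : Type*} (s : Finset ι) {f : ι → Eu n → ℝ → ℝ} {h : ι → ℝ}
    (hf : ∀ i ∈ s, HeatAt (f i) (h i) x t) :
    HeatAt (fun y r => ∑ i ∈ s, f i y r) (∑ i ∈ s, h i) x t := by
  classical
  induction s using Finset.induction_on with
  | empty => simpa using heatAt_const 0 x t
  | insert a s ha ih =>
    simp only [Finset.sum_insert ha]
    exact (hf a (Finset.mem_insert_self _ _)).add
      (ih fun i hi => hf i (Finset.mem_insert_of_mem hi))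

lemma heatAt_time (t0 : ℝ) (x : Eu n) (t : ℝ) : HeatAt (fun _ s => s - t0) 1 x t :=
  ⟨contDiffAt_const, ((hasDerivAt_id t).sub_const t0).congr_deriv (by rw [lap_const, zero_add])⟩

lemma heatAt_bump (c : ℝ) (x0 x : Eu n) (t : ℝ) :
    HeatAt (fun y _ => c - ‖y - x0‖ ^ 2) (2 * n) x t := by
  have h1 : ContDiffAt ℝ 2 (fun y : Eu n => ‖y - x0‖ ^ 2) x := (contDiff_normSq x0).contDiffAt
  refine ⟨contDiffAt_const.sub h1, (hasDerivAt_const t _).congr_deriv ?_⟩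
  rw [lap_sub contDiffAt_const h1, lap_const, lap_normSq]; ring

lemma pd_bump (c : ℝ) (x0 x : Eu n) (j : Fin n) :
    pd j (fun y => c - ‖y - x0‖ ^ 2) x = -2 * (x j - x0 j) := by
  have h1 : ContDiff ℝ 2 (fun y : Eu n => ‖y - x0‖ ^ 2) := contDiff_normSq x0
  have : (fun y : Eu n => c - ‖y - x0‖ ^ 2) = fun y => c + (-1) * ‖y - x0‖ ^ 2 := by
    funext y; ring
  have hd : DifferentiableAt ℝ (fun y : Eu n => ‖y - x0‖ ^ 2) x :=
    (h1.differentiable (by norm_num)).differentiableAt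
  rw [this, pd_add (differentiableAt_const c) (hd.const_mul _), pd_const,
    pd_mul (differentiableAt_const _) hd, pd_const, pd_normSq]
  ring

/-- Interior gradient bound for caloric functions. -/
lemma grad_bound_of_caloric (hρ : 0 < ρ) (h01 : t0 < t1) {w : Eu n → ℝ → ℝ}
    {g : Fin n → Eu n → ℝ → ℝ} (hwc : JC w (closedBall x0 ρ) (Icc t0 t1))
    (hgc : ∀ i, JC (g i) (closedBall x0 ρ) (Icc t0 t1))
    (hw : ∀ x ∈ ball x0 ρ, ∀ t ∈ Ioo t0 t1, HeatAt w 0 x t)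
    (hg : ∀ i, ∀ x ∈ ball x0 ρ, ∀ t ∈ Ioo t0 t1, HeatAt (g i) 0 x t)
    (hpd : ∀ i, ∀ x ∈ ball x0 ρ, ∀ t ∈ Ioo t0 t1, pd i (fun y => w y t) x = g i x t)
    (hB : ∀ x ∈ closedBall x0 ρ, ∀ t ∈ Icc t0 t1, |w x t| ≤ B) (i : Fin n) :
    g i x0 t1 ^ 2 ≤ (1 / (2 * (t1 - t0)) + (12 + 2 * n) / ρ ^ 2) * B ^ 2 := by
  set τ := t1 - t0 with hτ
  have hτ0 : 0 < τ := sub_pos.2 h01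
  set K : ℝ := (ρ ^ 4 + τ * (24 + 4 * n) * ρ ^ 2) / 2 with hK
  have hK0 : 0 ≤ K := by positivity
  set ζ : Eu n → ℝ → ℝ := fun y _ => ρ ^ 2 - ‖y - x0‖ ^ 2 with hζ
  have hcl : closure (ball x0 ρ) = closedBall x0 ρ := closure_ball x0 hρ.ne'
  have hB2 : ∀ x ∈ closedBall x0 ρ, ∀ t ∈ Icc t0 t1, w x t * w x t ≤ B ^ 2 := by
    intro x hx t ht
    rw [← pow_two]
    exact sq_le_sq' (neg_le_of_abs_le (hB x hx t ht)) (le_of_abs_le (hB x hx t ht))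
  set F : Fin n → Eu n → ℝ → ℝ := fun i y s => (s - t0) * ((ζ y s * ζ y s) * (g i y s * g i y s))
  have hζc : JC ζ (closedBall x0 ρ) (Icc t0 t1) :=
    Continuous.continuousOn (by simp only [hζ]; fun_prop)
  have hFc : ∀ i, JC (F i) (closedBall x0 ρ) (Icc t0 t1) := fun i =>
    ContinuousOn.mul (Continuous.continuousOn (by fun_prop))
      ((ContinuousOn.mul hζc hζc).mul (ContinuousOn.mul (hgc i) (hgc i)))
  set v : Eu n → ℝ → ℝ := fun y s => ∑ i, F i y s + (K * (w y s * w y s) + (-K) * B ^ 2)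
  have hvc : JC v (closedBall x0 ρ) (Icc t0 t1) := by
    refine ContinuousOn.add (continuousOn_finsetSum _ fun i _ => hFc i)
      (ContinuousOn.add (continuousOn_const.mul (ContinuousOn.mul hwc hwc)) continuousOn_const)
  have hheat : ∀ x ∈ ball x0 ρ, ∀ t ∈ Ioo t0 t1, ∃ h ≤ 0, HeatAt v h x t := by
    intro x hx t ht
    have hz := heatAt_bump (ρ ^ 2) x0 x t
    have hzz := hz.mul hz
    have hFi := fun i => (heatAt_time t0 x t).mul (hzz.mul ((hg i x hx t ht).mul (hg i x hx t ht)))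
    have hW := ((heatAt_const K x t).mul ((hw x hx t ht).mul (hw x hx t ht))).add
      (heatAt_const ((-K) * B ^ 2) x t)
    refine ⟨_, ?_, (HeatAt.sum Finset.univ fun i _ => hFi i).add hW⟩
    have hgd : ∀ i, DifferentiableAt ℝ (fun y => g i y t) x := fun i =>
      (hg i x hx t ht).c2.differentiableAt (by norm_num)
    have hzd : DifferentiableAt ℝ (fun y : Eu n => ρ ^ 2 - ‖y - x0‖ ^ 2) x :=
      hz.c2.differentiableAt (by norm_num)
    simp only [pd_const, pd_mul hzd hzd, pd_mul (hgd _) (hgd _), pd_bump, hpd _ x hx t ht,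
      zero_mul, mul_zero, Finset.sum_const_zero, sub_zero, add_zero, one_mul, zero_sub]
    set Z : ℝ := ρ ^ 2 - ‖x - x0‖ ^ 2 with hZ
    have hN := norm_sub_sq_eq_sum x x0
    have hxn : ‖x - x0‖ < ρ := by rwa [mem_ball, dist_eq_norm] at hx
    have hZ0 : 0 ≤ Z := by
      rw [hZ, sub_nonneg]; gcongr
    have hZρ : Z ≤ ρ ^ 2 := by rw [hZ]; linarith [sq_nonneg ‖x - x0‖]
    have hs0 : 0 ≤ t - t0 := by linarith [ht.1]
    have hsτ : t - t0 ≤ τ := by rw [hτ]; linarith [ht.2]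
    have key : ∀ i, (t - t0) * (Z * Z * -(2 * ∑ j, pd j (fun y => g i y t) x
          * pd j (fun y => g i y t) x)
        + (Z * (2 * n) + 2 * n * Z
            - 2 * ∑ j, -2 * (x j - x0 j) * (-2 * (x j - x0 j))) * (g i x t * g i x t)
        - 2 * ∑ j, (Z * (-2 * (x j - x0 j)) + -2 * (x j - x0 j) * Z) *
          (g i x t * pd j (fun y => g i y t) x + pd j (fun y => g i y t) x * g i x t))
        + Z * Z * (g i x t * g i x t) ≤ 2 * K * (g i x t * g i x t) := by
      intro i
      set G := g i x t
      have e1 : (Z * Z * -(2 * ∑ j, pd j (fun y => g i y t) x * pd j (fun y => g i y t) x)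
        + (Z * (2 * n) + 2 * n * Z
            - 2 * ∑ j, -2 * (x j - x0 j) * (-2 * (x j - x0 j))) * (G * G)
        - 2 * ∑ j, (Z * (-2 * (x j - x0 j)) + -2 * (x j - x0 j) * Z) *
          (G * pd j (fun y => g i y t) x + pd j (fun y => g i y t) x * G))
          = -∑ j, 2 * (Z * pd j (fun y => g i y t) x - 4 * G * (x j - x0 j)) ^ 2
            + 4 * n * Z * (G * G) + 24 * (G * G) * ∑ j, (x j - x0 j) ^ 2 := by
        have e2 : ∀ S1 S2 S3 S4 S5 : ℝ, S2 = 4 * S4 → S5 = 2 * Z ^ 2 * S1 + 2 * S3 + 32 * G ^ 2 * S4 →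
            Z * Z * -(2 * S1) + (Z * (2 * n) + 2 * n * Z - 2 * S2) * (G * G) - 2 * S3
            = -S5 + 4 * n * Z * (G * G) + 24 * (G * G) * S4 := by
          intro S1 S2 S3 S4 S5 h1 h2
          rw [h1, h2]; ring
        apply e2
        · rw [Finset.mul_sum]; exact Finset.sum_congr rfl fun j _ => by ring
        · simp only [Finset.mul_sum, ← Finset.sum_add_distrib]
          exact Finset.sum_congr rfl fun j _ => by ring
      rw [e1, ← hN]
      have h5 : 0 ≤ ∑ j, 2 * (Z * pd j (fun y => g i y t) x - 4 * G * (x j - x0 j)) ^ 2 :=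
        Finset.sum_nonneg fun j _ => by positivity
      have h6 : ‖x - x0‖ ^ 2 ≤ ρ ^ 2 := by gcongr
      have hG : 0 ≤ G * G := mul_self_nonneg G
      calc _ ≤ (t - t0) * (0 + 4 * n * ρ ^ 2 * (G * G) + 24 * (G * G) * ρ ^ 2)
            + ρ ^ 2 * ρ ^ 2 * (G * G) := by
            gcongr
            linarith
        _ ≤ τ * (0 + 4 * n * ρ ^ 2 * (G * G) + 24 * (G * G) * ρ ^ 2)
            + ρ ^ 2 * ρ ^ 2 * (G * G) := by gcongr
        _ = _ := by rw [hK]; ring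
    have := Finset.sum_le_sum fun i (_ : i ∈ Finset.univ) => key i
    rw [← Finset.mul_sum] at this
    have e3 : K * -(2 * ∑ j, g j x t * g j x t) = -(2 * K * ∑ j, g j x t * g j x t) := by ring
    rw [e3]
    linarith
  choose! h hh0 hh using hheat
  have hfr : frontier (ball x0 ρ) = sphere x0 ρ := frontier_ball x0 hρ.ne'
  have hweak : Weak (ball x0 ρ) t0 t1 (fun _ _ => (0 : ℝ)) (fun _ _ => 0) :=
    ⟨continuousOn_const, continuousOn_const, fun ψ _ _ _ s _ t _ _ => by simp⟩
  have hcmp := comparison (v1 := v) (v2 := fun _ _ => 0) (h1 := h) (h2 := fun _ _ => 0)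
    isOpen_ball isBounded_ball (t0 := t0) (t1 := t1)
    (by simpa only [add_zero, hcl] using hvc) (fun x hx t ht => (hh x hx t ht).c2)
    (fun x hx t ht => (hh x hx t ht).der) hweak
    (fun x hx t ht _ => by simpa using hh0 x hx t ht)
    (fun x hx => by
      rw [hcl] at hx
      have : ∀ i, F i x t0 = 0 := fun i => by simp [F]
      simp only [v, this, Finset.sum_const_zero, zero_add, add_zero]
      nlinarith [hB2 x hx t0 ⟨le_rfl, h01.le⟩])
    (fun x hx t ht => by
      rw [hfr] at hx
      have hx' : ‖x - x0‖ = ρ := by rwa [mem_sphere_iff_norm] at hx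
      have : ∀ i, F i x t = 0 := fun i => by simp [F, hζ, hx']
      simp only [v, this, Finset.sum_const_zero, zero_add, add_zero]
      nlinarith [hB2 x (sphere_subset_closedBall hx) t ht])
    x0 (by rw [hcl]; exact mem_closedBall_self hρ.le) t1 ⟨h01.le, le_rfl⟩
  have h7 : F i x0 t1 ≤ ∑ j, F j x0 t1 :=
    Finset.single_le_sum (f := fun j => F j x0 t1) (fun j _ => mul_nonneg hτ0.le
      (mul_nonneg (mul_self_nonneg _) (mul_self_nonneg _))) (Finset.mem_univ i)
  have h8 : F i x0 t1 = τ * ρ ^ 4 * g i x0 t1 ^ 2 := by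
    simp only [F, hζ, sub_self, norm_zero]; ring
  have h9 : τ * ρ ^ 4 * g i x0 t1 ^ 2 ≤ K * B ^ 2 := by
    rw [← h8]
    have : 0 ≤ K * (w x0 t1 * w x0 t1) := mul_nonneg hK0 (mul_self_nonneg _)
    simp only [v] at hcmp
    linarith
  have h10 : K * B ^ 2 = τ * ρ ^ 4 * ((1 / (2 * τ) + (12 + 2 * n) / ρ ^ 2) * B ^ 2) := by
    rw [hK]; field_simp; ring
  rw [h10] at h9
  exact le_of_mul_le_mul_left h9 (by positivity)

lemma Weak.heatAt_mol (hU : IsOpen U) (h : Weak U t0 t1 u (fun _ _ => 0))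
    (hκc : ContDiff ℝ (⊤ : ℕ∞) κ) (hκ : tsupport κ ⊆ closedBall 0 ε) (hx : x ∈ inner' U ε)
    (ht : t ∈ Ioo t0 t1) : HeatAt (fun x t => mol κ (fun y => u y t) x) 0 x t := by
  have h2 : ContDiff ℝ 2 κ := hκc.of_le (WithTop.coe_le_coe.2 le_top)
  have hc : ContinuousOn (fun y => u y t) U := h.cu.slice (Ioo_subset_Icc_self ht)
  refine ⟨mol_contDiffAt (k := 2) hU hc h2 hκ hx, ?_⟩
  refine (h.hasDerivAt_mol hU h2 hκ hx ht).congr_deriv ?_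
  rw [lap_mol hU hc h2 hκ hx]
  simp [mol]

/-- The constant in the interior gradient bound for caloric functions. -/
def gradC (n : ℕ) (τ ρ : ℝ) : ℝ := √(1 / (2 * τ) + (12 + 2 * n) / ρ ^ 2)

lemma gradC_nonneg (n : ℕ) (τ ρ : ℝ) : 0 ≤ gradC n τ ρ := Real.sqrt_nonneg _

lemma contDiff_top_pd (hκc : ContDiff ℝ (⊤ : ℕ∞) κ) (i : Fin n) :
    ContDiff ℝ (⊤ : ℕ∞) (pd i κ) := ContDiff.pd hκc (by simp)

lemma Weak.abs_mol_pd_le (hU : IsOpen U) (h : Weak U t0 t1 u (fun _ _ => 0))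
    (hκc : ContDiff ℝ (⊤ : ℕ∞) κ) (hκ : tsupport κ ⊆ closedBall 0 ε) (hρ : 0 < ρ) (hτ : 0 < τ)
    (hx : closedBall x0 ρ ⊆ inner' U ε) (ht : t ∈ Icc (t0 + τ) t1)
    (hB : ∀ x ∈ closedBall x0 ρ, ∀ s ∈ Icc (t - τ) t, |mol κ (fun y => u y s) x| ≤ B) (i : Fin n) :
    |mol (pd i κ) (fun y => u y t) x0| ≤ gradC n τ ρ * B := by
  have h' : Weak U (t - τ) t u (fun _ _ => 0) :=
    h.mono subset_rfl (by linarith [ht.1]) ht.2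
  have hs : ∀ i, tsupport (pd i κ) ⊆ closedBall 0 ε :=
    fun i => (tsupport_pd_subset i κ).trans hκ
  have hB0 : 0 ≤ B := (abs_nonneg _).trans
    (hB x0 (mem_closedBall_self hρ.le) t ⟨by linarith, le_rfl⟩)
  have hb := grad_bound_of_caloric (t0 := t - τ) (t1 := t) hρ (by linarith)
    (w := fun x t => mol κ (fun y => u y t) x)
    (g := fun i x t => mol (pd i κ) (fun y => u y t) x)
    ((jc_mol hU h'.cu hκc.continuous hκ).mono hx le_rfl)
    (fun i => (jc_mol hU h'.cu (contDiff_top_pd hκc i).continuous (hs i)).mono hx le_rfl)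
    (fun x hx' s hs' => h'.heatAt_mol hU hκc hκ (hx (ball_subset_closedBall hx')) hs')
    (fun i x hx' s hs' => h'.heatAt_mol hU (contDiff_top_pd hκc i) (hs i)
      (hx (ball_subset_closedBall hx')) hs')
    (fun i x hx' s hs' => pd_mol hU (h'.cu.slice (Ioo_subset_Icc_self hs'))
      (hκc.of_le (WithTop.coe_le_coe.2 le_top)) hκ (hx (ball_subset_closedBall hx')) i)
    hB i
  rw [sub_sub_cancel] at hb
  refine abs_le_of_sq_le_sq ?_ (mul_nonneg (gradC_nonneg _ _ _) hB0)
  rwa [mul_pow, gradC, Real.sq_sqrt (by positivity)]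

lemma Weak.abs_mol_pd_pd_le (hU : IsOpen U) (h : Weak U t0 t1 u (fun _ _ => 0))
    (hκc : ContDiff ℝ (⊤ : ℕ∞) κ) (hκ : tsupport κ ⊆ closedBall 0 ε) (hρ : 0 < ρ) (hτ : 0 < τ)
    (hx : closedBall x0 (ρ + ρ) ⊆ inner' U ε) (ht : t ∈ Icc (t0 + (τ + τ)) t1)
    (hB : ∀ x ∈ closedBall x0 (ρ + ρ), ∀ s ∈ Icc t0 t1,
      |mol κ (fun y => u y s) x| ≤ B) (i j : Fin n) :
    |mol (pd j (pd i κ)) (fun y => u y t) x0| ≤ gradC n τ ρ * (gradC n τ ρ * B) := by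
  refine h.abs_mol_pd_le hU (contDiff_top_pd hκc i) ((tsupport_pd_subset i κ).trans hκ) hρ hτ
    ((closedBall_subset_closedBall (by linarith)).trans hx) ⟨by linarith [ht.1], ht.2⟩ ?_ j
  intro x hx' s hs
  have hsub : closedBall x ρ ⊆ closedBall x0 (ρ + ρ) :=
    closedBall_subset_closedBall' (by rw [mem_closedBall] at hx'; linarith)
  refine h.abs_mol_pd_le hU hκc hκ hρ hτ (hsub.trans hx)
    ⟨by linarith [ht.1, hs.1], hs.2.trans ht.2⟩ (fun y hy r hr => hB y (hsub hy) r ?_) i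
  exact ⟨by linarith [hr.1, hs.1, ht.1], hr.2.trans (hs.2.trans ht.2)⟩

lemma abs_mol_le_of_bdd (hκc : Continuous κ) (hκ : tsupport κ ⊆ closedBall 0 ε)
    (hw : ∀ y, |w y| ≤ M) (x : Eu n) :
    |mol κ w x| ≤ M * ∫ z, |κ z| := by
  have := abs_integral_mul_le (w := w) (θ := fun y => κ (x - y)) (by fun_prop)
    (hasCompactSupport_reflect hκ x) fun y _ => hw y
  rwa [integral_sub_left_eq_self (fun z => |κ z|) volume x] at this

lemma mol_heatS (hg : Continuous g) (hM : ∀ x, |g x| ≤ M) (hκc : Continuous κ)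
    (hκ : tsupport κ ⊆ closedBall 0 ε) (σ : ℝ) (x : Eu n) :
    mol κ (heatS σ g) x = heatS σ (mol κ g) x := by
  have hs := hasCompactSupport_reflect hκ x
  unfold mol heatS
  simp_rw [← integral_mul_const]
  rw [integral_integral_swap]
  · refine integral_congr_ae (Eventually.of_forall fun z => ?_)
    simp only
    rw [← integral_add_right_eq_self (fun y => g y * κ (x + √(2 * σ) • z - y)) (√(2 * σ) • z)]
    simp
  · have : Integrable (fun q : Eu n × Eu n => κ (x - q.1) * (1 : ℝ))
        ((volume : Measure (Eu n)).prod (gam n)) :=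
      ((by fun_prop : Continuous fun y => κ (x - y)).integrable_of_hasCompactSupport hs).mul_prod
        (integrable_const 1)
    refine (this.norm.const_mul M).mono' ?_ (Eventually.of_forall fun q => ?_)
    · refine Continuous.aestronglyMeasurable ?_
      fun_prop
    · simp only [Function.uncurry, norm_mul, mul_one]
      gcongr
      exact hM _

lemma mol_Pot (hc : Continuous fun z : Eu n × ℝ => h z.1 z.2) (hM : ∀ x t, |h x t| ≤ M)
    (hκc : Continuous κ) (hκ : tsupport κ ⊆ closedBall 0 ε) (ht : 0 ≤ t) (x : Eu n) :
    mol κ (fun y => Pot h y t) x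
      = ∫ s in (0)..t, heatS s (mol κ fun y => h y (t - s)) x := by
  unfold mol
  rw [Pot_swap hc hM (θ := fun y => κ (x - y)) (by fun_prop) (hasCompactSupport_reflect hκ x) ht]
  have h1 := intervalIntegral.integral_comp_sub_left
    (f := fun s => ∫ y, heatS s (fun y => h y (t - s)) y * κ (x - y)) (a := 0) (b := t) t
  simp only [sub_self, sub_zero, sub_sub_cancel] at h1
  rw [h1]
  refine intervalIntegral.integral_congr fun s _ => ?_
  exact mol_heatS (continuous_slice hc _) (fun x => hM x _) hκc hκ s x

/-- A moment of the Gaussian measure. -/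
def momC (n : ℕ) : ℝ := ∫ z : Eu n, (1 + ‖z‖ ^ 2) ^ 2 ∂(gam n)

lemma momC_nonneg (n : ℕ) : 0 ≤ momC n := integral_nonneg fun z => by positivity

lemma abs_integral_gam_le_mom (h : ∀ z, |G z| ≤ C * (1 + ‖z‖ ^ 2) ^ 2) :
    |∫ z, G z ∂(gam n)| ≤ C * momC n := by
  rw [momC, ← integral_const_mul]
  rw [← Real.norm_eq_abs]
  exact norm_integral_le_of_norm_le (gam_moment.const_mul C) (Eventually.of_forall h)

lemma abs_integral_pd_affine_le (hG : ContDiff ℝ 1 G) (i : Fin n) (h0 : ∀ z, |G z| ≤ A)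
    (h1 : ∀ z, |pd i G z| ≤ C) (x : Eu n) (hr : 0 < r) :
    |∫ z, pd i G (x + r • z) ∂(gam n)| ≤ r⁻¹ * (A * momC n) := by
  have hA : 0 ≤ A := (abs_nonneg _).trans (h0 0)
  have h := gam_ibp_affine hG (C := max A C) i (fun z => (h0 z).trans (le_max_left _ _))
    (fun z => (h1 z).trans (le_max_right _ _)) x r
  have h2 : ∫ z, pd i G (x + r • z) ∂(gam n) = r⁻¹ * ∫ z, z i * G (x + r • z) ∂(gam n) := by
    rw [h]; field_simp
  rw [h2, abs_mul, abs_of_pos (inv_pos.2 hr)]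
  gcongr
  refine abs_integral_gam_le_mom fun z => ?_
  rw [abs_mul, mul_comm]
  have h3 := abs_coord_le z i
  refine mul_le_mul (h0 _) (h3.trans ?_) (abs_nonneg _) hA
  nlinarith [sq_nonneg (‖z‖ - 1), sq_nonneg (‖z‖ ^ 2), norm_nonneg z]

lemma integral_pd_pd_affine (hG : ContDiff ℝ 2 G) (i j : Fin n) (h0 : ∀ z, |G z| ≤ C)
    (h1 : ∀ z, |pd i G z| ≤ C) (h2 : ∀ z, |pd j (pd i G) z| ≤ C) (x : Eu n) (hr : 0 < r) :
    ∫ z, pd j (pd i G) (x + r • z) ∂(gam n) = (r ^ 2)⁻¹ *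
      ∫ z, (z i * z j - if i = j then 1 else 0) * G (x + r • z) ∂(gam n) := by
  have hC : 0 ≤ C := (abs_nonneg _).trans (h0 0)
  have hG1 : ContDiff ℝ 1 G := hG.of_le (by norm_num)
  have hp1 : ContDiff ℝ 1 (pd i G) := ContDiff.pd hG (by norm_num)
  have e1 := gam_ibp_affine hp1 j h1 h2 x r
  have hdG : Differentiable ℝ G := hG.differentiable (by norm_num)
  have hpa : ∀ z, pd i (fun z => G (x + r • z)) z = r * pd i G (x + r • z) := fun z =>
    pd_affine (hdG _) i
  have hcj : ContDiff ℝ 1 fun z : Eu n => z j := by fun_prop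
  have hpj : ∀ z : Eu n, pd i (fun z : Eu n => z j) z = if i = j then 1 else 0 := by
    intro z
    simpa only [sub_zero] using pd_coord_sub i j 0 z
  have hca : ContDiff ℝ 1 fun z : Eu n => G (x + r • z) := by fun_prop
  have hprod : ∀ z, pd i (fun z : Eu n => z j * G (x + r • z)) z
      = z j * (r * pd i G (x + r • z)) + (if i = j then 1 else 0) * G (x + r • z) := fun z => by
    rw [pd_mul (hcj.differentiable (by norm_num) z) (hca.differentiable (by norm_num) z), hpa, hpj]
  have hδ : |(if i = j then (1 : ℝ) else 0)| ≤ 1 := by split_ifs <;> simp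
  have hz : ∀ z : Eu n, |z j| ≤ 1 + ‖z‖ := fun z => (abs_coord_le z j).trans (by linarith)
  have hone : ∀ z : Eu n, 1 ≤ 1 + ‖z‖ := fun z => by linarith [norm_nonneg z]
  have e2 := gam_ibp (G := fun z => z j * G (x + r • z)) (C := r * C + C) (hcj.mul hca) i
    (fun z => by
      rw [abs_mul]
      calc |z j| * |G (x + r • z)| ≤ (1 + ‖z‖) * C :=
            mul_le_mul (hz z) (h0 _) (abs_nonneg _) (by positivity)
        _ ≤ _ := by nlinarith [mul_nonneg (mul_nonneg hr.le hC) (by positivity : 0 ≤ 1 + ‖z‖)])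
    (fun z => by
      rw [hprod]
      refine (abs_add_le _ _).trans ?_
      rw [abs_mul, abs_mul, abs_mul, abs_of_pos hr]
      calc |z j| * (r * |pd i G (x + r • z)|) + |if i = j then (1 : ℝ) else 0| * |G (x + r • z)|
          ≤ (1 + ‖z‖) * (r * C) + 1 * C := by
            gcongr
            exacts [hz z, h1 _, h0 _]
        _ ≤ _ := by nlinarith [norm_nonneg z])
  simp_rw [hprod] at e2
  have hb1 : ∀ z : Eu n, 1 + ‖z‖ ≤ 2 * (1 + ‖z‖ ^ 2) ^ 2 := fun z => by
    nlinarith [sq_nonneg (‖z‖ - 1), sq_nonneg (‖z‖ ^ 2), norm_nonneg z]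
  have i1 : Integrable (fun z : Eu n => z j * (r * pd i G (x + r • z))) (gam n) := by
    refine gam_integrable_of_le (C := 2 * (r * C))
      (hcj.continuous.mul (continuous_const.mul (hp1.continuous.comp (by fun_prop)))) fun z => ?_
    rw [abs_mul, abs_mul, abs_of_pos hr]
    calc |z j| * (r * |pd i G (x + r • z)|) ≤ (2 * (1 + ‖z‖ ^ 2) ^ 2) * (r * C) := by
          gcongr
          exacts [(hz z).trans (hb1 z), h1 _]
      _ = _ := by ring
  have i2 : Integrable (fun z : Eu n => (if i = j then (1 : ℝ) else 0) * G (x + r • z)) (gam n) :=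
    (gam_integrable_of_bdd hca.continuous fun z => h0 _).const_mul _
  have i3 : Integrable (fun z : Eu n => z i * (z j * G (x + r • z))) (gam n) := by
    refine gam_integrable_of_le (C := C)
      (Continuous.mul (by fun_prop) (hcj.continuous.mul hca.continuous)) fun z => ?_
    rw [abs_mul, abs_mul]
    calc |z i| * (|z j| * |G (x + r • z)|) ≤ ‖z‖ * (‖z‖ * C) := by
          gcongr
          exacts [abs_coord_le z i, abs_coord_le z j, h0 _]
      _ ≤ _ := by nlinarith [mul_nonneg hC (sq_nonneg (‖z‖)), mul_nonneg hC (sq_nonneg (‖z‖ ^ 2))]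
  rw [integral_add i1 i2] at e2
  have e3 : ∫ z, z j * (r * pd i G (x + r • z)) ∂(gam n)
      = r * ∫ z, z j * pd i G (x + r • z) ∂(gam n) := by
    rw [← integral_const_mul]
    exact integral_congr_ae (Eventually.of_forall fun z => by ring)
  have e4 : ∫ z, (z i * z j - if i = j then 1 else 0) * G (x + r • z) ∂(gam n)
      = ∫ z, z i * (z j * G (x + r • z)) ∂(gam n)
        - ∫ z, (if i = j then (1 : ℝ) else 0) * G (x + r • z) ∂(gam n) := by
    rw [← integral_sub i3 i2]
    exact integral_congr_ae (Eventually.of_forall fun z => by ring)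
  rw [e4, e2, e3, e1]
  field_simp
  ring

lemma abs_integral_pd_pd_affine_le (hG : ContDiff ℝ 2 G) (i j : Fin n) (hα : 0 < α) (hα1 : α ≤ 1)
    (h0 : ∀ z, |G z| ≤ A) (h1 : ∀ z, |pd i G z| ≤ C) (h2 : ∀ z, |pd j (pd i G) z| ≤ C)
    (hH : ∀ y z, |G y - G z| ≤ H * ‖y - z‖ ^ α) (x : Eu n) (hr : 0 < r) :
    |∫ z, pd j (pd i G) (x + r • z) ∂(gam n)|
      ≤ (r ^ 2)⁻¹ * (r ^ (α / 2) * √(2 * A * H) * momC n) := by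
  have hA : 0 ≤ A := (abs_nonneg _).trans (h0 0)
  have hpc : ∀ k, pd k (fun y => G y - G x) = pd k G := fun k => by
    funext y; simp only [pd, fderiv_sub_const]
  have hpd : pd i (fun y => G y - G x) = pd i G := hpc i
  have hC0 : 0 ≤ C := (abs_nonneg _).trans (h1 0)
  have key := integral_pd_pd_affine (G := fun y => G y - G x) (hG.sub contDiff_const)
    (C := 2 * A + C) i j
    (fun z => (abs_sub _ _).trans (by linarith [h0 z, h0 x]))
    (fun z => by rw [hpd]; linarith [h1 z])
    (fun z => by rw [hpd]; linarith [h2 z]) x hr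
  rw [hpd] at key
  rw [key, abs_mul, abs_of_pos (by positivity : 0 < (r ^ 2)⁻¹)]
  gcongr
  refine abs_integral_gam_le_mom fun z => ?_
  rw [abs_mul]
  set D := |G (x + r • z) - G x|
  have hD1 : D ≤ 2 * A := (abs_sub _ _).trans (by linarith [h0 (x + r • z), h0 x])
  have hD2 : D ≤ H * (r * ‖z‖) ^ α := by
    have := hH (x + r • z) x
    rwa [add_sub_cancel_left, norm_smul, Real.norm_of_nonneg hr.le] at this
  have hD0 : 0 ≤ D := abs_nonneg _
  have hrz : 0 ≤ r * ‖z‖ := by positivity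
  have hD3 : D ≤ √(2 * A * H) * (r * ‖z‖) ^ (α / 2) := by
    by_cases hH0 : 0 ≤ H
    · refine le_of_sq_le_sq ?_ (by positivity)
      rw [mul_pow, Real.sq_sqrt (by positivity), ← Real.rpow_natCast ((r * ‖z‖) ^ (α / 2)),
        ← Real.rpow_mul hrz]
      have : α / 2 * ((2 : ℕ) : ℝ) = α := by push_cast; ring
      rw [this, pow_two, mul_assoc]
      exact mul_le_mul hD1 hD2 hD0 (by positivity)
    · have : D ≤ 0 := hD2.trans (mul_nonpos_of_nonpos_of_nonneg (not_le.1 hH0).le (by positivity))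
      exact this.trans (by positivity)
  have hz1 : ‖z‖ ^ (α / 2) ≤ 1 + ‖z‖ ^ 2 := by
    rcases le_total ‖z‖ 1 with h | h
    · have := Real.rpow_le_one (norm_nonneg z) h (by positivity : 0 ≤ α / 2)
      nlinarith [sq_nonneg ‖z‖]
    · have : ‖z‖ ^ (α / 2) ≤ ‖z‖ ^ (1 : ℝ) := Real.rpow_le_rpow_of_exponent_le h (by linarith)
      rw [Real.rpow_one] at this
      nlinarith
  have hq : |z i * z j - if i = j then 1 else 0| ≤ 1 + ‖z‖ ^ 2 := by
    refine (abs_sub _ _).trans ?_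
    rw [abs_mul]
    have hδ : |(if i = j then (1 : ℝ) else 0)| ≤ 1 := by split_ifs <;> simp
    nlinarith [abs_coord_le z i, abs_coord_le z j, abs_nonneg (z i), abs_nonneg (z j),
      mul_le_mul (abs_coord_le z i) (abs_coord_le z j) (abs_nonneg _) (norm_nonneg z)]
  calc |z i * z j - if i = j then 1 else 0| * D
      ≤ (1 + ‖z‖ ^ 2) * (√(2 * A * H) * (r ^ (α / 2) * (1 + ‖z‖ ^ 2))) := by
        refine mul_le_mul hq (hD3.trans ?_) hD0 (by positivity)
        rw [Real.mul_rpow hr.le (norm_nonneg z)]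
        gcongr
    _ = _ := by ring

lemma abs_integral_le_rpow {F : ℝ → ℝ} {β : ℝ} (hβ : 0 < β) (ht : 0 ≤ t)
    (h : ∀ s ∈ Ioc 0 t, |F s| ≤ c * s ^ (β - 1)) :
    |∫ s in (0)..t, F s| ≤ c * (t ^ β / β) := by
  have h1 : ∫ s in (0)..t, c * s ^ (β - 1) = c * (t ^ β / β) := by
    rw [intervalIntegral.integral_const_mul, integral_rpow (Or.inl (by linarith))]
    rw [sub_add_cancel, Real.zero_rpow hβ.ne', sub_zero]
  rw [← h1, ← Real.norm_eq_abs]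
  exact intervalIntegral.norm_integral_le_of_norm_le ht
    (Eventually.of_forall fun s hs => h s hs)
    ((intervalIntegral.intervalIntegrable_rpow' (by linarith)).const_mul c)

lemma abs_mol_pd_Pot_le (hc : Continuous fun z : Eu n × ℝ => h z.1 z.2)
    (hM : ∀ x t, |h x t| ≤ M) (hκc : ContDiff ℝ (⊤ : ℕ∞) κ)
    (hκ : tsupport κ ⊆ closedBall 0 ε)
    (hA : ∀ y s, |mol κ (fun y => h y s) y| ≤ A) (ht : 0 ≤ t) (x : Eu n) (i : Fin n) :
    |mol (pd i κ) (fun y => Pot h y t) x| ≤ A * momC n * (t ^ (1 / 2 : ℝ) / (1 / 2)) := by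
  have hs := (tsupport_pd_subset i κ).trans hκ
  have hpc := (contDiff_top_pd hκc i).continuous
  rw [mol_Pot hc hM hpc hs ht]
  refine abs_integral_le_rpow (by norm_num) ht fun s hs' => ?_
  have hg := continuous_slice hc (t - s)
  have hin : ∀ x : Eu n, x ∈ inner' univ ε := fun x => subset_univ _
  have e : mol (pd i κ) (fun y => h y (t - s)) = pd i (mol κ fun y => h y (t - s)) := by
    ext y
    rw [pd_mol isOpen_univ hg.continuousOn (hκc.of_le (WithTop.coe_le_coe.2 le_top)) hκ (hin y)]
  have hr : 0 < √(2 * s) := Real.sqrt_pos.2 (by linarith [hs'.1])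
  rw [e]
  refine (abs_integral_pd_affine_le (contDiff_iff_contDiffAt.2 fun y => mol_contDiffAt (k := 1)
    isOpen_univ hg.continuousOn (hκc.of_le (WithTop.coe_le_coe.2 le_top)) hκ (hin y)) i
    (fun y => hA y _) (fun y => by
      rw [← e]; exact abs_mol_le_of_bdd hpc hs (fun y => hM y _) y) x hr).trans ?_
  have hA0 : 0 ≤ A := (abs_nonneg _).trans (hA 0 0)
  rw [mul_comm]
  refine mul_le_mul_of_nonneg_left ?_ (mul_nonneg hA0 (momC_nonneg n))
  rw [show (1 / 2 : ℝ) - 1 = -(1 / 2) by norm_num, Real.rpow_neg hs'.1.le, ← Real.sqrt_eq_rpow]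
  refine inv_anti₀ (Real.sqrt_pos.2 hs'.1) (Real.sqrt_le_sqrt (by linarith [hs'.1]))

lemma abs_mol_pd_pd_Pot_le (hc : Continuous fun z : Eu n × ℝ => h z.1 z.2)
    (hM : ∀ x t, |h x t| ≤ M) (hκc : ContDiff ℝ (⊤ : ℕ∞) κ) (hκ : tsupport κ ⊆ closedBall 0 ε)
    (hα : 0 < α) (hα1 : α ≤ 1) (hA : ∀ y s, |mol κ (fun y => h y s) y| ≤ A)
    (hH : ∀ y z s, |mol κ (fun y => h y s) y - mol κ (fun y => h y s) z| ≤ H * ‖y - z‖ ^ α)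
    (ht : 0 ≤ t) (x : Eu n) (i j : Fin n) :
    |mol (pd j (pd i κ)) (fun y => Pot h y t) x|
      ≤ √(2 * A * H) * momC n * (t ^ (α / 4) / (α / 4)) := by
  have hs1 := (tsupport_pd_subset i κ).trans hκ
  have hs := (tsupport_pd_subset j (pd i κ)).trans hs1
  have hpc1 := contDiff_top_pd hκc i
  have hpc := (contDiff_top_pd hpc1 j).continuous
  rw [mol_Pot hc hM hpc hs ht]
  refine abs_integral_le_rpow (by positivity) ht fun s hs' => ?_
  have hg := continuous_slice hc (t - s)
  have hin : ∀ x : Eu n, x ∈ inner' univ ε := fun x => subset_univ _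
  have e1 : mol (pd i κ) (fun y => h y (t - s)) = pd i (mol κ fun y => h y (t - s)) := by
    ext y
    rw [pd_mol isOpen_univ hg.continuousOn (hκc.of_le (WithTop.coe_le_coe.2 le_top)) hκ (hin y)]
  have e : mol (pd j (pd i κ)) (fun y => h y (t - s))
      = pd j (pd i (mol κ fun y => h y (t - s))) := by
    ext y
    rw [← e1, pd_mol isOpen_univ hg.continuousOn (hpc1.of_le (WithTop.coe_le_coe.2 le_top)) hs1
      (hin y)]
  have hs0 : 0 < s := hs'.1
  have hr : 0 < √(2 * s) := Real.sqrt_pos.2 (by linarith [hs'.1])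
  rw [e]
  have hA0 : 0 ≤ A := (abs_nonneg _).trans (hA 0 0)
  have hM0 : 0 ≤ M := (abs_nonneg _).trans (hM 0 0)
  refine (abs_integral_pd_pd_affine_le (C := (M * ∫ z, |pd i κ z|) + M * ∫ z, |pd j (pd i κ) z|)
    (contDiff_iff_contDiffAt.2 fun y => mol_contDiffAt (k := 2)
    isOpen_univ hg.continuousOn (hκc.of_le (WithTop.coe_le_coe.2 le_top)) hκ (hin y)) i j hα hα1
    (fun y => hA y _) (fun y => ?_) (fun y => ?_) (fun y z => hH y z _) x hr).trans ?_
  · rw [← e1]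
    have h1 := abs_mol_le_of_bdd hpc1.continuous hs1 (fun y => hM y (t - s)) y
    have h2 : 0 ≤ M * ∫ z, |pd j (pd i κ) z| :=
      mul_nonneg hM0 (integral_nonneg fun _ => abs_nonneg _)
    linarith
  · rw [← e]
    have h1 := abs_mol_le_of_bdd hpc hs (fun y => hM y (t - s)) y
    have h2 : 0 ≤ M * ∫ z, |pd i κ z| := mul_nonneg hM0 (integral_nonneg fun _ => abs_nonneg _)
    linarith
  have e5 : (√(2 * s) ^ 2)⁻¹ * √(2 * s) ^ (α / 2) = (2 * s) ^ (α / 4 - 1) := by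
    rw [Real.sq_sqrt (by linarith), Real.sqrt_eq_rpow, ← Real.rpow_mul (by linarith),
      Real.rpow_sub (by linarith), Real.rpow_one]
    rw [show 1 / 2 * (α / 2) = α / 4 by ring, mul_comm, ← div_eq_mul_inv]
  have e6 : (2 * s) ^ (α / 4 - 1) ≤ s ^ (α / 4 - 1) :=
    Real.rpow_le_rpow_of_nonpos hs0 (by linarith) (by linarith)
  calc _ = √(2 * A * H) * momC n * ((√(2 * s) ^ 2)⁻¹ * √(2 * s) ^ (α / 2)) := by ring
    _ ≤ _ := by
      rw [e5]
      exact mul_le_mul_of_nonneg_left e6 (mul_nonneg (Real.sqrt_nonneg _) (momC_nonneg n))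

/-- The linear form with coordinates `g i`. -/
def linForm (g : Fin n → ℝ) : Eu n →L[ℝ] ℝ := ∑ i, g i • (EuclideanSpace.proj i : Eu n →L[ℝ] ℝ)

lemma linForm_apply (g : Fin n → ℝ) (z : Eu n) : linForm g z = ∑ i, g i * z i := by
  simp [linForm]

lemma linForm_pd (x : Eu n) : fderiv ℝ f x = linForm fun i => pd i f x := by
  ext z
  rw [linForm_apply, fderiv_apply_eq_sum]
  exact Finset.sum_congr rfl fun i _ => mul_comm _ _

lemma norm_linForm_sub_le {g g' : Fin n → ℝ} (hθ : 0 ≤ θ) (h : ∀ i, |g i - g' i| ≤ θ) :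
    ‖linForm g - linForm g'‖ ≤ n * θ := by
  refine ContinuousLinearMap.opNorm_le_bound _ (by positivity) fun z => ?_
  rw [_root_.sub_apply, linForm_apply, linForm_apply, ← Finset.sum_sub_distrib,
    Real.norm_eq_abs]
  calc |∑ i, (g i * z i - g' i * z i)| ≤ ∑ i : Fin n, |g i * z i - g' i * z i| :=
        Finset.abs_sum_le_sum_abs _ _
    _ ≤ ∑ _i : Fin n, θ * ‖z‖ := Finset.sum_le_sum fun i _ => by
        rw [← sub_mul, abs_mul]
        exact mul_le_mul (h i) (abs_coord_le z i) (abs_nonneg _) hθ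
    _ = n * θ * ‖z‖ := by simp [mul_assoc]

lemma hasFDerivAt_of_pd_limit {s : Set (Eu n)} (hs : IsOpen s) {F : ℕ → Eu n → ℝ}
    {g : Fin n → Eu n → ℝ} (hF : ∀ m, ∀ x ∈ s, DifferentiableAt ℝ (F m) x)
    (hw : ∀ x ∈ s, Tendsto (fun m => F m x) atTop (nhds (w x)))
    (hg : ∀ θ > 0, ∃ N, ∀ m ≥ N, ∀ x ∈ s, ∀ i, |pd i (F m) x - g i x| ≤ θ) :
    ∀ x ∈ s, HasFDerivAt w (linForm fun i => g i x) x := by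
  intro x hx
  refine hasFDerivAt_of_tendstoUniformlyOn (l := atTop) (f := F)
    (f' := fun m x => linForm fun i => pd i (F m) x) (g' := fun x => linForm fun i => g i x)
    hs ?_ (fun m y hy => by rw [← linForm_pd]; exact (hF m y hy).hasFDerivAt) hw hx
  rw [tendstoUniformlyOn_iff]
  intro θ hθ
  obtain ⟨N, hN⟩ := hg (θ / (n + 1)) (by positivity)
  filter_upwards [eventually_ge_atTop N] with m hm y hy
  rw [dist_comm, dist_eq_norm]
  refine (norm_linForm_sub_le (by positivity) (hN m hm y hy)).trans_lt ?_
  rw [mul_div_assoc', div_lt_iff₀ (by positivity)]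
  nlinarith

lemma continuousOn_linForm {s : Set (Eu n)} {g : Fin n → Eu n → ℝ}
    (hg : ∀ i, ContinuousOn (g i) s) : ContinuousOn (fun x => linForm fun i => g i x) s := by
  unfold linForm
  exact continuousOn_finsetSum _ fun i _ => (hg i).smul continuousOn_const

lemma contDiffOn_linForm {s : Set (Eu n)} {g : Fin n → Eu n → ℝ}
    (hg : ∀ i, ContDiffOn ℝ 1 (g i) s) : ContDiffOn ℝ 1 (fun x => linForm fun i => g i x) s := by
  unfold linForm
  exact ContDiffOn.sum fun i _ => (hg i).smul contDiffOn_const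

lemma contDiffOn_one_of_linForm {s : Set (Eu n)} (hs : IsOpen s) {g : Fin n → Eu n → ℝ}
    (hw : ∀ x ∈ s, HasFDerivAt w (linForm fun i => g i x) x) (hg : ∀ i, ContinuousOn (g i) s) :
    ContDiffOn ℝ 1 w s := by
  rw [show (1 : WithTop ℕ∞) = 0 + 1 by norm_num, contDiffOn_succ_iff_fderiv_of_isOpen hs]
  refine ⟨fun x hx => (hw x hx).differentiableAt.differentiableWithinAt, by simp, ?_⟩
  rw [contDiffOn_zero]
  exact (continuousOn_linForm hg).congr fun x hx => (hw x hx).fderiv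

/-- Twice differentiability is preserved under uniform convergence of the derivatives up to
order two. -/
lemma contDiffOn_two_of_limit {s : Set (Eu n)} (hs : IsOpen s) {F : ℕ → Eu n → ℝ}
    {g : Fin n → Eu n → ℝ} {G : Fin n → Fin n → Eu n → ℝ}
    (hF : ∀ m, ∀ x ∈ s, ContDiffAt ℝ 2 (F m) x)
    (hw : ∀ x ∈ s, Tendsto (fun m => F m x) atTop (nhds (w x)))
    (hg : ∀ θ > 0, ∃ N, ∀ m ≥ N, ∀ x ∈ s, ∀ i, |pd i (F m) x - g i x| ≤ θ)
    (hG : ∀ θ > 0, ∃ N, ∀ m ≥ N, ∀ x ∈ s, ∀ i j, |pd j (pd i (F m)) x - G i j x| ≤ θ)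
    (hGc : ∀ i j, ContinuousOn (G i j) s) :
    ContDiffOn ℝ 2 w s ∧ ∀ x ∈ s, lap w x = ∑ i, G i i x := by
  have h1 := hasFDerivAt_of_pd_limit hs (fun m x hx => (hF m x hx).differentiableAt (by norm_num))
    hw hg
  have h2 : ∀ i, ∀ x ∈ s, HasFDerivAt (g i) (linForm fun j => G i j x) x := fun i =>
    hasFDerivAt_of_pd_limit (F := fun m => pd i (F m)) hs
      (fun m x hx => (ContDiffAt.pd (hF m x hx) (m := 1) (by norm_num)).differentiableAt
        (by norm_num))
      (fun x hx => by
        rw [Metric.tendsto_atTop]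
        intro θ hθ
        obtain ⟨N, hN⟩ := hg (θ / 2) (by positivity)
        exact ⟨N, fun m hm => (hN m hm x hx i).trans_lt (by linarith)⟩)
      (fun θ hθ => (hG θ hθ).imp fun N hN m hm x hx j => hN m hm x hx i j)
  have hg1 : ∀ i, ContDiffOn ℝ 1 (g i) s := fun i => contDiffOn_one_of_linForm hs (h2 i) (hGc i)
  have hsingle : ∀ (c : Fin n → ℝ) (i : Fin n), linForm c (EuclideanSpace.single i 1) = c i := by
    intro c i
    rw [linForm_apply]
    simp
  have hpd : ∀ i, ∀ x ∈ s, pd i w x = g i x := fun i x hx => by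
    rw [pd, (h1 x hx).fderiv, hsingle]
  constructor
  · rw [show (2 : WithTop ℕ∞) = 1 + 1 by norm_num, contDiffOn_succ_iff_fderiv_of_isOpen hs]
    exact ⟨fun x hx => (h1 x hx).differentiableAt.differentiableWithinAt, by simp,
      (contDiffOn_linForm hg1).congr fun x hx => (h1 x hx).fderiv⟩
  · intro x hx
    rw [lap_eq_sum_pd]
    refine Finset.sum_congr rfl fun i _ => ?_
    have : pd i w =ᶠ[nhds x] g i := by
      filter_upwards [hs.mem_nhds hx] with y hy using hpd i y hy
    rw [pd_congr this, pd, (h2 i x hx).fderiv, hsingle]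

/-- A uniformly Cauchy sequence of real functions has a uniform limit. -/
lemma exists_limit_of_cauchy {S : Type*} {K : Set S} {F : ℕ → S → ℝ}
    (h : ∀ θ > 0, ∃ N, ∀ m ≥ N, ∀ m' ≥ N, ∀ z ∈ K, |F m z - F m' z| ≤ θ) :
    ∃ g : S → ℝ, ∀ θ > 0, ∃ N, ∀ m ≥ N, ∀ z ∈ K, |F m z - g z| ≤ θ := by
  have hc : ∀ z ∈ K, ∃ l, Tendsto (fun m => F m z) atTop (nhds l) := fun z hz => by
    apply cauchySeq_tendsto_of_complete
    rw [Metric.cauchySeq_iff]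
    intro θ hθ
    obtain ⟨N, hN⟩ := h (θ / 2) (by positivity)
    exact ⟨N, fun m hm m' hm' => (hN m hm m' hm' z hz).trans_lt (by linarith)⟩
  choose! g hg using hc
  refine ⟨g, fun θ hθ => ?_⟩
  obtain ⟨N, hN⟩ := h θ hθ
  refine ⟨N, fun m hm z hz => ?_⟩
  have ht : Tendsto (fun m' => |F m z - F m' z|) atTop (nhds |F m z - g z|) :=
    (tendsto_const_nhds.sub (hg z hz)).abs
  exact le_of_tendsto ht (by filter_upwards [eventually_ge_atTop N] with m' hm' using hN m hm m' hm' z hz)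

/-- A sequence of smooth mollifiers with supports shrinking to the origin. -/
structure IsMol (ρ : ℕ → Eu n → ℝ) : Prop where
  smooth : ∀ m, ContDiff ℝ (⊤ : ℕ∞) (ρ m)
  supp : ∀ m : ℕ, tsupport (ρ m) ⊆ closedBall 0 (1 / ((m : ℝ) + 1))
  nonneg : ∀ m z, 0 ≤ ρ m z
  one : ∀ m, ∫ z, ρ m z = 1

lemma exists_isMol (n : ℕ) : ∃ ρ : ℕ → Eu n → ℝ, IsMol ρ := by
  choose ρ h1 h2 h3 h4 using fun m : ℕ =>
    exists_mollifier (n := n) (ε := 1 / ((m : ℝ) + 1)) (by positivity)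
  exact ⟨ρ, h1, h2, h3, h4⟩

lemma IsMol.eventually_supp {ρ : ℕ → Eu n → ℝ} (hρ : IsMol ρ) (hε : 0 < ε) :
    ∃ N, ∀ m ≥ N, tsupport (ρ m) ⊆ closedBall 0 ε := by
  obtain ⟨N, hN⟩ := exists_nat_one_div_lt hε
  refine ⟨N, fun m hm => (hρ.supp m).trans (closedBall_subset_closedBall ?_)⟩
  refine le_trans ?_ hN.le
  gcongr

lemma mol_kernel_sub {κ' : Eu n → ℝ} (hU : IsOpen U) (hw : ContinuousOn w U) (hκc : Continuous κ)
    (hκ : tsupport κ ⊆ closedBall 0 ε) (hκc' : Continuous κ') (hκ' : tsupport κ' ⊆ closedBall 0 ε)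
    (hx : x ∈ inner' U ε) :
    mol (fun z => κ z - κ' z) w x = mol κ w x - mol κ' w x := by
  simp only [mol, mul_sub]
  exact integral_sub (mol_integrable hU hw hκc hκ hx) (mol_integrable hU hw hκc' hκ' hx)

lemma mol_add {w' : Eu n → ℝ} (hU : IsOpen U) (hw : ContinuousOn w U) (hw' : ContinuousOn w' U)
    (hκc : Continuous κ) (hκ : tsupport κ ⊆ closedBall 0 ε) (hx : x ∈ inner' U ε) :
    mol κ (fun y => w y + w' y) x = mol κ w x + mol κ w' x := by
  simp only [mol, add_mul]
  exact integral_add (mol_integrable hU hw hκc hκ hx) (mol_integrable hU hw' hκc hκ hx)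

lemma pd_sub' (hf : ContDiff ℝ (⊤ : ℕ∞) f) (hg : ContDiff ℝ (⊤ : ℕ∞) g) (i : Fin n) :
    pd i (fun z => f z - g z) = fun z => pd i f z - pd i g z := by
  funext x
  simp only [pd]
  rw [fderiv_fun_sub (hf.differentiable (by simp) x) (hg.differentiable (by simp) x)]
  rfl

lemma tsupport_sub_subset (hf : tsupport f ⊆ S) (hg : tsupport g ⊆ S) :
    tsupport (fun z => f z - g z) ⊆ S :=
  (tsupport_sub f g).trans (union_subset hf hg)

theorem rpow_min_aux (hs : 0 ≤ s) (hα : 0 < α) (hα1 : α ≤ 1) : min 1 s ≤ s ^ α := by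
  rcases le_total s 1 with h | h
  · rw [min_eq_right h]
    rcases hs.eq_or_lt with rfl | h0
    · exact Real.rpow_nonneg le_rfl _
    · calc s = s ^ (1:ℝ) := (Real.rpow_one s).symm
        _ ≤ s ^ α := Real.rpow_le_rpow_of_exponent_ge h0 h hα1
  · rw [min_eq_left h]
    exact Real.one_le_rpow h hα.le

theorem exists_bump (x0 : Eu n) (hR : 0 < R) :
    ∃ χ : Eu n → ℝ, ContDiff ℝ (⊤ : ℕ∞) χ ∧ tsupport χ ⊆ closedBall x0 (4*R) ∧
      (∀ x, 0 ≤ χ x) ∧ (∀ x, χ x ≤ 1) ∧ (∀ x ∈ ball x0 (3*R), χ x = 1) := by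
  let c : ContDiffBump x0 := ⟨3*R, 4*R, by linarith, by linarith⟩
  refine ⟨c, c.contDiff, ?_, fun x => c.nonneg, fun x => c.le_one, fun x hx => ?_⟩
  · rw [c.tsupport_eq]
  · exact c.one_of_mem_closedBall (ball_subset_closedBall hx)

theorem Weak.exists_split (hU : IsOpen U) {F : ℝ} (hR : 0 < R) (hT : 0 ≤ T)
    (hsub : closedBall x0 (4*R) ⊆ U) {f : Eu n → ℝ → ℝ} (h : Weak U 0 T u f)
    (hF : ∀ x ∈ closedBall x0 (4*R), ∀ t ∈ Icc 0 T, |f x t| ≤ F) :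
    ∃ g : Eu n → ℝ → ℝ, (Continuous fun z : Eu n × ℝ => g z.1 z.2) ∧ (∀ x t, |g x t| ≤ F) ∧
      Weak (ball x0 (3*R)) 0 T (fun x t => u x t - Pot g x t) (fun _ _ => 0) ∧
      (∀ H α : ℝ, 0 < α → α ≤ 1 → 0 ≤ H →
        (∀ x ∈ closedBall x0 (4*R), ∀ y ∈ closedBall x0 (4*R), ∀ t ∈ Icc 0 T,
          |f x t - f y t| ≤ H * ‖x - y‖ ^ α) →
        ∃ H' : ℝ, 0 ≤ H' ∧ ∀ x y t, |g x t - g y t| ≤ H' * ‖x - y‖ ^ α) := by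
  obtain ⟨χ, hχ, hχs, hχ0, hχ1, hχe⟩ := exists_bump x0 hR
  have hF0 : 0 ≤ F := (abs_nonneg _).trans
    (hF x0 (mem_closedBall_self (by linarith)) 0 ⟨le_rfl, hT⟩)
  have hout : ∀ x, x ∉ closedBall x0 (4*R) → χ x = 0 := fun x hx =>
    image_eq_zero_of_notMem_tsupport fun hx' => hx (hχs hx')
  have hc := jc_univ_clamp hT (jc_mul_cutoff hU h.cf hχ.continuous (hχs.trans hsub))
  have hb : ∀ x t, |f x (clamp T t) * χ x| ≤ F := by
    intro x t
    by_cases hx : x ∈ closedBall x0 (4*R)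
    · rw [abs_mul, abs_of_nonneg (hχ0 x)]
      calc _ ≤ F * 1 := mul_le_mul (hF x hx _ (clamp_mem hT t)) (hχ1 x) (hχ0 x) hF0
        _ = F := mul_one F
    · rw [hout x hx]; simpa using hF0
  refine ⟨fun x t => f x (clamp T t) * χ x, hc, hb, ?_, ?_⟩
  · have hbs : ball x0 (3*R) ⊆ closedBall x0 (4*R) :=
      ball_subset_closedBall.trans (closedBall_subset_closedBall (by linarith))
    refine ((h.mono (hbs.trans hsub) le_rfl le_rfl).sub isOpen_ball
      ((weak_Pot hc hb T).mono (subset_univ _) le_rfl le_rfl)).congr (fun _ _ _ _ => rfl) ?_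
    intro x hx t ht
    simp [hχe x hx, clamp_of_mem ht]
  · intro H α hα hα1 hH hf
    obtain ⟨L, hL⟩ := hχ.lipschitzWith_of_hasCompactSupport
      (HasCompactSupport.of_support_subset_isCompact (isCompact_closedBall x0 (4*R))
        ((subset_tsupport χ).trans hχs)) (by simp)
    have hLχ : ∀ x y, |χ x - χ y| ≤ (L:ℝ) ^ α * ‖x - y‖ ^ α := by
      intro x y
      rw [← Real.mul_rpow L.coe_nonneg (norm_nonneg _)]
      refine le_trans (le_min ?_ ?_) (rpow_min_aux (by positivity) hα hα1)
      · rw [abs_le]; constructor <;> linarith [hχ0 x, hχ0 y, hχ1 x, hχ1 y]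
      · have := hL.dist_le_mul x y
        rwa [Real.dist_eq, dist_eq_norm] at this
    refine ⟨(L:ℝ) ^ α * F + H, by positivity, ?_⟩
    have key : ∀ x y t, x ∈ closedBall x0 (4*R) →
        |f x (clamp T t) * χ x - f y (clamp T t) * χ y| ≤ ((L:ℝ) ^ α * F + H) * ‖x - y‖ ^ α := by
      intro x y t hx
      have h1 : |f x (clamp T t) * (χ x - χ y)| ≤ F * ((L:ℝ) ^ α * ‖x - y‖ ^ α) := by
        rw [abs_mul]
        exact mul_le_mul (hF x hx _ (clamp_mem hT t)) (hLχ x y) (abs_nonneg _) hF0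
      have h2 : |(f x (clamp T t) - f y (clamp T t)) * χ y| ≤ H * ‖x - y‖ ^ α := by
        by_cases hy : y ∈ closedBall x0 (4*R)
        · rw [abs_mul, abs_of_nonneg (hχ0 y)]
          calc _ ≤ H * ‖x - y‖ ^ α * 1 := mul_le_mul (hf x hx y hy _ (clamp_mem hT t)) (hχ1 y)
                (hχ0 y) (by positivity)
            _ = _ := mul_one _
        · rw [hout y hy, mul_zero, abs_zero]; positivity
      calc _ = |f x (clamp T t) * (χ x - χ y) + (f x (clamp T t) - f y (clamp T t)) * χ y| := by
            congr 1; ring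
        _ ≤ _ := abs_add_le _ _
        _ ≤ _ := add_le_add h1 h2
        _ = _ := by ring
    intro x y t
    by_cases hx : x ∈ closedBall x0 (4*R)
    · exact key x y t hx
    by_cases hy : y ∈ closedBall x0 (4*R)
    · have := key y x t hy
      rwa [abs_sub_comm, norm_sub_rev] at this
    · beta_reduce; rw [hout x hx, hout y hy, mul_zero, mul_zero, sub_zero, abs_zero]; positivity

theorem closedBall_sub_inner (hx : x ∈ closedBall x0 R) (hr : R + r + ε < 3*R) :
    closedBall x r ⊆ inner' (ball x0 (3*R)) ε := by
  intro y hy z hz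
  have h1 := mem_closedBall.1 hx
  have h2 := mem_closedBall.1 hy
  have h3 := mem_closedBall.1 hz
  have h4 := dist_triangle z y x0
  have h5 := dist_triangle y x x0
  exact mem_ball.2 (by linarith)

theorem mem_inner_ball (hx : x ∈ closedBall x0 R) (hr : R + ε < 3*R) :
    x ∈ inner' (ball x0 (3*R)) ε := by
  intro z hz
  have h1 := mem_closedBall.1 hx
  have h3 := mem_closedBall.1 hz
  have h4 := dist_triangle z x x0
  exact mem_ball.2 (by linarith)

/-- Uniform interior gradient bound for mollified weak solutions. -/
theorem Weak.abs_mol_grad_le (hU : IsOpen U) {F : ℝ} (hR : 0 < R) (hτ : 0 < τ) (hτT : τ ≤ T)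
    (hsub : closedBall x0 (4*R) ⊆ U) {f : Eu n → ℝ → ℝ} (h : Weak U 0 T u f)
    (hB : ∀ x ∈ closedBall x0 (4*R), ∀ t ∈ Icc 0 T, |u x t| ≤ B)
    (hF : ∀ x ∈ closedBall x0 (4*R), ∀ t ∈ Icc 0 T, |f x t| ≤ F) (hκc : ContDiff ℝ (⊤ : ℕ∞) κ)
    (hκ : tsupport κ ⊆ closedBall 0 (R/2)) (hκ0 : ∀ z, 0 ≤ κ z) (hκ1 : ∫ z, κ z = 1)
    (hx : x ∈ closedBall x0 R) (ht : t ∈ Icc τ T) (i : Fin n) :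
    |mol (pd i κ) (fun y => u y t) x| ≤
      gradC n τ (R/2) * (B + T * F) + F * momC n * (T ^ (1/2:ℝ) / (1/2)) := by
  have hT : 0 ≤ T := hτ.le.trans hτT
  have ht0 : 0 ≤ t := hτ.le.trans ht.1
  obtain ⟨g, hgc, hgb, hw, -⟩ := h.exists_split hU hR hT hsub hF
  have hF0 : 0 ≤ F := (abs_nonneg _).trans (hgb 0 0)
  have hbs : ball x0 (3*R) ⊆ closedBall x0 (4*R) :=
      ball_subset_closedBall.trans (closedBall_subset_closedBall (by linarith))
  have h1 : |mol (pd i κ) (fun y => u y t - Pot g y t) x| ≤ gradC n τ (R/2) * (B + T * F) := by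
    refine hw.abs_mol_pd_le isOpen_ball hκc hκ (by linarith) hτ
      (closedBall_sub_inner hx (by linarith)) (by simpa using ht) ?_ i
    intro y hy s hs
    have hs' : s ∈ Icc 0 T := ⟨by linarith [hs.1, ht.1], hs.2.trans ht.2⟩
    refine abs_mol_le hκ0 hκc.continuous hκ1 hκ fun z hz => ?_
    have hz' : z ∈ closedBall x0 (4*R) :=
      hbs (closedBall_sub_inner (R := R) hx (r := R/2) (ε := R/2) (by linarith) hy hz)
    calc _ ≤ |u z s| + |Pot g z s| := abs_sub _ _
      _ ≤ B + s * F := add_le_add (hB z hz' s hs') (abs_Pot_le_const hs'.1 hgb)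
      _ ≤ B + T * F := by gcongr; exact hs'.2
  have h2 := abs_mol_pd_Pot_le hgc hgb hκc hκ
    (fun y s => abs_mol_le hκ0 hκc.continuous hκ1 hκ fun z _ => hgb z s) ht0 x i
  have hxi : x ∈ inner' (ball x0 (3*R)) (R/2) := mem_inner_ball hx (by linarith)
  have h3 : mol (pd i κ) (fun y => u y t) x = mol (pd i κ) (fun y => u y t - Pot g y t) x
      + mol (pd i κ) (fun y => Pot g y t) x := by
    rw [← mol_add isOpen_ball (JC.slice hw.cu ⟨ht0, ht.2⟩)
      ((continuous_slice (continuous_Pot hgc hgb) t).continuousOn)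
      (contDiff_top_pd hκc i).continuous ((tsupport_pd_subset i κ).trans hκ) hxi]
    simp
  rw [h3]
  refine (abs_add_le _ _).trans (add_le_add h1 (h2.trans ?_))
  gcongr
  · exact mul_nonneg hF0 (momC_nonneg n)
  · exact ht.2

theorem mol_eq (κ w : Eu n → ℝ) (x : Eu n) : mol κ w x = ∫ z, w (x - z) * κ z := by
  have := integral_sub_left_eq_self (fun y => w y * κ (x - y)) volume x
  rw [mol, ← this]
  simp

theorem abs_mol_sub_mol_le (hw : Continuous w) (hκ0 : ∀ z, 0 ≤ κ z) (hκc : Continuous κ)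
    (hκ : tsupport κ ⊆ closedBall 0 ε) (h1 : ∫ z, κ z = 1) {y : Eu n}
    (hC : ∀ ζ, |w (y - ζ) - w (z - ζ)| ≤ C) :
    |mol κ w y - mol κ w z| ≤ C := by
  have hs := hasCompactSupport_of_ball hκ
  have hi : ∀ y, Integrable fun ζ => w (y - ζ) * κ ζ := fun y =>
    ((hw.comp (continuous_const.sub continuous_id)).mul hκc).integrable_of_hasCompactSupport
      hs.mul_left
  have hκi : Integrable κ := hκc.integrable_of_hasCompactSupport hs
  rw [mol_eq, mol_eq, ← integral_sub (hi y) (hi z), ← Real.norm_eq_abs]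
  calc _ ≤ ∫ ζ, C * κ ζ := by
        refine norm_integral_le_of_norm_le (hκi.const_mul C) (Eventually.of_forall fun ζ => ?_)
        beta_reduce
        rw [← sub_mul, norm_mul, Real.norm_eq_abs, Real.norm_eq_abs, abs_of_nonneg (hκ0 ζ)]
        exact mul_le_mul_of_nonneg_right (hC ζ) (hκ0 ζ)
    _ = C := by rw [integral_const_mul, h1, mul_one]

theorem exists_small_pow {γ : ℝ} (hα : 0 < α) (hγ : 0 < γ) :
    ∃ ε : ℝ, 0 < ε ∧ H * ε ^ α ≤ γ := by
  have h : Tendsto (fun ε : ℝ => H * ε ^ α) (nhds 0) (nhds 0) := by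
    have := ((Real.continuous_rpow_const hα.le).const_mul H).tendsto 0
    rwa [Real.zero_rpow hα.ne', mul_zero] at this
  obtain ⟨ε, h1, h2⟩ := (((h.mono_left nhdsWithin_le_nhds).eventually (ge_mem_nhds hγ)).and
    (self_mem_nhdsWithin : Ioi (0:ℝ) ∈ nhdsWithin 0 (Ioi 0))).exists
  exact ⟨ε, h2, h1⟩

theorem Weak.cauchy_mol (hU : IsOpen U) {F : ℝ} (hR : 0 < R) (hτ : 0 < τ) (hT : 0 ≤ T)
    (hsub : closedBall x0 (4*R) ⊆ U) {f : Eu n → ℝ → ℝ} (h : Weak U 0 T u f)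
    (hF : ∀ x ∈ closedBall x0 (4*R), ∀ t ∈ Icc 0 T, |f x t| ≤ F) (hα : 0 < α) (hα1 : α ≤ 1)
    (hH : 0 ≤ H) (hf : ∀ x ∈ closedBall x0 (4*R), ∀ y ∈ closedBall x0 (4*R), ∀ t ∈ Icc 0 T,
          |f x t - f y t| ≤ H * ‖x - y‖ ^ α) {ρ : ℕ → Eu n → ℝ} (hρ : IsMol ρ) (hθ : 0 < θ) :
    ∃ N, ∀ m ≥ N, ∀ m' ≥ N, ∀ x ∈ closedBall x0 R, ∀ t ∈ Icc (τ + τ) T, ∀ i j,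
      |mol (pd i (ρ m)) (fun y => u y t) x - mol (pd i (ρ m')) (fun y => u y t) x| ≤ θ ∧
      |mol (pd j (pd i (ρ m))) (fun y => u y t) x
        - mol (pd j (pd i (ρ m'))) (fun y => u y t) x| ≤ θ := by
  obtain ⟨g, hgc, hgb, hw, hgH⟩ := h.exists_split hU hR hT hsub hF
  obtain ⟨H', hH', hg⟩ := hgH H α hα hα1 hH hf
  have hV : IsOpen (ball x0 (3*R)) := isOpen_ball
  set c1 := gradC n τ (R/4)
  have hlim1 : Tendsto (fun γ : ℝ => c1 * (2*γ) + (2*γ) * momC n * (T ^ (1/2:ℝ) / (1/2)))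
      (nhds 0) (nhds 0) := by
    have : Continuous fun γ : ℝ => c1 * (2*γ) + (2*γ) * momC n * (T ^ (1/2:ℝ) / (1/2)) := by
      fun_prop
    simpa using this.tendsto 0
  have hlim2 : Tendsto (fun γ : ℝ => c1 * (c1 * (2*γ)) + √(2 * (2*γ) * (2*H')) * momC n
      * (T ^ (α/4) / (α/4))) (nhds 0) (nhds 0) := by
    have : Continuous fun γ : ℝ => c1 * (c1 * (2*γ)) + √(2 * (2*γ) * (2*H')) * momC n
      * (T ^ (α/4) / (α/4)) := by
      fun_prop
    simpa using this.tendsto 0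
  obtain ⟨γ, ⟨hγ1, hγ2⟩, hγ⟩ := ((((hlim1.mono_left nhdsWithin_le_nhds).eventually
    (ge_mem_nhds hθ)).and ((hlim2.mono_left nhdsWithin_le_nhds).eventually
    (ge_mem_nhds hθ))).and (self_mem_nhdsWithin : Ioi (0:ℝ) ∈ nhdsWithin 0 (Ioi 0))).exists
  have hγ0 : 0 < γ := hγ
  obtain ⟨ε1, hε1, hu1⟩ := exists_unif_radius hV (isCompact_closedBall x0 (2*R))
    (closedBall_subset_ball (by linarith)) hw.cu hγ0
  obtain ⟨ε2, hε2, hpow⟩ := exists_small_pow (H := H') hα hγ0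
  obtain ⟨N, hN⟩ := hρ.eventually_supp (ε := min (min ε1 ε2) (R/2))
    (lt_min (lt_min hε1 hε2) (by linarith))
  refine ⟨N, fun m hm m' hm' x hx t ht i j => ?_⟩
  have hs : ∀ m ≥ N, tsupport (ρ m) ⊆ closedBall 0 ε1 := fun m hm => (hN m hm).trans
    (closedBall_subset_closedBall ((min_le_left _ _).trans (min_le_left _ _)))
  have hs2 : ∀ m ≥ N, tsupport (ρ m) ⊆ closedBall 0 ε2 := fun m hm => (hN m hm).trans
    (closedBall_subset_closedBall ((min_le_left _ _).trans (min_le_right _ _)))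
  have hs3 : ∀ m ≥ N, tsupport (ρ m) ⊆ closedBall 0 (R/2) := fun m hm => (hN m hm).trans
    (closedBall_subset_closedBall (min_le_right _ _))
  have ht0 : t ∈ Icc 0 T := ⟨by linarith [ht.1], ht.2⟩
  set κ : Eu n → ℝ := fun z => ρ m z - ρ m' z with hκdef
  have hκc : ContDiff ℝ (⊤ : ℕ∞) κ := (hρ.smooth m).sub (hρ.smooth m')
  have hκs : tsupport κ ⊆ closedBall 0 (R/2) := tsupport_sub_subset (hs3 m hm) (hs3 m' hm')
  have hvκ : ∀ y ∈ closedBall x0 (2*R), ∀ s ∈ Icc 0 T,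
      |mol κ (fun y => u y s - Pot g y s) y| ≤ 2*γ := by
    intro y hy s hs'
    obtain ⟨hyi, hyu⟩ := hu1 y hy
    have hws := JC.slice hw.cu hs'
    rw [hκdef, mol_kernel_sub hV hws (hρ.smooth m).continuous (hs m hm)
      (hρ.smooth m').continuous (hs m' hm') hyi]
    have e1 := fun m hm => abs_mol_sub_le hV hws (hρ.nonneg m) (hρ.smooth m).continuous (hρ.one m)
      (hs m hm) hyi (fun z hz => hyu z hz s hs')
    have a1 := abs_le.1 (e1 m hm)
    have a2 := abs_le.1 (e1 m' hm')
    rw [abs_le]; constructor <;> linarith [a1.1, a1.2, a2.1, a2.2]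
  have hgs : ∀ s, Continuous fun y => g y s := fun s => continuous_slice hgc s
  have hmg : ∀ y s, mol κ (fun y => g y s) y
      = mol (ρ m) (fun y => g y s) y - mol (ρ m') (fun y => g y s) y := fun y s =>
    mol_kernel_sub isOpen_univ (hgs s).continuousOn (hρ.smooth m).continuous (hs m hm)
      (hρ.smooth m').continuous (hs m' hm') (subset_univ _)
  have hgA : ∀ y s, |mol κ (fun y => g y s) y| ≤ 2*γ := by
    intro y s
    rw [hmg]
    have e1 := fun m hm => abs_mol_sub_le (B := γ) isOpen_univ (hgs s).continuousOn (hρ.nonneg m)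
      (hρ.smooth m).continuous (hρ.one m) (hs2 m hm) (subset_univ _ : y ∈ inner' univ ε2)
      (c := g y s) (fun z hz => (hg z y s).trans (le_trans (by
        gcongr
        exact mem_closedBall_iff_norm.1 hz) hpow))
    have a1 := abs_le.1 (e1 m hm)
    have a2 := abs_le.1 (e1 m' hm')
    rw [abs_le]; constructor <;> linarith [a1.1, a1.2, a2.1, a2.2]
  have hgHol : ∀ y z s, |mol κ (fun y => g y s) y - mol κ (fun y => g y s) z|
      ≤ (2*H') * ‖y - z‖ ^ α := by
    intro y z s
    rw [hmg, hmg]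
    have e1 := fun m hm => abs_mol_sub_mol_le (hgs s) (hρ.nonneg m) (hρ.smooth m).continuous
      (hs m hm) (hρ.one m) (y := y) (z := z) (C := H' * ‖y - z‖ ^ α) (fun ζ => by
        have := hg (y - ζ) (z - ζ) s
        rwa [sub_sub_sub_cancel_right] at this)
    have a1 := abs_le.1 (e1 m hm)
    have a2 := abs_le.1 (e1 m' hm')
    rw [abs_le]; constructor <;> linarith [a1.1, a1.2, a2.1, a2.2]
  have hxi : x ∈ inner' (ball x0 (3*R)) (R/2) := mem_inner_ball hx (by linarith)
  have hut : ContinuousOn (fun y => u y t) (ball x0 (3*R)) :=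
    (JC.slice h.cu ht0).mono (((ball_subset_ball (by linarith)).trans
      ball_subset_closedBall).trans hsub)
  have hPt : ContinuousOn (fun y => Pot g y t) (ball x0 (3*R)) :=
    (continuous_slice (continuous_Pot hgc hgb) t).continuousOn
  have hball : ∀ r, r ≤ R/2 → closedBall x r ⊆ closedBall x0 (2*R) := fun r hr =>
    closedBall_subset_closedBall' (by have := mem_closedBall.1 hx; linarith)
  have split : ∀ κ' : Eu n → ℝ, Continuous κ' → tsupport κ' ⊆ closedBall 0 (R/2) →
      mol κ' (fun y => u y t) x = mol κ' (fun y => u y t - Pot g y t) x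
        + mol κ' (fun y => Pot g y t) x := by
    intro κ' h1 h2
    rw [← mol_add hV (JC.slice hw.cu ht0) hPt h1 h2 hxi]
    simp
  have htsp : ∀ m ≥ N, ∀ i, tsupport (pd i (ρ m)) ⊆ closedBall 0 (R/2) := fun m hm i =>
    (tsupport_pd_subset i _).trans (hs3 m hm)
  have hcp : ∀ m i, ContDiff ℝ (⊤ : ℕ∞) (pd i (ρ m)) := fun m i => contDiff_top_pd (hρ.smooth m) i
  have hpdκ : pd i κ = fun z => pd i (ρ m) z - pd i (ρ m') z :=
    pd_sub' (hρ.smooth m) (hρ.smooth m') i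
  have hpdκ2 : pd j (pd i κ) = fun z => pd j (pd i (ρ m)) z - pd j (pd i (ρ m')) z := by
    rw [hpdκ]; exact pd_sub' (hcp m i) (hcp m' i) j
  have hpc := contDiff_top_pd hκc i
  constructor
  · rw [← mol_kernel_sub hV hut (hcp m i).continuous (htsp m hm i) (hcp m' i).continuous
      (htsp m' hm' i) hxi, ← hpdκ, split _ hpc.continuous ((tsupport_pd_subset i _).trans hκs)]
    refine (abs_add_le _ _).trans (le_trans (add_le_add ?_ ?_) hγ1)
    · refine hw.abs_mol_pd_le hV hκc hκs (by linarith) hτ (closedBall_sub_inner hx (by linarith))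
        ⟨by linarith [ht.1], ht.2⟩ ?_ i
      exact fun y hy s hs => hvκ y (hball _ (by linarith) hy) s
        ⟨by linarith [hs.1, ht.1], hs.2.trans ht.2⟩
    · refine (abs_mol_pd_Pot_le hgc hgb hκc hκs hgA ht0.1 x i).trans ?_
      have := momC_nonneg n
      gcongr
      · exact ht0.1
      · exact ht.2
  · rw [← mol_kernel_sub hV hut (contDiff_top_pd (hcp m i) j).continuous
      ((tsupport_pd_subset j _).trans (htsp m hm i)) (contDiff_top_pd (hcp m' i) j).continuous
      ((tsupport_pd_subset j _).trans (htsp m' hm' i)) hxi, ← hpdκ2,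
      split _ (contDiff_top_pd hpc j).continuous
      ((tsupport_pd_subset j _).trans ((tsupport_pd_subset i _).trans hκs))]
    refine (abs_add_le _ _).trans (le_trans (add_le_add ?_ ?_) hγ2)
    · refine hw.abs_mol_pd_pd_le hV hκc hκs (by linarith) hτ
        (closedBall_sub_inner hx (by linarith)) ⟨by linarith [ht.1], ht.2⟩ ?_ i j
      exact fun y hy s hs => hvκ y (hball _ (by linarith) hy) s hs
    · refine (abs_mol_pd_pd_Pot_le hgc hgb hκc hκs hα hα1 hgA hgHol ht0.1 x i j).trans ?_
      have := momC_nonneg n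
      gcongr
      · exact ht0.1
      · exact ht.2

theorem IsMol.unif_conv {ρ : ℕ → Eu n → ℝ} (hρ : IsMol ρ) {K : Set (Eu n)} (hU : IsOpen U)
    (hK : IsCompact K) (hKU : K ⊆ U) (hv : JC v U (Icc t0 t1)) (hθ : 0 < θ) :
    ∃ N, ∀ m ≥ N, ∀ x ∈ K, ∀ t ∈ Icc t0 t1, |mol (ρ m) (fun y => v y t) x - v x t| ≤ θ := by
  obtain ⟨ε, hε, h⟩ := exists_unif_radius hU hK hKU hv hθ
  obtain ⟨N, hN⟩ := hρ.eventually_supp hε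
  exact ⟨N, fun m hm x hx t ht => abs_mol_sub_le hU (JC.slice hv ht) (hρ.nonneg m)
    (hρ.smooth m).continuous (hρ.one m) (hN m hm) (h x hx).1 fun y hy => (h x hx).2 y hy t ht⟩

theorem pd_pd_mol (hU : IsOpen U) (hw : ContinuousOn w U) (hκc : ContDiff ℝ (⊤ : ℕ∞) κ)
    (hκ : tsupport κ ⊆ closedBall 0 ε) (hx : x ∈ inner' U ε) (i j : Fin n) :
    pd j (pd i (mol κ w)) x = mol (pd j (pd i κ)) w x := by
  have h1 : ∀ κ : Eu n → ℝ, ContDiff ℝ (⊤ : ℕ∞) κ → ContDiff ℝ 1 κ := fun κ h => h.of_le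
    (WithTop.coe_le_coe.2 le_top)
  rw [pd_congr (g := mol (pd i κ) w), pd_mol hU hw (h1 _ (contDiff_top_pd hκc i))
    ((tsupport_pd_subset i κ).trans hκ) hx]
  filter_upwards [(isOpen_inner' hU ε).mem_nhds hx] with y hy
  exact pd_mol hU hw (h1 _ hκc) hκ hy i

theorem Weak.heatAt_local (hU : IsOpen U) {F : ℝ} (hR : 0 < R) (hτ : 0 < τ) (hT : 0 ≤ T)
    (hsub : closedBall x0 (4*R) ⊆ U) {f : Eu n → ℝ → ℝ} (h : Weak U 0 T u f)
    (hF : ∀ x ∈ closedBall x0 (4*R), ∀ t ∈ Icc 0 T, |f x t| ≤ F) (hα : 0 < α) (hα1 : α ≤ 1)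
    (hH : 0 ≤ H) (hf : ∀ x ∈ closedBall x0 (4*R), ∀ y ∈ closedBall x0 (4*R), ∀ t ∈ Icc 0 T,
          |f x t - f y t| ≤ H * ‖x - y‖ ^ α) (hx : x ∈ ball x0 R) (ht : t ∈ Ioo (τ + τ) T) :
    HeatAt u (f x t) x t := by
  obtain ⟨ρ, hρ⟩ := exists_isMol n
  have hcau := fun θ hθ => h.cauchy_mol (θ := θ) hU hR hτ hT hsub hF hα hα1 hH hf hρ hθ
  set K := closedBall x0 R with hK
  set I := Icc (τ + τ) T with hI
  have hI0 : I ⊆ Icc 0 T := Icc_subset_Icc_left (by linarith)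
  have hball : ball x0 R ⊆ K := ball_subset_closedBall
  have hKU : K ⊆ U := (closedBall_subset_closedBall (by linarith)).trans hsub
  obtain ⟨g, hg⟩ := exists_limit_of_cauchy (S := (Eu n × ℝ) × Fin n) (K := (K ×ˢ I) ×ˢ univ)
    (F := fun m z => mol (pd z.2 (ρ m)) (fun y => u y z.1.2) z.1.1) (by
      intro θ hθ
      obtain ⟨N, hN⟩ := hcau θ hθ
      exact ⟨N, fun m hm m' hm' z hz => (hN m hm m' hm' z.1.1 hz.1.1 z.1.2 hz.1.2 z.2 z.2).1⟩)
  obtain ⟨G, hG⟩ := exists_limit_of_cauchy (S := (Eu n × ℝ) × (Fin n × Fin n))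
    (K := (K ×ˢ I) ×ˢ univ)
    (F := fun m z => mol (pd z.2.2 (pd z.2.1 (ρ m))) (fun y => u y z.1.2) z.1.1) (by
      intro θ hθ
      obtain ⟨N, hN⟩ := hcau θ hθ
      exact ⟨N, fun m hm m' hm' z hz => (hN m hm m' hm' z.1.1 hz.1.1 z.1.2 hz.1.2 z.2.1 z.2.2).2⟩)
  obtain ⟨N0, hN0⟩ := hρ.eventually_supp hR
  have hinn : ∀ y ∈ ball x0 R, y ∈ inner' U R := by
    intro y hy
    exact (mem_inner_ball (hball hy) (by linarith)).trans
      ((ball_subset_ball (by linarith)).trans (ball_subset_closedBall.trans hsub))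
  have hs := fun m => hN0 (m + N0) (Nat.le_add_left N0 m)
  have hsm1 : ∀ m, ContDiff ℝ 1 (ρ m) := fun m => (hρ.smooth m).of_le
    (WithTop.coe_le_coe.2 le_top)
  have hsm2 : ∀ m, ContDiff ℝ 2 (ρ m) := fun m => (hρ.smooth m).of_le
    (WithTop.coe_le_coe.2 le_top)
  have hconv : ∀ y ∈ ball x0 R, ∀ s ∈ I,
      Tendsto (fun m => mol (ρ (m + N0)) (fun y => u y s) y) atTop (nhds (u y s)) := by
    intro y hy s hs'
    rw [Metric.tendsto_atTop]
    intro θ hθ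
    obtain ⟨N, hN⟩ := hρ.unif_conv hU (isCompact_closedBall x0 R) hKU h.cu (half_pos hθ)
    refine ⟨N, fun m hm => ?_⟩
    rw [Real.dist_eq]
    exact (hN (m + N0) (by omega) y (hball hy) s (hI0 hs')).trans_lt (half_lt_self hθ)
  have hC2 : ∀ s ∈ I, ContDiffOn ℝ 2 (fun y => u y s) (ball x0 R) ∧
      ∀ y ∈ ball x0 R, lap (fun y => u y s) y = ∑ i, G ((y, s), (i, i)) := by
    intro s hsI
    have hus := JC.slice h.cu (hI0 hsI)
    refine contDiffOn_two_of_limit (F := fun m => mol (ρ (m + N0)) (fun y => u y s))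
      (g := fun i y => g ((y, s), i)) (G := fun i j y => G ((y, s), (i, j))) isOpen_ball
      ?_ (fun y hy => hconv y hy s hsI) ?_ ?_ ?_
    · intro m y hy
      exact mol_contDiffAt (k := 2) hU hus (hsm2 _) (hs m) (hinn y hy)
    · intro θ hθ
      obtain ⟨N, hN⟩ := hg θ hθ
      refine ⟨N, fun m hm y hy i => ?_⟩
      rw [pd_mol hU hus (hsm1 _) (hs m) (hinn y hy)]
      exact hN (m + N0) (by omega) ((y, s), i) ⟨⟨hball hy, hsI⟩, mem_univ _⟩
    · intro θ hθ
      obtain ⟨N, hN⟩ := hG θ hθ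
      refine ⟨N, fun m hm y hy i j => ?_⟩
      rw [pd_pd_mol hU hus (hρ.smooth _) (hs m) (hinn y hy)]
      exact hN (m + N0) (by omega) ((y, s), (i, j)) ⟨⟨hball hy, hsI⟩, mem_univ _⟩
    · intro i j
      refine continuousOn_of_unif_approx fun θ hθ => ?_
      obtain ⟨N, hN⟩ := hG θ hθ
      refine ⟨mol (pd j (pd i (ρ (N + N0)))) (fun y => u y s), ?_, fun y hy =>
        hN (N + N0) (by omega) ((y, s), (i, j)) ⟨⟨hball hy, hsI⟩, mem_univ _⟩⟩
      intro y hy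
      exact (mol_contDiffAt (k := ⊤) hU hus (contDiff_top_pd (contDiff_top_pd (hρ.smooth _) i) j)
        ((tsupport_pd_subset j _).trans ((tsupport_pd_subset i _).trans (hs N)))
        (hinn y hy)).continuousAt.continuousWithinAt
  have htI : t ∈ I := Ioo_subset_Icc_self ht
  refine ⟨(hC2 t htI).1.contDiffAt (isOpen_ball.mem_nhds hx), ?_⟩
  rw [(hC2 t htI).2 x hx]
  refine hasDerivAt_of_tendstoUniformlyOn (l := atTop) (s := Ioo (τ + τ) T)
    (f := fun m t => mol (ρ (m + N0)) (fun y => u y t) x)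
    (f' := fun m t => mol (lap (ρ (m + N0))) (fun y => u y t) x
      + mol (ρ (m + N0)) (fun y => f y t) x)
    (g' := fun t => (∑ i, G ((x, t), (i, i))) + f x t) isOpen_Ioo ?_ ?_
    (fun s hs' => hconv x hx s (Ioo_subset_Icc_self hs')) ht
  · rw [tendstoUniformlyOn_iff]
    intro θ hθ
    obtain ⟨N1, hN1⟩ := hG (θ / (4 * (n + 1))) (by positivity)
    obtain ⟨N2, hN2⟩ := hρ.unif_conv hU (isCompact_closedBall x0 R) hKU h.cf
      (show 0 < θ / 4 by linarith)
    filter_upwards [eventually_ge_atTop (max N1 N2)] with m hm s hsI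
    have hsI' : s ∈ I := Ioo_subset_Icc_self hsI
    have hus := JC.slice h.cu (hI0 hsI')
    rw [← lap_mol hU hus (hsm2 _) (hs m) (hinn x hx), lap_eq_sum_pd, dist_comm, Real.dist_eq]
    have e1 : |∑ i, pd i (pd i (mol (ρ (m + N0)) (fun y => u y s))) x
        - ∑ i, G ((x, s), (i, i))| ≤ θ / 4 := by
      rw [← Finset.sum_sub_distrib]
      refine (Finset.abs_sum_le_sum_abs _ _).trans ?_
      calc _ ≤ ∑ _i : Fin n, θ / (4 * (n + 1)) := by
            refine Finset.sum_le_sum fun i _ => ?_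
            rw [pd_pd_mol hU hus (hρ.smooth _) (hs m) (hinn x hx)]
            exact hN1 (m + N0) (by omega) ((x, s), (i, i)) ⟨⟨hball hx, hsI'⟩, mem_univ _⟩
        _ = n * (θ / (4 * (n + 1))) := by simp
        _ ≤ (n + 1) * (θ / (4 * (n + 1))) := by gcongr; linarith
        _ = θ / 4 := by field_simp
    have e2 := hN2 (m + N0) (by omega) x (hball hx) s (hI0 hsI')
    have a1 := abs_le.1 e1
    have a2 := abs_le.1 e2
    rw [abs_lt]; constructor <;> linarith [a1.1, a1.2, a2.1, a2.2]
  · refine Eventually.of_forall fun m s hs' => ?_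
    exact h.hasDerivAt_mol hU (hsm2 _) (hs m) (hinn x hx) ⟨by linarith [hs'.1], hs'.2⟩

/-- Interior regularity: a weak solution whose source is locally Hölder in space is classical. -/
theorem Weak.heatAt (hU : IsOpen U) {f : Eu n → ℝ → ℝ} (h : Weak U 0 T u f)
    (hf : ∀ x0 ∈ U, ∀ τ > 0, ∃ R > (0:ℝ), ∃ H ≥ (0:ℝ), ∃ α > (0:ℝ), α ≤ 1 ∧
      closedBall x0 R ⊆ U ∧ ∀ x ∈ closedBall x0 R, ∀ y ∈ closedBall x0 R,
        ∀ t ∈ Icc τ T, |f x t - f y t| ≤ H * ‖x - y‖ ^ α) (hx : x ∈ U) (ht : t ∈ Ioo 0 T) :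
    HeatAt u (f x t) x t := by
  set c := t / 2 with hc
  have hc0 : 0 < c := half_pos ht.1
  obtain ⟨R, hR, H, hH, α, hα, hα1, hsub, hHol⟩ := hf x hx c hc0
  have hsh := (h.mono Subset.rfl hc0.le le_rfl).shift (-c)
  simp only [sub_neg_eq_add, add_neg_cancel] at hsh
  have hJ : JC (fun x t => f x (t + c)) U (Icc 0 (T + -c)) := hsh.cf
  have h4 : 4 * (R/4) = R := by ring
  obtain ⟨F, hF⟩ := ((isCompact_closedBall x R).prod (isCompact_Icc (a := 0) (b := T + -c)))
    |>.exists_bound_of_continuousOn (hJ.mono hsub Subset.rfl)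
  have key := hsh.heatAt_local hU (x0 := x) (R := R/4) (τ := c/4) (F := F) (H := H) (α := α)
    (by linarith) (by linarith) (by linarith [ht.2]) (by rwa [h4])
    (by rw [h4]; exact fun y hy s hs => hF (y, s) ⟨hy, hs⟩) hα hα1 hH
    (by rw [h4]; exact fun y hy z hz s hs => hHol y hy z hz (s + c)
          ⟨by linarith [hs.1], by linarith [hs.2]⟩)
    (mem_ball_self (by linarith)) (t := c) ⟨by linarith, by linarith [ht.2]⟩
  have hcc : c + c = t := by rw [hc]; ring
  refine ⟨by simpa only [hcc] using key.c2, ?_⟩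
  have hd := key.der
  simp only [hcc] at hd
  have h2 := HasDerivAt.comp_sub_const t c (f := fun s => u x (s + c)) (by
    rw [show t - c = c by linarith]; exact hd)
  simpa using h2

theorem norm_fderiv_le_of_pd (hC : 0 ≤ C) (h : ∀ i, |pd i g x| ≤ C) : ‖fderiv ℝ g x‖ ≤ n * C := by
  refine ContinuousLinearMap.opNorm_le_bound _ (by positivity) fun z => ?_
  rw [fderiv_apply_eq_sum, Real.norm_eq_abs]
  refine (Finset.abs_sum_le_sum_abs _ _).trans ?_
  calc _ ≤ ∑ _i : Fin n, ‖z‖ * C := Finset.sum_le_sum fun i _ => by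
        rw [abs_mul]
        exact mul_le_mul (abs_coord_le z i) (h i) (abs_nonneg _) (norm_nonneg _)
    _ = _ := by simp; ring

theorem Weak.lipschitz_space (hU : IsOpen U) {F : ℝ} (hR : 0 < R) (hτ : 0 < τ) (hτT : τ ≤ T)
    (hsub : closedBall x0 (4*R) ⊆ U) :
    ∃ L : ℝ, 0 ≤ L ∧ ∀ u f : Eu n → ℝ → ℝ, Weak U 0 T u f →
    (∀ x ∈ closedBall x0 (4*R), ∀ t ∈ Icc 0 T, |u x t| ≤ B) →
    (∀ x ∈ closedBall x0 (4*R), ∀ t ∈ Icc 0 T, |f x t| ≤ F) →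
    ∀ x ∈ closedBall x0 R, ∀ y ∈ closedBall x0 R, ∀ t ∈ Icc τ T,
      |u x t - u y t| ≤ L * ‖x - y‖ := by
  set C := max 0 (gradC n τ (R/2) * (B + T * F) + F * momC n * (T ^ (1/2:ℝ) / (1/2))) with hC
  refine ⟨n * C, by positivity, fun u f h hB hF x hx y hy t ht => ?_⟩
  have ht0 : t ∈ Icc 0 T := ⟨hτ.le.trans ht.1, ht.2⟩
  obtain ⟨ρ, hρ⟩ := exists_isMol n
  obtain ⟨N, hN⟩ := hρ.eventually_supp (half_pos hR)
  have hus := JC.slice h.cu ht0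
  have hKU : closedBall x0 R ⊆ U :=
    (closedBall_subset_closedBall (by linarith)).trans hsub
  have hinn : ∀ y ∈ closedBall x0 R, y ∈ inner' U (R/2) := fun y hy =>
    (mem_inner_ball hy (by linarith)).trans
      ((ball_subset_ball (by linarith)).trans (ball_subset_closedBall.trans hsub))
  have hconv : ∀ y ∈ closedBall x0 R,
      Tendsto (fun m => mol (ρ m) (fun y => u y t) y) atTop (nhds (u y t)) := by
    intro y hy
    rw [Metric.tendsto_atTop]
    intro θ hθ
    obtain ⟨N, hN⟩ := hρ.unif_conv hU (isCompact_closedBall x0 R) hKU h.cu (half_pos hθ)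
    refine ⟨N, fun m hm => ?_⟩
    rw [Real.dist_eq]
    exact (hN m hm y hy t ht0).trans_lt (half_lt_self hθ)
  refine le_of_tendsto ((hconv x hx).sub (hconv y hy)).abs ?_
  filter_upwards [eventually_ge_atTop N] with m hm
  have hsm1 : ContDiff ℝ 1 (ρ m) := (hρ.smooth m).of_le (WithTop.coe_le_coe.2 le_top)
  refine (convex_closedBall x0 R).norm_image_sub_le_of_norm_fderiv_le (𝕜 := ℝ) (fun z hz => ?_)
    (fun z hz => norm_fderiv_le_of_pd (le_max_left _ _) fun i => ?_) hy hx
  · exact (mol_contDiffAt (k := 1) hU hus hsm1 (hN m hm) (hinn z hz)).differentiableAt (by simp)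
  · rw [pd_mol hU hus hsm1 (hN m hm) (hinn z hz)]
    exact (h.abs_mol_grad_le hU hR hτ hτT hsub hB hF (hρ.smooth m) (hN m hm) (hρ.nonneg m)
      (hρ.one m) hz ht i).trans (le_max_right _ _)

theorem abs_mol_le_of_bdd_local (hM : 0 ≤ M) (hκc : Continuous κ)
    (hκ : tsupport κ ⊆ closedBall 0 ε) (hw : ∀ y ∈ closedBall x ε, |w y| ≤ M) :
    |mol κ w x| ≤ M * ∫ z, |κ z| := by
  rw [mol_congr (w' := (closedBall x ε).indicator w) hκ fun y hy =>
    (indicator_of_mem hy w).symm]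
  refine abs_mol_le_of_bdd hκc hκ (fun y => ?_) x
  by_cases hy : y ∈ closedBall x ε
  · rw [indicator_of_mem hy]; exact hw y hy
  · rw [indicator_of_notMem hy]; simpa using hM

theorem tsupport_lap_subset' (h : tsupport κ ⊆ S) :
    tsupport (lap κ) ⊆ S := (tsupport_lap_subset κ).trans h

/-- Interior equicontinuity of bounded weak solutions with bounded sources. -/
theorem Weak.equicont (hU : IsOpen U) {F : ℝ} (hR : 0 < R) (hτ : 0 < τ) (hτT : τ ≤ T)
    (hsub : closedBall x0 (4*R) ⊆ U) (hB0 : 0 ≤ B) (hF0 : 0 ≤ F) (hθ : 0 < θ) :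
    ∃ δ > 0, ∀ u f : Eu n → ℝ → ℝ, Weak U 0 T u f →
    (∀ x ∈ closedBall x0 (4*R), ∀ t ∈ Icc 0 T, |u x t| ≤ B) →
    (∀ x ∈ closedBall x0 (4*R), ∀ t ∈ Icc 0 T, |f x t| ≤ F) →
    ∀ x ∈ closedBall x0 (R/2), ∀ y ∈ closedBall x0 (R/2), ∀ s ∈ Icc τ T,
      ∀ t ∈ Icc τ T, ‖x - y‖ ≤ δ → |s - t| ≤ δ → |u x s - u y t| ≤ θ := by
  obtain ⟨L, hL, hLip⟩ := Weak.lipschitz_space (n := n) (F := F) (B := B) hU hR hτ hτT hsub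
  set ε := min (R/2) (θ / (8 * (L + 1))) with hε
  have hε0 : 0 < ε := lt_min (by linarith) (by positivity)
  have hLε : L * ε ≤ θ / 8 := by
    calc L * ε ≤ (L + 1) * (θ / (8 * (L + 1))) := by
          apply mul_le_mul (by linarith) (min_le_right _ _) hε0.le (by linarith)
      _ = θ / 8 := by field_simp
  obtain ⟨κ, hκc, hκ, hκ0, hκ1⟩ := exists_mollifier (n := n) hε0
  have hκ2 : ContDiff ℝ 2 κ := hκc.of_le (WithTop.coe_le_coe.2 le_top)
  set C := B * (∫ z, |lap κ z|) + F with hC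
  have hC0 : 0 ≤ C := add_nonneg (mul_nonneg hB0 (integral_nonneg fun _ => abs_nonneg _)) hF0
  refine ⟨min (θ / (8 * (L + 1))) (θ / (8 * (C + 1))), lt_min (by positivity) (by positivity), ?_⟩
  intro u f h hB hF
  have hball : ∀ y ∈ closedBall x0 (R/2), closedBall y ε ⊆ closedBall x0 R :=
    fun y hy => closedBall_subset_closedBall' (by
      have := mem_closedBall.1 hy
      have := min_le_left (R/2) (θ / (8 * (L + 1)))
      linarith)
  have hR4 : closedBall x0 R ⊆ closedBall x0 (4*R) :=
    closedBall_subset_closedBall (by linarith)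
  have hmol : ∀ y ∈ closedBall x0 (R/2), ∀ s ∈ Icc τ T,
      |mol κ (fun z => u z s) y - u y s| ≤ θ / 8 := by
    intro y hy s hs
    refine abs_mol_sub_le hU (JC.slice h.cu ⟨hτ.le.trans hs.1, hs.2⟩) hκ0 hκc.continuous hκ1 hκ
      ((hball y hy).trans (hR4.trans hsub)) fun z hz => ?_
    refine (hLip u f h hB hF z (hball y hy hz) y (hball y hy (mem_closedBall_self hε0.le))
      s hs).trans (le_trans ?_ hLε)
    gcongr
    exact mem_closedBall_iff_norm.1 hz
  have htime : ∀ y ∈ closedBall x0 (R/2), ∀ s ∈ Icc τ T, ∀ t ∈ Icc τ T, s ≤ t →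
      |mol κ (fun z => u z t) y - mol κ (fun z => u z s) y| ≤ C * (t - s) := by
    intro y hy s hs t ht hst
    have hyi : y ∈ inner' U ε := (hball y hy).trans (hR4.trans hsub)
    refine norm_image_sub_le_of_norm_deriv_right_le_segment
      (f := fun t => mol κ (fun z => u z t) y) (a := s) (b := t)
      (f' := fun t => mol (lap κ) (fun z => u z t) y + mol κ (fun z => f z t) y)
      ?_ ?_ ?_ t ⟨hst, le_rfl⟩
    · exact ((jc_mol hU h.cu hκc.continuous hκ).time hyi).mono
        (Icc_subset_Icc (hτ.le.trans hs.1) ht.2)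
    · intro r hr
      exact (h.hasDerivAt_mol hU hκ2 hκ hyi
        ⟨by linarith [hs.1, hr.1], hr.2.trans_le ht.2⟩).hasDerivWithinAt
    · intro r hr
      have hr' : r ∈ Icc 0 T := ⟨by linarith [hs.1, hr.1], hr.2.le.trans ht.2⟩
      refine (norm_add_le _ _).trans (add_le_add ?_ ?_)
      · exact abs_mol_le_of_bdd_local hB0 (continuous_lap hκ2) (tsupport_lap_subset' hκ)
          fun z hz => hB z (hR4 (hball y hy hz)) r hr'
      · exact abs_mol_le hκ0 hκc.continuous hκ1 hκ
          fun z hz => hF z (hR4 (hball y hy hz)) r hr'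
  intro x hx y hy s hs t ht hxy hst
  have hRR : closedBall x0 (R/2) ⊆ closedBall x0 R :=
    closedBall_subset_closedBall (by linarith)
  have e1 : |u x s - u y s| ≤ θ / 8 := by
    refine (hLip u f h hB hF x (hRR hx) y (hRR hy) s hs).trans ?_
    calc L * ‖x - y‖ ≤ (L + 1) * (θ / (8 * (L + 1))) :=
          mul_le_mul (by linarith) (hxy.trans (min_le_left _ _)) (norm_nonneg _) (by linarith)
      _ = θ / 8 := by field_simp
  have e2 : |mol κ (fun z => u z t) y - mol κ (fun z => u z s) y| ≤ θ / 8 := by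
    have : C * |s - t| ≤ θ / 8 := by
      calc C * |s - t| ≤ (C + 1) * (θ / (8 * (C + 1))) :=
            mul_le_mul (by linarith) (hst.trans (min_le_right _ _)) (abs_nonneg _) (by linarith)
        _ = θ / 8 := by field_simp
    rcases le_total s t with hle | hle
    · refine (htime y hy s hs t ht hle).trans ?_
      rwa [abs_sub_comm, abs_of_nonneg (sub_nonneg.2 hle)] at this
    · rw [abs_sub_comm]
      refine (htime y hy t ht s hs hle).trans ?_
      rwa [abs_of_nonneg (sub_nonneg.2 hle)] at this
  have a1 := abs_le.1 e1
  have a2 := abs_le.1 e2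
  have a3 := abs_le.1 (hmol y hy s hs)
  have a4 := abs_le.1 (hmol y hy t ht)
  rw [abs_le]
  constructor <;> linarith [a1.1, a1.2, a2.1, a2.2, a3.1, a3.2, a4.1, a4.2]

/-- The nonlocal reaction term. -/
def NF (Ω : Set (Eu n)) (β a : Eu n → ℝ → ℝ) (r p : ℝ) (W : Eu n → ℝ → ℝ) (x : Eu n) (t : ℝ) : ℝ :=
  β x t * W x t + a x t * W x t ^ r * ∫ y in Ω, W y t ^ p

/-- The nonlocal boundary term. -/
def NG (Ω : Set (Eu n)) (k : Eu n → Eu n → ℝ → ℝ) (l : ℝ) (W : Eu n → ℝ → ℝ) (x : Eu n)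
    (t : ℝ) : ℝ :=
  ∫ y in Ω, k x y t * W y t ^ l

structure NL (Ω : Set (Eu n)) (β a : Eu n → ℝ → ℝ) (k : Eu n → Eu n → ℝ → ℝ) (Tm r p l : ℝ) :
    Prop where
  op : IsOpen Ω
  bdd : Bornology.IsBounded Ω
  cb : JC β (closure Ω) (Icc 0 Tm)
  ca : JC a (closure Ω) (Icc 0 Tm)
  b0 : ∀ x ∈ closure Ω, ∀ t ∈ Icc 0 Tm, 0 ≤ β x t
  a0 : ∀ x ∈ closure Ω, ∀ t ∈ Icc 0 Tm, 0 ≤ a x t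
  ck : ContinuousOn (fun z : (Eu n × Eu n) × ℝ => k z.1.1 z.1.2 z.2)
    ((frontier Ω ×ˢ closure Ω) ×ˢ Icc 0 Tm)
  k0 : ∀ x ∈ frontier Ω, ∀ y ∈ closure Ω, ∀ t ∈ Icc 0 Tm, 0 ≤ k x y t
  r0 : 0 < r
  p0 : 0 < p
  l0 : 0 < l

/-- Continuous in `Ω × I` with values in `[0, B]`. -/
structure Adm (Ω : Set (Eu n)) (I : Set ℝ) (B : ℝ) (W : Eu n → ℝ → ℝ) : Prop where
  jc : JC W Ω I
  nn : ∀ x ∈ Ω, ∀ t ∈ I, 0 ≤ W x t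
  le : ∀ x ∈ Ω, ∀ t ∈ I, W x t ≤ B

theorem rpow_continuousOn {α : Type*} [TopologicalSpace α] {s : Set α} {f : α → ℝ} (hq : 0 < q)
    (hf : ContinuousOn f s) : ContinuousOn (fun x => f x ^ q) s :=
  (Real.continuous_rpow_const hq.le).comp_continuousOn hf

theorem integrableOn_of_bdd (ho : IsOpen Ω) (hb : Bornology.IsBounded Ω) (hg : ContinuousOn g Ω)
    (hM : ∀ x ∈ Ω, |g x| ≤ M) :
    IntegrableOn g Ω := by
  refine IntegrableOn.of_bound hb.measure_lt_top
    (hg.aestronglyMeasurable ho.measurableSet) M ?_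
  exact (ae_restrict_iff' ho.measurableSet).2 (Eventually.of_forall hM)

theorem NL.finite (h : NL Ω β a k Tm r p l) : IsFiniteMeasure (volume.restrict Ω) :=
  ⟨by simpa using h.bdd.measure_lt_top⟩

theorem continuousOn_integral_rpow (ho : IsOpen Ω) (hb : Bornology.IsBounded Ω) (hW : Adm Ω I B W)
    (hq : 0 < q) :
    ContinuousOn (fun t => ∫ y in Ω, W y t ^ q) I := by
  have : IsFiniteMeasure (volume.restrict Ω) := ⟨by simpa using hb.measure_lt_top⟩
  refine continuousOn_of_dominated (bound := fun _ => B ^ q) ?_ ?_ (integrable_const _) ?_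
  · exact fun t ht => (rpow_continuousOn hq (JC.slice hW.jc ht)).aestronglyMeasurable
      ho.measurableSet
  · refine fun t ht => (ae_restrict_iff' ho.measurableSet).2 (Eventually.of_forall fun y hy => ?_)
    rw [Real.norm_of_nonneg (Real.rpow_nonneg (hW.nn y hy t ht) _)]
    exact Real.rpow_le_rpow (hW.nn y hy t ht) (hW.le y hy t ht) hq.le
  · refine (ae_restrict_iff' ho.measurableSet).2 (Eventually.of_forall fun y hy => ?_)
    exact rpow_continuousOn hq (JC.time hW.jc hy)

theorem integral_rpow_nonneg (ho : IsOpen Ω) (hW : Adm Ω I B W) (ht : t ∈ I) (q : ℝ) :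
    0 ≤ ∫ y in Ω, W y t ^ q :=
  setIntegral_nonneg ho.measurableSet fun y hy => Real.rpow_nonneg (hW.nn y hy t ht) _

theorem integral_rpow_le (ho : IsOpen Ω) (hb : Bornology.IsBounded Ω) (hW : Adm Ω I B W)
    (ht : t ∈ I) (hq : 0 < q) : ∫ y in Ω, W y t ^ q ≤ volume.real Ω * B ^ q := by
  have : IsFiniteMeasure (volume.restrict Ω) := ⟨by simpa using hb.measure_lt_top⟩
  calc _ ≤ ∫ _y in Ω, B ^ q := by
        refine setIntegral_mono_on ?_ (integrable_const _) ho.measurableSet fun y hy =>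
          Real.rpow_le_rpow (hW.nn y hy t ht) (hW.le y hy t ht) hq.le
        refine integrableOn_of_bdd (M := B ^ q) ho hb (rpow_continuousOn hq (JC.slice hW.jc ht))
          fun y hy => ?_
        rw [abs_of_nonneg (Real.rpow_nonneg (hW.nn y hy t ht) _)]
        exact Real.rpow_le_rpow (hW.nn y hy t ht) (hW.le y hy t ht) hq.le
    _ = _ := by rw [setIntegral_const, smul_eq_mul]

theorem NL.jc_NF (h : NL Ω β a k Tm r p l) (hI : I ⊆ Icc 0 Tm) (hW : Adm Ω I B W) :
    JC (NF Ω β a r p W) Ω I := by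
  have hb := JC.mono h.cb subset_closure hI
  have ha := JC.mono h.ca subset_closure hI
  have hi : ContinuousOn (fun z : Eu n × ℝ => ∫ y in Ω, W y z.2 ^ p) (Ω ×ˢ I) :=
    (continuousOn_integral_rpow h.op h.bdd hW h.p0).comp continuousOn_snd fun z hz => hz.2
  exact (hb.mul hW.jc).add ((ha.mul (rpow_continuousOn h.r0 hW.jc)).mul hi)

theorem NL.exists_coef_bound (h : NL Ω β a k Tm r p l) : ∃ A : ℝ, 0 ≤ A ∧
    (∀ x ∈ closure Ω, ∀ t ∈ Icc 0 Tm, β x t ≤ A ∧ a x t ≤ A) ∧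
    (∀ x ∈ frontier Ω, ∀ y ∈ closure Ω, ∀ t ∈ Icc 0 Tm, k x y t ≤ A) := by
  have hc : IsCompact (closure Ω) := h.bdd.isCompact_closure
  have hf : IsCompact (frontier Ω) := hc.of_isClosed_subset isClosed_frontier
    frontier_subset_closure
  obtain ⟨A1, h1⟩ := (hc.prod isCompact_Icc).exists_bound_of_continuousOn h.cb
  obtain ⟨A2, h2⟩ := (hc.prod isCompact_Icc).exists_bound_of_continuousOn h.ca
  obtain ⟨A3, h3⟩ := ((hf.prod hc).prod isCompact_Icc).exists_bound_of_continuousOn h.ck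
  refine ⟨max 0 (max A1 (max A2 A3)), le_max_left _ _, fun x hx t ht => ⟨?_, ?_⟩,
    fun x hx y hy t ht => ?_⟩
  · exact (le_abs_self _).trans ((h1 (x, t) ⟨hx, ht⟩).trans (by simp))
  · exact (le_abs_self _).trans ((h2 (x, t) ⟨hx, ht⟩).trans (by simp))
  · exact (le_abs_self _).trans ((h3 ((x, y), t) ⟨⟨hx, hy⟩, ht⟩).trans (by simp))

theorem NL.NF_nonneg (h : NL Ω β a k Tm r p l) (hI : I ⊆ Icc 0 Tm) (hW : Adm Ω I B W) (hx : x ∈ Ω)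
    (ht : t ∈ I) :
    0 ≤ NF Ω β a r p W x t := by
  have h1 := h.b0 x (subset_closure hx) t (hI ht)
  have h2 := h.a0 x (subset_closure hx) t (hI ht)
  have h3 := hW.nn x hx t ht
  have h4 := integral_rpow_nonneg h.op hW ht p
  unfold NF
  positivity

theorem NL.exists_NF_bound (h : NL Ω β a k Tm r p l) (hB : 0 ≤ B) :
    ∃ C : ℝ, 0 ≤ C ∧ ∀ I : Set ℝ, I ⊆ Icc 0 Tm → ∀ W, Adm Ω I B W →
      ∀ x ∈ Ω, ∀ t ∈ I, |NF Ω β a r p W x t| ≤ C := by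
  obtain ⟨A, hA, hA1, -⟩ := h.exists_coef_bound
  refine ⟨A * B + A * B ^ r * (volume.real Ω * B ^ p), by positivity, ?_⟩
  intro I hI W hW x hx t ht
  rw [abs_of_nonneg (h.NF_nonneg hI hW hx ht)]
  have h1 := h.b0 x (subset_closure hx) t (hI ht)
  have h2 := h.a0 x (subset_closure hx) t (hI ht)
  have h3 := hW.nn x hx t ht
  have h4 := integral_rpow_nonneg h.op hW ht p
  have h5 := hA1 x (subset_closure hx) t (hI ht)
  unfold NF
  gcongr
  · exact h5.1
  · exact hW.le x hx t ht
  · exact h5.2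
  · exact h.r0.le
  · exact hW.le x hx t ht
  · exact integral_rpow_le h.op h.bdd hW ht h.p0

theorem NL.k_slice (h : NL Ω β a k Tm r p l) (hx : x ∈ frontier Ω) (ht : t ∈ Icc 0 Tm) :
    ContinuousOn (fun y => k x y t) Ω :=
  h.ck.comp (f := fun y => ((x, y), t)) (by fun_prop) fun _ hy => ⟨⟨hx, subset_closure hy⟩, ht⟩

theorem NL.continuousOn_NG (h : NL Ω β a k Tm r p l) (hI : I ⊆ Icc 0 Tm) (hW : Adm Ω I B W) :
    ContinuousOn (fun z : Eu n × ℝ => NG Ω k l W z.1 z.2) (frontier Ω ×ˢ I) := by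
  have := h.finite
  obtain ⟨A, hA, -, hA2⟩ := h.exists_coef_bound
  refine continuousOn_of_dominated (bound := fun _ => A * B ^ l) ?_ ?_ (integrable_const _) ?_
  · exact fun z hz => ((h.k_slice hz.1 (hI hz.2)).mul (rpow_continuousOn h.l0
      (JC.slice hW.jc hz.2))).aestronglyMeasurable h.op.measurableSet
  · refine fun z hz => (ae_restrict_iff' h.op.measurableSet).2
      (Eventually.of_forall fun y hy => ?_)
    have h1 := h.k0 z.1 hz.1 y (subset_closure hy) z.2 (hI hz.2)
    have h2 := hW.nn y hy z.2 hz.2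
    rw [Real.norm_of_nonneg (mul_nonneg h1 (Real.rpow_nonneg h2 _))]
    gcongr
    · exact hA2 z.1 hz.1 y (subset_closure hy) z.2 (hI hz.2)
    · exact h.l0.le
    · exact hW.le y hy z.2 hz.2
  · refine (ae_restrict_iff' h.op.measurableSet).2 (Eventually.of_forall fun y hy => ?_)
    refine ContinuousOn.mul ?_ (rpow_continuousOn h.l0 ?_)
    · exact h.ck.comp (f := fun z : Eu n × ℝ => ((z.1, y), z.2)) (by fun_prop)
        fun z hz => ⟨⟨hz.1, subset_closure hy⟩, hI hz.2⟩
    · exact (JC.time hW.jc hy).comp continuousOn_snd fun z hz => hz.2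

theorem NL.NG_nonneg (h : NL Ω β a k Tm r p l) (hI : I ⊆ Icc 0 Tm) (hW : Adm Ω I B W)
    (hx : x ∈ frontier Ω) (ht : t ∈ I) :
    0 ≤ NG Ω k l W x t :=
  setIntegral_nonneg h.op.measurableSet fun y hy =>
    mul_nonneg (h.k0 x hx y (subset_closure hy) t (hI ht)) (Real.rpow_nonneg (hW.nn y hy t ht) _)

theorem NF_congr (ho : IsOpen Ω) (hWW : ∀ x ∈ Ω, W x t = W' x t) (hx : x ∈ Ω) :
    NF Ω β a r p W x t = NF Ω β a r p W' x t := by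
  unfold NF
  rw [hWW x hx, setIntegral_congr_fun ho.measurableSet fun y hy => by
    show W y t ^ p = W' y t ^ p; rw [hWW y hy]]

theorem NG_congr (ho : IsOpen Ω) (hWW : ∀ x ∈ Ω, W x t = W' x t) (x : Eu n) :
    NG Ω k l W x t = NG Ω k l W' x t := by
  unfold NG
  exact setIntegral_congr_fun ho.measurableSet fun y hy => by
    show k x y t * W y t ^ l = k x y t * W' y t ^ l; rw [hWW y hy]

/-- The sublevel layers of the barrier inside `Ω` have small measure. -/
theorem Bar.exists_vol_small (hB : Bar Ω lam f) (hη : 0 < η) :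
    ∃ c > 0, volume.real (Ω ∩ {x | f x < c}) ≤ η := by
  have ht : Tendsto (fun m : ℕ => volume (Ω ∩ {x | f x < 1 / ((m:ℝ) + 1)})) atTop
      (nhds (volume (⋂ m : ℕ, Ω ∩ {x | f x < 1 / ((m:ℝ) + 1)}))) := by
    refine tendsto_measure_iInter_atTop (fun m => ?_) ?_ ⟨0, ?_⟩
    · exact (hB.op.inter (isOpen_lt hB.cont continuous_const)).measurableSet.nullMeasurableSet
    · intro m m' hm x hx
      have h2 : f x < 1 / ((m':ℝ) + 1) := hx.2
      have h3 : 1 / ((m':ℝ) + 1) ≤ 1 / ((m:ℝ) + 1) := by gcongr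
      exact ⟨hx.1, show f x < 1 / ((m:ℝ) + 1) from h2.trans_le h3⟩
    · exact ((measure_mono inter_subset_left).trans_lt hB.bdd.measure_lt_top).ne
  have he : (⋂ m : ℕ, Ω ∩ {x | f x < 1 / ((m:ℝ) + 1)}) = ∅ := by
    refine eq_empty_of_forall_notMem fun x hx => ?_
    rw [mem_iInter] at hx
    obtain ⟨m, hm⟩ := exists_nat_one_div_lt (hB.pos x (hx 0).1)
    exact lt_asymm hm (hx m).2
  rw [he, measure_empty] at ht
  obtain ⟨m, hm⟩ := (ht.eventually (gt_mem_nhds (ENNReal.ofReal_pos.2 hη))).exists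
  refine ⟨1 / ((m:ℝ) + 1), by positivity, ?_⟩
  exact ENNReal.toReal_le_of_le_ofReal hη.le hm.le

/-- Continuity modulus for integrals of powers of bounded functions, uniform on compacts. -/
theorem Bar.exists_modulus (hB : Bar Ω lam f) (hq : 0 < q) (hB0 : 0 ≤ B) (hη : 0 < η) :
    ∃ c > 0, ∃ γ > 0, ∀ W W' : Eu n → ℝ, ContinuousOn W Ω → ContinuousOn W' Ω →
      (∀ x ∈ Ω, W x ∈ Icc 0 B) → (∀ x ∈ Ω, W' x ∈ Icc 0 B) →
      (∀ x ∈ Ω, c ≤ f x → |W x - W' x| ≤ γ) →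
      ∫ x in Ω, |W x ^ q - W' x ^ q| ≤ η := by
  have hfin : IsFiniteMeasure (volume.restrict Ω) := ⟨by simpa using hB.bdd.measure_lt_top⟩
  set V := volume.real Ω
  have hV : 0 ≤ V := measureReal_nonneg
  obtain ⟨c, hc, hvol⟩ := hB.exists_vol_small (η := η / (2 * (B ^ q + 1))) (by positivity)
  have huc : UniformContinuousOn (fun s : ℝ => s ^ q) (Icc 0 B) :=
    isCompact_Icc.uniformContinuousOn_of_continuous (rpow_continuousOn hq continuousOn_id)
  obtain ⟨γ, hγ, hu⟩ := uniformContinuousOn_iff.1 huc (η / (2 * (V + 1))) (by positivity)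
  refine ⟨c, hc, γ / 2, half_pos hγ, fun W W' hW hW' hWB hWB' hWW => ?_⟩
  have hm : MeasurableSet (Ω ∩ {x | f x < c}) :=
    (hB.op.inter (isOpen_lt hB.cont continuous_const)).measurableSet
  have hpt : ∀ x ∈ Ω, |W x ^ q - W' x ^ q| ≤
      η / (2 * (V + 1)) + (Ω ∩ {x | f x < c}).indicator (fun _ => B ^ q) x := by
    intro x hx
    have h1 := hWB x hx
    have h2 := hWB' x hx
    by_cases hxc : f x < c
    · rw [indicator_of_mem (show x ∈ Ω ∩ {x | f x < c} from ⟨hx, hxc⟩)]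
      have e1 := Real.rpow_nonneg h1.1 q
      have e2 := Real.rpow_nonneg h2.1 q
      have e3 := Real.rpow_le_rpow h1.1 h1.2 hq.le
      have e4 := Real.rpow_le_rpow h2.1 h2.2 hq.le
      have e5 : 0 ≤ η / (2 * (V + 1)) := by positivity
      rw [abs_le]; constructor <;> linarith
    · rw [indicator_of_notMem (fun h => hxc h.2), add_zero]
      have := hu (W x) h1 (W' x) h2 (by
        rw [Real.dist_eq]
        exact (hWW x hx (not_lt.1 hxc)).trans_lt (half_lt_self hγ))
      rw [Real.dist_eq] at this
      exact this.le
  have hind : Integrable ((Ω ∩ {x | f x < c}).indicator (fun _ => B ^ q)) (volume.restrict Ω) :=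
    (integrable_const _).indicator hm
  calc _ ≤ ∫ x in Ω, (η / (2 * (V + 1))
        + (Ω ∩ {x | f x < c}).indicator (fun _ => B ^ q) x) := by
        refine setIntegral_mono_on ?_ ((integrable_const _).add hind) hB.op.measurableSet hpt
        refine integrableOn_of_bdd (M := η / (2 * (V + 1)) + B ^ q) hB.op hB.bdd
          ((rpow_continuousOn hq hW).sub (rpow_continuousOn hq hW')).abs fun x hx => ?_
        rw [abs_abs]
        refine (hpt x hx).trans ?_
        gcongr
        exact indicator_le_self' (fun _ _ => by positivity) x
    _ = V * (η / (2 * (V + 1))) + volume.real (Ω ∩ {x | f x < c}) * B ^ q := by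
        rw [integral_add (integrable_const _) hind, integral_indicator hm, setIntegral_const,
          Measure.restrict_restrict hm, setIntegral_const, smul_eq_mul, smul_eq_mul,
          inter_eq_left.2 (inter_subset_left : Ω ∩ {x | f x < c} ⊆ Ω)]
    _ ≤ (V + 1) * (η / (2 * (V + 1))) + η / (2 * (B ^ q + 1)) * (B ^ q + 1) := by
        gcongr <;> linarith
    _ = η := by field_simp; ring

theorem Bar.contDiff_cut (hB : Bar Ω lam f) (hε : 0 < ε) : ContDiff ℝ 2 (cut f ε) := by
  rw [contDiff_iff_contDiffAt]
  intro x
  by_cases hx : x ∈ Ω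
  · exact (contDiff_eta1 (m := 2) (WithTop.coe_le_coe.2 le_top)).contDiffAt.comp x
      ((hB.c2 x hx).div_const ε)
  · refine (contDiffAt_const (c := (0:ℝ))).congr_of_eventuallyEq ?_
    filter_upwards [hB.cont.continuousAt.eventually_lt continuousAt_const
      (show f x < ε by rw [hB.zero x hx]; exact hε)] with y hy
    exact cut_eq_zero hε hy.le

/-- Short-time interior bound, insensitive to the boundary values. -/
theorem Bar.interior_bound (hB : Bar Ω lam f) (hc : 0 < c) (hB0 : 0 ≤ B) (hC : 0 ≤ C) :
    ∃ D : ℝ, 0 ≤ D ∧ ∀ (M t0 t1 : ℝ) (w g : Eu n → ℝ → ℝ), 0 ≤ M → Weak Ω t0 t1 w g →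
      JC w (closure Ω) (Icc t0 t1) → (∀ x ∈ Ω, ∀ t ∈ Icc t0 t1, g x t ≤ C) →
      (∀ x ∈ closure Ω, w x t0 ≤ M) → (∀ x ∈ frontier Ω, ∀ t ∈ Icc t0 t1, w x t ≤ B) →
      ∀ x, c ≤ f x → ∀ t ∈ Icc t0 t1, w x t ≤ M + D * (t - t0) := by
  have hε : 0 < c / 2 := half_pos hc
  have hχ := hB.contDiff_cut hε
  set χ := cut f (c / 2)
  obtain ⟨L, hL⟩ := (hB.bdd.isCompact_closure).exists_bound_of_continuousOn
    (continuous_lap hχ).continuousOn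
  set D := C + B * max L 0
  have hD : 0 ≤ D := by positivity
  refine ⟨D, hD, fun M t0 t1 w g hM hw hcw hg h0 h1 x hx t ht => ?_⟩
  have hxΩ : x ∈ Ω := hB.ge_subset hc hx
  have hcd : ∀ s, ContDiff ℝ 2 fun y => (-(M + B - D * t0) + -D * s) + B * χ y := fun s =>
    contDiff_const.add (contDiff_const.mul hχ)
  have key := comparison hB.op hB.bdd
    (v1 := fun y s => (-(M + B - D * t0) + -D * s) + B * χ y) (v2 := w)
    (h1 := fun y s => -D - B * lap χ y) (h2 := g) (t0 := t0) (t1 := t1) ?_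
    (fun y _ s _ => (hcd s).contDiffAt) ?_ hw ?_ ?_ ?_ x (subset_closure hxΩ) t ht
  · have : χ x = 1 := cut_eq_one hε (by linarith)
    rw [this] at key
    linarith
  · exact ContinuousOn.add (Continuous.continuousOn (by have := hχ.continuous; fun_prop)) hcw
  · intro y hy s hs
    have e : lap (fun z => (-(M + B - D * t0) + -D * s) + B * χ z) y = B * lap χ y := by
      rw [lap_add contDiffAt_const (contDiffAt_const.mul hχ.contDiffAt), lap_const,
        lap_const_mul B hχ.contDiffAt, zero_add]
    rw [e]
    refine ((hasDerivAt_lin (-(M + B - D * t0)) (-D) s).add_const (B * χ y)).congr_deriv (by ring)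
  · intro y hy s hs _
    have e1 := hg y hy s (Ioo_subset_Icc_self hs)
    have e2 := hL y (subset_closure hy)
    rw [Real.norm_eq_abs, abs_le] at e2
    have e3 : -lap χ y ≤ max L 0 := le_trans (by linarith [e2.1]) (le_max_left _ _)
    have := mul_le_mul_of_nonneg_left e3 hB0
    simp only [D]
    linarith
  · intro y hy
    have e1 := h0 y hy
    have e2 : χ y ≤ 1 := cut_le_one y
    nlinarith
  · intro y hy s hs
    have e1 := h1 y hy s hs
    have e2 : χ y = 0 := cut_eq_zero hε (by
      rw [hB.zero y (by rw [hB.op.frontier_eq] at hy; exact hy.2)]; exact hε.le)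
    rw [e2]
    nlinarith [mul_nonneg hD (sub_nonneg.2 hs.1)]

/-- Bound for the nonlocal boundary term from a good bound away from the boundary. -/
theorem NL.NG_le (h : NL Ω β a k Tm r p l) (hA : 0 ≤ A)
    (hk : ∀ x ∈ frontier Ω, ∀ y ∈ closure Ω, ∀ t ∈ Icc 0 Tm, k x y t ≤ A) (hf : Continuous f)
    (hI : I ⊆ Icc 0 Tm) (hW : Adm Ω I B W) (hM : 0 ≤ M) (hB : 0 ≤ B) (ht : t ∈ I)
    (hWM : ∀ x, c ≤ f x → x ∈ Ω → W x t ≤ M) (hx : x ∈ frontier Ω) :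
    NG Ω k l W x t ≤ A * volume.real Ω * M ^ l + A * B ^ l * volume.real (Ω ∩ {x | f x < c}) := by
  have hfin := h.finite
  have hl := h.l0.le
  have hm : MeasurableSet (Ω ∩ {x | f x < c}) :=
    (h.op.inter (isOpen_lt hf continuous_const)).measurableSet
  have hind : Integrable ((Ω ∩ {x | f x < c}).indicator (fun _ => A * B ^ l))
      (volume.restrict Ω) := (integrable_const _).indicator hm
  have hpt : ∀ y ∈ Ω, k x y t * W y t ^ l ≤
      A * M ^ l + (Ω ∩ {x | f x < c}).indicator (fun _ => A * B ^ l) y := by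
    intro y hy
    have e1 := hk x hx y (subset_closure hy) t (hI ht)
    have e2 := hW.nn y hy t ht
    have e0 := h.k0 x hx y (subset_closure hy) t (hI ht)
    by_cases hyc : f y < c
    · rw [indicator_of_mem (show y ∈ Ω ∩ {x | f x < c} from ⟨hy, hyc⟩)]
      have : k x y t * W y t ^ l ≤ A * B ^ l := by
        gcongr
        exact hW.le y hy t ht
      have : 0 ≤ A * M ^ l := by positivity
      linarith
    · rw [indicator_of_notMem (fun h => hyc h.2), add_zero]
      gcongr
      exact hWM y (not_lt.1 hyc) hy
  calc NG Ω k l W x t ≤ ∫ y in Ω, (A * M ^ l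
        + (Ω ∩ {x | f x < c}).indicator (fun _ => A * B ^ l) y) := by
        refine setIntegral_mono_on ?_ ((integrable_const _).add hind) h.op.measurableSet hpt
        refine integrableOn_of_bdd (M := A * B ^ l) h.op h.bdd
          ((h.k_slice hx (hI ht)).mul (rpow_continuousOn h.l0 (JC.slice hW.jc ht))) fun y hy => ?_
        have e1 := hk x hx y (subset_closure hy) t (hI ht)
        have e2 := hW.nn y hy t ht
        have e0 := h.k0 x hx y (subset_closure hy) t (hI ht)
        rw [abs_of_nonneg (by positivity)]
        gcongr
        exact hW.le y hy t ht
    _ = _ := by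
        rw [integral_add (integrable_const _) hind, integral_indicator hm, setIntegral_const,
          Measure.restrict_restrict hm, setIntegral_const, smul_eq_mul, smul_eq_mul,
          inter_eq_left.2 (inter_subset_left : Ω ∩ {x | f x < c} ⊆ Ω)]
        ring

/-- Constants controlling the growth of solutions on a short time interval. -/
structure Ctl (Ω : Set (Eu n)) (β a : Eu n → ℝ → ℝ) (k : Eu n → Eu n → ℝ → ℝ) (Tm r p l : ℝ)
    (f : Eu n → ℝ) (M B c τ : ℝ) : Prop where
  M0 : 0 ≤ M
  MB : M + 1 < B
  c0 : 0 < c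
  τ0 : 0 < τ
  inner : ∀ t0 t1, 0 ≤ t0 → t1 ≤ Tm → t1 ≤ t0 + τ → ∀ W w : Eu n → ℝ → ℝ,
    Adm Ω (Icc t0 t1) B W → Weak Ω t0 t1 w (NF Ω β a r p W) → JC w (closure Ω) (Icc t0 t1) →
    (∀ x ∈ closure Ω, w x t0 ≤ M) → (∀ x ∈ frontier Ω, ∀ t ∈ Icc t0 t1, w x t ≤ B) →
    ∀ x, c ≤ f x → ∀ t ∈ Icc t0 t1, w x t ≤ M + 1
  outer : ∀ t0 t1, 0 ≤ t0 → t1 ≤ Tm → t1 ≤ t0 + τ → ∀ W w : Eu n → ℝ → ℝ,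
    Adm Ω (Icc t0 t1) B W → Weak Ω t0 t1 w (NF Ω β a r p W) → JC w (closure Ω) (Icc t0 t1) →
    (∀ x ∈ closure Ω, w x t0 ≤ M) →
    (∀ x ∈ frontier Ω, ∀ t ∈ Icc t0 t1, w x t = NG Ω k l W x t) →
    (∀ x, c ≤ f x → ∀ t ∈ Icc t0 t1, W x t ≤ M + 1) →
    ∀ x ∈ closure Ω, ∀ t ∈ Icc t0 t1, w x t ≤ B - 1

theorem NL.exists_ctl (h : NL Ω β a k Tm r p l) (hb : Bar Ω lam f) (hM : 0 ≤ M) :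
    ∃ B c τ, Ctl Ω β a k Tm r p l f M B c τ := by
  obtain ⟨A, hA, -, hk⟩ := h.exists_coef_bound
  set B := M + A * volume.real Ω * (M + 1) ^ l + 3 with hBdef
  have hV : 0 ≤ volume.real Ω := measureReal_nonneg
  have hB0 : 0 ≤ B := by positivity
  obtain ⟨c, hc, hvol⟩ := hb.exists_vol_small (η := 1 / (A * B ^ l + 1)) (by positivity)
  obtain ⟨C, hC, hNF⟩ := h.exists_NF_bound hB0
  obtain ⟨D, hD, hitg⟩ := hb.interior_bound hc hB0 hC
  have hτ : 0 < 1 / (C + D + 1) := by positivity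
  have hsub : ∀ {t0 t1 : ℝ}, 0 ≤ t0 → t1 ≤ Tm → Icc t0 t1 ⊆ Icc 0 Tm := fun h0 h1 =>
    Icc_subset_Icc h0 h1
  have hsm : ∀ {E s : ℝ}, 0 ≤ E → E ≤ C + D → s ≤ 1 / (C + D + 1) → E * s ≤ 1 := by
    intro E s h1 h2 h3
    calc E * s ≤ (C + D + 1) * (1 / (C + D + 1)) := by
          refine (mul_le_mul_of_nonneg_left h3 h1).trans ?_
          exact mul_le_mul_of_nonneg_right (by linarith) hτ.le
      _ = 1 := by field_simp
  refine ⟨B, c, 1 / (C + D + 1), hM, ?_, hc, hτ, ?_, ?_⟩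
  · have : 0 ≤ A * volume.real Ω * (M + 1) ^ l := by positivity
    linarith
  · intro t0 t1 h0 h1 h2 W w hW hw hcw hw0 hwB x hx t ht
    refine (hitg M t0 t1 w _ hM hw hcw (fun y hy s hs => (le_abs_self _).trans
      (hNF _ (hsub h0 h1) W hW y hy s hs)) hw0 hwB x hx t ht).trans ?_
    have := hsm hD (by linarith) (show t - t0 ≤ 1 / (C + D + 1) by linarith [ht.2])
    linarith
  · intro t0 t1 h0 h1 h2 W w hW hw hcw hw0 hwG hWM x hx t ht
    refine (hw.le_of_bdry hb.op hb.bdd (c := B - 2) hcw (fun y hy s hs => (le_abs_self _).trans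
      (hNF _ (hsub h0 h1) W hW y hy s (Ioo_subset_Icc_self hs))) hC (fun y hy => ?_)
      (fun y hy s hs => ?_) x hx t ht).trans ?_
    · have : 0 ≤ A * volume.real Ω * (M + 1) ^ l := by positivity
      linarith [hw0 y hy]
    · rw [hwG y hy s hs]
      refine (h.NG_le hA hk hb.cont (hsub h0 h1) hW (M := M + 1) (c := c) (by linarith) hB0 hs
        (fun z hz _ => hWM z hz s hs) hy).trans ?_
      have : A * B ^ l * volume.real (Ω ∩ {x | f x < c}) ≤ 1 := by
        calc _ ≤ (A * B ^ l + 1) * (1 / (A * B ^ l + 1)) := by gcongr; linarith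
          _ = 1 := by field_simp
      linarith
    · have := hsm hC (by linarith) (show t - t0 ≤ 1 / (C + D + 1) by linarith [ht.2])
      linarith

/-- Nonnegative weak solution of the linear problem whose data are computed from `W`. -/
structure LSol (Ω : Set (Eu n)) (β a : Eu n → ℝ → ℝ) (k : Eu n → Eu n → ℝ → ℝ) (r p l T : ℝ)
    (W w : Eu n → ℝ → ℝ) : Prop where
  jc : JC w (closure Ω) (Icc 0 T)
  nn : ∀ x ∈ closure Ω, ∀ t ∈ Icc 0 T, 0 ≤ w x t
  weak : Weak Ω 0 T w (NF Ω β a r p W)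
  bdry : ∀ x ∈ frontier Ω, ∀ t ∈ Icc 0 T, w x t = NG Ω k l W x t

theorem LSol.mono {w : Eu n → ℝ → ℝ} (h : LSol Ω β a k r p l T W w) (hT : T' ≤ T) :
    LSol Ω β a k r p l T' W w :=
  have hs : Icc 0 T' ⊆ Icc 0 T := Icc_subset_Icc_right hT
  ⟨JC.mono h.jc Subset.rfl hs, fun x hx t ht => h.nn x hx t (hs ht),
    h.weak.mono Subset.rfl le_rfl hT, fun x hx t ht => h.bdry x hx t (hs ht)⟩

theorem LSol.congr_data (ho : IsOpen Ω) {w : Eu n → ℝ → ℝ} (h : LSol Ω β a k r p l T W w)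
    (hW : ∀ x ∈ Ω, ∀ t ∈ Icc 0 T, W' x t = W x t) :
    LSol Ω β a k r p l T W' w :=
  ⟨h.jc, h.nn, h.weak.congr (fun _ _ _ _ => rfl) fun x hx t ht =>
    NF_congr ho (fun y hy => hW y hy t ht) hx, fun x hx t ht => by
      rw [h.bdry x hx t ht, NG_congr ho (fun y hy => hW y hy t ht) x]⟩

theorem LSol.adm {w : Eu n → ℝ → ℝ} (h : LSol Ω β a k r p l T W w) (hI : I ⊆ Icc 0 T)
    (hB : ∀ x ∈ Ω, ∀ t ∈ I, w x t ≤ B) : Adm Ω I B w :=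
  ⟨JC.mono h.jc subset_closure hI, fun x hx t ht => h.nn x (subset_closure hx) t (hI ht), hB⟩

theorem LSol.unique (ho : IsOpen Ω) (hb : Bornology.IsBounded Ω) {w w' : Eu n → ℝ → ℝ}
    (h : LSol Ω β a k r p l T W w) (h' : LSol Ω β a k r p l T W' w')
    (hW : ∀ x ∈ Ω, ∀ t ∈ Icc 0 T, W x t = W' x t) (h0 : ∀ x ∈ closure Ω, w x 0 = w' x 0) :
    ∀ x ∈ closure Ω, ∀ t ∈ Icc 0 T, w x t = w' x t := by
  intro x hx t ht
  have := (h.weak.sub ho h'.weak).abs_le_of_bdry ho hb (c := 0) (m := 0) (ContinuousOn.sub h.jc h'.jc)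
    (fun y hy s hs => by
      rw [NF_congr ho (fun z hz => hW z hz s (Ioo_subset_Icc_self hs)) hy, sub_self, abs_zero])
    le_rfl (fun y hy => by rw [h0 y hy, sub_self, abs_zero]) (fun y hy s hs => by
      rw [h.bdry y hy s hs, h'.bdry y hy s hs, NG_congr ho (fun z hz => hW z hz s hs), sub_self,
        abs_zero]) x hx t ht
  rw [zero_mul, add_zero] at this
  exact sub_eq_zero.1 (abs_nonpos_iff.1 this)

theorem NL.exists_sol (h : NL Ω β a k Tm r p l) (hb : Bar Ω lam f) (hT : 0 ≤ T) (hTm : T ≤ Tm)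
    (hB : 0 ≤ B) (hW : Adm Ω (Icc 0 T) B W) (hu0 : ContinuousOn u0 (closure Ω))
    (hu0' : ∀ x ∈ closure Ω, 0 ≤ u0 x) (hcomp : ∀ x ∈ frontier Ω, u0 x = NG Ω k l W x 0) :
    ∃ w, LSol Ω β a k r p l T W w ∧ ∀ x ∈ closure Ω, w x 0 = u0 x := by
  classical
  have hI : Icc 0 T ⊆ Icc 0 Tm := Icc_subset_Icc_right hTm
  obtain ⟨C, hC, hNF⟩ := h.exists_NF_bound hB
  set G : Eu n → ℝ → ℝ := fun x t => if x ∈ frontier Ω then NG Ω k l W x t else u0 x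
  have h0T : (0:ℝ) ∈ Icc 0 T := ⟨le_rfl, hT⟩
  have hG0 : ∀ x, G x 0 = u0 x := by
    intro x
    by_cases hx : x ∈ frontier Ω
    · simp only [G, if_pos hx]; exact (hcomp x hx).symm
    · simp only [G, if_neg hx]
  have hGc : ContinuousOn (fun z : Eu n × ℝ => G z.1 z.2) (PB Ω 0 T) := by
    have e : PB Ω 0 T ⊆ closure Ω ×ˢ {0} ∪ frontier Ω ×ˢ Icc 0 T := by
      rintro z ⟨h1, h2, h3 | h3⟩
      · exact Or.inl ⟨h1, h3⟩
      · exact Or.inr ⟨h3, h2⟩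
    refine ContinuousOn.mono (ContinuousOn.union_of_isClosed ?_ ?_
      (isClosed_closure.prod isClosed_singleton) (isClosed_frontier.prod isClosed_Icc)) e
    · refine (hu0.comp continuousOn_fst fun z hz => hz.1).congr fun z hz => ?_
      have hz2 : z.2 = 0 := hz.2
      show G z.1 z.2 = u0 z.1
      rw [hz2, hG0]
    · exact (h.continuousOn_NG hI hW).congr fun z hz => if_pos hz.1
  obtain ⟨v, hv, hvG, hvw⟩ := hb.exists_data hT (h.jc_NF hI hW)
    (fun x hx t ht => hNF _ hI W hW x hx t ht) hGc
  have hv0 : ∀ x ∈ closure Ω, v x 0 = u0 x := fun x hx => by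
    rw [hvG (x, 0) ⟨hx, h0T, Or.inl rfl⟩, hG0]
  have hvb : ∀ x ∈ frontier Ω, ∀ t ∈ Icc 0 T, v x t = NG Ω k l W x t := fun x hx t ht => by
    rw [hvG (x, t) ⟨frontier_subset_closure hx, ht, Or.inr hx⟩]
    exact if_pos hx
  refine ⟨v, ⟨hv, fun x hx t ht => ?_, hvw, hvb⟩, hv0⟩
  have := hvw.neg.le_of_bdry h.op h.bdd (c := 0) (m := 0) (ContinuousOn.neg hv)
    (fun y hy s hs => neg_nonpos.2 (h.NF_nonneg hI hW hy (Ioo_subset_Icc_self hs))) le_rfl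
    (fun y hy => neg_nonpos.2 (by rw [hv0 y hy]; exact hu0' y hy))
    (fun y hy s hs => neg_nonpos.2 (by rw [hvb y hy s hs]; exact h.NG_nonneg hI hW hy hs)) x hx t ht
  linarith

/-- A solution bounded by `M` at time `t0` stays below `B` on `[t0, t0 + τ]`. -/
theorem LSol.le_of_ctl (hb : Bornology.IsBounded Ω) (hc : Ctl Ω β a k Tm r p l f M B c τ)
    (hu : LSol Ω β a k r p l T u u) (ht0 : 0 ≤ t0) (hTm : T ≤ Tm) (hTτ : T ≤ t0 + τ)
    (hM : ∀ x ∈ closure Ω, u x t0 ≤ M) :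
    ∀ x ∈ closure Ω, ∀ t ∈ Icc t0 T, u x t < B := by
  by_contra! hcon
  obtain ⟨x1, hx1, s1, hs1, hus1⟩ := hcon
  have hsub : Icc t0 T ⊆ Icc 0 T := Icc_subset_Icc_left ht0
  have hjc := JC.mono hu.jc (Subset.refl _) hsub
  set S := {z : Eu n × ℝ | z ∈ closure Ω ×ˢ Icc t0 T ∧ B ≤ u z.1 z.2}
  have hScl : IsCompact S := by
    have hK : IsCompact (closure Ω ×ˢ Icc t0 T) := hb.isCompact_closure.prod isCompact_Icc
    exact hK.of_isClosed_subset
      (hjc.preimage_isClosed_of_isClosed hK.isClosed isClosed_Ici) fun z hz => hz.1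
  obtain ⟨z, hzS, hzmin⟩ := hScl.exists_isMinOn ⟨(x1, s1), ⟨hx1, hs1⟩, hus1⟩
    (continuous_snd.continuousOn (s := S))
  obtain ⟨⟨hz1, hz2⟩, hz3⟩ := hzS
  have htz : t0 < z.2 := by
    rcases eq_or_lt_of_le hz2.1 with h | h
    · rw [← h] at hz3
      linarith [hM z.1 hz1, hc.MB]
    · exact h
  have hlt : ∀ x ∈ closure Ω, ∀ t ∈ Ico t0 z.2, u x t ≤ B := by
    intro x hx t ht
    by_contra! hgt
    have hmem : (x, t) ∈ S := ⟨⟨hx, ht.1, ht.2.le.trans hz2.2⟩, hgt.le⟩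
    have : z.2 ≤ t := hzmin hmem
    linarith [ht.2]
  have hle : ∀ x ∈ closure Ω, ∀ t ∈ Icc t0 z.2, u x t ≤ B := by
    intro x hx t ht
    have hcl := closure_Ico htz.ne
    have hcx := (JC.time hjc hx).mono (Icc_subset_Icc_right hz2.2)
    rw [← hcl] at hcx ht
    exact le_on_closure (fun s hs => hlt x hx s hs) hcx continuousOn_const ht
  have hsub2 : Icc t0 z.2 ⊆ Icc 0 T := fun s hs => ⟨ht0.trans hs.1, hs.2.trans hz2.2⟩
  have hadm : Adm Ω (Icc t0 z.2) B u := hu.adm hsub2 fun x hx t ht => hle x (subset_closure hx) t ht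
  have hw := hu.weak.mono (Subset.refl _) ht0 hz2.2
  have hj := JC.mono hu.jc (Subset.refl _) hsub2
  have h1 := hc.inner t0 z.2 ht0 (hz2.2.trans hTm) (hz2.2.trans hTτ) u u hadm hw hj hM
    fun x hx t ht => hle x (frontier_subset_closure hx) t ht
  have h2 := hc.outer t0 z.2 ht0 (hz2.2.trans hTm) (hz2.2.trans hTτ) u u hadm hw hj hM
    (fun x hx t ht => hu.bdry x hx t (hsub2 ht)) h1 z.1 hz1 z.2 ⟨htz.le, le_rfl⟩
  linarith

/-- The delay map: the identity up to `s`, then lagging behind by at most `δ`. -/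
def lag (s δ t : ℝ) : ℝ := max (min t s) (t - δ)

theorem continuous_lag (s δ : ℝ) : Continuous (lag s δ) := by unfold lag; fun_prop

theorem lag_of_le (hδ : 0 ≤ δ) (ht : t ≤ s) : lag s δ t = t := by
  unfold lag; rw [min_eq_left ht, max_eq_left (by linarith)]

theorem lag_le (hδ : 0 ≤ δ) : lag s δ t ≤ t := by
  unfold lag; exact max_le (min_le_left _ _) (by linarith)

theorem le_lag (ht : s ≤ t) : s ≤ lag s δ t := by
  unfold lag; rw [min_eq_right ht]; exact le_max_left _ _

theorem lag_nonneg (hs : 0 ≤ s) (ht : 0 ≤ t) : 0 ≤ lag s δ t :=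
  (le_min ht hs).trans (le_max_left _ _)

theorem abs_lag_sub_le (hδ : 0 ≤ δ) : |lag s δ t - t| ≤ δ := by
  rw [abs_le]
  exact ⟨by have : t - δ ≤ lag s δ t := le_max_right _ _
            linarith, by linarith [lag_le (s := s) (t := t) hδ]⟩

theorem lag_le_add {m : ℕ} (hδ : 0 ≤ δ) (ht : t ≤ s + (m + 1 : ℕ) * δ) :
    lag s δ t ≤ s + m * δ := by
  push_cast at ht
  have : 0 ≤ (m:ℝ) * δ := by positivity
  exact max_le ((min_le_right _ _).trans (by linarith)) (by linarith)

/-- Solutions of the delayed problem exist past the time `s`. -/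
theorem NL.exists_delayed (h : NL Ω β a k Tm r p l) (hb : Bar Ω lam f) {B1 : ℝ}
    (hc : Ctl Ω β a k Tm r p l f M B c τ) (hs : 0 ≤ s) (hu : LSol Ω β a k r p l s u u)
    (hsT : s ≤ T) (hTm : T ≤ Tm) (hTτ : T ≤ s + τ) (hδ : 0 < δ) (hM : ∀ x ∈ closure Ω, u x s ≤ M)
    (hBB : B ≤ B1) (huB : ∀ x ∈ closure Ω, ∀ t ∈ Icc 0 s, u x t ≤ B1) :
    ∃ w, LSol Ω β a k r p l T (fun x t => w x (lag s δ t)) w ∧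
      (∀ x ∈ closure Ω, ∀ t ∈ Icc 0 s, w x t = u x t) ∧
      ∀ x ∈ closure Ω, ∀ t ∈ Icc 0 T, w x t ≤ B1 := by
  have hT : 0 ≤ T := hs.trans hsT
  have hB0 : 0 ≤ B := by linarith [hc.M0, hc.MB]
  have h0s : (0:ℝ) ∈ Icc 0 s := ⟨le_rfl, hs⟩
  have hss : s ∈ Icc 0 s := ⟨hs, le_rfl⟩
  have hsub : Icc 0 s ⊆ Icc 0 T := Icc_subset_Icc_right hsT
  let P : (Eu n → ℝ → ℝ) → Prop := fun w => JC w (closure Ω) (Icc 0 T) ∧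
    (∀ x ∈ closure Ω, ∀ t ∈ Icc 0 T, 0 ≤ w x t) ∧
    (∀ x ∈ closure Ω, ∀ t ∈ Icc 0 s, w x t = u x t) ∧
    (∀ x ∈ closure Ω, ∀ t ∈ Icc s T, w x t ≤ B) ∧
    (∀ x, c ≤ f x → ∀ t ∈ Icc s T, w x t ≤ M + 1)
  have hbd : ∀ w, P w → ∀ x ∈ closure Ω, ∀ t ∈ Icc 0 T, w x t ≤ B1 := by
    intro w hw x hx t ht
    rcases le_total t s with hts | hts
    · rw [hw.2.2.1 x hx t ⟨ht.1, hts⟩]; exact huB x hx t ⟨ht.1, hts⟩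
    · exact (hw.2.2.2.1 x hx t ⟨hts, ht.2⟩).trans hBB
  have hlag : ∀ t ∈ Icc 0 T, lag s δ t ∈ Icc 0 T := fun t ht =>
    ⟨lag_nonneg hs ht.1, (lag_le hδ.le).trans ht.2⟩
  have hlag' : ∀ t ∈ Icc s T, lag s δ t ∈ Icc s T := fun t ht =>
    ⟨le_lag ht.1, (lag_le hδ.le).trans ht.2⟩
  have hstep : ∀ w, P w → ∃ w', P w' ∧ LSol Ω β a k r p l T (fun x t => w x (lag s δ t)) w' := by
    intro w hw
    have hjl : JC (fun x t => w x (lag s δ t)) Ω (Icc 0 T) :=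
      ContinuousOn.comp (g := fun z : Eu n × ℝ => w z.1 z.2)
        (f := fun z : Eu n × ℝ => (z.1, lag s δ z.2)) hw.1
        (by have := continuous_lag s δ; fun_prop)
        fun z hz => ⟨subset_closure hz.1, hlag _ hz.2⟩
    have hadm : Adm Ω (Icc 0 T) B1 (fun x t => w x (lag s δ t)) :=
      ⟨hjl, fun x hx t ht => hw.2.1 x (subset_closure hx) _ (hlag t ht),
        fun x hx t ht => hbd w hw x (subset_closure hx) _ (hlag t ht)⟩
    have hlow : ∀ x ∈ closure Ω, ∀ t ∈ Icc 0 s, w x (lag s δ t) = u x t := by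
      intro x hx t ht
      rw [lag_of_le hδ.le ht.2]; exact hw.2.2.1 x hx t ht
    obtain ⟨w', hw', hw'0⟩ := h.exists_sol hb hT hTm (hB0.trans hBB) hadm (u0 := fun x => u x 0)
      (JC.slice hu.jc h0s) (fun x hx => hu.nn x hx 0 h0s) (fun x hx => by
        rw [hu.bdry x hx 0 h0s]
        exact NG_congr h.op (fun y hy => (hlow y (subset_closure hy) 0 h0s).symm) x)
    have heq : ∀ x ∈ closure Ω, ∀ t ∈ Icc 0 s, w' x t = u x t :=
      (hw'.mono hsT).unique h.op h.bdd hu (fun x hx t ht => hlow x (subset_closure hx) t ht) hw'0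
    have hI : Icc s T ⊆ Icc 0 T := Icc_subset_Icc_left hs
    have hadm' : Adm Ω (Icc s T) B (fun x t => w x (lag s δ t)) :=
      ⟨JC.mono hjl (Subset.refl _) hI, fun x hx t ht => hadm.nn x hx t (hI ht),
        fun x hx t ht => hw.2.2.2.1 x (subset_closure hx) _ (hlag' t ht)⟩
    have hwk := hw'.weak.mono (Subset.refl _) hs le_rfl
    have hj := JC.mono hw'.jc (Subset.refl _) hI
    have hMs : ∀ x ∈ closure Ω, w' x s ≤ M := fun x hx => by rw [heq x hx s hss]; exact hM x hx
    have h2 := hc.outer s T hs hTm hTτ _ _ hadm' hwk hj hMs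
      (fun x hx t ht => hw'.bdry x hx t (hI ht))
      (fun x hx t ht => hw.2.2.2.2 x hx _ (hlag' t ht))
    have h2' : ∀ x ∈ closure Ω, ∀ t ∈ Icc s T, w' x t ≤ B := fun x hx t ht => by
      linarith [h2 x hx t ht]
    have h1 := hc.inner s T hs hTm hTτ _ _ hadm' hwk hj hMs
      (fun x hx t ht => h2' x (frontier_subset_closure hx) t ht)
    exact ⟨w', ⟨hw'.jc, hw'.nn, heq, h2', h1⟩, hw'⟩
  have hP0 : P fun x t => u x (min t s) := by
    have hmin : ∀ t ∈ Icc 0 T, min t s ∈ Icc 0 s := fun t ht => ⟨le_min ht.1 hs, min_le_right _ _⟩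
    refine ⟨?_, fun x hx t ht => hu.nn x hx _ (hmin t ht), fun x hx t ht => by
      beta_reduce; rw [min_eq_left ht.2], fun x hx t ht => ?_, fun x hx t ht => ?_⟩
    · exact ContinuousOn.comp (g := fun z : Eu n × ℝ => u z.1 z.2)
        (f := fun z : Eu n × ℝ => (z.1, min z.2 s)) hu.jc (by fun_prop)
        fun z hz => ⟨hz.1, hmin _ hz.2⟩
    · beta_reduce; rw [min_eq_right ht.1]; linarith [hM x hx, hc.MB]
    · beta_reduce; rw [min_eq_right ht.1]; linarith [hM x (subset_closure (hb.ge_subset hc.c0 hx))]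
  choose! Φ hΦP hΦS using hstep
  let W : ℕ → Eu n → ℝ → ℝ := fun m => Φ^[m] fun x t => u x (min t s)
  have hWs : ∀ m, W (m + 1) = Φ (W m) := fun m => Function.iterate_succ_apply' _ _ _
  have hWP : ∀ m, P (W m) := by
    intro m
    induction m with
    | zero => exact hP0
    | succ m ih => rw [hWs]; exact hΦP _ ih
  have hWS : ∀ m, LSol Ω β a k r p l T (fun x t => W m x (lag s δ t)) (W (m + 1)) := fun m => by
    rw [hWs]; exact hΦS _ (hWP m)
  have hstab : ∀ m : ℕ, ∀ x ∈ closure Ω, ∀ t ∈ Icc 0 T, t ≤ s + m * δ → W (m + 1) x t = W m x t := by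
    intro m
    induction m with
    | zero =>
      intro x hx t ht hts
      simp only [Nat.cast_zero, zero_mul, add_zero] at hts
      rw [(hWP 1).2.2.1 x hx t ⟨ht.1, hts⟩, (hWP 0).2.2.1 x hx t ⟨ht.1, hts⟩]
    | succ m ih =>
      intro x hx t ht hts
      refine ((hWS (m + 1)).mono ht.2).unique h.op h.bdd ((hWS m).mono ht.2) (fun y hy q hq => ?_)
        (fun y hy => ?_) x hx t ⟨ht.1, le_rfl⟩
      · exact ih y (subset_closure hy) _ (hlag q ⟨hq.1, hq.2.trans ht.2⟩)
          (lag_le_add hδ.le (hq.2.trans hts))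
      · rw [(hWP (m + 1 + 1)).2.2.1 y hy 0 h0s, (hWP (m + 1)).2.2.1 y hy 0 h0s]
  obtain ⟨m, hm⟩ := exists_nat_ge ((T - s) / δ)
  rw [div_le_iff₀ hδ] at hm
  refine ⟨W (m + 1), (hWS m).congr_data h.op fun x hx t ht => ?_, (hWP (m + 1)).2.2.1,
    hbd _ (hWP (m + 1))⟩
  exact hstab m x (subset_closure hx) _ (hlag t ht) (by linarith [(hlag t ht).2])

/-- Arzelà-type extraction along an ultrafilter, with perturbed evaluation points. -/
theorem exists_limit_of_equicont {X : Type*} [PseudoMetricSpace X] {S : Set X} {F : ℕ → X → ℝ}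
    (hF : ∀ j, ∀ z ∈ S, F j z ∈ Icc 0 B)
    (heq : ∀ z0 ∈ S, ∀ γ > 0, ∃ δ > 0, ∀ᶠ j in atTop, ∀ z ∈ S, ∀ z' ∈ S,
      dist z z0 < δ → dist z' z0 < δ → |F j z - F j z'| ≤ γ) {d : ℕ → ℝ}
    (hd : Tendsto d atTop (nhds 0)) :
    ∃ (G : X → ℝ) (L : Filter ℕ), L.NeBot ∧ L ≤ atTop ∧ (∀ z ∈ S, G z ∈ Icc 0 B) ∧
      ContinuousOn G S ∧ (∀ z ∈ S, Tendsto (fun j => F j z) L (nhds (G z))) ∧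
      ∀ K ⊆ S, IsCompact K → ∀ γ > 0, ∀ᶠ j in L, ∀ z ∈ K, ∀ z' ∈ S, dist z' z ≤ d j →
        |F j z' - G z| ≤ γ := by
  have hL : (hyperfilter ℕ : Filter ℕ) ≤ atTop := Nat.hyperfilter_le_atTop
  have hlim : ∀ z ∈ S, ∃ x ∈ Icc 0 B, Tendsto (fun j => F j z) (hyperfilter ℕ) (nhds x) := by
    intro z hz
    obtain ⟨x, hx, hle⟩ := (isCompact_Icc (a := (0:ℝ)) (b := B)).ultrafilter_le_nhds'
      ((hyperfilter ℕ).map fun j => F j z) (Ultrafilter.mem_map.2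
        (Eventually.of_forall (f := (hyperfilter ℕ : Filter ℕ)) fun j => hF j z hz))
    exact ⟨x, hx, hle⟩
  choose! G hG hGt using hlim
  have hGe : ∀ z0 ∈ S, ∀ γ > 0, ∃ δ > 0,
      (∀ᶠ j in atTop, ∀ z ∈ S, ∀ z' ∈ S, dist z z0 < δ → dist z' z0 < δ → |F j z - F j z'| ≤ γ) ∧
      ∀ z ∈ S, dist z z0 < δ → |G z - G z0| ≤ γ := by
    intro z0 hz0 γ hγ
    obtain ⟨δ, hδ, hev⟩ := heq z0 hz0 γ hγ
    refine ⟨δ, hδ, hev, fun z hz hd => ?_⟩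
    refine le_of_tendsto ((hGt z hz).sub (hGt z0 hz0)).abs ((hev.filter_mono hL).mono fun j hj => ?_)
    exact hj z hz z0 hz0 hd (by rwa [dist_self])
  refine ⟨G, hyperfilter ℕ, inferInstance, hL, hG, ?_, hGt, ?_⟩
  · rw [Metric.continuousOn_iff]
    intro z0 hz0 ε hε
    obtain ⟨δ, hδ, -, h2⟩ := hGe z0 hz0 (ε / 2) (half_pos hε)
    exact ⟨δ, hδ, fun z hz hdz => (h2 z hz hdz).trans_lt (half_lt_self hε)⟩
  · intro K hKS hK γ hγ
    suffices H : ∀ᶠ j in (hyperfilter ℕ : Filter ℕ), ∀ z ∈ K ∩ S, ∀ z' ∈ S, dist z' z ≤ d j →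
        |F j z' - G z| ≤ γ from H.mono fun j hj z hz => hj z ⟨hz, hKS hz⟩
    refine hK.induction_on (p := fun K => ∀ᶠ j in (hyperfilter ℕ : Filter ℕ), ∀ z ∈ K ∩ S,
      ∀ z' ∈ S, dist z' z ≤ d j → |F j z' - G z| ≤ γ) ?_ ?_ ?_ ?_
    · exact Eventually.of_forall fun j z hz => hz.1.elim
    · exact fun s t hst ht => ht.mono fun j hj z hz => hj z ⟨hst hz.1, hz.2⟩
    · intro s t hs ht
      filter_upwards [hs, ht] with j h1 h2 z hz
      exact hz.1.elim (fun h => h1 z ⟨h, hz.2⟩) fun h => h2 z ⟨h, hz.2⟩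
    · intro z0 hz0
      obtain ⟨δ, hδ, h1, h2⟩ := hGe z0 (hKS hz0) (γ / 3) (by positivity)
      refine ⟨ball z0 (δ / 2), mem_nhdsWithin_of_mem_nhds
        (ball_mem_nhds _ (half_pos hδ)), ?_⟩
      have e3 := (Metric.tendsto_nhds.1 (hGt z0 (hKS hz0))) (γ / 3) (by positivity)
      have e4 := hL (hd.eventually (gt_mem_nhds (half_pos hδ)))
      filter_upwards [hL h1, e3, e4] with j h1 h3 h4 z hz z' hz' hzz
      have hzd : dist z z0 < δ / 2 := hz.1
      have hz'd : dist z' z0 < δ := by linarith [dist_triangle z' z z0]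
      have a1 := h1 z' hz' z0 (hKS hz0) hz'd (by rwa [dist_self])
      have a2 := h2 z hz.2 (by linarith)
      rw [Real.dist_eq] at h3
      rw [abs_le] at a1 a2 ⊢
      have a3 := abs_lt.1 h3
      constructor <;> linarith [a1.1, a1.2, a2.1, a2.2, a3.1, a3.2]

/-- A strict bound on the lateral boundary persists in a sublevel layer of the barrier. -/
theorem Bar.near_bdry (hB : Bar Ω lam f) {κ : ℝ} {z : Eu n → ℝ → ℝ}
    (hz : JC z (closure Ω) (Icc t0 t1)) (hfr : ∀ x ∈ frontier Ω, ∀ t ∈ Icc t0 t1, z x t < κ) :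
    ∃ c > 0, ∀ x ∈ closure Ω, f x ≤ c → ∀ t ∈ Icc t0 t1, z x t < κ := by
  have hK : IsCompact (closure Ω ×ˢ Icc t0 t1) := hB.bdd.isCompact_closure.prod isCompact_Icc
  set S := {q : Eu n × ℝ | q ∈ closure Ω ×ˢ Icc t0 t1 ∧ κ ≤ z q.1 q.2}
  have hS : IsCompact S := hK.of_isClosed_subset
    (hz.preimage_isClosed_of_isClosed hK.isClosed isClosed_Ici) fun q hq => hq.1
  rcases S.eq_empty_or_nonempty with he | hne
  · refine ⟨1, one_pos, fun x hx _ t ht => ?_⟩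
    by_contra! hge
    have : (x, t) ∈ S := ⟨⟨hx, ht⟩, hge⟩
    rw [he] at this
    exact this
  · obtain ⟨q, hq, hmin⟩ := hS.exists_isMinOn hne (hB.cont.comp continuous_fst).continuousOn
    have hqΩ : q.1 ∈ Ω := by
      by_contra hn
      exact absurd hq.2 (not_le.2 (hfr q.1 (by
        rw [hB.op.frontier_eq]; exact ⟨hq.1.1, hn⟩) q.2 hq.1.2))
    have hpos := hB.pos q.1 hqΩ
    refine ⟨f q.1 / 2, half_pos hpos, fun x hx hxc t ht => ?_⟩
    by_contra! hge
    have hmem : (x, t) ∈ S := ⟨⟨hx, ht⟩, hge⟩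
    have : f q.1 ≤ f x := hmin hmem
    linarith

/-- Continuity of the nonlocal terms with respect to convergence away from the boundary. -/
theorem NL.exists_modulus (h : NL Ω β a k Tm r p l) (hb : Bar Ω lam f) (hB : 0 ≤ B) (hη : 0 < η) :
    ∃ c > 0, ∃ γ > 0, ∀ I ⊆ Icc 0 Tm, ∀ W W', Adm Ω I B W → Adm Ω I B W' →
      ∀ t ∈ I, (∀ x ∈ Ω, c ≤ f x → |W x t - W' x t| ≤ γ) →
      (∀ x ∈ Ω, |W x t - W' x t| ≤ γ → |NF Ω β a r p W x t - NF Ω β a r p W' x t| ≤ η) ∧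
      ∀ x ∈ frontier Ω, |NG Ω k l W x t - NG Ω k l W' x t| ≤ η := by
  obtain ⟨A, hA, hA1, hA2⟩ := h.exists_coef_bound
  have hV : 0 ≤ volume.real Ω := measureReal_nonneg
  have hr := h.r0
  set Q := 1 + volume.real Ω * B ^ p + B ^ r
  have hQ : 1 ≤ Q := by
    have : 0 ≤ volume.real Ω * B ^ p + B ^ r := by positivity
    simp only [Q]; linarith
  set η' := η / ((A + 1) * Q) with hη'd
  have hη' : 0 < η' := by positivity
  have hAQ : A * η' * Q ≤ η := by
    calc A * η' * Q ≤ (A + 1) * η' * Q := by gcongr; linarith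
      _ = η := by rw [hη'd]; field_simp
  obtain ⟨c1, hc1, γ1, hγ1, m1⟩ := hb.exists_modulus h.p0 hB hη'
  obtain ⟨c2, hc2, γ2, hγ2, m2⟩ := hb.exists_modulus h.l0 hB hη'
  have huc : UniformContinuousOn (fun s : ℝ => s ^ r) (Icc 0 B) :=
    isCompact_Icc.uniformContinuousOn_of_continuous (rpow_continuousOn hr continuousOn_id)
  obtain ⟨γ3, hγ3, hu⟩ := uniformContinuousOn_iff.1 huc η' hη'
  refine ⟨min c1 c2, lt_min hc1 hc2, min (min γ1 γ2) (min (γ3 / 2) η'), by positivity,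
    fun I hI W W' hW hW' t ht hWW => ⟨fun x hx hxx => ?_, fun x hx => ?_⟩⟩
  · have cW := JC.slice hW.jc ht
    have cW' := JC.slice hW'.jc ht
    have bW : ∀ y ∈ Ω, W y t ∈ Icc 0 B := fun y hy => ⟨hW.nn y hy t ht, hW.le y hy t ht⟩
    have bW' : ∀ y ∈ Ω, W' y t ∈ Icc 0 B := fun y hy => ⟨hW'.nn y hy t ht, hW'.le y hy t ht⟩
    have hitg : ∀ V : Eu n → ℝ → ℝ, Adm Ω I B V → IntegrableOn (fun y => V y t ^ p) Ω := by
      intro V hV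
      refine integrableOn_of_bdd (M := B ^ p) h.op h.bdd
        (rpow_continuousOn h.p0 (JC.slice hV.jc ht)) fun y hy => ?_
      rw [abs_of_nonneg (Real.rpow_nonneg (hV.nn y hy t ht) _)]
      exact Real.rpow_le_rpow (hV.nn y hy t ht) (hV.le y hy t ht) h.p0.le
    have i1 := m1 (fun y => W y t) (fun y => W' y t) cW cW' bW bW' fun y hy hyc =>
      (hWW y hy ((min_le_left _ _).trans hyc)).trans ((min_le_left _ _).trans (min_le_left _ _))
    have i2 : |(∫ y in Ω, W y t ^ p) - ∫ y in Ω, W' y t ^ p| ≤ η' := by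
      rw [← integral_sub (hitg W hW) (hitg W' hW')]
      exact (abs_integral_le_integral_abs).trans i1
    have i3 : |W x t ^ r - W' x t ^ r| ≤ η' := by
      have := hu (W x t) (bW x hx) (W' x t) (bW' x hx) (by
        rw [Real.dist_eq]
        refine (hxx.trans ((min_le_right _ _).trans (min_le_left _ _))).trans_lt
          (half_lt_self hγ3))
      rw [Real.dist_eq] at this
      exact this.le
    have i4 : |W x t - W' x t| ≤ η' := hxx.trans ((min_le_right _ _).trans (min_le_right _ _))
    have j1 := hA1 x (subset_closure hx) t (hI ht)
    have j2 := h.b0 x (subset_closure hx) t (hI ht)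
    have j3 := h.a0 x (subset_closure hx) t (hI ht)
    have j4 := integral_rpow_le h.op h.bdd hW' ht h.p0
    have j5 := integral_rpow_nonneg h.op hW' ht p
    have j6 : W x t ^ r ≤ B ^ r := Real.rpow_le_rpow (bW x hx).1 (bW x hx).2 hr.le
    have j7 := Real.rpow_nonneg (bW x hx).1 r
    have e : NF Ω β a r p W x t - NF Ω β a r p W' x t = β x t * (W x t - W' x t)
        + a x t * ((W x t ^ r - W' x t ^ r) * (∫ y in Ω, W' y t ^ p)
          + W x t ^ r * ((∫ y in Ω, W y t ^ p) - ∫ y in Ω, W' y t ^ p)) := by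
      unfold NF; ring
    rw [e]
    refine (abs_add_le _ _).trans ?_
    rw [abs_mul, abs_mul, abs_of_nonneg j2, abs_of_nonneg j3]
    have e2 : |(W x t ^ r - W' x t ^ r) * (∫ y in Ω, W' y t ^ p)
          + W x t ^ r * ((∫ y in Ω, W y t ^ p) - ∫ y in Ω, W' y t ^ p)|
          ≤ η' * (volume.real Ω * B ^ p) + B ^ r * η' := by
      refine (abs_add_le _ _).trans ?_
      rw [abs_mul, abs_mul, abs_of_nonneg j5, abs_of_nonneg j7]
      gcongr
    calc _ ≤ A * η' + A * (η' * (volume.real Ω * B ^ p) + B ^ r * η') := by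
          gcongr
          · exact j1.1
          · exact j1.2
      _ = A * η' * Q := by simp only [Q]; ring
      _ ≤ η := hAQ
  · have i1 := m2 (fun y => W y t) (fun y => W' y t) (JC.slice hW.jc ht) (JC.slice hW'.jc ht)
      (fun y hy => ⟨hW.nn y hy t ht, hW.le y hy t ht⟩)
      (fun y hy => ⟨hW'.nn y hy t ht, hW'.le y hy t ht⟩) fun y hy hyc =>
      (hWW y hy ((min_le_right _ _).trans hyc)).trans ((min_le_left _ _).trans (min_le_right _ _))
    have hitg : ∀ V : Eu n → ℝ → ℝ, Adm Ω I B V → IntegrableOn (fun y => k x y t * V y t ^ l) Ω := by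
      intro V hV
      refine integrableOn_of_bdd (M := A * B ^ l) h.op h.bdd
        ((h.k_slice hx (hI ht)).mul (rpow_continuousOn h.l0 (JC.slice hV.jc ht))) fun y hy => ?_
      have e0 := h.k0 x hx y (subset_closure hy) t (hI ht)
      have e2 := hV.nn y hy t ht
      have := h.l0.le
      rw [abs_of_nonneg (by positivity)]
      gcongr
      · exact hA2 x hx y (subset_closure hy) t (hI ht)
      · exact hV.le y hy t ht
    have hitg' : IntegrableOn (fun y => A * |W y t ^ l - W' y t ^ l|) Ω := by
      refine Integrable.const_mul ?_ A
      refine integrableOn_of_bdd (M := B ^ l) h.op h.bdd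
        (((rpow_continuousOn h.l0 (JC.slice hW.jc ht)).sub
          (rpow_continuousOn h.l0 (JC.slice hW'.jc ht))).abs) fun y hy => ?_
      have q1 := Real.rpow_nonneg (hW.nn y hy t ht) l
      have q2 := Real.rpow_nonneg (hW'.nn y hy t ht) l
      have q3 := Real.rpow_le_rpow (hW.nn y hy t ht) (hW.le y hy t ht) h.l0.le
      have q4 := Real.rpow_le_rpow (hW'.nn y hy t ht) (hW'.le y hy t ht) h.l0.le
      rw [abs_abs, abs_le]
      constructor <;> linarith
    unfold NG
    rw [← integral_sub (hitg W hW) (hitg W' hW')]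
    refine (abs_integral_le_integral_abs).trans ?_
    calc _ ≤ ∫ y in Ω, A * |W y t ^ l - W' y t ^ l| := by
          refine setIntegral_mono_on ((hitg W hW).sub (hitg W' hW')).abs hitg' h.op.measurableSet
            fun y hy => ?_
          have e0 := h.k0 x hx y (subset_closure hy) t (hI ht)
          rw [← mul_sub, abs_mul, abs_of_nonneg e0]
          gcongr
          exact hA2 x hx y (subset_closure hy) t (hI ht)
      _ ≤ A * η' := by rw [integral_const_mul]; gcongr
      _ ≤ A * η' * Q := le_mul_of_one_le_right (by positivity) hQ
      _ ≤ η := hAQ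

theorem NL.stability (h : NL Ω β a k Tm r p l) (hb : Bar Ω lam f) (hT : 0 ≤ T) (hTm : T ≤ Tm)
    (hB : 0 ≤ B) (hε : 0 < ε) : ∃ c > 0, ∃ γ > 0, ∀ W W' w w' : Eu n → ℝ → ℝ,
      Adm Ω (Icc 0 T) B W → Adm Ω (Icc 0 T) B W' → LSol Ω β a k r p l T W w →
      LSol Ω β a k r p l T W' w' → (∀ x ∈ closure Ω, w x 0 = w' x 0) →
      (∀ x ∈ Ω, c ≤ f x → ∀ t ∈ Icc 0 T, |W x t - W' x t| ≤ γ) →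
      ∀ x ∈ closure Ω, ∀ t ∈ Icc 0 T, |w x t - w' x t| ≤ ε := by
  obtain ⟨C, hC0, hC⟩ := h.exists_NF_bound hB
  obtain ⟨z, hzc, hz0, hzw⟩ := hb.exists_data (t0 := 0) (t1 := T) hT (F := fun _ _ => 1) (M := 1)
    continuousOn_const (fun _ _ _ _ => by simp) (G := fun _ _ => 0) continuousOn_const
  have hI : Icc 0 T ⊆ Icc 0 Tm := Icc_subset_Icc_right hTm
  set κ := ε / (8 * (C + 1)) with hκ
  have hκ0 : 0 < κ := by positivity
  have hCκ : 2 * C * κ ≤ ε / 4 := by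
    rw [hκ, mul_div_assoc', div_le_div_iff₀ (by positivity) (by norm_num)]
    nlinarith
  set η := ε / (4 * (T + 1)) with hη
  have hη0 : 0 < η := by positivity
  have hηT : η * (T + 1) = ε / 4 := by rw [hη]; field_simp
  have hη4 : η ≤ ε / 4 := by nlinarith
  have hbF : ∀ x ∈ frontier Ω, ∀ t ∈ Icc 0 T, z x t = 0 := fun x hx t ht =>
    hz0 (x, t) ⟨frontier_subset_closure hx, ht, Or.inr hx⟩
  obtain ⟨c1, hc1, hz1⟩ := hb.near_bdry hzc (κ := κ) fun x hx t ht => by rw [hbF x hx t ht]; exact hκ0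
  obtain ⟨c2, hc2, γ, hγ, hmod⟩ := h.exists_modulus hb hB hη0
  refine ⟨min c1 c2, lt_min hc1 hc2, γ, hγ, fun W W' w w' hW hW' hw hw' h0 hd => ?_⟩
  have hmod' := fun t ht => hmod _ hI W W' hW hW' t ht
    fun x hx hcx => hd x hx ((min_le_right _ _).trans hcx) t ht
  have half : ∀ W W' w w' : Eu n → ℝ → ℝ, Adm Ω (Icc 0 T) B W → Adm Ω (Icc 0 T) B W' →
      LSol Ω β a k r p l T W w → LSol Ω β a k r p l T W' w' →
      (∀ x ∈ closure Ω, w x 0 = w' x 0) →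
      (∀ t ∈ Icc 0 T, ∀ x ∈ frontier Ω, |NG Ω k l W x t - NG Ω k l W' x t| ≤ η) →
      ∀ x ∈ closure Ω, ∀ t ∈ Icc 0 T, w x t - w' x t ≤ η + 2 * C * z x t := by
    intro W W' w w' hW hW' hw hw' h0 hG x hx t ht
    have := Weak.le_of_bdry h.op h.bdd (c := η) (m := 0)
      ((hw.weak.sub h.op hw'.weak).sub h.op (hzw.const_mul (2 * C)))
      (ContinuousOn.sub (ContinuousOn.sub hw.jc hw'.jc) (ContinuousOn.mul continuousOn_const hzc))
      (fun x hx t ht => by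
        have h1 := abs_le.1 (hC _ hI W hW x hx t (Ioo_subset_Icc_self ht))
        have h2 := abs_le.1 (hC _ hI W' hW' x hx t (Ioo_subset_Icc_self ht))
        linarith [h1.2, h2.1]) le_rfl
      (fun x hx => by
        rw [h0 x hx, hz0 (x, 0) ⟨hx, ⟨le_rfl, hT⟩, Or.inl rfl⟩]
        linarith)
      (fun x hx t ht => by
        rw [hbF x hx t ht, hw.bdry x hx t ht, hw'.bdry x hx t ht]
        linarith [(abs_le.1 (hG t ht x hx)).2]) x hx t ht
    linarith
  have hA : ∀ x ∈ closure Ω, ∀ t ∈ Icc 0 T, |w x t - w' x t| ≤ η + 2 * C * z x t := by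
    intro x hx t ht
    refine abs_le'.2 ⟨half W W' w w' hW hW' hw hw' h0 (fun t ht => (hmod' t ht).2) x hx t ht, ?_⟩
    rw [neg_sub]
    exact half W' W w' w hW' hW hw' hw (fun x hx => (h0 x hx).symm)
      (fun t ht x hx => by rw [abs_sub_comm]; exact (hmod' t ht).2 x hx) x hx t ht
  have hN : ∀ x ∈ closure Ω, f x ≤ c1 → ∀ t ∈ Icc 0 T, |w x t - w' x t| ≤ η + 2 * C * κ :=
    fun x hx hfx t ht => (hA x hx t ht).trans (by
      have := hz1 x hx hfx t ht
      have := mul_le_mul_of_nonneg_left this.le (by positivity : 0 ≤ 2 * C)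
      linarith)
  intro x hx t ht
  rcases le_or_gt (f x) c1 with hfx | hfx
  · exact (hN x hx hfx t ht).trans (by linarith)
  have hUo : IsOpen {x | c1 < f x} := isOpen_lt continuous_const hb.cont
  have hUs : {x | c1 < f x} ⊆ Ω := fun x hx => hb.mem (hc1.trans hx)
  have hcl : closure {x | c1 < f x} ⊆ {x | c1 ≤ f x} :=
    closure_minimal (fun x hx => show c1 ≤ f x from le_of_lt hx) (isClosed_le continuous_const hb.cont)
  have := Weak.abs_le_of_bdry hUo (h.bdd.subset hUs) (c := η + 2 * C * κ) (m := η)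
    ((hw.weak.sub h.op hw'.weak).mono hUs le_rfl le_rfl)
    (JC.mono (ContinuousOn.sub hw.jc hw'.jc) (closure_mono hUs) Subset.rfl)
    (fun x hx t ht => (hmod' t (Ioo_subset_Icc_self ht)).1 x (hUs hx)
      (hd x (hUs hx) ((min_le_left _ _).trans (le_of_lt hx)) t (Ioo_subset_Icc_self ht))) hη0.le
    (fun x hx => by rw [h0 x (closure_mono hUs hx), sub_self, abs_zero]; positivity)
    (fun x hx t ht => by
      rw [hUo.frontier_eq] at hx
      exact hN x (closure_mono hUs hx.1) (not_lt.1 hx.2) t ht) x (subset_closure hfx) t ht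
  refine this.trans ?_
  have : η * (t - 0) ≤ η * (T + 1) := mul_le_mul_of_nonneg_left (by linarith [ht.2]) hη0.le
  linarith

theorem Adm.lag {w : Eu n → ℝ → ℝ} (hw : Adm Ω (Icc 0 T) B w) (hs : 0 ≤ s) (hδ : 0 ≤ δ) :
    Adm Ω (Icc 0 T) B fun x t => w x (lag s δ t) := by
  have hm : ∀ t ∈ Icc 0 T, _root_.lag s δ t ∈ Icc 0 T := fun t ht =>
    ⟨lag_nonneg hs ht.1, (lag_le hδ).trans ht.2⟩
  refine ⟨?_, fun x hx t ht => hw.nn x hx _ (hm t ht), fun x hx t ht => hw.le x hx _ (hm t ht)⟩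
  have hcl := continuous_lag s δ
  exact hw.jc.comp (f := fun z : Eu n × ℝ => (z.1, _root_.lag s δ z.2))
    (Continuous.continuousOn (by fun_prop)) fun z hz => ⟨hz.1, hm _ hz.2⟩

theorem NL.extend (h : NL Ω β a k Tm r p l) (hb : Bar Ω lam f) {Ts : ℝ} (hTs : 0 < Ts)
    (hTm : Ts < Tm) (hM : 0 ≤ M) (hu : ∀ T, 0 ≤ T → T < Ts → LSol Ω β a k r p l T u u)
    (hfr : ∃ᶠ t in nhdsWithin Ts (Iio Ts), ∀ x ∈ closure Ω, u x t ≤ M) :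
    ∃ T, Ts < T ∧ T ≤ Tm ∧ ∃ v, LSol Ω β a k r p l T v v ∧
      ∀ x ∈ closure Ω, ∀ t ∈ Ico 0 Ts, v x t = u x t := by
  obtain ⟨B, c, τ, hctl⟩ := h.exists_ctl hb hM
  have hτ := hctl.τ0
  have hB0 : 0 ≤ B := by linarith [hctl.MB]
  have pick : ∀ s < Ts, ∃ t, s < t ∧ t < Ts ∧ ∀ x ∈ closure Ω, u x t ≤ M := by
    intro s hs
    obtain ⟨t, ht1, ht2⟩ := (hfr.and_eventually (Ioo_mem_nhdsLT hs)).exists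
    exact ⟨t, ht2.1, ht2.2, ht1⟩
  set s0 := Ts / 2 with hs0
  have hs0p : 0 < s0 := half_pos hTs
  set σ := max (Ts - τ / 2) s0 with hσ
  have hσT : σ < Ts := max_lt (by linarith) (half_lt_self hTs)
  obtain ⟨tB, htB, htBT, huM⟩ := pick σ hσT
  have htB0 : 0 ≤ tB := hs0p.le.trans ((le_max_right _ _).trans htB.le)
  have htBτ : Ts - τ / 2 < tB := (le_max_left _ _).trans_lt htB
  have hK : IsCompact (closure Ω ×ˢ Icc 0 tB) :=
    (isCompact_of_isClosed_isBounded isClosed_closure h.bdd.closure).prod isCompact_Icc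
  obtain ⟨B0, hB0'⟩ := hK.exists_bound_of_continuousOn (hu tB htB0 htBT).jc
  set B1 := max B B0 with hB1
  have hB10 : 0 ≤ B1 := hB0.trans (le_max_left _ _)
  have huB : ∀ x ∈ closure Ω, ∀ t ∈ Ico 0 Ts, u x t ≤ B1 := by
    intro x hx t ht
    rcases le_total t tB with h1 | h1
    · exact ((le_abs_self _).trans (hB0' (x, t) ⟨hx, ht.1, h1⟩)).trans (le_max_right _ _)
    · exact ((hu t ht.1 ht.2).le_of_ctl h.bdd hctl htB0 (ht.2.le.trans hTm.le)
        (by linarith [ht.2]) huM x hx t ⟨h1, le_rfl⟩).le.trans (le_max_left _ _)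
  set T := min Tm (Ts + τ / 2) with hTdef
  have hTsT : Ts < T := lt_min hTm (by linarith)
  have hTTm : T ≤ Tm := min_le_left _ _
  have hT0 : 0 ≤ T := hTs.le.trans hTsT.le
  have hseq : ∀ j : ℕ, ∃ tj, max σ (Ts - 1 / ((j : ℝ) + 1)) < tj ∧ tj < Ts ∧
      ∀ x ∈ closure Ω, u x tj ≤ M := fun j =>
    pick _ (max_lt hσT (sub_lt_self _ (by positivity)))
  choose tj htj1 htj2 htj3 using hseq
  have htjσ : ∀ j, σ < tj j := fun j => (le_max_left _ _).trans_lt (htj1 j)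
  have htj0 : ∀ j, s0 < tj j := fun j => (le_max_right _ _).trans_lt (htjσ j)
  have hδ : ∀ j : ℕ, (0:ℝ) < 1 / ((j : ℝ) + 1) := fun j => by positivity
  have hwj : ∀ j : ℕ, ∃ w, LSol Ω β a k r p l T (fun x t => w x (lag (tj j) (1 / ((j:ℝ) + 1)) t)) w ∧
      (∀ x ∈ closure Ω, ∀ t ∈ Icc 0 (tj j), w x t = u x t) ∧
      ∀ x ∈ closure Ω, ∀ t ∈ Icc 0 T, w x t ≤ B1 := fun j =>
    h.exists_delayed hb hctl (hs0p.le.trans (htj0 j).le)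
      (hu _ (hs0p.le.trans (htj0 j).le) (htj2 j)) ((htj2 j).le.trans hTsT.le) hTTm
      ((min_le_right _ _).trans (by linarith [(le_max_left _ _).trans_lt (htjσ j)])) (hδ j)
      (htj3 j) (le_max_left _ _) (fun x hx t ht => huB x hx t ⟨ht.1, ht.2.trans_lt (htj2 j)⟩)
  choose w hw hwu hwB using hwj
  have hwA : ∀ j, Adm Ω (Icc 0 T) B1 (w j) := fun j =>
    (hw j).adm Subset.rfl fun x hx => hwB j x (subset_closure hx)
  have hWA := fun j => (hwA j).lag (hs0p.le.trans (htj0 j).le) (hδ j).le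
  have hI : Icc 0 T ⊆ Icc 0 Tm := Icc_subset_Icc_right hTTm
  obtain ⟨C, hC0, hC⟩ := h.exists_NF_bound hB10
  have hwabs : ∀ j, ∀ x ∈ Ω, ∀ t ∈ Icc 0 T, |w j x t| ≤ B1 := fun j x hx t ht => by
    rw [abs_of_nonneg ((hwA j).nn x hx t ht)]; exact (hwA j).le x hx t ht
  have heq : ∀ z0 ∈ Ω ×ˢ Icc 0 T, ∀ γ > (0:ℝ), ∃ δ > (0:ℝ), ∀ᶠ j in (atTop : Filter ℕ),
      ∀ z ∈ Ω ×ˢ Icc 0 T, ∀ z' ∈ Ω ×ˢ Icc 0 T, dist z z0 < δ → dist z' z0 < δ →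
      |w j z.1 z.2 - w j z'.1 z'.2| ≤ γ := by
    rintro ⟨x0, t0⟩ ⟨hx0, ht0⟩ γ hγ
    rcases lt_or_ge t0 s0 with hts | hts
    · have hcu := (hu s0 hs0p.le (half_lt_self hTs)).jc
      obtain ⟨δ, hδ0, hδ⟩ := Metric.continuousOn_iff.1 hcu (x0, t0)
        ⟨subset_closure hx0, ht0.1, hts.le⟩ (γ / 2) (half_pos hγ)
      refine ⟨min δ (s0 - t0), lt_min hδ0 (sub_pos.2 hts), Eventually.of_forall fun j => ?_⟩
      have key : ∀ z ∈ Ω ×ˢ Icc 0 T, dist z (x0, t0) < min δ (s0 - t0) →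
          |w j z.1 z.2 - u x0 t0| < γ / 2 := by
        rintro ⟨x, t⟩ ⟨hx, ht⟩ hd
        have h1 : dist t t0 < s0 - t0 :=
          (le_max_right _ _).trans_lt (hd.trans_le (min_le_right _ _))
        have h2 : t ≤ s0 := by
          rw [Real.dist_eq] at h1; linarith [(abs_lt.1 h1).2]
        rw [hwu j x (subset_closure hx) t ⟨ht.1, h2.trans (htj0 j).le⟩]
        exact hδ (x, t) ⟨subset_closure hx, ht.1, h2⟩ (hd.trans_le (min_le_left _ _))
      intro z hz z' hz' hd hd'
      have h1 := abs_lt.1 (key z hz hd)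
      have h2 := abs_lt.1 (key z' hz' hd')
      exact abs_le.2 ⟨by linarith, by linarith⟩
    · obtain ⟨R, hR, hsub⟩ := nhds_basis_closedBall.mem_iff.1 (h.op.mem_nhds hx0)
      have hR4 : 4 * (R / 4) = R := by ring
      obtain ⟨δ, hδ0, hδ⟩ := Weak.equicont h.op (x0 := x0) (R := R / 4) (T := T) (F := C) (B := B1)
        (τ := s0 / 2) (θ := γ) (by positivity) (half_pos hs0p) (by linarith)
        (by rwa [hR4]) hB10 hC0 hγ
      rw [hR4] at hδ
      refine ⟨min (δ / 2) (min (R / 8) (s0 / 2)), by positivity, Eventually.of_forall fun j => ?_⟩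
      have key : ∀ z ∈ Ω ×ˢ Icc 0 T, dist z (x0, t0) < min (δ / 2) (min (R / 8) (s0 / 2)) →
          z.1 ∈ closedBall x0 (R / 4 / 2) ∧ z.2 ∈ Icc (s0 / 2) T ∧ dist z.1 x0 ≤ δ / 2 ∧
          dist z.2 t0 ≤ δ / 2 := by
        rintro ⟨x, t⟩ ⟨hx, ht⟩ hd
        have h1 : dist x x0 < _ := (le_max_left _ _).trans_lt hd
        have h2 : dist t t0 < _ := (le_max_right _ _).trans_lt hd
        rw [lt_min_iff, lt_min_iff] at h1 h2
        refine ⟨?_, ⟨?_, ht.2⟩, h1.1.le, h2.1.le⟩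
        · rw [mem_closedBall]; linarith [h1.2.1]
        · have := h2.2.2
          rw [Real.dist_eq] at this
          linarith [(abs_lt.1 this).1]
      intro z hz z' hz' hd hd'
      obtain ⟨a1, a2, a3, a4⟩ := key z hz hd
      obtain ⟨b1, b2, b3, b4⟩ := key z' hz' hd'
      refine hδ (w j) _ (hw j).weak (fun x hx => hwabs j x (hsub hx))
        (fun x hx => hC _ hI _ (hWA j) x (hsub hx)) _ a1 _ b1 _ a2 _ b2 ?_ ?_
      · rw [← dist_eq_norm]; linarith [dist_triangle_right z.1 z'.1 x0]
      · rw [← Real.dist_eq]; linarith [dist_triangle_right z.2 z'.2 t0]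
  obtain ⟨G, L, hLne, hLat, hG, hGc, hGt, hGK⟩ := exists_limit_of_equicont
    (F := fun j (z : Eu n × ℝ) => w j z.1 z.2) (S := Ω ×ˢ Icc 0 T) (B := B1)
    (fun j z hz => ⟨(hwA j).nn _ hz.1 _ hz.2, (hwA j).le _ hz.1 _ hz.2⟩) heq
    (tendsto_one_div_add_atTop_nhds_zero_nat (𝕜 := ℝ))
  have hGu : ∀ x ∈ Ω, ∀ t ∈ Ico 0 Ts, G (x, t) = u x t := by
    intro x hx t ht
    refine tendsto_nhds_unique (hGt (x, t) ⟨hx, ht.1, ht.2.le.trans hTsT.le⟩) ?_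
    refine tendsto_const_nhds.congr' ?_
    have hev : ∀ᶠ j : ℕ in atTop, 1 / ((j:ℝ) + 1) < Ts - t :=
      (tendsto_one_div_add_atTop_nhds_zero_nat (𝕜 := ℝ)).eventually_lt_const (sub_pos.2 ht.2)
    filter_upwards [hev.filter_mono hLat] with j hj
    refine (hwu j x (subset_closure hx) t ⟨ht.1, ?_⟩).symm
    linarith [(le_max_right _ _).trans_lt (htj1 j)]
  have hWinf : Adm Ω (Icc 0 T) B1 fun x t => G (x, t) :=
    ⟨hGc, fun x hx t ht => (hG (x, t) ⟨hx, ht⟩).1, fun x hx t ht => (hG (x, t) ⟨hx, ht⟩).2⟩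
  have hu00 := hu 0 le_rfl hTs
  have h00 : (0:ℝ) ∈ Icc (0:ℝ) 0 := ⟨le_rfl, le_rfl⟩
  obtain ⟨v, hv, hv0⟩ := h.exists_sol hb hT0 hTTm hB10 hWinf (u0 := fun x => u x 0)
    (JC.slice hu00.jc h00) (fun x hx => hu00.nn x hx 0 h00) (fun x hx => by
      rw [hu00.bdry x hx 0 h00]
      exact NG_congr h.op (fun y hy => (hGu y hy 0 ⟨le_rfl, hTs⟩).symm) x)
  have hvG : ∀ x ∈ Ω, ∀ t ∈ Icc 0 T, v x t = G (x, t) := by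
    intro x hx t ht
    refine tendsto_nhds_unique (l := L) ?_ (hGt (x, t) ⟨hx, ht⟩)
    rw [Metric.tendsto_nhds]
    intro ε hε
    obtain ⟨c', hc', γ, hγ, hst⟩ := h.stability hb hT0 hTTm hB10 (half_pos hε)
    have hKc : IsCompact ({x | c' ≤ f x} ×ˢ Icc 0 T) := (hb.isCompact_ge hc').prod isCompact_Icc
    filter_upwards [hGK _ (fun z hz => ⟨hb.ge_subset hc' hz.1, hz.2⟩) hKc γ hγ] with j hj
    rw [Real.dist_eq]
    refine (hst _ _ (w j) v (hWA j) hWinf (hw j) hv (fun x hx => ?_) ?_ x (subset_closure hx) t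
      ht).trans_lt (half_lt_self hε)
    · rw [hwu j x hx 0 ⟨le_rfl, hs0p.le.trans (htj0 j).le⟩, hv0 x hx]
    · intro x hx hcx t ht
      refine hj (x, t) ⟨hcx, ht⟩ (x, lag (tj j) (1 / ((j:ℝ) + 1)) t)
        ⟨hx, lag_nonneg (hs0p.le.trans (htj0 j).le) ht.1, (lag_le (hδ j).le).trans ht.2⟩ ?_
      rw [Prod.dist_eq, dist_self, Real.dist_eq]
      exact max_le (hδ j).le (abs_lag_sub_le (hδ j).le)
  have hvv := hv.congr_data h.op (W' := v) hvG
  refine ⟨T, hTsT, hTTm, v, hvv, fun x hx t ht => ?_⟩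
  refine (hvv.mono (ht.2.le.trans hTsT.le)).unique h.op h.bdd (hu t ht.1 ht.2) ?_ hv0 x hx t
    ⟨ht.1, le_rfl⟩
  intro y hy s hs
  rw [hvG y hy s ⟨hs.1, hs.2.trans (ht.2.le.trans hTsT.le)⟩, hGu y hy s ⟨hs.1, hs.2.trans_lt ht.2⟩]

/-- `g` is bounded on `S × I` and Hölder continuous in `x ∈ S`, uniformly in `t ∈ I`. -/
def HolS (S : Set (Eu n)) (I : Set ℝ) (g : Eu n → ℝ → ℝ) : Prop :=
  ∃ M : ℝ, 0 ≤ M ∧ ∃ α : ℝ, 0 < α ∧ α ≤ 1 ∧ (∀ x ∈ S, ∀ t ∈ I, |g x t| ≤ M) ∧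
    ∀ x ∈ S, ∀ y ∈ S, ∀ t ∈ I, |g x t - g y t| ≤ M * ‖x - y‖ ^ α

section
variable {g : Eu n → ℝ → ℝ}

theorem HolS.time {τ : ℝ → ℝ} (hM : ∀ t ∈ I, |τ t| ≤ M) : HolS S I fun _ t => τ t := by
  refine ⟨max M 0, le_max_right _ _, 1, one_pos, le_rfl,
    fun _ _ t ht => (hM t ht).trans (le_max_left _ _), fun x _ y _ t _ => ?_⟩
  rw [sub_self, abs_zero]
  exact mul_nonneg (le_max_right _ _) (Real.rpow_nonneg (norm_nonneg _) _)

theorem HolS.congr (hg : HolS S I g) (hgh : ∀ x ∈ S, ∀ t ∈ I, h x t = g x t) : HolS S I h := by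
  obtain ⟨M, hM, α, h0, h1, hb, hd⟩ := hg
  exact ⟨M, hM, α, h0, h1, fun x hx t ht => by rw [hgh x hx t ht]; exact hb x hx t ht,
    fun x hx y hy t ht => by rw [hgh x hx t ht, hgh y hy t ht]; exact hd x hx y hy t ht⟩

theorem rpow_min_left {β : ℝ} (hs : 0 ≤ s) (hs1 : s ≤ 1) (hα : 0 < α) (hβ : 0 < β) :
    s ^ α ≤ s ^ min α β ∧ s ^ β ≤ s ^ min α β :=
  ⟨Real.rpow_le_rpow_of_exponent_ge' hs hs1 (le_min hα.le hβ.le) (min_le_left _ _),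
    Real.rpow_le_rpow_of_exponent_ge' hs hs1 (le_min hα.le hβ.le) (min_le_right _ _)⟩

theorem HolS.add (hS : ∀ x ∈ S, ∀ y ∈ S, ‖x - y‖ ≤ 1) (hg : HolS S I g) (hh : HolS S I h) :
    HolS S I fun x t => g x t + h x t := by
  obtain ⟨M, hM, α, h0, h1, hb, hd⟩ := hg
  obtain ⟨M', hM', α', h0', h1', hb', hd'⟩ := hh
  refine ⟨M + M', by positivity, min α α', lt_min h0 h0', (min_le_left _ _).trans h1,
    fun x hx t ht => (abs_add_le _ _).trans (add_le_add (hb x hx t ht) (hb' x hx t ht)),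
    fun x hx y hy t ht => ?_⟩
  obtain ⟨e1, e2⟩ := rpow_min_left (norm_nonneg _) (hS x hx y hy) h0 h0'
  calc |g x t + h x t - (g y t + h y t)| = |(g x t - g y t) + (h x t - h y t)| := by ring_nf
    _ ≤ M * ‖x - y‖ ^ α + M' * ‖x - y‖ ^ α' :=
      (abs_add_le _ _).trans (add_le_add (hd x hx y hy t ht) (hd' x hx y hy t ht))
    _ ≤ M * ‖x - y‖ ^ min α α' + M' * ‖x - y‖ ^ min α α' := by gcongr
    _ = _ := by ring

theorem HolS.mul (hS : ∀ x ∈ S, ∀ y ∈ S, ‖x - y‖ ≤ 1) (hg : HolS S I g) (hh : HolS S I h) :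
    HolS S I fun x t => g x t * h x t := by
  obtain ⟨M, hM, α, h0, h1, hb, hd⟩ := hg
  obtain ⟨M', hM', α', h0', h1', hb', hd'⟩ := hh
  refine ⟨2 * (M * M'), by positivity, min α α', lt_min h0 h0', (min_le_left _ _).trans h1,
    fun x hx t ht => ?_, fun x hx y hy t ht => ?_⟩
  · rw [abs_mul]
    have := mul_le_mul (hb x hx t ht) (hb' x hx t ht) (abs_nonneg _) hM
    nlinarith [mul_nonneg hM hM']
  obtain ⟨e1, e2⟩ := rpow_min_left (norm_nonneg _) (hS x hx y hy) h0 h0'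
  calc |g x t * h x t - g y t * h y t|
      = |(g x t - g y t) * h x t + g y t * (h x t - h y t)| := by ring_nf
    _ ≤ M * ‖x - y‖ ^ min α α' * M' + M * (M' * ‖x - y‖ ^ min α α') := by
      refine (abs_add_le _ _).trans ?_
      rw [abs_mul, abs_mul]
      refine add_le_add (mul_le_mul ((hd x hx y hy t ht).trans ?_) (hb' x hx t ht) (abs_nonneg _)
        (by positivity)) (mul_le_mul (hb y hy t ht) ((hd' x hx y hy t ht).trans ?_) (abs_nonneg _)
        hM)
      · gcongr
      · gcongr
    _ = _ := by ring

theorem abs_rpow_sub_rpow_le {a b : ℝ} (ha : 0 ≤ a) (hb : 0 ≤ b) (hρ : 0 ≤ ρ) (hρ1 : ρ ≤ 1) :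
    |a ^ ρ - b ^ ρ| ≤ |a - b| ^ ρ := by
  wlog hab : b ≤ a generalizing a b
  · rw [abs_sub_comm, abs_sub_comm a b]; exact this hb ha (le_of_not_ge hab)
  rw [abs_of_nonneg (sub_nonneg.2 hab),
    abs_of_nonneg (sub_nonneg.2 (Real.rpow_le_rpow hb hab hρ)), sub_le_iff_le_add']
  have := NNReal.rpow_add_le_add_rpow ⟨b, hb⟩ ⟨a - b, sub_nonneg.2 hab⟩ hρ hρ1
  have h2 : (b + (a - b)) ^ ρ ≤ b ^ ρ + (a - b) ^ ρ := by exact_mod_cast this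
  rwa [add_sub_cancel] at h2

theorem HolS.rpow (hS : ∀ x ∈ S, ∀ y ∈ S, ‖x - y‖ ≤ 1) (hg : HolS S I g)
    (h0 : ∀ x ∈ S, ∀ t ∈ I, 0 ≤ g x t) (hq : 0 < q) : HolS S I fun x t => g x t ^ q := by
  have small : ∀ ρ : ℝ, 0 < ρ → ρ ≤ 1 → HolS S I fun x t => g x t ^ ρ := by
    intro ρ hρ hρ1
    obtain ⟨M, hM, α, hα, hα1, hb, hd⟩ := hg
    refine ⟨M ^ ρ, by positivity, α * ρ, by positivity, mul_le_one₀ hα1 hρ.le hρ1,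
      fun x hx t ht => ?_, fun x hx y hy t ht => ?_⟩
    · rw [abs_of_nonneg (Real.rpow_nonneg (h0 x hx t ht) _)]
      exact Real.rpow_le_rpow (h0 x hx t ht) ((le_abs_self _).trans (hb x hx t ht)) hρ.le
    · refine (abs_rpow_sub_rpow_le (h0 x hx t ht) (h0 y hy t ht) hρ.le hρ1).trans ?_
      rw [Real.rpow_mul (norm_nonneg _), ← Real.mul_rpow hM (Real.rpow_nonneg (norm_nonneg _) _)]
      exact Real.rpow_le_rpow (abs_nonneg _) (hd x hx y hy t ht) hρ.le
  obtain ⟨m, hm⟩ := exists_nat_gt q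
  have hm0 : (0:ℝ) < m := hq.trans hm
  have hs := small (q / m) (by positivity) ((div_le_one hm0).2 hm.le)
  have hpow : ∀ N : ℕ, HolS S I fun x t => (g x t ^ (q / m)) ^ N := by
    intro N
    induction N with
    | zero => exact (HolS.time (τ := fun _ => 1) (M := 1) (by simp)).congr (by simp)
    | succ N ih => exact (ih.mul hS hs).congr fun x _ t _ => pow_succ _ _
  refine (hpow m).congr fun x hx t ht => ?_
  rw [← Real.rpow_natCast, ← Real.rpow_mul (h0 x hx t ht), div_mul_cancel₀ _ hm0.ne']

end

theorem LocHolder.holS {g : Eu n → ℝ → ℝ} (hg : LocHolder Ω g) (hS : S ⊆ closure Ω)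
    (hM : ∀ x ∈ S, ∀ t ∈ Icc 0 T, |g x t| ≤ M) :
    HolS S (Icc 0 T) g := by
  obtain ⟨α, hα, hα1, h⟩ := hg
  obtain ⟨C, hC⟩ := h (max T 1) (by positivity)
  refine ⟨max M |C|, (abs_nonneg _).trans (le_max_right _ _), α, hα, hα1.le,
    fun x hx t ht => (hM x hx t ht).trans (le_max_left _ _), fun x hx y hy t ht => ?_⟩
  have ht' : t ∈ Icc 0 (max T 1) := ⟨ht.1, ht.2.trans (le_max_left _ _)⟩
  refine (hC x (hS hx) y (hS hy) t ht' t ht').trans ?_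
  rw [sub_self, abs_zero, add_zero, dist_eq_norm]
  exact mul_le_mul_of_nonneg_right ((le_abs_self C).trans (le_max_right _ _))
    (Real.rpow_nonneg (norm_nonneg _) _)

theorem LocHolder.jc {g : Eu n → ℝ → ℝ} (hg : LocHolder Ω g) :
    JC g (closure Ω) (Ici 0) := by
  obtain ⟨α, hα, hα1, h⟩ := hg
  rintro ⟨x0, t0⟩ ⟨hx0, ht0⟩
  have ht0' : (0:ℝ) ≤ t0 := ht0
  obtain ⟨C, hC⟩ := h (t0 + 1) (by positivity)
  have hlim : Tendsto (fun z : Eu n × ℝ => C * (dist z.1 x0 + |z.2 - t0|) ^ α)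
      (nhdsWithin (x0, t0) (closure Ω ×ˢ Ici 0)) (nhds 0) := by
    have hc : Continuous fun z : Eu n × ℝ => C * (dist z.1 x0 + |z.2 - t0|) ^ α :=
      continuous_const.mul ((by fun_prop : Continuous fun z : Eu n × ℝ =>
        dist z.1 x0 + |z.2 - t0|).rpow_const fun _ => Or.inr hα.le)
    have := hc.tendsto (x0, t0)
    simp only [dist_self, sub_self, abs_zero, add_zero, Real.zero_rpow hα.ne', mul_zero] at this
    exact this.mono_left nhdsWithin_le_nhds
  refine tendsto_iff_dist_tendsto_zero.2 (squeeze_zero' (Eventually.of_forall fun _ => dist_nonneg)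
    ?_ hlim)
  have hnear : ∀ᶠ z : Eu n × ℝ in nhdsWithin (x0, t0) (closure Ω ×ˢ Ici 0), z.2 < t0 + 1 :=
    nhdsWithin_le_nhds (continuous_snd.continuousAt.eventually_lt continuousAt_const
      (show ((x0, t0) : Eu n × ℝ).2 < t0 + 1 by simp))
  filter_upwards [hnear, self_mem_nhdsWithin] with z hz hzm
  rw [Real.dist_eq]
  exact hC z.1 hzm.1 x0 hx0 z.2 ⟨hzm.2, hz.le⟩ t0 ⟨ht0', by linarith⟩

/-- Interior regularity of solutions with Hölder continuous coefficients. -/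
theorem LSol.heatAt (h : NL Ω β a k Tm r p l) (hTm : T ≤ Tm) (hv : LSol Ω β a k r p l T v v)
    (hβ : HolS Ω (Icc 0 T) β) (ha : HolS Ω (Icc 0 T) a) (hx : x ∈ Ω) (ht : t ∈ Ioo 0 T) :
    HeatAt v (NF Ω β a r p v x t) x t := by
  have hI : Icc 0 T ⊆ Icc 0 Tm := Icc_subset_Icc_right hTm
  have hK : IsCompact (closure Ω ×ˢ Icc 0 T) :=
    (isCompact_of_isClosed_isBounded isClosed_closure h.bdd.closure).prod isCompact_Icc
  obtain ⟨B', hB'⟩ := hK.exists_bound_of_continuousOn hv.jc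
  set B := max B' 0
  have hB : ∀ x ∈ closure Ω, ∀ t ∈ Icc 0 T, |v x t| ≤ B := fun x hx t ht =>
    (hB' (x, t) ⟨hx, ht⟩).trans (le_max_left _ _)
  have hadm : Adm Ω (Icc 0 T) B v := hv.adm Subset.rfl fun x hx t ht =>
    (le_abs_self _).trans (hB x (subset_closure hx) t ht)
  obtain ⟨C, -, hC⟩ := h.exists_NF_bound (B := B) (le_max_right _ _)
  refine hv.weak.heatAt h.op (fun x0 hx0 τ hτ => ?_) hx ht
  obtain ⟨R', hR', hsub'⟩ := nhds_basis_closedBall.mem_iff.1 (h.op.mem_nhds hx0)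
  set R := min (R' / 4) (1 / 2) with hRdef
  have hR : 0 < R := lt_min (by positivity) (by norm_num)
  have hsub : closedBall x0 (4 * R) ⊆ Ω :=
    (closedBall_subset_closedBall (by linarith [min_le_left (R' / 4) (1 / 2)])).trans hsub'
  have hsub1 : closedBall x0 R ⊆ Ω :=
    (closedBall_subset_closedBall (by linarith)).trans hsub
  have hS : ∀ x ∈ closedBall x0 R, ∀ y ∈ closedBall x0 R, ‖x - y‖ ≤ 1 := by
    intro x hx y hy
    rw [← dist_eq_norm]
    rw [mem_closedBall] at hx hy
    linarith [dist_triangle_right x y x0, min_le_right (R' / 4) (1 / 2)]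
  rcases lt_or_ge T τ with hTτ | hτT
  · exact ⟨R, hR, 0, le_rfl, 1, one_pos, le_rfl, hsub1, fun x _ y _ t ht => by
      linarith [ht.1, ht.2]⟩
  have hmono : ∀ {g}, HolS Ω (Icc 0 T) g → HolS (closedBall x0 R) (Icc τ T) g := by
    rintro g ⟨M, hM, α, h0, h1, hb, hd⟩
    have hi : Icc τ T ⊆ Icc 0 T := Icc_subset_Icc_left hτ.le
    exact ⟨M, hM, α, h0, h1, fun x hx t ht => hb x (hsub1 hx) t (hi ht),
      fun x hx y hy t ht => hd x (hsub1 hx) y (hsub1 hy) t (hi ht)⟩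
  obtain ⟨L, hL, hlip⟩ := Weak.lipschitz_space h.op (F := C) (B := B) hR hτ hτT hsub
  have hi : Icc τ T ⊆ Icc 0 T := Icc_subset_Icc_left hτ.le
  have hvH : HolS (closedBall x0 R) (Icc τ T) v := by
    refine ⟨max L B, hL.trans (le_max_left _ _), 1, one_pos, le_rfl, fun x hx t ht =>
      (hB x (subset_closure (hsub1 hx)) t (hi ht)).trans (le_max_right _ _),
      fun x hx y hy t ht => ?_⟩
    rw [Real.rpow_one]
    exact (hlip v _ hv.weak (fun x hx => hB x (subset_closure (hsub hx)))
      (fun x hx => hC _ hI v hadm x (hsub hx)) x hx y hy t ht).trans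
      (mul_le_mul_of_nonneg_right (le_max_left _ _) (norm_nonneg _))
  have hitg : HolS (closedBall x0 R) (Icc τ T) fun _ t => ∫ y in Ω, v y t ^ p :=
    HolS.time (M := volume.real Ω * B ^ p) fun t ht => by
      rw [abs_of_nonneg (integral_rpow_nonneg h.op hadm (hi ht) p)]
      exact integral_rpow_le h.op h.bdd hadm (hi ht) h.p0
  have hN := ((hmono hβ).mul hS hvH).add hS (((hmono ha).mul hS (hvH.rpow hS
    (fun x hx t ht => hadm.nn x (hsub1 hx) t (hi ht)) h.r0)).mul hS hitg)
  obtain ⟨M, hM, α, h0, h1, -, hd⟩ := hN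
  exact ⟨R, hR, M, hM, α, h0, h1, hsub1, hd⟩

theorem HeatAt.exp_mul {h : ℝ} (hu : HeatAt u h x t) :
    HeatAt (fun y s => exp (c * s) * u y s) (exp (c * t) * (c * u x t + h)) x t := by
  refine ⟨contDiffAt_const.mul hu.c2, ?_⟩
  have he : HasDerivAt (fun s : ℝ => exp (c * s)) (exp (c * t) * c) t := by
    simpa using ((hasDerivAt_id t).const_mul c).exp
  refine (he.mul hu.der).congr_deriv ?_
  rw [lap_const_mul _ hu.c2]; ring

theorem NF_exp (ho : IsOpen Ω) (hu : ∀ y ∈ Ω, 0 ≤ u y t) (hx : x ∈ Ω) :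
    NF Ω (fun x t => N - b x t) (fun x t => a x t * exp (N * (1 - r - p) * t)) r p
      (fun y s => exp (N * s) * u y s) x t =
    exp (N * t) * (N * u x t + (a x t * u x t ^ r * (∫ y in Ω, u y t ^ p) - b x t * u x t)) := by
  have h1 : ∫ y in Ω, (exp (N * t) * u y t) ^ p = exp (N * t * p) * ∫ y in Ω, u y t ^ p := by
    rw [← integral_const_mul]
    refine setIntegral_congr_fun ho.measurableSet fun y hy => ?_
    rw [Real.mul_rpow (exp_pos _).le (hu y hy), ← Real.exp_mul]
  rw [NF, h1, Real.mul_rpow (exp_pos _).le (hu x hx), ← Real.exp_mul]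
  have h2 : exp (N * (1 - r - p) * t) * exp (N * t * r) * exp (N * t * p) = exp (N * t) := by
    rw [← Real.exp_add, ← Real.exp_add]; congr 1; ring
  rw [← h2]; ring

theorem NG_exp (ho : IsOpen Ω) (hu : ∀ y ∈ Ω, 0 ≤ u y t) (x : Eu n) :
    NG Ω (fun x y t => k x y t * exp (N * (1 - l) * t)) l (fun y s => exp (N * s) * u y s) x t =
    exp (N * t) * ∫ y in Ω, k x y t * u y t ^ l := by
  rw [NG, ← integral_const_mul]
  refine setIntegral_congr_fun ho.measurableSet fun y hy => ?_
  rw [Real.mul_rpow (exp_pos _).le (hu y hy), ← Real.exp_mul]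
  have h2 : exp (N * (1 - l) * t) * exp (N * t * l) = exp (N * t) := by
    rw [← Real.exp_add]; congr 1; ring
  rw [← h2]; ring

theorem IsSol.heatAt (ho : IsOpen Ω) (h : IsSol r p 1 l Ω a b k u0 T u) (hx : x ∈ Ω)
    (ht : t ∈ Ioo 0 T) :
    HeatAt u (a x t * u x t ^ r * (∫ y in Ω, u y t ^ p) - b x t * u x t) x t := by
  obtain ⟨⟨⟨-, h2, h3⟩, -, h4, -, -⟩, -, -, h5, -, -⟩ := h
  refine ⟨(h2 t ht).contDiffAt (ho.mem_nhds hx), (h3 x hx t ht).hasDerivAt.congr_deriv ?_⟩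
  have e1 := h4 x hx t ht
  have e2 := h5 x hx t ht
  rw [Real.rpow_one] at e1 e2
  linarith

theorem IsSol.init (hT : 0 < T) (h : IsSol r p q l Ω a b k u0 T u) (hu0 : GoodInit Ω k l u0) :
    ∀ x ∈ closure Ω, u x 0 = u0 x := by
  have hc : ContinuousOn (fun x => u x 0) (closure Ω) := JC.slice h.1.1.1 ⟨le_rfl, hT⟩
  have heq : EqOn (fun x => u x 0) u0 Ω := fun x hx =>
    le_antisymm (h.1.2.2.2.2 x hx) (h.2.2.2.2.2 x hx)
  exact heq.of_subset_closure hc hu0.1 subset_closure Subset.rfl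

theorem IsSol.bdry (ho : IsOpen Ω) (h : IsSol r p q l Ω a b k u0 T u) (hu0 : GoodInit Ω k l u0) :
    ∀ x ∈ frontier Ω, ∀ t ∈ Ico 0 T, u x t = ∫ y in Ω, k x y t * u y t ^ l := by
  intro x hx t ht
  rcases ht.1.eq_or_lt with rfl | h0
  · have hi := h.init ht.2 hu0
    rw [hi x (frontier_subset_closure hx), hu0.2.2 x hx]
    exact setIntegral_congr_fun ho.measurableSet fun y hy => by
      rw [hi y (subset_closure hy)]
  · exact le_antisymm (h.1.2.2.2.1 x hx t ⟨h0, ht.2⟩) (h.2.2.2.2.1 x hx t ⟨h0, ht.2⟩)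

/-- A classical solution of the heat equation, continuous up to the parabolic boundary, is weak. -/
theorem Bar.weak_of_heatAt (hB : Bar Ω lam f) (hT : 0 ≤ T) (hW : JC W (closure Ω) (Icc 0 T))
    (hF : JC F Ω (Icc 0 T)) (hFM : ∀ x ∈ Ω, ∀ t ∈ Icc 0 T, |F x t| ≤ M)
    (h : ∀ x ∈ Ω, ∀ t ∈ Ioo 0 T, HeatAt W (F x t) x t) : Weak Ω 0 T W F := by
  obtain ⟨v, hv, hvP, hvw⟩ := hB.exists_data hT hF hFM (G := W)
    (ContinuousOn.mono hW fun z hz => ⟨hz.1, hz.2.1⟩)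
  have e0 : ∀ x ∈ closure Ω, v x 0 = W x 0 := fun x hx => hvP (x, 0) ⟨hx, ⟨le_rfl, hT⟩, Or.inl rfl⟩
  have e1 : ∀ x ∈ frontier Ω, ∀ t ∈ Icc 0 T, v x t = W x t := fun x hx t ht =>
    hvP (x, t) ⟨frontier_subset_closure hx, ht, Or.inr hx⟩
  have hneg : ∀ x ∈ Ω, ∀ t ∈ Ioo 0 T, HeatAt (fun y s => -1 * W y s) (-F x t) x t :=
    fun x hx t ht => ((heatAt_const (-1) x t).mul (h x hx t ht)).congr_source (by
      simp [pd_const])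
  have l1 := comparison hB.op hB.bdd (v1 := W) (v2 := fun x t => -v x t) (h1 := F)
    (h2 := fun x t => -F x t) (ContinuousOn.add hW (ContinuousOn.neg hv))
    (fun x hx t ht => (h x hx t ht).c2) (fun x hx t ht => (h x hx t ht).der) hvw.neg
    (fun x hx t ht _ => by linarith) (fun x hx => by rw [e0 x hx]; linarith)
    (fun x hx t ht => by rw [e1 x hx t ht]; linarith)
  have l2 := comparison hB.op hB.bdd (v1 := fun x t => -1 * W x t) (v2 := v)
    (h1 := fun x t => -F x t) (h2 := F)
    (ContinuousOn.add (ContinuousOn.mul continuousOn_const hW) hv)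
    (fun x hx t ht => (hneg x hx t ht).c2) (fun x hx t ht => (hneg x hx t ht).der) hvw
    (fun x hx t ht _ => by linarith) (fun x hx => by rw [e0 x hx]; linarith)
    (fun x hx t ht => by rw [e1 x hx t ht]; linarith)
  refine hvw.congr (fun x hx t ht => ?_) fun _ _ _ _ => rfl
  linarith [l1 x (subset_closure hx) t ht, l2 x (subset_closure hx) t ht]

/-- The exponential substitution makes the linear absorption nonnegative. -/
theorem GoodData.nl (hd : GoodData Ω a b k) (hr : 0 < r) (hp : 0 < p) (hl : 0 < l)
    (hN : ∀ x ∈ closure Ω, ∀ t ∈ Icc 0 Tm, b x t ≤ N) :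
    NL Ω (fun x t => N - b x t) (fun x t => a x t * exp (N * (1 - r - p) * t))
      (fun x y t => k x y t * exp (N * (1 - l) * t)) Tm r p l := by
  obtain ⟨ho, hb, -, hda, hdb, h0, hk, hk0⟩ := hd
  have hI : Icc 0 Tm ⊆ Ici 0 := fun t ht => ht.1
  refine ⟨ho, hb, ContinuousOn.sub continuousOn_const (hdb.jc.mono Subset.rfl hI),
    ContinuousOn.mul (hda.jc.mono Subset.rfl hI) (Continuous.continuousOn (by fun_prop)),
    fun x hx t ht => sub_nonneg.2 (hN x hx t ht),
    fun x hx t ht => mul_nonneg (h0 x hx t ht.1).1 (exp_pos _).le,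
    ContinuousOn.mul (hk.mono (Set.prod_mono Subset.rfl hI)) (Continuous.continuousOn (by fun_prop)),
    fun x hx y hy t ht => mul_nonneg (hk0 x hx y hy t ht.1) (exp_pos _).le, hr, hp, hl⟩

theorem IsSol.lsol (hd : GoodData Ω a b k) (hB : Bar Ω lam f) (hr : 0 < r) (hp : 0 < p)
    (hl : 0 < l) (hN : ∀ x ∈ closure Ω, ∀ t ∈ Icc 0 Tm, b x t ≤ N) (hu0 : GoodInit Ω k l u0)
    (h : IsSol r p 1 l Ω a b k u0 T u) (hT' : 0 ≤ T') (hTT : T' < T) (hTm : T' ≤ Tm) :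
    LSol Ω (fun x t => N - b x t) (fun x t => a x t * exp (N * (1 - r - p) * t))
      (fun x y t => k x y t * exp (N * (1 - l) * t)) r p l T'
      (fun y s => exp (N * s) * u y s) (fun y s => exp (N * s) * u y s) := by
  have hnl := hd.nl hr hp hl hN
  have hI : Icc 0 T' ⊆ Ico 0 T := fun t ht => ⟨ht.1, ht.2.trans_lt hTT⟩
  have hIm : Icc 0 T' ⊆ Icc 0 Tm := Icc_subset_Icc_right hTm
  have hnn : ∀ x ∈ closure Ω, ∀ t ∈ Icc 0 T', 0 ≤ u x t := fun x hx t ht =>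
    h.1.2.1 x hx t (hI ht)
  have hjc : JC (fun y s => exp (N * s) * u y s) (closure Ω) (Icc 0 T') :=
    ContinuousOn.mul (Continuous.continuousOn (by fun_prop)) (JC.mono h.1.1.1 Subset.rfl hI)
  have hnn' : ∀ x ∈ closure Ω, ∀ t ∈ Icc 0 T', 0 ≤ exp (N * t) * u x t := fun x hx t ht =>
    mul_nonneg (exp_pos _).le (hnn x hx t ht)
  have hK : IsCompact (closure Ω ×ˢ Icc 0 T') :=
    (isCompact_of_isClosed_isBounded isClosed_closure hB.bdd.closure).prod isCompact_Icc
  obtain ⟨B, hBd⟩ := hK.exists_bound_of_continuousOn hjc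
  have hadm : Adm Ω (Icc 0 T') (max B 0) (fun y s => exp (N * s) * u y s) :=
    ⟨JC.mono hjc subset_closure Subset.rfl, fun x hx => hnn' x (subset_closure hx),
      fun x hx t ht => ((le_abs_self _).trans (hBd (x, t) ⟨subset_closure hx, ht⟩)).trans
        (le_max_left _ _)⟩
  obtain ⟨C, -, hC⟩ := hnl.exists_NF_bound (B := max B 0) (le_max_right _ _)
  refine ⟨hjc, hnn', hB.weak_of_heatAt hT' hjc (hnl.jc_NF hIm hadm) (hC _ hIm _ hadm)
    fun x hx t ht => ?_, fun x hx t ht => ?_⟩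
  · have ht' := Ioo_subset_Icc_self ht
    refine (h.heatAt hB.op hx ⟨ht.1, ht.2.trans hTT⟩).exp_mul.congr_source ?_
    exact (NF_exp hB.op (fun y hy => hnn y (subset_closure hy) t ht') hx).symm
  · rw [NG_exp hB.op (fun y hy => hnn y (subset_closure hy) t ht), h.bdry hB.op hu0 x hx t (hI ht)]

theorem LSol.isSol (hd : GoodData Ω a b k) (hr : 0 < r) (hp : 0 < p) (hl : 0 < l)
    (hN : ∀ x ∈ closure Ω, ∀ t ∈ Icc 0 Tm, b x t ≤ N) (hTm : T ≤ Tm) (hT : 0 ≤ T)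
    (hv : LSol Ω (fun x t => N - b x t) (fun x t => a x t * exp (N * (1 - r - p) * t))
      (fun x y t => k x y t * exp (N * (1 - l) * t)) r p l T v v) (hv0 : ∀ x ∈ Ω, v x 0 = u0 x) :
    IsSol r p 1 l Ω a b k u0 T fun x t => exp (-N * t) * v x t := by
  have hnl := hd.nl hr hp hl hN
  have hI : Ico 0 T ⊆ Icc 0 T := Ico_subset_Icc_self
  have hbd : ∀ {g : Eu n → ℝ → ℝ}, LocHolder Ω g → HolS Ω (Icc 0 T) g := by
    intro g hg
    have hK : IsCompact (closure Ω ×ˢ Icc 0 T) := (isCompact_of_isClosed_isBounded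
      isClosed_closure hnl.bdd.closure).prod isCompact_Icc
    obtain ⟨M, hM⟩ := hK.exists_bound_of_continuousOn (hg.jc.mono Subset.rfl fun t ht => ht.1)
    exact hg.holS subset_closure fun x hx t ht => hM (x, t) ⟨subset_closure hx, ht⟩
  have ha : HolS Ω (Icc 0 T) fun x t => a x t * exp (N * (1 - r - p) * t) := by
    obtain ⟨M, hM⟩ := (isCompact_Icc (a := (0:ℝ)) (b := T)).exists_bound_of_continuousOn
      (f := fun t : ℝ => exp (N * (1 - r - p) * t)) (Continuous.continuousOn (by fun_prop))
    obtain ⟨A, hA, α, h0, h1, hb, hda⟩ := hbd hd.2.2.2.1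
    have hM0 : 0 ≤ M := (norm_nonneg _).trans (hM 0 ⟨le_rfl, hT⟩)
    refine ⟨A * M, by positivity, α, h0, h1, fun x hx t ht => ?_, fun x hx y hy t ht => ?_⟩
    · rw [abs_mul]
      exact mul_le_mul (hb x hx t ht) (hM t ht) (abs_nonneg _) hA
    · rw [← sub_mul, abs_mul, mul_right_comm A M]
      exact mul_le_mul (hda x hx y hy t ht) (hM t ht) (abs_nonneg _)
        (mul_nonneg hA (Real.rpow_nonneg (norm_nonneg _) _))
  have hβ : HolS Ω (Icc 0 T) fun x t => N - b x t := by
    obtain ⟨A, hA, α, h0, h1, hb, hdb⟩ := hbd hd.2.2.2.2.1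
    refine ⟨|N| + A, by positivity, α, h0, h1, fun x hx t ht => (abs_sub _ _).trans
      (add_le_add le_rfl (hb x hx t ht)), fun x hx y hy t ht => ?_⟩
    rw [sub_sub_sub_cancel_left, abs_sub_comm]
    exact (hdb x hx y hy t ht).trans (mul_le_mul_of_nonneg_right
      (le_add_of_nonneg_left (abs_nonneg N)) (Real.rpow_nonneg (norm_nonneg _) _))
  set u : Eu n → ℝ → ℝ := fun x t => exp (-N * t) * v x t with hu
  have hexp : ∀ t, exp (-N * t) * exp (N * t) = 1 := fun t => by
    rw [← Real.exp_add, neg_mul, neg_add_cancel, Real.exp_zero]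
  have hve : v = fun y s => exp (N * s) * u y s := by
    funext y s
    rw [hu]; beta_reduce
    rw [← mul_assoc, mul_comm (exp (N * s)), hexp, one_mul]
  have hnn : ∀ x ∈ closure Ω, ∀ t ∈ Icc 0 T, 0 ≤ u x t := fun x hx t ht =>
    mul_nonneg (exp_pos _).le (hv.nn x hx t ht)
  have hheat : ∀ x ∈ Ω, ∀ t ∈ Ioo 0 T,
      HeatAt u (a x t * u x t ^ r * (∫ y in Ω, u y t ^ p) - b x t * u x t) x t := by
    intro x hx t ht
    have h1 := LSol.heatAt hnl hTm hv hβ ha hx ht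
    refine (h1.exp_mul (c := -N)).congr_source ?_
    rw [hve, NF_exp hnl.op (fun y hy => hnn y (subset_closure hy) t (Ioo_subset_Icc_self ht)) hx]
    rw [← hve]
    have : v x t = exp (N * t) * u x t := by conv_lhs => rw [hve]
    rw [this]
    linear_combination (a x t * u x t ^ r * (∫ y in Ω, u y t ^ p) - b x t * u x t) * hexp t
  have hreg : RegQ Ω T u := ⟨ContinuousOn.mul (Continuous.continuousOn (by fun_prop))
    (JC.mono hv.jc Subset.rfl hI), fun t ht x hx => (hheat x hx t ht).c2.contDiffWithinAt,
    fun x hx t ht => (hheat x hx t ht).der.differentiableAt⟩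
  have heq : ∀ x ∈ Ω, ∀ t ∈ Ioo 0 T, deriv (u x) t = lap (fun y => u y t) x
      + a x t * u x t ^ r * (∫ y in Ω, u y t ^ p) - b x t * u x t ^ (1:ℝ) := fun x hx t ht => by
    rw [(hheat x hx t ht).der.deriv, Real.rpow_one]; ring
  have hbdry : ∀ x ∈ frontier Ω, ∀ t ∈ Ioo 0 T, u x t = ∫ y in Ω, k x y t * u y t ^ l := by
    intro x hx t ht
    have ht' := Ioo_subset_Icc_self ht
    have h1 := hv.bdry x hx t ht'
    rw [hve, NG_exp hnl.op fun y hy => hnn y (subset_closure hy) t ht'] at h1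
    exact mul_left_cancel₀ (exp_pos _).ne' h1
  have hinit : ∀ x ∈ Ω, u x 0 = u0 x := fun x hx => by
    rw [hu]; beta_reduce; rw [mul_zero, Real.exp_zero, one_mul, hv0 x hx]
  exact ⟨⟨hreg, fun x hx t ht => hnn x hx t (hI ht), fun x hx t ht => (heq x hx t ht).le,
    fun x hx t ht => (hbdry x hx t ht).le, fun x hx => (hinit x hx).le⟩,
    ⟨hreg, fun x hx t ht => hnn x hx t (hI ht), fun x hx t ht => (heq x hx t ht).ge,
    fun x hx t ht => (hbdry x hx t ht).ge, fun x hx => (hinit x hx).ge⟩⟩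

theorem IsSol.mono (h : IsSol r p q l Ω a b k u0 T u) (hT : T' ≤ T) :
    IsSol r p q l Ω a b k u0 T' u := by
  have h1 : Ico 0 T' ⊆ Ico 0 T := Ico_subset_Ico_right hT
  have h2 : Ioo 0 T' ⊆ Ioo 0 T := Ioo_subset_Ioo_right hT
  obtain ⟨⟨⟨a1, a2, a3⟩, a4, a5, a6, a7⟩, -, -, b5, b6, b7⟩ := h
  have hreg : RegQ Ω T' u := ⟨JC.mono a1 Subset.rfl h1, fun t ht => a2 t (h2 ht),
    fun x hx t ht => a3 x hx t (h2 ht)⟩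
  exact ⟨⟨hreg, fun x hx t ht => a4 x hx t (h1 ht), fun x hx t ht => a5 x hx t (h2 ht),
    fun x hx t ht => a6 x hx t (h2 ht), a7⟩, hreg, fun x hx t ht => a4 x hx t (h1 ht),
    fun x hx t ht => b5 x hx t (h2 ht), fun x hx t ht => b6 x hx t (h2 ht), b7⟩

/-- A solution which cannot be continued blows up in the supremum norm. -/
theorem IsSolOn.blowsUpAt (hd : GoodData Ω a b k) (hB : Bar Ω lam f) (hr : 0 < r) (hp : 0 < p)
    (hl : 0 < l) (hu0 : GoodInit Ω k l u0) {Ts : ℝ} (hTs : 0 < Ts)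
    (h : IsSolOn r p 1 l Ω a b k u0 Ts u)
    (hmax : ¬ ∃ (v : Eu n → ℝ → ℝ) (T' : ℝ), Ts < T' ∧ IsSolOn r p 1 l Ω a b k u0 T' v ∧
      ∀ x ∈ closure Ω, ∀ t ∈ Ico (0:ℝ) Ts, v x t = u x t) : BlowsUpAt Ω u Ts := by
  by_contra hbu
  unfold BlowsUpAt at hbu
  push Not at hbu
  obtain ⟨M, hM⟩ := hbu
  refine hmax ?_
  have hK : IsCompact (closure Ω ×ˢ Icc 0 (Ts + 1)) := (isCompact_of_isClosed_isBounded
    isClosed_closure hB.bdd.closure).prod isCompact_Icc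
  obtain ⟨N', hN'⟩ := hK.exists_bound_of_continuousOn
    (hd.2.2.2.2.1.jc.mono Subset.rfl fun t ht => ht.1)
  set N := max N' 0
  have hN : ∀ x ∈ closure Ω, ∀ t ∈ Icc 0 (Ts + 1), b x t ≤ N := fun x hx t ht =>
    ((le_abs_self _).trans (hN' (x, t) ⟨hx, ht⟩)).trans (le_max_left _ _)
  have hN0 : 0 ≤ N := le_max_right _ _
  have hnl := hd.nl hr hp hl hN
  have hlsol : ∀ T, 0 ≤ T → T < Ts → LSol Ω (fun x t => N - b x t)
      (fun x t => a x t * exp (N * (1 - r - p) * t))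
      (fun x y t => k x y t * exp (N * (1 - l) * t)) r p l T
      (fun y s => exp (N * s) * u y s) (fun y s => exp (N * s) * u y s) := fun T hT0 hT =>
    (h ((T + Ts) / 2) (by linarith) (by linarith)).lsol hd hB hr hp hl hN hu0 hT0 (by linarith)
      (by linarith)
  obtain ⟨T, hT1, hT2, v, hv, hvu⟩ := hnl.extend hB (M := exp (N * Ts) * max M 0) hTs (by linarith)
    (by positivity) hlsol (by
      refine (hM.and_eventually (Ioo_mem_nhdsLT hTs)).mono ?_
      rintro t ⟨h1, h2⟩ x hx
      have hjc : JC u (closure Ω) (Ico 0 ((t + Ts) / 2)) :=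
        (h ((t + Ts) / 2) (by linarith [h2.1]) (by linarith [h2.2])).1.1.1
      have hle : u x t ≤ M := closure_minimal (s := Ω) (t := closure Ω ∩ {x | u x t ≤ M})
        (fun y hy => ⟨subset_closure hy, h1 y hy⟩)
        ((JC.slice hjc ⟨h2.1.le, by linarith [h2.2]⟩).preimage_isClosed_of_isClosed isClosed_closure
          (isClosed_Iic (a := M))) hx |>.2
      exact mul_le_mul (Real.exp_le_exp.2 (mul_le_mul_of_nonneg_left h2.2.le hN0))
        (hle.trans (le_max_left _ _)) ((h ((t + Ts) / 2) (by linarith [h2.1])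
          (by linarith [h2.2])).1.2.1 x hx t ⟨h2.1.le, by linarith [h2.2]⟩) (exp_pos _).le)
  refine ⟨fun x t => exp (-N * t) * v x t, T, hT1, fun T' _ hT' => ?_, fun x hx t ht => ?_⟩
  · refine (LSol.isSol hd hr hp hl hN hT2 (hTs.le.trans hT1.le) hv fun x hx => ?_).mono hT'.le
    rw [hvu x (subset_closure hx) 0 ⟨le_rfl, hTs⟩, mul_zero, Real.exp_zero, one_mul]
    exact (h (Ts / 2) (by linarith) (by linarith)).init (by linarith) hu0 x (subset_closure hx)
  · beta_reduce
    rw [hvu x hx t ht, ← mul_assoc, ← Real.exp_add, neg_mul, neg_add_cancel, Real.exp_zero, one_mul]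

/-- A superlinear integral inequality bounds the integral of its coefficient. -/
theorem exists_integral_le_of_superlinear {κ y : ℝ → ℝ} (hl : 1 < l) (hC : 0 < C)
    (hκ : Continuous κ) (hκ0 : ∀ t, 0 ≤ κ t) (hy : Continuous y) (hy0 : ∀ t, 0 ≤ y t)
    (h0 : 0 < y 0) (h : ∀ t ≥ 0, y 0 + C * ∫ τ in (0:ℝ)..t, κ τ * y τ ^ l ≤ y t) :
    ∃ K, ∀ t ≥ 0, ∫ τ in (0:ℝ)..t, κ τ ≤ K := by
  have hc : Continuous fun τ => κ τ * y τ ^ l :=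
    hκ.mul (hy.rpow_const fun _ => Or.inr (by linarith))
  set G : ℝ → ℝ := fun t => y 0 + C * ∫ τ in (0:ℝ)..t, κ τ * y τ ^ l with hG
  have hGd : ∀ t, HasDerivAt G (C * (κ t * y t ^ l)) t := fun t =>
    ((hc.integral_hasStrictDerivAt 0 t).hasDerivAt.const_mul C).const_add _
  have hGp : ∀ t ≥ 0, y 0 ≤ G t := fun t ht => le_add_of_nonneg_right (mul_nonneg hC.le
    (intervalIntegral.integral_nonneg ht fun τ _ => mul_nonneg (hκ0 τ) (rpow_nonneg (hy0 τ) l)))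
  have hΦ : ∀ t ≥ 0, HasDerivAt (fun t => G t ^ (1 - l) + (l - 1) * C * ∫ τ in (0:ℝ)..t, κ τ)
      (C * (κ t * y t ^ l) * (1 - l) * G t ^ (1 - l - 1) + (l - 1) * C * κ t) t := fun t ht =>
    ((hGd t).rpow_const (Or.inl (h0.trans_le (hGp t ht)).ne')).add
      ((hκ.integral_hasStrictDerivAt 0 t).hasDerivAt.const_mul _)
  have hanti : AntitoneOn (fun t => G t ^ (1 - l) + (l - 1) * C * ∫ τ in (0:ℝ)..t, κ τ) (Ici 0) := by
    refine antitoneOn_of_deriv_nonpos (convex_Ici 0)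
      (fun t ht => (hΦ t ht).continuousAt.continuousWithinAt) ?_ ?_
    · intro t ht
      exact (hΦ t (interior_subset ht)).differentiableAt.differentiableWithinAt
    · intro t ht
      have ht := interior_subset ht
      rw [(hΦ t ht).deriv]
      have hp : 0 < G t := h0.trans_le (hGp t ht)
      have h1 : 1 ≤ y t ^ l * G t ^ (1 - l - 1) := by
        have : (1 - l - 1) = -l := by ring
        rw [this, Real.rpow_neg hp.le, ← div_eq_mul_inv, one_le_div (rpow_pos_of_pos hp l)]
        exact rpow_le_rpow hp.le (h t ht) (by linarith)
      nlinarith [mul_le_mul_of_nonneg_left h1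
        (mul_nonneg (mul_nonneg hC.le (hκ0 t)) (sub_nonneg.2 hl.le))]
  refine ⟨y 0 ^ (1 - l) / ((l - 1) * C), fun t ht => ?_⟩
  have h1 := hanti self_mem_Ici (show t ∈ Ici 0 from ht) ht
  have h2 : 0 ≤ G t ^ (1 - l) := rpow_nonneg (h0.le.trans (hGp t ht)) _
  have h3 : G 0 = y 0 := by simp [hG]
  simp only [intervalIntegral.integral_same, mul_zero, add_zero, h3] at h1
  rw [le_div_iff₀ (mul_pos (sub_pos.2 hl) hC)]
  linarith

theorem Bar.integrableOn_of_closure (hB : Bar Ω lam f) (hg : ContinuousOn g (closure Ω)) :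
    IntegrableOn g Ω :=
  (hg.integrableOn_compact hB.bdd.isCompact_closure).mono_set subset_closure

theorem Bar.integral_mul_pos (hB : Bar Ω lam f) (hw : ContinuousOn w (closure Ω))
    (hw0 : ∀ x ∈ closure Ω, 0 ≤ w x) (hx : x0 ∈ Ω) (hpos : 0 < w x0) :
    0 < ∫ x in Ω, w x * f x := by
  have hc : ContinuousOn (fun x => w x * f x) (closure Ω) := hw.mul hB.cont.continuousOn
  have hU : IsOpen (Ω ∩ (fun x => w x * f x) ⁻¹' Ioi 0) :=
    (hc.mono subset_closure).isOpen_inter_preimage hB.op isOpen_Ioi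
  rw [setIntegral_pos_iff_support_of_nonneg_ae ((ae_restrict_iff' hB.op.measurableSet).2
    (Eventually.of_forall fun x hx => mul_nonneg (hw0 x (subset_closure hx)) (hB.nonneg x)))
    (hB.integrableOn_of_closure hc)]
  refine (hU.measure_pos volume ⟨x0, hx, mul_pos hpos (hB.pos x0 hx)⟩).trans_le
    (measure_mono fun x hx => ⟨(ne_of_gt hx.2 : _ ≠ _), hx.1⟩)

/-- Jensen's inequality for the weight `f`, in the form `c (∫ w f) ^ l ≤ ∫ w ^ l`. -/
theorem Bar.exists_jensen (hB : Bar Ω lam f) (hne : Ω.Nonempty) (hl : 1 < l) :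
    ∃ c > 0, ∀ w : Eu n → ℝ, ContinuousOn w (closure Ω) → (∀ x ∈ closure Ω, 0 ≤ w x) →
      c * (∫ x in Ω, w x * f x) ^ l ≤ ∫ x in Ω, w x ^ l := by
  have hi := fun g => hB.integrableOn_of_closure (g := g)
  obtain ⟨M, hM, hfM⟩ := hB.exists_bound
  have hA := hB.integral_mul_pos (w := fun _ => 1) continuousOn_const (fun _ _ => zero_le_one)
    hne.some_mem one_pos
  simp only [one_mul] at hA
  set A := ∫ x in Ω, f x
  refine ⟨1 / (M * A ^ (l - 1)), by positivity, fun w hw hw0 => ?_⟩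
  have hl0 : 0 < l := by linarith
  have hwl : ContinuousOn (fun x => w x ^ l) (closure Ω) := rpow_continuousOn hl0 hw
  have hwf := hw.mul hB.cont.continuousOn
  have hy : 0 ≤ ∫ x in Ω, w x * f x := setIntegral_nonneg hB.op.measurableSet fun x hx =>
    mul_nonneg (hw0 x (subset_closure hx)) (hB.nonneg x)
  set y := ∫ x in Ω, w x * f x with hydef
  rcases hy.eq_or_lt with h0 | hy
  · rw [← h0, zero_rpow hl0.ne', mul_zero]
    exact setIntegral_nonneg hB.op.measurableSet fun x hx => rpow_nonneg (hw0 x (subset_closure hx)) l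
  set m := y / A
  have hm : 0 < m := div_pos hy hA
  have hpt : ∀ x ∈ Ω, m ^ l / M * (l / m * (w x * f x) + (1 - l) * f x) ≤ w x ^ l := by
    intro x hx
    have h0 := hw0 x (subset_closure hx)
    have hb := one_add_mul_self_le_rpow_one_add (s := w x / m - 1) (by
      have := div_nonneg h0 hm.le; linarith) hl.le
    rw [add_sub_cancel, div_rpow h0 hm.le, le_div_iff₀ (rpow_pos_of_pos hm l)] at hb
    have hf0 := hB.nonneg x
    have h3 : m ^ l / M * (l / m * (w x * f x) + (1 - l) * f x)
        = f x / M * ((1 + l * (w x / m - 1)) * m ^ l) := by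
      field_simp; ring
    rw [h3]
    calc _ ≤ f x / M * w x ^ l := mul_le_mul_of_nonneg_left hb (by positivity)
      _ ≤ 1 * w x ^ l := mul_le_mul_of_nonneg_right
          ((div_le_one hM).2 (hfM x)) (rpow_nonneg h0 l)
      _ = _ := one_mul _
  have i1 : IntegrableOn (fun x => l / m * (w x * f x)) Ω := hi _ (continuousOn_const.mul hwf)
  have i2 : IntegrableOn (fun x => (1 - l) * f x) Ω :=
    hi _ (continuousOn_const.mul hB.cont.continuousOn)
  have hitg := setIntegral_mono_on ((i1.add i2).const_mul _) (hi _ hwl) hB.op.measurableSet hpt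
  simp only [Pi.add_apply] at hitg
  refine le_trans (le_of_eq ?_) hitg
  rw [integral_const_mul, integral_add i1 i2, integral_const_mul, integral_const_mul]
  have h4 : m ^ l = y ^ l / (A ^ (l - 1) * A) := by
    rw [div_rpow hy.le hA.le, ← rpow_add_one hA.ne', sub_add_cancel]
  have h5 : l / m * y + (1 - l) * A = A := by
    have : y = m * A := by rw [div_mul_cancel₀ _ hA.ne']
    rw [this]; field_simp; ring
  rw [h4, h5]
  field_simp

/-- Green's formula against the eigenfunction, as an inequality. -/
theorem Bar.pairing_growth (hB : Bar Ω lam f) {w : Eu n → ℝ → ℝ} {g : ℝ → ℝ}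
    (hw : JC w (closure Ω) (Icc 0 T)) (hw0 : ∀ x ∈ closure Ω, ∀ t ∈ Icc 0 T, 0 ≤ w x t)
    (hW : Weak Ω 0 T w F) (hF : ∀ x ∈ Ω, ∀ t ∈ Icc 0 T, lam * w x t ≤ F x t)
    (hg : ContinuousOn g (Icc 0 T)) (hgw : ∀ x ∈ frontier Ω, ∀ t ∈ Icc 0 T, g t ≤ w x t)
    (hT : 0 ≤ T) :
    (∫ x in Ω, w x 0 * f x) + lam * (∫ x in Ω, f x) * (∫ τ in (0:ℝ)..T, g τ) ≤
      ∫ x in Ω, w x T * f x := by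
  have hm := hB.op.measurableSet
  have hfin : IsFiniteMeasure (volume.restrict Ω) := ⟨by simpa using hB.bdd.measure_lt_top⟩
  have hi := fun g => hB.integrableOn_of_closure (g := g)
  have hlam := hB.lam_pos
  have h0T : (0:ℝ) ∈ Icc 0 T := ⟨le_rfl, hT⟩
  have hTT : T ∈ Icc 0 T := ⟨hT, le_rfl⟩
  have hws : ∀ t ∈ Icc 0 T, ContinuousOn (fun x => w x t) (closure Ω) := fun t ht => JC.slice hw ht
  obtain ⟨Bw0, hBw0⟩ := (hB.bdd.isCompact_closure.prod isCompact_Icc).exists_bound_of_continuousOn hw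
  have hBw : ∀ x ∈ Ω, ∀ t ∈ Icc 0 T, w x t ≤ Bw0 := fun x hx t ht =>
    (le_abs_self _).trans (hBw0 (x, t) ⟨subset_closure hx, ht⟩)
  obtain ⟨Bg, hBg⟩ := isCompact_Icc.exists_bound_of_continuousOn hg
  set A := ∫ x in Ω, f x with hA
  set V := volume.real Ω
  have hV : 0 ≤ V := measureReal_nonneg
  have hA0 : 0 ≤ A := setIntegral_nonneg hm fun x _ => hB.nonneg x
  have hwV : ∀ t ∈ Icc 0 T, ∫ x in Ω, w x t ≤ Bw0 * V := fun t ht => by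
    have := setIntegral_mono_on (hi _ (hws t ht)) (hi _ continuousOn_const) hm
      fun x hx => hBw x hx t ht
    simpa [V, mul_comm] using this
  have hw00 : ∀ t ∈ Icc 0 T, 0 ≤ ∫ x in Ω, w x t := fun t ht =>
    setIntegral_nonneg hm fun x hx => hw0 x (subset_closure hx) t ht
  have hBw00 : 0 ≤ Bw0 * V := (hw00 0 h0T).trans (hwV 0 h0T)
  have hBg0 : 0 ≤ Bg := (norm_nonneg _).trans (hBg 0 h0T)
  set K := 2 * Bw0 * V + lam * (2 * Bg * V + A + 2 * Bw0 * V) * T with hK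
  have hK0 : 0 ≤ K := by
    have : 0 ≤ Bg * V := mul_nonneg hBg0 hV
    have h2 : 0 ≤ lam * (2 * Bg * V + A + 2 * Bw0 * V) := mul_nonneg hlam.le (by linarith)
    have := mul_nonneg h2 hT
    linarith
  suffices H : ∀ η > 0, (∫ x in Ω, w x 0 * f x) + lam * A * (∫ τ in (0:ℝ)..T, g τ) ≤
      (∫ x in Ω, w x T * f x) + η * K by
    refine le_of_forall_pos_le_add fun δ hδ => (H (δ / (K + 1)) (by positivity)).trans ?_
    have : δ / (K + 1) * K ≤ δ := by
      rw [div_mul_eq_mul_div, div_le_iff₀ (by positivity)]; nlinarith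
    linarith
  intro η hη
  obtain ⟨c, hc, hnear⟩ := hB.near_bdry (t0 := 0) (t1 := T) (z := fun x t => g t - w x t) (κ := η)
    (ContinuousOn.sub (hg.comp continuousOn_snd fun z hz => hz.2) hw)
    fun x hx t ht => by linarith [hgw x hx t ht]
  obtain ⟨ε, hε, hεη, hεc⟩ : ∃ ε > (0:ℝ), ε ≤ η ∧ 2 * ε ≤ c :=
    ⟨min η (c / 2), by positivity, min_le_left _ _, by linarith [min_le_right η (c / 2)]⟩
  have hψ := hB.contDiff_psi hε
  have hψs := hB.hasCompactSupport_psi hε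
  have hψU := (hB.tsupport_psi hε).trans (hB.ge_subset hε)
  have hcutc : Continuous fun x => cut f ε x * f x := (hB.continuous_cut ε).mul hB.cont
  have hcut1 : ∀ x, cut f ε x * f x ≤ f x := fun x =>
    mul_le_of_le_one_left (hB.nonneg x) (cut_le_one x)
  have hcut2 : ∀ x, f x - 2 * ε ≤ cut f ε x * f x := fun x => by
    rcases le_total (2 * ε) (f x) with h | h
    · rw [cut_eq_one hε h]; linarith
    · linarith [mul_nonneg (cut_nonneg (f := f) (ε := ε) x) (hB.nonneg x)]
  set Q := ∫ x in Ω, cut f ε x * f x with hQ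
  have hif := hi f hB.cont.continuousOn
  have hQ1 : Q ≤ A := setIntegral_mono_on (hi _ hcutc.continuousOn) hif hm fun x _ => hcut1 x
  have hQ2 : A - 2 * ε * V ≤ Q := by
    have := setIntegral_mono_on (hif.sub (hi (fun _ => 2 * ε) continuousOn_const))
      (hi _ hcutc.continuousOn) hm fun x _ => hcut2 x
    simp only [Pi.sub_apply] at this
    rw [integral_sub hif (integrable_const _)] at this
    simpa [V, A, Q, mul_comm] using this
  have hlap0 : ∫ x in Ω, lap (psi f ε) x = 0 := by
    rw [setIntegral_eq_integral_of_forall_compl_eq_zero fun x hx =>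
      lap_eq_zero_of_notMem fun h => hx (hψU h)]
    exact integral_lap_eq_zero hψ hψs
  have hpen : ∫ x in Ω, pen f ε x = lam * Q := by
    have e : ∀ x, pen f ε x = lap (psi f ε) x + lam * (cut f ε x * f x) := fun x => by
      rw [hB.lap_psi hε]; ring
    simp only [e]
    rw [integral_add (hi _ (continuous_lap hψ).continuousOn)
      ((hi _ hcutc.continuousOn).const_mul lam), hlap0, integral_const_mul, zero_add]
  have hsupp : ∀ h : Eu n → ℝ, ∫ x, h x * psi f ε x = ∫ x in Ω, h x * psi f ε x := fun h =>
    (setIntegral_eq_integral_of_forall_compl_eq_zero fun x hx => by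
      rw [image_eq_zero_of_notMem_tsupport fun h => hx (hψU h), mul_zero]).symm
  have hsupl : ∀ h : Eu n → ℝ, ∫ x, h x * lap (psi f ε) x = ∫ x in Ω, h x * lap (psi f ε) x :=
    fun h => (setIntegral_eq_integral_of_forall_compl_eq_zero fun x hx => by
      rw [lap_eq_zero_of_notMem fun h => hx (hψU h), mul_zero]).symm
  have hrate : ∀ τ ∈ Icc 0 T, lam * A * g τ - η * (lam * (2 * Bg * V + A + 2 * Bw0 * V)) ≤
      (∫ x, w x τ * lap (psi f ε) x) + ∫ x, F x τ * psi f ε x := by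
    intro τ hτ
    have i1 : IntegrableOn (fun x => w x τ * lap (psi f ε) x) Ω :=
      hi _ ((hws τ hτ).mul (continuous_lap hψ).continuousOn)
    have i2 : IntegrableOn (fun x => F x τ * psi f ε x) Ω :=
      (integrable_mul_cutoff hB.op (JC.slice hW.cf hτ) hψ.continuous hψs hψU).integrableOn
    have i3 : IntegrableOn (fun x => (g τ - η) * pen f ε x) Ω :=
      (hi _ (hB.continuous_pen hε).continuousOn).const_mul _
    have i4 : IntegrableOn (fun x => 2 * ε * lam * w x τ) Ω := (hi _ (hws τ hτ)).const_mul _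
    have hmono := setIntegral_mono_on (i3.sub i4) (i1.add i2) hm fun x hx => by
      have e1 := mul_le_mul_of_nonneg_right (hF x hx τ hτ) (hB.psi_nonneg hε x)
      have e2 : 0 ≤ lam * w x τ := mul_nonneg hlam.le (hw0 x (subset_closure hx) τ hτ)
      have e3 := mul_le_mul_of_nonneg_left
        ((sub_le_sub_right (hcut1 x) (2 * ε)).trans (hB.le_psi hε x)) e2
      have e4 : (g τ - η) * pen f ε x ≤ w x τ * pen f ε x := by
        rcases lt_or_ge (2 * ε) (f x) with h | h
        · rw [pen_eq_zero hε h, mul_zero, mul_zero]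
        · exact mul_le_mul_of_nonneg_right
            (by linarith [hnear x (subset_closure hx) (h.trans hεc) τ hτ]) (pen_nonneg hε x)
      show (g τ - η) * pen f ε x - 2 * ε * lam * w x τ ≤
        w x τ * lap (psi f ε) x + F x τ * psi f ε x
      rw [hB.lap_psi hε]
      linarith
    simp only [Pi.sub_apply, Pi.add_apply] at hmono
    rw [integral_sub i3 i4, integral_add i1 i2, integral_const_mul, integral_const_mul, hpen] at hmono
    rw [hsupp, hsupl]
    refine le_trans ?_ hmono
    have hgB := abs_le.1 (hBg τ hτ)
    have e1 : 2 * ε * lam * ∫ x in Ω, w x τ ≤ 2 * η * lam * (Bw0 * V) :=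
      mul_le_mul (by gcongr) (hwV τ hτ) (hw00 τ hτ) (by positivity)
    have e2 : g τ * A - 2 * η * Bg * V ≤ g τ * Q := by
      have : g τ * (A - Q) ≤ Bg * (2 * η * V) :=
        (mul_le_mul_of_nonneg_right hgB.2 (by linarith)).trans
          (mul_le_mul_of_nonneg_left (by nlinarith) hBg0)
      linarith
    have e3 := mul_le_mul_of_nonneg_left hQ1 hη.le
    have e4 := mul_le_mul_of_nonneg_left (a := lam)
      (show g τ * A - 2 * η * Bg * V - η * A ≤ (g τ - η) * Q by linarith) hlam.le
    linarith
  have hitg := intervalIntegral.integral_mono_on hT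
    (((hg.intervalIntegrable_of_Icc hT).const_mul (lam * A)).sub
      (_root_.intervalIntegrable_const (c := η * (lam * (2 * Bg * V + A + 2 * Bw0 * V)))))
    (hW.intervalIntegrable_rhs hB.op hψ hψs hψU h0T hTT) hrate
  rw [← hW.eq _ hψ hψs hψU 0 h0T T hTT hT, intervalIntegral.integral_sub
    ((hg.intervalIntegrable_of_Icc hT).const_mul _) intervalIntegrable_const,
    intervalIntegral.integral_const_mul, intervalIntegral.integral_const, hsupp, hsupp] at hitg
  have hwψ : ∀ t ∈ Icc 0 T, IntegrableOn (fun x => w x t * psi f ε x) Ω := fun t ht =>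
    hi _ ((hws t ht).mul hψ.continuous.continuousOn)
  have hwf : ∀ t ∈ Icc 0 T, IntegrableOn (fun x => w x t * f x) Ω := fun t ht =>
    hi _ ((hws t ht).mul hB.cont.continuousOn)
  have u1 : ∫ x in Ω, w x T * psi f ε x ≤ ∫ x in Ω, w x T * f x :=
    setIntegral_mono_on (hwψ T hTT) (hwf T hTT) hm fun x hx =>
      mul_le_mul_of_nonneg_left (hB.psi_le hε x) (hw0 x (subset_closure hx) T hTT)
  have u2 : (∫ x in Ω, w x 0 * f x) - 2 * ε * (∫ x in Ω, w x 0) ≤ ∫ x in Ω, w x 0 * psi f ε x := by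
    have i4 : IntegrableOn (fun x => 2 * ε * w x 0) Ω := (hi _ (hws 0 h0T)).const_mul _
    rw [← integral_const_mul, ← integral_sub (hwf 0 h0T) i4]
    refine setIntegral_mono_on ((hwf 0 h0T).sub i4) (hwψ 0 h0T) hm fun x hx => ?_
    have := mul_le_mul_of_nonneg_left (hB.le_psi hε x) (hw0 x (subset_closure hx) 0 h0T)
    linarith
  have u3 : 2 * ε * ∫ x in Ω, w x 0 ≤ 2 * η * (Bw0 * V) :=
    mul_le_mul (by gcongr) (hwV 0 h0T) (hw00 0 h0T) (by positivity)
  simp only [sub_zero, smul_eq_mul] at hitg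
  rw [hK]
  linarith

theorem continuousOn_sSup_image {X : Type*} [PseudoMetricSpace X] {K S : Set X} (hK : IsCompact K)
    (hSK : S ⊆ K) (hS : S.Nonempty) {h : X → ℝ → ℝ}
    (hc : ContinuousOn (fun z : X × ℝ => h z.1 z.2) (K ×ˢ Ici 0)) :
    ContinuousOn (fun t => sSup ((fun x => h x t) '' S)) (Ici 0) ∧
      ∀ t ≥ 0, ∀ x ∈ S, h x t ≤ sSup ((fun x => h x t) '' S) := by
  have hbd : ∀ t ≥ 0, BddAbove ((fun x => h x t) '' S) := fun t ht =>
    (hK.bddAbove_image (hc.comp (by fun_prop : ContinuousOn (fun x => (x, t)) K)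
      fun x hx => ⟨hx, ht⟩)).mono (image_mono hSK)
  have hle : ∀ t ≥ 0, ∀ x ∈ S, h x t ≤ sSup ((fun x => h x t) '' S) := fun t ht x hx =>
    le_csSup (hbd t ht) ⟨x, hx, rfl⟩
  refine ⟨Metric.continuousOn_iff.2 fun t0 ht0 ε hε => ?_, hle⟩
  obtain ⟨δ, hδ, hu⟩ := uniformContinuousOn_iff.1
    ((hK.prod (isCompact_Icc (a := (0:ℝ)) (b := t0 + 1))).uniformContinuousOn_of_continuous
      (hc.mono (Set.prod_mono Subset.rfl fun t ht => ht.1))) (ε / 2) (half_pos hε)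
  refine ⟨min δ 1, by positivity, fun t ht hd => ?_⟩
  have hd1 := abs_lt.1 (hd.trans_le (min_le_right _ _))
  have hx : ∀ x ∈ S, |h x t - h x t0| < ε / 2 := fun x hx =>
    hu (x, t) ⟨hSK hx, ht, by linarith [hd1.2]⟩ (x, t0) ⟨hSK hx, ht0, by linarith⟩ (by
      rw [Prod.dist_eq, dist_self, max_eq_right dist_nonneg]
      exact hd.trans_le (min_le_left _ _))
  have h1 : sSup ((fun x => h x t) '' S) ≤ sSup ((fun x => h x t0) '' S) + ε / 2 :=
    csSup_le (hS.image _) (forall_mem_image.2 fun x hxS => by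
      linarith [(abs_lt.1 (hx x hxS)).2, hle t0 ht0 x hxS])
  have h2 : sSup ((fun x => h x t0) '' S) ≤ sSup ((fun x => h x t) '' S) + ε / 2 :=
    csSup_le (hS.image _) (forall_mem_image.2 fun x hxS => by
      linarith [(abs_lt.1 (hx x hxS)).1, hle t ht x hxS])
  rw [Real.dist_eq, abs_lt]
  constructor <;> linarith

theorem GoodData.supOmega_props (hd : GoodData Ω a b k) :
    ContinuousOn (supOmega Ω b) (Ici 0) ∧ ∀ t ≥ 0, ∀ x ∈ Ω, b x t ≤ supOmega Ω b t :=
  continuousOn_sSup_image hd.2.1.isCompact_closure subset_closure hd.2.2.1 hd.2.2.2.2.1.jc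

theorem GoodData.infBdry_props (hd : GoodData Ω a b k) (hfr : (frontier Ω).Nonempty) :
    ContinuousOn (infBdry Ω k) (Ici 0) ∧
      (∀ t ≥ 0, ∀ x ∈ frontier Ω, ∀ y ∈ Ω, infBdry Ω k t ≤ k x y t) ∧
      ∀ t ≥ 0, 0 ≤ infBdry Ω k t := by
  obtain ⟨-, hb, hne, -, -, -, hk, hk0⟩ := hd
  have hKf : IsCompact (frontier Ω) :=
    hb.isCompact_closure.of_isClosed_subset isClosed_frontier frontier_subset_closure
  obtain ⟨h1, h2⟩ := continuousOn_sSup_image (hKf.prod hb.isCompact_closure)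
    (Set.prod_mono Subset.rfl subset_closure) (hfr.prod hne) (h := fun z t => -k z.1 z.2 t) hk.neg
  have e : ∀ t, infBdry Ω k t
      = -sSup ((fun z : Eu n × Eu n => -k z.1 z.2 t) '' (frontier Ω ×ˢ Ω)) := fun t => by
    rw [infBdry, Real.sInf_def, ← Set.image_neg_eq_neg, Set.image_image]
  refine ⟨h1.neg.congr fun t _ => e t, fun t ht x hx y hy => ?_, fun t ht => ?_⟩
  · rw [e]; linarith [h2 t ht (x, y) ⟨hx, hy⟩]
  · refine le_csInf ((hfr.prod hne).image _) (forall_mem_image.2 fun z hz => ?_)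
    exact hk0 z.1 hz.1 z.2 (subset_closure hz.2) t ht

theorem HeatAt.time_mul {h d : ℝ} {e : ℝ → ℝ} (hu : HeatAt u h x t) (he : HasDerivAt e d t) :
    HeatAt (fun y s => e s * u y s) (d * u x t + e t * h) x t := by
  refine ⟨contDiffAt_const.mul hu.c2, (he.mul hu.der).congr_deriv ?_⟩
  rw [lap_const_mul _ hu.c2]; ring

/-- Continuity on `[0, ∞)` from continuity on all compact time intervals. -/
theorem continuousOn_Ici_of_Icc {y : ℝ → ℝ} (h : ∀ T > 0, ContinuousOn y (Icc 0 T)) :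
    ContinuousOn y (Ici 0) := fun t ht =>
  (h (t + 1) (by have : (0:ℝ) ≤ t := ht
                 linarith) t ⟨ht, by linarith⟩).mono_of_mem_nhdsWithin
    (by rw [← Ici_inter_Iic]; exact inter_mem self_mem_nhdsWithin
          (mem_nhdsWithin_of_mem_nhds (Iic_mem_nhds (by linarith))))

/-- A nontrivial global solution forces the weighted boundary kernel to be integrable. -/
theorem GoodData.integrableOn_of_global (hd : GoodData Ω a b k) (hB : Bar Ω lam f) (hr : 0 < r)
    (hp : 0 < p) (hl : 1 < l) (hfr : (frontier Ω).Nonempty) (hu0 : GoodInit Ω k l u0)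
    (hnt : ∃ x ∈ Ω, u0 x ≠ 0) (h : ∀ T : ℝ, 0 < T → IsSol r p 1 l Ω a b k u0 T u) :
    IntegrableOn (fun t => infBdry Ω k t *
      exp (-(l - 1) * (lam * t + ∫ τ in (0:ℝ)..t, supOmega Ω b τ))) (Ioi 0) := by
  obtain ⟨hbc, hble⟩ := hd.supOmega_props
  obtain ⟨hkc, hkle, hk0⟩ := hd.infBdry_props hfr
  obtain ⟨ho, hbdd, hne, hda, hdb, hab0, hk, hkn⟩ := hd
  have hm := ho.measurableSet
  have hl0 : 0 < l := by linarith
  have hmaxc : Continuous fun t : ℝ => max t 0 := by fun_prop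
  have hmax : ∀ t : ℝ, max t 0 ∈ Ici (0:ℝ) := fun t => mem_Ici.2 (le_max_right _ _)
  set β : ℝ → ℝ := fun t => supOmega Ω b (max t 0) with hβ
  have hβc : Continuous β := hbc.comp_continuous hmaxc hmax
  set L : ℝ → ℝ := fun t => lam * t + ∫ τ in (0:ℝ)..t, β τ with hL
  have hLd : ∀ t, HasDerivAt L (lam + β t) t := fun t =>
    (((hasDerivAt_id t).const_mul lam).congr_deriv (mul_one _)).add
      (hβc.integral_hasStrictDerivAt 0 t).hasDerivAt
  have hLc : Continuous L := continuous_iff_continuousAt.2 fun t => (hLd t).continuousAt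
  set E : ℝ → ℝ := fun t => exp (L t)
  have hEc : Continuous E := continuous_exp.comp hLc
  have hE0 : ∀ t, 0 < E t := fun t => exp_pos _
  have hEd : ∀ t, HasDerivAt E (E t * (lam + β t)) t := fun t => (hLd t).exp
  set κ : ℝ → ℝ := fun t => infBdry Ω k (max t 0) * exp (-(l - 1) * L t) with hκ
  have hκc : Continuous κ := (hkc.comp_continuous hmaxc hmax).mul (by fun_prop)
  have hκ0 : ∀ t, 0 ≤ κ t := fun t => mul_nonneg (hk0 _ (hmax t)) (exp_pos _).le
  set w : Eu n → ℝ → ℝ := fun x t => E t * u x t with hw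
  have hun : ∀ x ∈ closure Ω, ∀ t ≥ 0, 0 ≤ u x t := fun x hx t ht =>
    (h (t + 1) (by linarith)).1.2.1 x hx t ⟨ht, by linarith⟩
  have hwn : ∀ x ∈ closure Ω, ∀ t ≥ 0, 0 ≤ w x t := fun x hx t ht =>
    mul_nonneg (hE0 t).le (hun x hx t ht)
  have huJ : ∀ T ≥ 0, JC u (closure Ω) (Icc 0 T) := fun T hT =>
    JC.mono (h (T + 1) (by linarith)).1.1.1 Subset.rfl fun t ht => ⟨ht.1, by linarith [ht.2]⟩
  have hwJ : ∀ T ≥ 0, JC w (closure Ω) (Icc 0 T) := fun T hT =>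
    (hEc.comp continuous_snd).continuousOn.mul (huJ T hT)
  obtain ⟨c, hc, hjen⟩ := hB.exists_jensen hne hl
  set y : ℝ → ℝ := fun t => ∫ x in Ω, w x t * f x with hy
  have hadm : ∀ T ≥ 0, ∀ v : Eu n → ℝ → ℝ, JC v (closure Ω) (Icc 0 T) →
      (∀ x ∈ closure Ω, ∀ t ≥ 0, 0 ≤ v x t) → ∃ B, Adm Ω (Icc 0 T) B v := fun T hT v hv hv0 => by
    obtain ⟨B, hBd⟩ := (hbdd.isCompact_closure.prod isCompact_Icc).exists_bound_of_continuousOn hv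
    exact ⟨B, JC.mono hv subset_closure Subset.rfl, fun x hx t ht => hv0 x (subset_closure hx) t ht.1,
      fun x hx t ht => (le_abs_self _).trans (hBd (x, t) ⟨subset_closure hx, ht⟩)⟩
  have hyc : ContinuousOn y (Ici 0) := continuousOn_Ici_of_Icc fun T hT => by
    obtain ⟨B, hBd⟩ := hadm T hT.le (fun x t => w x t * f x)
      ((hwJ T hT.le).mul (hB.cont.comp continuous_fst).continuousOn)
      fun x hx t ht => mul_nonneg (hwn x hx t ht) (hB.nonneg x)
    simpa only [rpow_one] using continuousOn_integral_rpow ho hbdd hBd one_pos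
  have hy0 : ∀ t ≥ 0, 0 ≤ y t := fun t ht => setIntegral_nonneg hm fun x hx =>
    mul_nonneg (hwn x (subset_closure hx) t ht) (hB.nonneg x)
  have hypos : 0 < y 0 := by
    obtain ⟨x0, hx0, hne0⟩ := hnt
    refine hB.integral_mul_pos (JC.slice (hwJ 0 le_rfl) ⟨le_rfl, le_rfl⟩)
      (fun x hx => hwn x hx 0 le_rfl) hx0 (mul_pos (hE0 0) ?_)
    rw [(h 1 one_pos).init one_pos hu0 x0 (subset_closure hx0)]
    exact (hu0.2.1 x0 (subset_closure hx0)).lt_of_ne' hne0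
  have hA : 0 < ∫ x in Ω, f x := by
    simpa using hB.integral_mul_pos (w := fun _ => 1) continuousOn_const
      (fun _ _ => zero_le_one) hne.some_mem one_pos
  have hbdry : ∀ x ∈ frontier Ω, ∀ t ≥ 0, κ t * (c * y t ^ l) ≤ w x t := by
    intro x hx t ht
    have hus : ContinuousOn (fun y => u y t) (closure Ω) := JC.slice (huJ t ht) ⟨ht, le_rfl⟩
    have hul := rpow_continuousOn hl0 hus
    have hks : ContinuousOn (fun y => k x y t) (closure Ω) := hk.comp
      (by fun_prop : ContinuousOn (fun y : Eu n => ((x, y), t)) _) fun y hy => ⟨⟨hx, hy⟩, ht⟩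
    have e1 := (h (t + 1) (by linarith)).bdry ho hu0 x hx t ⟨ht, by linarith⟩
    have e2 : infBdry Ω k t * ∫ y in Ω, u y t ^ l ≤ u x t := by
      rw [e1, ← integral_const_mul]
      exact setIntegral_mono_on (hB.integrableOn_of_closure (continuousOn_const.mul hul))
        (hB.integrableOn_of_closure (hks.mul hul)) hm fun y hy =>
          mul_le_mul_of_nonneg_right (hkle t ht x hx y hy)
            (rpow_nonneg (hun y (subset_closure hy) t ht) l)
    have e3 : ∫ y in Ω, w y t ^ l = exp (L t * l) * ∫ y in Ω, u y t ^ l := by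
      rw [← integral_const_mul]
      refine setIntegral_congr_fun hm fun y hy => ?_
      simp only [hw, E]
      rw [Real.mul_rpow (exp_pos _).le (hun y (subset_closure hy) t ht), ← Real.exp_mul]
    have e4 := mul_le_mul_of_nonneg_left (hjen (fun x => w x t)
      (JC.slice (hwJ t ht) ⟨ht, le_rfl⟩) fun x hx => hwn x hx t ht) (hκ0 t)
    refine e4.trans ?_
    rw [e3]
    have e5 : exp (-(l - 1) * L t) * exp (L t * l) = E t := by
      rw [← Real.exp_add]; congr 1; ring
    calc _ = exp (-(l - 1) * L t) * exp (L t * l) * (infBdry Ω k t * ∫ y in Ω, u y t ^ l) := by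
            simp only [hκ, max_eq_left ht]; ring
      _ ≤ _ := by rw [e5]; exact mul_le_mul_of_nonneg_left e2 (hE0 t).le
  have hgrow : ∀ T ≥ 0, y 0 + lam * (∫ x in Ω, f x) * (∫ τ in (0:ℝ)..T, κ τ * (c * y τ ^ l))
      ≤ y T := by
    intro T hT
    have hI : Icc 0 T ⊆ Ici 0 := fun t ht => ht.1
    obtain ⟨B, hBd⟩ := hadm T hT u (huJ T hT) hun
    have hIc : ContinuousOn (fun t => ∫ y in Ω, u y t ^ p) (Icc 0 T) :=
      continuousOn_integral_rpow ho hbdd hBd hp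
    set F : Eu n → ℝ → ℝ := fun x t => E t * (lam + β t) * u x t +
      E t * (a x t * u x t ^ r * (∫ y in Ω, u y t ^ p) - b x t * u x t) with hF
    have hFJ : JC F (closure Ω) (Icc 0 T) := by
      refine ContinuousOn.add (ContinuousOn.mul (Continuous.continuousOn (by fun_prop)) (huJ T hT))
        (ContinuousOn.mul (Continuous.continuousOn (by fun_prop)) (ContinuousOn.sub
          (ContinuousOn.mul (ContinuousOn.mul (hda.jc.mono Subset.rfl hI)
            (rpow_continuousOn hr (huJ T hT))) (hIc.comp continuousOn_snd fun z hz => hz.2))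
          (ContinuousOn.mul (hdb.jc.mono Subset.rfl hI) (huJ T hT))))
    obtain ⟨M, hM⟩ := (hbdd.isCompact_closure.prod isCompact_Icc).exists_bound_of_continuousOn hFJ
    have hweak : Weak Ω 0 T w F := hB.weak_of_heatAt hT (hwJ T hT)
      (JC.mono hFJ subset_closure Subset.rfl) (M := M)
      (fun x hx t ht => hM (x, t) ⟨subset_closure hx, ht⟩) fun x hx t ht =>
        ((h T (ht.1.trans ht.2)).heatAt ho hx ht).time_mul (hEd t)
    refine hB.pairing_growth (hwJ T hT) (fun x hx t ht => hwn x hx t ht.1) hweak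
      (fun x hx t ht => ?_) (hκc.continuousOn.mul (continuousOn_const.mul
        (rpow_continuousOn hl0 (hyc.mono hI)))) (fun x hx t ht => hbdry x hx t ht.1) hT
    have e1 : b x t ≤ β t := by
      simp only [hβ, max_eq_left ht.1]; exact hble t ht.1 x hx
    have e2 := mul_le_mul_of_nonneg_right e1 (hun x (subset_closure hx) t ht.1)
    have e3 : 0 ≤ a x t * u x t ^ r * ∫ y in Ω, u y t ^ p :=
      mul_nonneg (mul_nonneg (hab0 x (subset_closure hx) t ht.1).1
        (rpow_nonneg (hun x (subset_closure hx) t ht.1) r)) (integral_rpow_nonneg ho hBd ht p)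
    have e4 := mul_nonneg (hE0 t).le (add_nonneg (sub_nonneg.2 e2) e3)
    simp only [hF, hw]
    linarith
  obtain ⟨K, hK⟩ := exists_integral_le_of_superlinear (y := fun t => y (max t 0)) hl
    (mul_pos (mul_pos hB.lam_pos hA) hc) hκc hκ0 (hyc.comp_continuous hmaxc hmax)
    (fun t => hy0 _ (hmax t)) (by simpa using hypos) fun t ht => by
      have := hgrow t ht
      have e : ∫ τ in (0:ℝ)..t, κ τ * (c * y τ ^ l)
          = c * ∫ τ in (0:ℝ)..t, κ τ * y (max τ 0) ^ l := by
        rw [← intervalIntegral.integral_const_mul]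
        refine intervalIntegral.integral_congr fun τ hτ => ?_
        rw [uIcc_of_le ht] at hτ
        simp only [max_eq_left hτ.1]; ring
      rw [e] at this
      simp only [max_eq_left ht, max_self]
      linarith
  have hitg : IntegrableOn κ (Ioi 0) := integrableOn_Ioi_of_intervalIntegral_norm_bounded K 0
    (fun t => hκc.integrableOn_Ioc) tendsto_id ((eventually_ge_atTop 0).mono fun t ht => by
      simp only [id, Real.norm_of_nonneg (hκ0 _)]
      exact hK t ht)
  refine hitg.congr_fun (fun t ht => ?_) measurableSet_Ioi
  have ht : (0:ℝ) ≤ t := le_of_lt ht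
  have e : ∫ τ in (0:ℝ)..t, β τ = ∫ τ in (0:ℝ)..t, supOmega Ω b τ :=
    intervalIntegral.integral_congr fun τ hτ => by
      rw [uIcc_of_le ht] at hτ
      simp only [hβ, max_eq_left hτ.1]
  simp only [hκ, hL, max_eq_left ht, e]

end

/-- **Blow-up of all nontrivial solutions for `q = 1` via the boundary term.** If `q = 1`,
`l > 1` and `∫₀^∞ k̲(t) exp[−(l−1)(λ₁t + ∫₀ᵗ b̄)] dt = ∞`, where
`k̲(t) = inf_{∂Ω×Ω} k(·,·,t)`, then every nontrivial solution of problem (P) blows up in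
finite time. -/
theorem blowup_all_q_eq_one_boundary {n : ℕ} (r p q l : ℝ)
    (hr : 0 < r) (hp : 0 < p) (hq : q = 1) (hl : 1 < l)
    (Ω : Set (EuclideanSpace ℝ (Fin n)))
    (a b : EuclideanSpace ℝ (Fin n) → ℝ → ℝ)
    (k : EuclideanSpace ℝ (Fin n) → EuclideanSpace ℝ (Fin n) → ℝ → ℝ)
    (hdata : GoodData Ω a b k)
    (lam : ℝ) (φ : EuclideanSpace ℝ (Fin n) → ℝ) (heig : IsFirstEigen Ω lam φ)
    (hdiv : ¬ IntegrableOn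
      (fun t => infBdry Ω k t *
        Real.exp (-(l - 1) * (lam * t + ∫ τ in (0:ℝ)..t, supOmega Ω b τ)))
      (Ioi (0:ℝ))) :
    ∀ u0 : EuclideanSpace ℝ (Fin n) → ℝ, GoodInit Ω k l u0 →
      (∃ x ∈ Ω, u0 x ≠ 0) → AllSolutionsBlowUp r p q l Ω a b k u0 := by
  intro u0 hu0 hnt
  subst hq
  rcases (frontier Ω).eq_empty_or_nonempty with hfr | hfr
  · exact absurd (by simp [infBdry, hfr]) hdiv
  have hn : 0 < n := by
    rcases Nat.eq_zero_or_pos n with rfl | hn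
    · have : frontier Ω = ∅ := (isClopen_discrete Ω).frontier_eq
      exact absurd this hfr.ne_empty
    · exact hn
  have hB := Bar.of_eigen hn hdata.1 hdata.2.1 hdata.2.2.1 heig.1
  exact ⟨fun u hu => hdiv (hdata.integrableOn_of_global hB hr hp hl hfr hu0 hnt hu),
    fun u Ts hTs hu hmax => hu.blowsUpAt hdata hB hr hp (by linarith) hu0 hTs hmax⟩
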